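/- Let k ≥ 1, α₁,…,α_k : Fˣ → ℂˣ characters, n = ab, x ∈ GL_a(F) regular elliptic, E a degree-a extension of F, ξ ∈ E a root of the characteristic polynomial of x, and b ≥ 1. Suppose ω₁,…,ω_k ∈ ℂ satisfy Σ_{i=1}^k ω_i^m = (-1)^{k-1} K_{E_m}(α,ψ,ξ_m) for every m ≥ 1. Then K(α,ψ,J_{(b)}(x)) = (-1)^{(k-1)n} · q^{(k-1)·n(n-1)/2} · Σ over functions d : {1,…,k} → ℕ with d₁+⋯+d_k = b of ω₁^{d₁}⋯ω_k^{d_k} (i.e., the complete homogeneous symmetric polynomial of degree b evaluated at ω₁,…,ω_k). -/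

import Mathlib

open scoped BigOperators

/-- The twisted matrix Kloosterman sum
`K(α,ψ,x) = Σ_{g₁⋯g_k = x} (∏ αᵢ(det gᵢ)) ψ(tr(g₁+⋯+g_k))`. -/
noncomputable def matrixKloosterman {F : Type} [Field F] [Fintype F] [DecidableEq F]
    {ι : Type} [Fintype ι] [DecidableEq ι] {k : ℕ}
    (α : Fin k → Fˣ →* ℂˣ) (ψ : AddChar F ℂ) (x : Matrix ι ι F) : ℂ :=
  ∑ g : Fin k → (Matrix ι ι F)ˣ,
    if ((List.ofFn g).prod : Matrix ι ι F) = x then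
      (∏ i, (α i (Units.map (Matrix.detMonoidHom) (g i)) : ℂ)) *
        ψ (Matrix.trace (∑ i, ((g i : Matrix ι ι F))))
    else 0

/-- The twisted Kloosterman sum over a finite extension `E` of `F`:
`K_E(α,ψ,ξ) = Σ_{t₁⋯t_k = ξ} (∏ αᵢ(N_{E/F}(tᵢ))) ψ(Tr_{E/F}(t₁+⋯+t_k))`. -/
noncomputable def fieldKloosterman {F : Type} [Field F] [Fintype F] {k : ℕ}
    (α : Fin k → Fˣ →* ℂˣ) (ψ : AddChar F ℂ)
    (E : Type) [Field E] [Fintype E] [DecidableEq E] [Algebra F E] (ξ : E) : ℂ :=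
  ∑ t : Fin k → Eˣ,
    if ((∏ i, t i : Eˣ) : E) = ξ then
      (∏ i, (α i (Units.map (Algebra.norm F : E →* F) (t i)) : ℂ)) *
        ψ (Algebra.trace F E (∑ i, (t i : E)))
    else 0

/-- `J_{(m)}(y)`: block matrix with `m` copies of the `a×a` matrix `y` on the block diagonal
and identity blocks on the block superdiagonal. -/
def jordanBlock {F : Type} [Zero F] [One F] {a : ℕ}
    (y : Matrix (Fin a) (Fin a) F) (m : ℕ) :
    Matrix (Fin m × Fin a) (Fin m × Fin a) F :=
  fun p q =>
    if p.1 = q.1 then y p.2 q.2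
    else if (p.1 : ℕ) + 1 = (q.1 : ℕ) then (if p.2 = q.2 then 1 else 0) else 0


set_option linter.all false

namespace MK
open Module Polynomial
open scoped BigOperators Classical

noncomputable scoped instance (priority := 50) fintypeOfFinite (α : Type) [Finite α] : Fintype α :=
  Fintype.ofFinite α

section basics
variable {F : Type} [Field F] {V : Type} [AddCommGroup V] [Module F V]

scoped instance (priority := 50) finite_linearMap {W : Type} [AddCommGroup W] [Module F W]
    [Finite V] [Finite W] : Finite (V →ₗ[F] W) := DFunLike.finite _

scoped instance (priority := 50) finite_end [Finite V] : Finite (Module.End F V) :=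
  finite_linearMap

scoped instance (priority := 50) finite_linearEquiv {W : Type} [AddCommGroup W] [Module F W]
    [Finite V] [Finite W] : Finite (V ≃ₗ[F] W) := DFunLike.finite _

/-- `𝔫_U`. -/
def nil (U : Submodule F V) : Submodule F (Module.End F V) where
  carrier := {N | (∀ v, N v ∈ U) ∧ ∀ u ∈ U, N u = 0}
  add_mem' := by
    rintro a b ⟨ha, ha'⟩ ⟨hb, hb'⟩
    exact ⟨fun v => U.add_mem (ha v) (hb v), fun u hu => by simp [ha' u hu, hb' u hu]⟩
  zero_mem' := ⟨fun v => U.zero_mem, fun u _ => rfl⟩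
  smul_mem' := by
    rintro c a ⟨ha, ha'⟩
    exact ⟨fun v => U.smul_mem c (ha v), fun u hu => by simp [ha' u hu]⟩

theorem mem_nil {U : Submodule F V} {N : Module.End F V} :
    N ∈ nil U ↔ (∀ v, N v ∈ U) ∧ ∀ u ∈ U, N u = 0 := Iff.rfl

/-- `U` is `y`-invariant. -/
def Inv (y : Module.End F V) (U : Submodule F V) : Prop := U ≤ U.comap y

theorem Inv.apply {y : Module.End F V} {U : Submodule F V} (h : Inv y U) {u : V} (hu : u ∈ U) :
    y u ∈ U := h hu

theorem inv_add_nil {y : Module.End F V} {U : Submodule F V} (h : Inv y U) {N : Module.End F V}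
    (hN : N ∈ nil U) : Inv (y + N) U := by
  intro u hu
  simp only [Submodule.mem_comap, LinearMap.add_apply]
  exact U.add_mem (h hu) (hN.1 u)

theorem inv_add_nil_iff {y : Module.End F V} {U : Submodule F V} {N : Module.End F V}
    (hN : N ∈ nil U) : Inv (y + N) U ↔ Inv y U := by
  refine ⟨fun h => ?_, fun h => inv_add_nil h hN⟩
  have := inv_add_nil h ((nil U).neg_mem hN)
  simpa using this

/-- primitive functions -/
def Prim [Finite V] (Φ : Module.End F V → ℂ) : Prop :=
  ∀ U : Submodule F V, U ≠ ⊥ → U ≠ ⊤ → ∀ y, Inv y U → ∑ N : nil U, Φ (y + N) = 0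

def ClassFn (Φ : Module.End F V → ℂ) : Prop :=
  ∀ (g : V ≃ₗ[F] V) (y : Module.End F V), Φ (g.conj y) = Φ y

theorem charpoly_mul [Module.Finite F V] (W : Submodule F V) (e : Module.End F V)
    (he : W ≤ W.comap e) :
    e.charpoly = (e.restrict he).charpoly * (W.mapQ W e he).charpoly := by
  let m := Module.Free.ChooseBasisIndex F W
  let bW : Basis m F W := Module.Free.chooseBasis F W
  let n := Module.Free.ChooseBasisIndex F (V ⧸ W)
  let bQ : Basis n F (V ⧸ W) := Module.Free.chooseBasis F (V ⧸ W)
  let b := Module.Basis.sumQuot bW bQ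
  let A : Matrix m m F := LinearMap.toMatrix bW bW (e.restrict he)
  let B : Matrix m n F := Matrix.of fun i l ↦
    (b.repr (e (b (Sum.inr l)))) (Sum.inl i)
  let D : Matrix n n F := LinearMap.toMatrix bQ bQ (W.mapQ W e he)
  suffices LinearMap.toMatrix b b e = Matrix.fromBlocks A B 0 D by
    rw [← LinearMap.charpoly_toMatrix e b, this, ← LinearMap.charpoly_toMatrix _ bW,
      ← LinearMap.charpoly_toMatrix _ bQ, Matrix.charpoly_fromBlocks_zero₂₁]
  ext u v
  cases u with
  | inl i =>
    cases v with
    | inl k =>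
      simp only [b, Module.Basis.sumQuot_inl, Matrix.fromBlocks_apply₁₁, A, LinearMap.toMatrix_apply]
      apply Module.Basis.sumQuot_repr_inl_of_mem
    | inr l => simp [b, LinearMap.toMatrix_apply, Matrix.fromBlocks_apply₁₂, B]
  | inr j =>
    cases v with
    | inl k =>
      suffices W.mkQ (e (bW k)) = 0 by simp [LinearMap.toMatrix_apply, b, this]
      rw [← LinearMap.mem_ker, Submodule.ker_mkQ]
      exact he (Submodule.coe_mem (bW k))
    | inr l =>
      have h : W.mkQ (b (Sum.inr l)) = bQ l := by simp [b]
      simp only [LinearMap.toMatrix_apply, b, Module.Basis.sumQuot_repr_inr, D,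
        Matrix.fromBlocks_apply₂₂]
      rw [← h]
      rfl

theorem trace_add [Module.Finite F V] (W : Submodule F V) (e : Module.End F V)
    (he : W ≤ W.comap e) :
    LinearMap.trace F V e = LinearMap.trace F W (e.restrict he) +
      LinearMap.trace F (V ⧸ W) (W.mapQ W e he) := by
  obtain ⟨s, hs⟩ := W.mkQ.exists_rightInverse_of_surjective (LinearMap.range_eq_top.2 W.mkQ_surjective)
  have hs' : ∀ q, Submodule.Quotient.mk (s q) = q := fun q => LinearMap.congr_fun hs q
  let π : V →ₗ[F] W := LinearMap.codRestrict W (LinearMap.id - s ∘ₗ W.mkQ) (by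
    intro v
    rw [← Submodule.Quotient.mk_eq_zero W]
    simp [hs'])
  have h1 : e = W.subtype ∘ₗ ((e.restrict he) ∘ₗ π) + (e ∘ₗ s) ∘ₗ W.mkQ := by
    ext v
    simp [π]
  have h2 : π ∘ₗ W.subtype = LinearMap.id := by
    ext w
    have : (Submodule.Quotient.mk (w : V) : V ⧸ W) = 0 := (Submodule.Quotient.mk_eq_zero W).2 w.2
    simp [π, this]
  conv_lhs => rw [h1]
  rw [map_add, LinearMap.trace_comp_comm', LinearMap.comp_assoc, h2, LinearMap.comp_id,
    LinearMap.trace_comp_comm']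
  congr 2
  ext v
  have : (W.mapQ W e he) (Submodule.Quotient.mk (s (Submodule.Quotient.mk v))) =
    (W.mapQ W e he) (Submodule.Quotient.mk v) := by rw [hs']
  simpa using this

theorem restrict_add_nil {y : Module.End F V} {U : Submodule F V} (h : Inv y U)
    {N : Module.End F V} (hN : N ∈ nil U) :
    (y + N).restrict (inv_add_nil h hN) = y.restrict h := by
  refine LinearMap.ext fun u => Subtype.ext ?_
  change y u + N u = y u
  rw [hN.2 u u.2, add_zero]

theorem mapQ_add_nil {y : Module.End F V} {U : Submodule F V} (h : Inv y U)
    {N : Module.End F V} (hN : N ∈ nil U) :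
    U.mapQ U (y + N) (inv_add_nil h hN) = U.mapQ U y h := by
  ext v
  have : (Submodule.Quotient.mk (N v) : V ⧸ U) = 0 := (Submodule.Quotient.mk_eq_zero U).2 (hN.1 v)
  change (Submodule.Quotient.mk (y v + N v) : V ⧸ U) = Submodule.Quotient.mk (y v)
  rw [Submodule.Quotient.mk_add, this, add_zero]

theorem charpoly_add_nil [Module.Finite F V] {y : Module.End F V} {U : Submodule F V} (h : Inv y U)
    {N : Module.End F V} (hN : N ∈ nil U) : (y + N).charpoly = y.charpoly := by
  rw [charpoly_mul U _ (inv_add_nil h hN), charpoly_mul U y h, restrict_add_nil h hN,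
    mapQ_add_nil h hN]

theorem det_of_charpoly_eq [Module.Finite F V] {y z : Module.End F V} (h : y.charpoly = z.charpoly) :
    LinearMap.det y = LinearMap.det z := by
  rw [LinearMap.det_eq_sign_charpoly_coeff, LinearMap.det_eq_sign_charpoly_coeff, h]

theorem trace_nil_mul [Module.Finite F V] {y : Module.End F V} {U : Submodule F V} (h : Inv y U)
    {N : Module.End F V} (hN : N ∈ nil U) : LinearMap.trace F V (N * y) = 0 := by
  have h0 : (N * y) * (N * y) = 0 := by
    ext v
    simp only [Module.End.mul_apply, LinearMap.zero_apply]
    exact hN.2 _ (h (hN.1 _))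
  have : IsNilpotent (N * y) := ⟨2, by rw [pow_two, h0]⟩
  exact (LinearMap.isNilpotent_trace_of_isNilpotent this).eq_zero

theorem trace_nil [Module.Finite F V] {U : Submodule F V}
    {N : Module.End F V} (hN : N ∈ nil U) : LinearMap.trace F V N = 0 := by
  have := trace_nil_mul (y := 1) (U := U) (fun u hu => hu) hN
  simpa using this

theorem inv_of_trace_nil [Module.Finite F V] {z : Module.End F V} {U : Submodule F V}
    (h : ∀ N ∈ nil U, LinearMap.trace F V (z * N) = 0) : Inv z U := by
  intro u hu
  by_contra hz
  rw [Submodule.mem_comap] at hz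
  obtain ⟨f, hf, hfU⟩ := Submodule.exists_le_ker_of_notMem hz
  have hN : (LinearMap.toSpanSingleton F V u ∘ₗ f) ∈ nil U := by
    refine ⟨fun v => ?_, fun w hw => ?_⟩
    · simpa using U.smul_mem _ hu
    · have := hfU hw
      simp only [LinearMap.mem_ker] at this
      simp [this]
  have := h _ hN
  rw [Module.End.mul_eq_comp, ← LinearMap.comp_assoc, LinearMap.trace_comp_comm'] at this
  have h3 : LinearMap.trace F F (f ∘ₗ z ∘ₗ LinearMap.toSpanSingleton F V u) = f (z u) := by
    have : f ∘ₗ z ∘ₗ LinearMap.toSpanSingleton F V u = (f (z u)) • LinearMap.id := by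
      ext; simp
    rw [this]; simp
  exact hf (h3 ▸ this)

/-- K1 -/
theorem prim_sum_zero [Finite V] {Φ : Module.End F V → ℂ} (hΦ : Prim Φ) {U : Submodule F V}
    (h0 : U ≠ ⊥) (h1 : U ≠ ⊤) (w : Module.End F V → ℂ) (hw : ∀ y, ¬ Inv y U → w y = 0)
    (hwN : ∀ y, Inv y U → ∀ N ∈ nil U, w (y + N) = w y) : ∑ y, Φ y * w y = 0 := by
  have key : ∀ N : nil U, ∑ y, Φ y * w y = ∑ y, Φ (y + N) * w y := by
    intro N
    rw [← Equiv.sum_comp (Equiv.addRight (N : Module.End F V))]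
    refine Finset.sum_congr rfl fun y _ => ?_
    simp only [Equiv.coe_addRight]
    by_cases hy : Inv y U
    · rw [hwN y hy N N.2]
    · rw [hw y hy, hw _ (by rwa [inv_add_nil_iff N.2]), mul_zero]
  have h2 : ∑ _N : nil U, ∑ y, Φ y * w y = 0 := by
    rw [Finset.sum_congr rfl fun N _ => key N, Finset.sum_comm]
    refine Finset.sum_eq_zero fun y _ => ?_
    rw [← Finset.sum_mul]
    by_cases hy : Inv y U
    · rw [hΦ U h0 h1 y hy, zero_mul]
    · rw [hw y hy, mul_zero]
  rw [Finset.sum_const, nsmul_eq_mul, mul_eq_zero] at h2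
  rcases h2 with h2 | h2
  · simp at h2
  · exact h2

theorem Prim.mul_stable [Finite V] {Φ : Module.End F V → ℂ} (hΦ : Prim Φ)
    (h : Module.End F V → ℂ)
    (hh : ∀ y z, y.charpoly = z.charpoly → h y = h z) : Prim (fun y => h y * Φ y) := by
  intro U h0 h1 y hy
  rw [Finset.sum_congr rfl (g := fun N : nil U => h y * Φ (y + N))
    (fun N _ => by beta_reduce; rw [hh _ _ (charpoly_add_nil hy N.2)]), ← Finset.mul_sum, hΦ U h0 h1 y hy, mul_zero]

end basics

section fourier
variable {F : Type} [Field F] {V : Type} [AddCommGroup V] [Module F V] [Finite V]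
variable (ψ : AddChar F ℂ)

/-- Fourier transform. -/
noncomputable def four (Φ : Module.End F V → ℂ) : Module.End F V → ℂ :=
  fun y => ∑ z, Φ z * ψ (LinearMap.trace F V (z * y))

theorem sum_psi_linear [Finite F] (hψ : ψ ≠ 1) {M : Type} [AddCommGroup M] [Module F M] [Fintype M]
    (l : M →ₗ[F] F) : ∑ m : M, ψ (l m) = if l = 0 then (Nat.card M : ℂ) else 0 := by
  split_ifs with h
  · subst h; simp
  · let χ : AddChar M ℂ := ψ.compAddMonoidHom l.toAddMonoidHom
    have : χ ≠ 1 := by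
      obtain ⟨a, ha⟩ := AddChar.ne_one_iff.1 hψ
      obtain ⟨m, hm⟩ := LinearMap.surjective h a
      refine AddChar.ne_one_iff.2 ⟨m, ?_⟩
      simp [χ, hm, ha]
    exact AddChar.sum_eq_zero_of_ne_one this

theorem sum_nil [Finite F] (hψ : ψ ≠ 1) (z : Module.End F V) (U : Submodule F V) :
    ∑ N : nil U, ψ (LinearMap.trace F V (z * N)) = if Inv z U then (Nat.card (nil U) : ℂ) else 0 := by
  let l : nil U →ₗ[F] F := (LinearMap.trace F V ∘ₗ LinearMap.mulLeft F z) ∘ₗ (nil U).subtype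
  have h1 := sum_psi_linear ψ hψ l
  have h2 : l = 0 ↔ Inv z U := by
    constructor
    · intro h
      exact inv_of_trace_nil fun N hN => LinearMap.congr_fun h ⟨N, hN⟩
    · intro h
      ext N
      have := trace_nil_mul h N.2
      rw [LinearMap.trace_mul_comm] at this
      simpa [l] using this
  simp only [h2] at h1
  rw [← h1]
  rfl

theorem Prim.four [Finite F] (hψ : ψ ≠ 1) {Φ : Module.End F V → ℂ} (hΦ : Prim Φ) :
    Prim (four ψ Φ) := by
  intro U h0 h1 y hy
  unfold MK.four
  rw [Finset.sum_comm]
  have : ∀ z : Module.End F V, ∑ N : nil U, Φ z * ψ (LinearMap.trace F V (z * (y + N))) =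
      Φ z * (ψ (LinearMap.trace F V (z * y)) * if Inv z U then (Nat.card (nil U) : ℂ) else 0) := by
    intro z
    rw [← sum_nil ψ hψ z U, Finset.mul_sum, Finset.mul_sum]
    refine Finset.sum_congr rfl fun N _ => ?_
    rw [mul_add, map_add, AddChar.map_add_eq_mul]
  rw [Finset.sum_congr rfl fun z _ => this z]
  refine prim_sum_zero hΦ h0 h1 (fun z => ψ (LinearMap.trace F V (z * y)) *
    if Inv z U then (Nat.card (nil U) : ℂ) else 0) (fun z hz => by simp [hz]) ?_
  intro z hz N hN
  simp only [inv_add_nil_iff hN, hz, add_mul, map_add, trace_nil_mul hy hN, add_zero]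

theorem conj_mul_conj (g : V ≃ₗ[F] V) (y z : Module.End F V) :
    g.conj (y * z) = g.conj y * g.conj z := by
  ext v; simp [LinearEquiv.conj_apply]

theorem ClassFn.four {Φ : Module.End F V → ℂ} (hΦ : ClassFn Φ) : ClassFn (four ψ Φ) := by
  intro g y
  unfold MK.four
  rw [← Equiv.sum_comp (g.conj.toEquiv)]
  refine Finset.sum_congr rfl fun z _ => ?_
  have : (g.conj.toEquiv z : Module.End F V) = g.conj z := rfl
  rw [this, hΦ g z, ← conj_mul_conj, LinearMap.trace_conj']

/-- Plancherel -/
theorem plancherel [Finite F] (hψ : ψ ≠ 1) (Φ Ψ : Module.End F V → ℂ) :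
    ∑ y, four ψ Φ y * starRingEnd ℂ (four ψ Ψ y) =
      (Nat.card (Module.End F V) : ℂ) * ∑ y, Φ y * starRingEnd ℂ (Ψ y) := by
  have hstar : ∀ a : F, starRingEnd ℂ (ψ a) = ψ (-a) := by
    intro a
    rw [AddChar.map_neg_eq_conj]
  unfold MK.four
  simp only [map_sum, map_mul, hstar, Finset.sum_mul_sum]
  rw [Finset.sum_comm, Finset.mul_sum]
  refine Finset.sum_congr rfl fun z _ => ?_
  rw [Finset.sum_comm]
  have : ∀ w : Module.End F V, ∑ y : Module.End F V,
      Φ z * ψ (LinearMap.trace F V (z * y)) * (starRingEnd ℂ (Ψ w) * ψ (-LinearMap.trace F V (w * y)))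
      = if w = z then (Nat.card (Module.End F V) : ℂ) * (Φ z * starRingEnd ℂ (Ψ z)) else 0 := by
    intro w
    let l : Module.End F V →ₗ[F] F := LinearMap.trace F V ∘ₗ LinearMap.mulLeft F (z - w)
    have h1 := sum_psi_linear ψ hψ l
    have h2 : l = 0 ↔ w = z := by
      constructor
      · intro h
        have h3 : ∀ u : V, Inv (z - w) (F ∙ u) := fun u =>
          inv_of_trace_nil fun N _ => LinearMap.congr_fun h N
        by_contra hne
        have h4 : z - w ≠ 0 := fun h => hne (sub_eq_zero.1 h).symm
        obtain ⟨u, hu⟩ : ∃ u, (z - w) u ≠ 0 := by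
          by_contra hcon
          push Not at hcon
          exact h4 (LinearMap.ext hcon)
        obtain ⟨f, hf, _⟩ := Submodule.exists_le_ker_of_notMem (p := (⊥ : Submodule F V)) (v := (z - w) u)
          (by simpa using hu)
        have h5 := LinearMap.congr_fun h (LinearMap.toSpanSingleton F V u ∘ₗ f)
        simp only [l, LinearMap.comp_apply, LinearMap.mulLeft_apply, LinearMap.zero_apply] at h5
        rw [Module.End.mul_eq_comp, ← LinearMap.comp_assoc, LinearMap.trace_comp_comm'] at h5
        have h6 : f ∘ₗ (z - w) ∘ₗ LinearMap.toSpanSingleton F V u =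
          (f ((z - w) u)) • LinearMap.id := by
          ext; simp
        rw [h6] at h5
        apply hf
        simpa using h5
      · rintro rfl
        ext N; simp [l]
    simp only [h2] at h1
    have h7 : ∀ y : Module.End F V, Φ z * ψ (LinearMap.trace F V (z * y)) *
        (starRingEnd ℂ (Ψ w) * ψ (-LinearMap.trace F V (w * y))) =
        (Φ z * starRingEnd ℂ (Ψ w)) * ψ (l y) := by
      intro y
      have h8 : l y = LinearMap.trace F V (z * y) + -LinearMap.trace F V (w * y) := by
        simp only [l, LinearMap.comp_apply, LinearMap.mulLeft_apply, sub_mul, map_sub]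
        rw [sub_eq_add_neg]
      rw [h8, AddChar.map_add_eq_mul]
      ring
    rw [Finset.sum_congr rfl fun y _ => h7 y, ← Finset.mul_sum, h1]
    split_ifs with h
    · subst h; ring
    · simp
  rw [Finset.sum_congr rfl fun w _ => this w]
  simp

end fourier
end MK

set_option linter.all false

namespace MK
open Module Polynomial
open scoped BigOperators Classical

section cyc
variable {F : Type} [Field F] {V : Type} [AddCommGroup V] [Module F V]

/-- evaluation `p ↦ p(y) v` -/
noncomputable def ev (y : Module.End F V) (v : V) : F[X] →ₗ[F] V :=
  (LinearMap.applyₗ v) ∘ₗ (aeval y).toLinearMap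

@[simp] theorem ev_apply (y : Module.End F V) (v : V) (p : F[X]) : ev y v p = aeval y p v := rfl

noncomputable def cyc (y : Module.End F V) (v : V) : Submodule F V := LinearMap.range (ev y v)

theorem mem_cyc {y : Module.End F V} {v u : V} : u ∈ cyc y v ↔ ∃ p : F[X], aeval y p v = u := Iff.rfl

theorem self_mem_cyc (y : Module.End F V) (v : V) : v ∈ cyc y v := ⟨1, by simp⟩

theorem inv_cyc (y : Module.End F V) (v : V) : Inv y (cyc y v) := by
  rintro _ ⟨p, rfl⟩
  exact ⟨X * p, by simp⟩

theorem Inv.aeval {y : Module.End F V} {U : Submodule F V} (h : Inv y U) (p : F[X]) :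
    Inv (aeval y p) U := by
  intro u hu
  rw [Submodule.mem_comap]
  induction p using Polynomial.induction_on' with
  | add p q hp hq => rw [map_add, LinearMap.add_apply]; exact U.add_mem hp hq
  | monomial n a =>
    rw [aeval_monomial]
    have : ∀ n, (y ^ n) u ∈ U := by
      intro n
      induction n with
      | zero => simpa
      | succ n ih => rw [pow_succ', Module.End.mul_apply]; exact h ih
    exact U.smul_mem a (this n)

theorem aeval_congr {y z : Module.End F V} {U : Submodule F V} (h : Inv y U)
    (hz : ∀ u ∈ U, z u = y u) (p : F[X]) {u : V} (hu : u ∈ U) : aeval z p u = aeval y p u := by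
  induction p using Polynomial.induction_on' with
  | add p q hp hq => simp [hp, hq]
  | monomial n a =>
    rw [aeval_monomial, aeval_monomial]
    have : ∀ n, (z ^ n) u = (y ^ n) u := by
      intro n
      induction n with
      | zero => rfl
      | succ n ih =>
        rw [pow_succ', pow_succ', Module.End.mul_apply, Module.End.mul_apply, ih, hz]
        have := h.aeval (X ^ n) hu
        simpa using this
    change a • (z ^ n) u = a • (y ^ n) u
    rw [this]

theorem aeval_add_nil {y N : Module.End F V} {U : Submodule F V} (h : Inv y U)
    (hN : N ∈ nil U) (p : F[X]) {u : V} (hu : u ∈ U) : aeval (y + N) p u = aeval y p u :=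
  aeval_congr h (fun u hu => by simp [hN.2 u hu]) p hu

theorem aeval_sub_mem {y N : Module.End F V} {U : Submodule F V} (h : Inv y U)
    (hN : N ∈ nil U) (p : F[X]) (v : V) : aeval (y + N) p v - aeval y p v ∈ U := by
  induction p using Polynomial.induction_on' with
  | add p q hp hq =>
    have := U.add_mem hp hq
    simp only [map_add, LinearMap.add_apply]
    convert this using 1
    abel
  | monomial n a =>
    rw [aeval_monomial, aeval_monomial]
    have : ∀ n, ((y + N) ^ n) v - (y ^ n) v ∈ U := by
      intro n
      induction n with
      | zero => simp
      | succ n ih =>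
        rw [pow_succ', pow_succ', Module.End.mul_apply, Module.End.mul_apply]
        have h1 := U.add_mem (h ih) (hN.1 (((y + N) ^ n) v))
        convert h1 using 1
        simp
        abel
    have := U.smul_mem a (this n)
    rw [smul_sub] at this
    exact this

theorem cyc_add_nil {y N : Module.End F V} {U : Submodule F V} {v : V} (hU : cyc y v = U)
    (hN : N ∈ nil U) : cyc (y + N) v = U := by
  have hi : Inv y U := hU ▸ inv_cyc y v
  have hv : v ∈ U := hU ▸ self_mem_cyc y v
  rw [← hU]
  ext u
  simp only [mem_cyc]
  constructor
  · rintro ⟨p, rfl⟩; exact ⟨p, (aeval_add_nil hi hN p hv).symm⟩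
  · rintro ⟨p, rfl⟩; exact ⟨p, (aeval_add_nil hi hN p hv)⟩

theorem cyc_ne_bot {y : Module.End F V} {v : V} (hv : v ≠ 0) : cyc y v ≠ ⊥ := by
  intro h
  have := self_mem_cyc y v
  rw [h, Submodule.mem_bot] at this
  exact hv this

variable [Finite V]

/-- K1 for cyclic vectors -/
theorem sum_cyc {Φ : Module.End F V → ℂ} (hΦ : Prim Φ) (c : F[X]) {v : V} (hv : v ≠ 0) :
    ∑ y, Φ y * (if y.charpoly = c then 1 else 0) =
    ∑ y, Φ y * (if y.charpoly = c ∧ cyc y v = ⊤ then 1 else 0) := by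
  have h1 : ∀ y : Module.End F V, Φ y * (if y.charpoly = c then 1 else 0) =
      ∑ U : Submodule F V, Φ y * (if y.charpoly = c ∧ cyc y v = U then 1 else 0) := by
    intro y
    rw [← Finset.mul_sum, Finset.sum_eq_single (cyc y v)]
    · simp
    · intro U _ hU
      rw [if_neg]
      rintro ⟨_, rfl⟩
      exact hU rfl
    · simp
  rw [Finset.sum_congr rfl fun y _ => h1 y, Finset.sum_comm, Finset.sum_eq_single ⊤]
  · intro U _ hU
    by_cases h0 : U = ⊥
    · refine Finset.sum_eq_zero fun y _ => ?_
      rw [if_neg, mul_zero]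
      rintro ⟨_, h⟩
      exact cyc_ne_bot hv (h.trans h0)
    · refine prim_sum_zero hΦ h0 hU _ ?_ ?_
      · intro y hy
        rw [if_neg]
        rintro ⟨_, rfl⟩
        exact hy (inv_cyc y v)
      · intro y hy N hN
        have hiff : cyc (y + N) v = U ↔ cyc y v = U := by
          constructor
          · intro h
            have := cyc_add_nil h ((nil U).neg_mem hN)
            simpa using this
          · intro h; exact cyc_add_nil h hN
        simp only [charpoly_add_nil hy hN, hiff]
  · simp

end cyc

section A4
variable {F : Type} [Field F] {V : Type} [AddCommGroup V] [Module F V] [Finite V]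

/-- multiplication by the root on `F[X]/(c)`. -/
noncomputable def rootMul (c : F[X]) : Module.End F (AdjoinRoot c) :=
  LinearMap.mulLeft F (AdjoinRoot.root c)

theorem aeval_rootMul (c p : F[X]) (z : AdjoinRoot c) : aeval (rootMul c) p z = AdjoinRoot.mk c p * z := by
  have : rootMul c = Algebra.lmul F (AdjoinRoot c) (AdjoinRoot.root c) := rfl
  rw [this, aeval_algHom_apply, AdjoinRoot.aeval_eq]
  rfl

theorem finite_adjoinRoot {c : F[X]} (hc : c.Monic) : Module.Finite F (AdjoinRoot c) :=
  hc.finite_adjoinRoot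

theorem finrank_adjoinRoot {c : F[X]} (hc : c.Monic) : finrank F (AdjoinRoot c) = c.natDegree := by
  rw [(AdjoinRoot.powerBasis' hc).finrank, AdjoinRoot.powerBasis'_dim]

theorem charpoly_rootMul {c : F[X]} (hc : c.Monic) [Nontrivial (AdjoinRoot c)] [Module.Finite F (AdjoinRoot c)] : (rootMul c).charpoly = c := by
  have h1 := charpoly_leftMulMatrix (AdjoinRoot.powerBasis' hc)
  rw [AdjoinRoot.powerBasis'_gen, AdjoinRoot.minpoly_root hc.ne_zero] at h1
  rw [← LinearMap.charpoly_toMatrix _ (AdjoinRoot.powerBasis' hc).basis]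
  rw [hc.leadingCoeff, inv_one, map_one, mul_one] at h1
  rw [← Algebra.toMatrix_lmul_eq] at h1
  exact h1

theorem aeval_conj {W : Type} [AddCommGroup W] [Module F W] (e : W ≃ₗ[F] V) (y : Module.End F W) (p : F[X]) :
    aeval (e.conj y) p = e.conj (aeval y p) := by
  have : e.conj y = e.conjAlgEquiv F y := rfl
  rw [this, aeval_algHom_apply]
  rfl

theorem A4aux {c : F[X]} (hc : c.Monic) [Nontrivial V] (hn : c.natDegree = finrank F V) (y : Module.End F V)
    (v : V) (hy : y.charpoly = c) (hv : cyc y v = ⊤) :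
    ∃! e : AdjoinRoot c ≃ₗ[F] V, e.conj (rootMul c) = y ∧ e 1 = v := by
  haveI := finite_adjoinRoot hc
  have hker : ∀ p, c ∣ p → aeval y p v = 0 := by
    rintro p ⟨r, rfl⟩
    rw [mul_comm, map_mul, ← hy, LinearMap.aeval_self_charpoly]
    simp
  let θ : AdjoinRoot c →ₗ[F] V :=
    (Submodule.liftQ ((Ideal.span {c}).restrictScalars F) (ev y v) (by
      intro p hp
      rw [Submodule.restrictScalars_mem, Ideal.mem_span_singleton] at hp
      exact hker p hp))
  have hθ : ∀ p, θ (AdjoinRoot.mk c p) = aeval y p v := fun p => rfl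
  have hsurj : Function.Surjective θ := by
    intro u
    have : u ∈ cyc y v := hv ▸ Submodule.mem_top
    obtain ⟨p, hp⟩ := this
    exact ⟨AdjoinRoot.mk c p, hp⟩
  have hinj : Function.Injective θ :=
    (LinearMap.injective_iff_surjective_of_finrank_eq_finrank (by rw [finrank_adjoinRoot hc, hn])).2 hsurj
  let e := LinearEquiv.ofBijective θ ⟨hinj, hsurj⟩
  have he : ∀ p, e (AdjoinRoot.mk c p) = aeval y p v := fun p => rfl
  refine ⟨e, ⟨?_, ?_⟩, ?_⟩
  · refine LinearMap.ext fun u => ?_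
    obtain ⟨z, rfl⟩ := e.surjective u
    obtain ⟨p, rfl⟩ := AdjoinRoot.mk_surjective z
    rw [LinearEquiv.conj_apply_apply, e.symm_apply_apply, he]
    have : rootMul c (AdjoinRoot.mk c p) = AdjoinRoot.mk c (X * p) := by
      rw [map_mul]; rfl
    rw [this, he, map_mul, aeval_X, Module.End.mul_apply]
  · have := he 1
    rw [map_one] at this
    rw [this]; simp
  · rintro e' ⟨h1, h2⟩
    refine LinearEquiv.ext fun z => ?_
    obtain ⟨p, rfl⟩ := AdjoinRoot.mk_surjective z
    rw [he, ← h1, aeval_conj, ← h2, LinearEquiv.conj_apply_apply, e'.symm_apply_apply, aeval_rootMul, mul_one]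

theorem A4aux2 {c : F[X]} (hc : c.Monic) [Nontrivial V] (hn : c.natDegree = finrank F V)
    (e : AdjoinRoot c ≃ₗ[F] V) : (e.conj (rootMul c)).charpoly = c ∧ cyc (e.conj (rootMul c)) (e 1) = ⊤ := by
  haveI := finite_adjoinRoot hc
  haveI : Nontrivial (AdjoinRoot c) := e.toEquiv.nontrivial
  refine ⟨by rw [LinearEquiv.charpoly_conj, charpoly_rootMul hc], ?_⟩
  rw [eq_top_iff]
  rintro u -
  obtain ⟨z, rfl⟩ := e.surjective u
  obtain ⟨p, rfl⟩ := AdjoinRoot.mk_surjective z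
  exact ⟨p, by rw [ev_apply, aeval_conj, LinearEquiv.conj_apply_apply, e.symm_apply_apply, aeval_rootMul, mul_one]⟩

theorem A4 {Φ : Module.End F V → ℂ} (hΦ : Prim Φ) {c : F[X]} (hc : c.Monic) [Nontrivial V]
    (hn : c.natDegree = finrank F V) [Finite (AdjoinRoot c)] :
    ((Nat.card V : ℂ) - 1) * ∑ y, Φ y * (if y.charpoly = c then 1 else 0) =
      ∑ e : AdjoinRoot c ≃ₗ[F] V, Φ (e.conj (rootMul c)) := by
  have h1 : ∀ v : V, ∑ y, Φ y * (if y.charpoly = c ∧ cyc y (v : V) = ⊤ then 1 else 0) =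
      (∑ y, Φ y * (if y.charpoly = c then 1 else 0)) -
      if v = 0 then (∑ y, Φ y * (if y.charpoly = c then 1 else 0)) else 0 := by
    intro v
    split_ifs with h
    · subst h
      rw [sub_self]
      refine Finset.sum_eq_zero fun y _ => ?_
      rw [if_neg, mul_zero]
      rintro ⟨_, h⟩
      have : cyc y (0 : V) = ⊥ := by
        rw [eq_bot_iff]
        rintro _ ⟨p, rfl⟩
        simp
      rw [this] at h
      exact bot_ne_top h
    · rw [sub_zero, sum_cyc hΦ c h]
  have h2 : ((Nat.card V : ℂ) - 1) * ∑ y, Φ y * (if y.charpoly = c then 1 else 0) =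
      ∑ v : V, ∑ y, Φ y * (if y.charpoly = c ∧ cyc y (v : V) = ⊤ then 1 else 0) := by
    rw [Finset.sum_congr rfl fun v _ => h1 v, Finset.sum_sub_distrib, Finset.sum_const, nsmul_eq_mul]
    simp [sub_mul]
  rw [h2]
  rw [← Finset.sum_product', ← Finset.sum_filter_add_sum_filter_not _ (fun x : V × Module.End F V => x.2.charpoly = c ∧ cyc x.2 x.1 = ⊤)]
  rw [Finset.sum_eq_zero (s := Finset.filter (fun x : V × Module.End F V => ¬ (x.2.charpoly = c ∧ cyc x.2 x.1 = ⊤)) _), add_zero]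
  · symm
    refine Finset.sum_bij (fun e _ => (e 1, e.conj (rootMul c))) ?_ ?_ ?_ ?_
    · intro e _
      rw [Finset.mem_filter]
      exact ⟨by simp, A4aux2 hc hn e⟩
    · intro e _ e' _ h
      rw [Prod.mk.injEq] at h
      obtain ⟨h3, h4⟩ := A4aux2 hc hn e
      exact (A4aux hc hn _ _ h3 h4).unique ⟨rfl, rfl⟩ ⟨h.2.symm, h.1.symm⟩
    · rintro ⟨v, y⟩ h
      rw [Finset.mem_filter] at h
      obtain ⟨e, he, -⟩ := A4aux hc hn y v h.2.1 h.2.2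
      exact ⟨e, by simp, by rw [he.1, he.2]⟩
    · intro e _
      rw [if_pos (A4aux2 hc hn e), mul_one]
  · intro x hx
    rw [Finset.mem_filter] at hx
    rw [if_neg hx.2, mul_zero]

/-- `A4` for class functions. -/
theorem A4class {Φ : Module.End F V → ℂ} (hΦ : Prim Φ) (hcl : ClassFn Φ) [Nontrivial V]
    (y : Module.End F V) (v : V) (hv : cyc y v = ⊤) :
    ((Nat.card V : ℂ) - 1) * ∑ z, Φ z * (if z.charpoly = y.charpoly then 1 else 0) =
      (Nat.card (V ≃ₗ[F] V) : ℂ) * Φ y := by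
  have hm := LinearMap.charpoly_monic y
  have hd := LinearMap.charpoly_natDegree y
  obtain ⟨e0, ⟨h1, h2⟩, -⟩ := A4aux hm hd y v rfl hv
  haveI : Finite (AdjoinRoot y.charpoly) := Finite.of_equiv _ e0.symm.toEquiv
  rw [A4 hΦ hm hd]
  have h3 : ∀ e : AdjoinRoot y.charpoly ≃ₗ[F] V, Φ (e.conj (rootMul y.charpoly)) = Φ y := by
    intro e
    rw [← hcl (e0.symm.trans e) y]
    congr 1
    ext u
    have h5 := LinearMap.congr_fun h1 (e0 (e.symm u))
    simp only [LinearEquiv.conj_apply_apply, LinearEquiv.symm_apply_apply] at h5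
    simp [LinearEquiv.conj_apply, ← h5]
  rw [Finset.sum_congr rfl fun e _ => h3 e, Finset.sum_const, nsmul_eq_mul]
  congr 2
  rw [Finset.card_univ, ← Nat.card_eq_fintype_card]
  exact Nat.card_congr ⟨fun e => e0.symm.trans e, fun g => e0.trans g, fun e => by ext; simp, fun e => by ext; simp⟩

theorem exists_cyclic {c : F[X]} (hc : c.Monic) [Nontrivial V] (hn : c.natDegree = finrank F V) :
    ∃ (y : Module.End F V) (v : V), y.charpoly = c ∧ cyc y v = ⊤ := by
  haveI := finite_adjoinRoot hc
  let e : AdjoinRoot c ≃ₗ[F] V := LinearEquiv.ofFinrankEq _ _ (by rw [finrank_adjoinRoot hc, hn])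
  exact ⟨_, _, A4aux2 hc hn e⟩
end A4

section A5
variable {F : Type} [Field F] {V : Type} [AddCommGroup V] [Module F V]

/-- an irreducible factor of the characteristic polynomial kills some vector -/
theorem ker_aeval_ne_bot [Module.Finite F V] {y : Module.End F V} {p : F[X]} (hp : Irreducible p) (hd : p ∣ y.charpoly) :
    LinearMap.ker (aeval y p) ≠ ⊥ := by
  intro hk
  haveI : Fact (Irreducible p) := ⟨hp⟩
  have hu : IsUnit (aeval y p) := by
    rw [Module.End.isUnit_iff]
    exact ⟨LinearMap.ker_eq_bot.1 hk, LinearMap.injective_iff_surjective.1 (LinearMap.ker_eq_bot.1 hk)⟩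
  let K := AdjoinRoot p
  have h1 : (y.baseChange K).charpoly.IsRoot (AdjoinRoot.root p) := by
    rw [LinearMap.charpoly_baseChange, Polynomial.IsRoot, Polynomial.eval_map_algebraMap]
    obtain ⟨r, hr⟩ := hd
    rw [hr, map_mul, AdjoinRoot.aeval_eq, AdjoinRoot.mk_self, zero_mul]
  rw [← Module.End.hasEigenvalue_iff_isRoot_charpoly] at h1
  obtain ⟨w, hw⟩ := h1.exists_hasEigenvector
  have h2 : aeval (y.baseChange K) (p.map (algebraMap F K)) w = 0 := by
    rw [Module.End.aeval_apply_of_hasEigenvector hw]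
    rw [Polynomial.eval_map_algebraMap, AdjoinRoot.aeval_eq, AdjoinRoot.mk_self, zero_smul]
  have h3 : aeval (y.baseChange K) (p.map (algebraMap F K)) = (aeval y p).baseChange K := by
    rw [aeval_map_algebraMap]
    have := aeval_algHom_apply (Module.End.baseChangeHom F K V) y p
    exact this
  rw [h3] at h2
  have h4 := hu.map (Module.End.baseChangeHom F K V)
  rw [Module.End.isUnit_iff] at h4
  have h5 : (aeval y p).baseChange K w = (aeval y p).baseChange K 0 := by rw [h2, map_zero]
  exact hw.2 (h4.1 h5)

theorem ker_aeval_ne_bot' [Module.Finite F V] {y : Module.End F V} {p : F[X]} (hp : ¬ IsUnit p) (hp0 : p ≠ 0)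
    (hd : p ∣ y.charpoly) : LinearMap.ker (aeval y p) ≠ ⊥ := by
  obtain ⟨r, hr, s, hs⟩ := WfDvdMonoid.exists_irreducible_factor hp hp0
  have := ker_aeval_ne_bot hr ((Dvd.intro _ hs.symm).trans hd)
  intro h
  apply this
  rw [eq_bot_iff, ← h]
  intro v hv
  rw [LinearMap.mem_ker] at hv ⊢
  rw [hs, mul_comm, map_mul, Module.End.mul_apply, hv, map_zero]

theorem inv_ker_aeval (y : Module.End F V) (p : F[X]) : Inv y (LinearMap.ker (aeval y p)) := by
  intro v hv
  rw [Submodule.mem_comap, LinearMap.mem_ker] at *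
  have : aeval y p (y v) = y (aeval y p v) := by
    have h : aeval y (p * X) = aeval y (X * p) := by rw [mul_comm]
    rw [map_mul, map_mul, aeval_X] at h
    exact LinearMap.congr_fun h v
  rw [this, hv, map_zero]

/-- coprime stability of `ker p₁(y)` -/
theorem ker_add_nil {y N : Module.End F V} {p₁ p₂ : F[X]} (hcop : IsCoprime p₁ p₂)
    (h0 : aeval y (p₁ * p₂) = 0) (hN : N ∈ nil (LinearMap.ker (aeval y p₁))) :
    LinearMap.ker (aeval (y + N) p₁) = LinearMap.ker (aeval y p₁) := by
  have hi := inv_ker_aeval y p₁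
  ext v
  constructor
  · intro hv
    rw [LinearMap.mem_ker] at hv
    have h1 := aeval_sub_mem hi hN p₁ v
    rw [hv, zero_sub, Submodule.neg_mem_iff, LinearMap.mem_ker] at h1
    obtain ⟨a, b, hab⟩ := hcop
    have h2 : aeval y p₁ v = aeval y (a * p₁ + b * p₂) (aeval y p₁ v) := by rw [hab]; simp
    have h3 : aeval y p₂ (aeval y p₁ v) = 0 := by
      rw [← Module.End.mul_apply, ← map_mul, mul_comm, h0]; rfl
    rw [LinearMap.mem_ker, h2, map_add, map_mul, map_mul, LinearMap.add_apply, Module.End.mul_apply,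
      Module.End.mul_apply, h1, h3, map_zero, map_zero, add_zero]
  · intro hv
    rw [LinearMap.mem_ker, aeval_add_nil hi hN p₁ hv]
    exact hv

variable [Finite V]

theorem A5 {Φ : Module.End F V → ℂ} (hΦ : Prim Φ) {p₁ p₂ : F[X]} (hcop : IsCoprime p₁ p₂)
    (h1 : ¬ IsUnit p₁) (h2 : ¬ IsUnit p₂) (h01 : p₁ ≠ 0) (h02 : p₂ ≠ 0):
    ∑ y, Φ y * (if y.charpoly = p₁ * p₂ then 1 else 0) = 0 := by
  have h3 : ∀ y : Module.End F V, Φ y * (if y.charpoly = p₁ * p₂ then 1 else 0) =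
      ∑ U : Submodule F V, Φ y * (if y.charpoly = p₁ * p₂ ∧ LinearMap.ker (aeval y p₁) = U then 1 else 0) := by
    intro y
    rw [← Finset.mul_sum, Finset.sum_eq_single (LinearMap.ker (aeval y p₁))]
    · simp
    · intro U _ hU
      rw [if_neg]
      rintro ⟨_, rfl⟩
      exact hU rfl
    · simp
  have hann : ∀ y : Module.End F V, y.charpoly = p₁ * p₂ → aeval y (p₁ * p₂) = 0 := by
    intro y hy
    rw [← hy, LinearMap.aeval_self_charpoly]
  rw [Finset.sum_congr rfl fun y _ => h3 y, Finset.sum_comm]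
  refine Finset.sum_eq_zero fun U _ => ?_
  by_cases hb : U = ⊥
  · refine Finset.sum_eq_zero fun y _ => ?_
    rw [if_neg, mul_zero]
    rintro ⟨hy, h⟩
    exact ker_aeval_ne_bot' h1 h01 (hy ▸ Dvd.intro _ rfl) (h.trans hb)
  by_cases ht : U = ⊤
  · refine Finset.sum_eq_zero fun y _ => ?_
    rw [if_neg, mul_zero]
    rintro ⟨hy, h⟩
    refine ker_aeval_ne_bot' h2 h02 (hy ▸ Dvd.intro_left _ rfl) ?_
    rw [eq_bot_iff]
    intro v hv
    obtain ⟨a, b, hab⟩ := hcop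
    have h4 : v = aeval y (a * p₁ + b * p₂) v := by rw [hab]; simp
    have h5 : aeval y p₁ v = 0 := by
      rw [← LinearMap.mem_ker, h.trans ht]; trivial
    rw [LinearMap.mem_ker] at hv
    rw [Submodule.mem_bot, h4, map_add, map_mul, map_mul, LinearMap.add_apply, Module.End.mul_apply,
      Module.End.mul_apply, h5, hv, map_zero, map_zero, add_zero]
  refine prim_sum_zero hΦ hb ht _ ?_ ?_
  · intro y hy
    rw [if_neg]
    rintro ⟨_, rfl⟩
    exact hy (inv_ker_aeval y p₁)
  · intro y hy N hN
    congr 1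
    rw [charpoly_add_nil hy hN, eq_iff_iff]
    refine and_congr_right fun hc => ?_
    constructor
    · intro h
      subst h
      have hN' := (nil (LinearMap.ker (aeval (y + N) p₁))).neg_mem hN
      have := ker_add_nil hcop (hann _ ((charpoly_add_nil hy hN).trans hc)) hN'
      rw [add_neg_cancel_right] at this
      exact this
    · intro h
      subst h
      exact ker_add_nil hcop (hann _ hc) hN
end A5
end MK

set_option linter.all false

namespace MK
open Module Polynomial
open scoped BigOperators Classical

section A2
variable {F : Type} [Field F] {V : Type} [AddCommGroup V] [Module F V] [Finite V]

theorem split_conj {y N : Module.End F V} {U : Submodule F V} (hi : Inv y U) (hN : N ∈ nil U)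
    (P Q : Module.End F V) (hP : ∀ v, P v ∈ U) (hP1 : ∀ u ∈ U, P u = u) (hPy : ∀ v, P (y v) = y (P v))
    (hQ : ∀ v, Q v ∈ U) (hQ1 : ∀ u ∈ U, Q u = u) (hQy : ∀ v, Q ((y + N) v) = (y + N) (Q v)) :
    ∃ g : V ≃ₗ[F] V, g.conj y = y + N := by
  let g0 : Module.End F V := P + (1 - Q)
  have hg0 : ∀ v, g0 v = P v + (v - Q v) := fun v => rfl
  have hinj : Function.Injective g0 := by
    rw [injective_iff_map_eq_zero]
    intro v hv
    rw [hg0] at hv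
    have h1 : Q (P v + (v - Q v)) = 0 := by rw [hv, map_zero]
    rw [map_add, map_sub, hQ1 _ (hP v), hQ1 _ (hQ v), sub_self, add_zero] at h1
    rw [h1, zero_add, sub_eq_zero] at hv
    rw [← h1, hv, hP1 _ (hQ v)]
  let g := LinearEquiv.ofBijective g0 ⟨hinj, LinearMap.injective_iff_surjective.1 hinj⟩
  have hg : ∀ v, g v = P v + (v - Q v) := fun v => rfl
  refine ⟨g, LinearMap.ext fun u => ?_⟩
  obtain ⟨v, rfl⟩ := g.surjective u
  rw [LinearEquiv.conj_apply_apply, g.symm_apply_apply, hg, hg, map_add, map_sub, ← hQy, hPy]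
  have h2 : (y + N) (P v) = y (P v) := by simp [hN.2 _ (hP v)]
  rw [h2, LinearMap.add_apply, map_add, hQ1 _ (hN.1 v)]
  abel

theorem proj_coprime (y : Module.End F V) {p₁ p₂ : F[X]} (hcop : IsCoprime p₁ p₂)
    (h0 : aeval y (p₁ * p₂) = 0) : ∃ P : Module.End F V, (∀ v, P v ∈ LinearMap.ker (aeval y p₁)) ∧
      (∀ u ∈ LinearMap.ker (aeval y p₁), P u = u) ∧ ∀ v, P (y v) = y (P v) := by
  obtain ⟨a, b, hab⟩ := hcop
  refine ⟨aeval y (b * p₂), ?_, ?_, ?_⟩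
  · intro v
    rw [LinearMap.mem_ker, ← Module.End.mul_apply, ← map_mul, mul_left_comm, map_mul, h0, mul_zero]
    rfl
  · intro u hu
    have h4 : u = aeval y (a * p₁ + b * p₂) u := by rw [hab]; simp
    rw [LinearMap.mem_ker] at hu
    conv_rhs => rw [h4, map_add, map_mul, LinearMap.add_apply, Module.End.mul_apply, hu, map_zero, zero_add]
  · intro v
    have h : aeval y (b * p₂ * X) = aeval y (X * (b * p₂)) := by rw [mul_comm]
    rw [map_mul _ (b * p₂) X, map_mul _ X (b * p₂), aeval_X] at h
    exact LinearMap.congr_fun h v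

theorem aeval_ne_of_deg {z : Module.End F V} {v : V} {ℓ : F[X]} (hℓ : Irreducible ℓ) {e : ℕ}
    (h0 : aeval z (ℓ ^ (e + 1)) = 0) (h1 : aeval z (ℓ ^ e) v ≠ 0) {p : F[X]} (hp : aeval z p v = 0) :
    ℓ ^ (e + 1) ∣ p := by
  by_contra hnd
  have hp0 : p ≠ 0 := by rintro rfl; exact hnd (dvd_zero _)
  obtain ⟨i, r, hr, rfl⟩ := WfDvdMonoid.max_power_factor hp0 hℓ
  have hi : i ≤ e := by
    by_contra hi
    exact hnd ((pow_dvd_pow ℓ (by omega)).trans (Dvd.intro _ rfl))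
  have hcop : IsCoprime r (ℓ ^ (e + 1)) :=
    (IsCoprime.pow_left ((hℓ.coprime_iff_not_dvd).2 hr)).symm
  obtain ⟨a, b, hab⟩ := hcop
  apply h1
  have h2 : ℓ ^ e = (ℓ ^ (e - i) * a) * (ℓ ^ i * r) + (ℓ ^ e * b) * ℓ ^ (e + 1) := by
    have : ℓ ^ e = ℓ ^ e * (a * r + b * ℓ ^ (e + 1)) := by rw [hab, mul_one]
    conv_lhs => rw [this]
    have h3 : ℓ ^ e = ℓ ^ (e - i) * ℓ ^ i := by rw [← pow_add]; congr 1; omega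
    rw [mul_add]
    congr 1
    · rw [h3]; ring
    · ring
  rw [h2, map_add, map_mul _ (_ * a), map_mul _ (_ * b), h0, mul_zero, add_zero, Module.End.mul_apply, hp, map_zero]

theorem proj_primary {z : Module.End F V} {v : V} {ℓ : F[X]} (hℓ : Irreducible ℓ) {e : ℕ}
    (h0 : aeval z (ℓ ^ (e + 1)) = 0) (h1 : aeval z (ℓ ^ e) v ≠ 0) :
    ∃ P : Module.End F V, (∀ u, P u ∈ cyc z v) ∧ (∀ u ∈ cyc z v, P u = u) ∧ ∀ u, P (z u) = z (P u) := by
  set m := ℓ ^ (e + 1) with hm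
  have hm0 : m ≠ 0 := pow_ne_zero _ hℓ.ne_zero
  set n := m.natDegree with hn
  have hn0 : 0 < n := by
    rw [hn, hm, natDegree_pow]
    exact Nat.mul_pos (by omega) hℓ.natDegree_pos
  have key : ∀ p : F[X], aeval z p v = 0 → m ∣ p := fun p hp => aeval_ne_of_deg hℓ h0 h1 hp
  have hred : ∀ p : F[X], aeval z (p % m) = aeval z p := by
    intro p
    conv_rhs => rw [← EuclideanDomain.mod_add_div p m, map_add, map_mul, h0, zero_mul, add_zero]
  let φ : degreeLT F n →ₗ[F] V := ev z v ∘ₗ (degreeLT F n).subtype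
  have hφ : LinearMap.ker φ = ⊥ := by
    rw [LinearMap.ker_eq_bot']
    rintro ⟨p, hp⟩ h
    have hd := key p h
    rw [mem_degreeLT] at hp
    by_contra hne
    have hp0 : p ≠ 0 := fun h => hne (Subtype.ext h)
    have := natDegree_le_of_dvd hd hp0
    rw [degree_eq_natDegree hp0] at hp
    have : p.natDegree < n := by exact_mod_cast hp
    omega
  obtain ⟨L, hL⟩ := φ.exists_leftInverse_of_injective hφ
  let lam : V →ₗ[F] F := (lcoeff F (n - 1)) ∘ₗ (degreeLT F n).subtype ∘ₗ L
  have hlam : ∀ p : F[X], p.degree < n → lam (aeval z p v) = p.coeff (n - 1) := by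
    intro p hp
    have := LinearMap.congr_fun hL ⟨p, mem_degreeLT.2 hp⟩
    have h3 : L (aeval z p v) = ⟨p, mem_degreeLT.2 hp⟩ := this
    simp [lam, h3]
  have hmod : ∀ p : F[X], (p % m).degree < n := by
    intro p
    have := EuclideanDomain.mod_lt p hm0
    exact lt_of_lt_of_le this degree_le_natDegree
  -- nondegeneracy
  have hnd : ∀ u ∈ cyc z v, (∀ i < n, lam (aeval z (X ^ i : F[X]) u) = 0) → u = 0 := by
    rintro u ⟨p, rfl⟩ h
    rw [ev_apply, ← hred p] at h ⊢
    set r := p % m with hr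
    by_contra hu
    have hr0 : r ≠ 0 := by intro h; apply hu; rw [h]; simp
    have hrd : r.natDegree < n := by
      have := hmod p
      rw [← hr, degree_eq_natDegree hr0] at this
      exact_mod_cast this
    have h2 := h (n - 1 - r.natDegree) (by omega)
    rw [← Module.End.mul_apply, ← map_mul, hlam] at h2
    · have h3 : n - 1 = r.natDegree + (n - 1 - r.natDegree) := by omega
      rw [h3] at h2
      rw [show r.natDegree + (n - 1 - r.natDegree) - r.natDegree = n - 1 - r.natDegree by omega,
        coeff_X_pow_mul] at h2
      exact hr0 (leadingCoeff_eq_zero.1 h2)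
    · refine lt_of_le_of_lt degree_le_natDegree ?_
      rw [natDegree_X_pow_mul _ hr0]
      exact_mod_cast (by omega)
  let T : V →ₗ[F] (Fin n → F) := LinearMap.pi fun i => lam ∘ₗ aeval z (X ^ (i : ℕ) : F[X])
  let TU : cyc z v →ₗ[F] (Fin n → F) := T ∘ₗ (cyc z v).subtype
  have hTUinj : Function.Injective TU := by
    rw [injective_iff_map_eq_zero]
    rintro ⟨u, hu⟩ h
    refine Subtype.ext (hnd u hu fun i hi => ?_)
    exact congr_fun h ⟨i, hi⟩
  have hfr : finrank F (cyc z v) = n := by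
    have h3 : cyc z v = LinearMap.range φ := by
      ext u
      constructor
      · rintro ⟨p, rfl⟩
        exact ⟨⟨p % m, mem_degreeLT.2 (hmod p)⟩, by change aeval z (p % m) v = aeval z p v; rw [hred]⟩
      · rintro ⟨p, rfl⟩
        exact ⟨p, rfl⟩
    rw [h3, LinearMap.finrank_range_of_inj (LinearMap.ker_eq_bot.1 hφ), (degreeLTEquiv F n).finrank_eq]
    simp
  have hTUsurj : Function.Surjective TU := by
    rw [← LinearMap.injective_iff_surjective_of_finrank_eq_finrank]
    · exact hTUinj
    · rw [hfr]; simp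
  let eT := LinearEquiv.ofBijective TU ⟨hTUinj, hTUsurj⟩
  let P : Module.End F V := (cyc z v).subtype ∘ₗ eT.symm.toLinearMap ∘ₗ T
  have hPmem : ∀ u, P u ∈ cyc z v := fun u => (eT.symm (T u)).2
  have hPT : ∀ u, T (P u) = T u := fun u => eT.apply_symm_apply (T u)
  have hlamall : ∀ w, T w = 0 → ∀ p : F[X], lam (aeval z p w) = 0 := by
    intro w hw p
    rw [← hred p]
    have h3 := hmod p
    rw [as_sum_range' (p % m) n (by
      by_cases h : p % m = 0
      · rw [h]; simpa using hn0
      · rw [degree_eq_natDegree h] at h3; exact_mod_cast h3)]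
    rw [map_sum, LinearMap.sum_apply, map_sum]
    refine Finset.sum_eq_zero fun i hi => ?_
    rw [← C_mul_X_pow_eq_monomial, ← smul_eq_C_mul, map_smul, LinearMap.smul_apply, map_smul]
    have := congr_fun hw ⟨i, Finset.mem_range.1 hi⟩
    have h4 : lam (aeval z (X ^ i : F[X]) w) = 0 := this
    rw [h4, smul_zero]
  refine ⟨P, hPmem, ?_, ?_⟩
  · intro u hu
    have : (⟨P u, hPmem u⟩ : cyc z v) = ⟨u, hu⟩ := hTUinj (hPT u)
    exact congrArg Subtype.val this
  · intro u
    have hz : z (P u) ∈ cyc z v := inv_cyc z v (hPmem u)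
    have : (⟨P (z u), hPmem _⟩ : cyc z v) = ⟨z (P u), hz⟩ := by
      apply hTUinj
      change T (P (z u)) = T (z (P u))
      rw [hPT]
      have h5 : T (u - P u) = 0 := by rw [map_sub, hPT, sub_self]
      rw [← sub_eq_zero, ← map_sub, ← map_sub]
      funext i
      have := hlamall _ h5 (X ^ (i : ℕ) * X)
      rw [map_mul, aeval_X] at this
      exact this
    exact congrArg Subtype.val this

theorem primary_or {c : F[X]} (hc : c.Monic) (h1 : c ≠ 1) :
    (∃ ℓ : F[X], ∃ j : ℕ, ℓ.Monic ∧ Irreducible ℓ ∧ c = ℓ ^ (j + 1)) ∨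
    ∃ p₁ p₂ : F[X], IsCoprime p₁ p₂ ∧ ¬ IsUnit p₁ ∧ ¬ IsUnit p₂ ∧ p₁ ≠ 0 ∧ p₂ ≠ 0 ∧ c = p₁ * p₂ := by
  have hnu : ¬ IsUnit c := fun h => h1 (hc.eq_one_of_isUnit h)
  obtain ⟨ℓ, hm, hℓ, hd⟩ := Polynomial.exists_monic_irreducible_factor c hnu
  obtain ⟨i, r, hr, hcr⟩ := WfDvdMonoid.max_power_factor hc.ne_zero hℓ
  have hi : i ≠ 0 := by
    rintro rfl
    rw [pow_zero, one_mul] at hcr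
    exact hr (hcr ▸ hd)
  have hr0 : r ≠ 0 := by rintro rfl; exact hr (dvd_zero _)
  by_cases hu : IsUnit r
  · left
    refine ⟨ℓ, i - 1, hm, hℓ, ?_⟩
    have : r.Monic := (hm.pow i).of_mul_monic_left (hcr ▸ hc)
    rw [hcr, this.eq_one_of_isUnit hu, mul_one]
    congr 1; omega
  · right
    exact ⟨ℓ ^ i, r, IsCoprime.pow_left ((hℓ.coprime_iff_not_dvd).2 hr), fun h => hℓ.not_isUnit ((isUnit_pow_iff hi).1 h), hu,
      pow_ne_zero _ hℓ.ne_zero, hr0, hcr⟩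

theorem A2 [Nontrivial V] {Φ : Module.End F V → ℂ} (hΦ : Prim Φ) (hcl : ClassFn Φ)
    (h : ∀ y v, cyc y v = ⊤ → Φ y = 0) (y : Module.End F V) : Φ y = 0 := by
  have hne1 : ∀ y : Module.End F V, y.charpoly ≠ 1 := by
    intro y hy
    have := LinearMap.charpoly_natDegree y
    rw [hy, natDegree_one] at this
    exact finrank_pos.ne this
  rcases primary_or (LinearMap.charpoly_monic y) (hne1 y) with ⟨ℓ, j, hm, hℓ, hc⟩ | ⟨p₁, p₂, hcop, hu1, hu2, h01, h02, hc⟩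
  · -- primary case: downward induction
    suffices H : ∀ m e : ℕ, m + e = j + 1 → ∀ y : Module.End F V, y.charpoly = ℓ ^ (j + 1) →
        (∃ v, aeval y (ℓ ^ e) v ≠ 0) → Φ y = 0 by
      obtain ⟨v, hv⟩ := exists_ne (0 : V)
      exact H (j + 1) 0 rfl y hc ⟨v, by simpa using hv⟩
    intro m
    induction m with
    | zero =>
      rintro e he y hc ⟨v, hv⟩
      rw [zero_add] at he
      rw [he, ← hc, LinearMap.aeval_self_charpoly] at hv
      exact (hv rfl).elim
    | succ m ih =>
      rintro e he y hc ⟨v, hv⟩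
      by_cases hex : ∃ v, aeval y (ℓ ^ (e + 1)) v ≠ 0
      · exact ih (e + 1) (by omega) y hc hex
      push Not at hex
      have hex' : aeval y (ℓ ^ (e + 1)) = 0 := LinearMap.ext hex
      by_cases htop : cyc y v = ⊤
      · exact h y v htop
      have hv0 : v ≠ 0 := by rintro rfl; exact hv (map_zero _)
      have hi := inv_cyc y v
      obtain ⟨P, hP, hP1, hPy⟩ := proj_primary hℓ hex' hv
      have hs := hΦ _ (cyc_ne_bot hv0) htop y hi
      have key : ∀ N : nil (cyc y v), Φ (y + N) = 0 ∨ Φ (y + N) = Φ y := by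
        intro N
        by_cases hexz : ∃ v, aeval (y + (N : Module.End F V)) (ℓ ^ (e + 1)) v ≠ 0
        · left
          exact ih (e + 1) (by omega) _ (by rw [charpoly_add_nil hi N.2, hc]) hexz
        · right
          push Not at hexz
          have hcz : cyc (y + (N : Module.End F V)) v = cyc y v := cyc_add_nil rfl N.2
          obtain ⟨Q, hQ, hQ1, hQy⟩ := proj_primary (v := v) hℓ (LinearMap.ext hexz) (by
            rw [aeval_add_nil hi N.2 _ (self_mem_cyc y v)]; exact hv)
          rw [hcz] at hQ hQ1
          obtain ⟨g, hg⟩ := split_conj hi N.2 P Q hP hP1 hPy hQ hQ1 hQy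
          rw [← hg, hcl]
      by_contra hne
      have h3 : ∀ N : nil (cyc y v), Φ (y + N) = (if Φ (y + N) = Φ y then 1 else 0) * Φ y := by
        intro N
        split_ifs with h4
        · rw [h4, one_mul]
        · rw [(key N).resolve_right h4, zero_mul]
      rw [Finset.sum_congr rfl fun N _ => h3 N, ← Finset.sum_mul, mul_eq_zero] at hs
      rcases hs with hs | hs
      · rw [Finset.sum_boole, Nat.cast_eq_zero, Finset.card_eq_zero, Finset.filter_eq_empty_iff] at hs
        exact hs (x := 0) (Finset.mem_univ _) (by simp)
      · exact hne hs
  · have h0 : aeval y (p₁ * p₂) = 0 := by rw [← hc, LinearMap.aeval_self_charpoly]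
    have hi := inv_ker_aeval y p₁
    have hb : LinearMap.ker (aeval y p₁) ≠ ⊥ := ker_aeval_ne_bot' hu1 h01 (hc ▸ Dvd.intro _ rfl)
    have ht : LinearMap.ker (aeval y p₁) ≠ ⊤ := by
      intro ht
      refine ker_aeval_ne_bot' hu2 h02 (hc ▸ Dvd.intro_left _ rfl) ?_
      rw [eq_bot_iff]
      intro v hv
      obtain ⟨a, b, hab⟩ := hcop
      have h4 : v = aeval y (a * p₁ + b * p₂) v := by rw [hab]; simp
      have h5 : aeval y p₁ v = 0 := by
        rw [← LinearMap.mem_ker, ht]; trivial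
      rw [LinearMap.mem_ker] at hv
      rw [Submodule.mem_bot, h4, map_add, map_mul, map_mul, LinearMap.add_apply, Module.End.mul_apply,
        Module.End.mul_apply, h5, hv, map_zero, map_zero, add_zero]
    have hs := hΦ _ hb ht y hi
    obtain ⟨P, hP, hP1, hPy⟩ := proj_coprime y hcop h0
    have key : ∀ N : nil (LinearMap.ker (aeval y p₁)), Φ (y + N) = Φ y := by
      intro N
      obtain ⟨Q, hQ, hQ1, hQy⟩ := proj_coprime (y + (N : Module.End F V)) hcop (by
        rw [← hc, ← charpoly_add_nil hi N.2, LinearMap.aeval_self_charpoly])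
      rw [ker_add_nil hcop h0 N.2] at hQ hQ1
      obtain ⟨g, hg⟩ := split_conj hi N.2 P Q hP hP1 hPy hQ hQ1 hQy
      rw [← hg, hcl]
    rw [Finset.sum_congr rfl fun N _ => key N, Finset.sum_const, nsmul_eq_mul, mul_eq_zero] at hs
    rcases hs with hs | hs
    · simp at hs
    · exact hs

end A2
end MK

set_option linter.all false

namespace MK
open Module Polynomial
open scoped BigOperators Classical

section phi
variable (F : Type) [Field F]

/-- proper invariant subspaces -/
abbrev PI {V : Type} [AddCommGroup V] [Module F V] (y : Module.End F V) : Type :=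
  {W : Submodule F V // W ≠ ⊤ ∧ Inv y W}

noncomputable def phiAux : ℕ → ∀ (V : Type) [AddCommGroup V] [Module F V] [Finite V], Module.End F V → ℂ
  | 0, _, _, _, _, _ => 0
  | k + 1, V, _, _, _, y => (finrank F V : ℂ) - ∑ W : PI F y, phiAux k W.1 (y.restrict W.2.2)

variable {F}
theorem inv_map {V V' : Type} [AddCommGroup V] [Module F V] [AddCommGroup V'] [Module F V']
    (e : V ≃ₗ[F] V') {y : Module.End F V} {y' : Module.End F V'} (h : ∀ v, e (y v) = y' (e v))
    {W : Submodule F V} (hW : Inv y W) : Inv y' (W.map e.toLinearMap) := by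
  rintro _ ⟨w, hw, rfl⟩
  exact ⟨y w, hW hw, h w⟩

theorem phiAux_congr (k : ℕ) : ∀ {V V' : Type} [AddCommGroup V] [Module F V] [Finite V] [AddCommGroup V'] [Module F V']
    [Finite V'] (e : V ≃ₗ[F] V') (y : Module.End F V) (y' : Module.End F V'), (∀ v, e (y v) = y' (e v)) →
    phiAux F k V y = phiAux F k V' y' := by
  induction k with
  | zero => intros; rfl
  | succ k ih =>
    intro V V' _ _ _ _ _ _ e y y' h
    have h' : ∀ v, e.symm (y' v) = y (e.symm v) := by
      intro v
      rw [LinearEquiv.symm_apply_eq, h, e.apply_symm_apply]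
    unfold phiAux
    rw [e.finrank_eq]
    congr 1
    let σ : PI F y ≃ PI F y' :=
      { toFun := fun W => ⟨W.1.map e.toLinearMap, by
          intro ht
          apply W.2.1
          rw [← Submodule.map_top e.toLinearMap |>.trans (LinearMap.range_eq_top.2 e.surjective)] at ht
          exact Submodule.map_injective_of_injective e.injective ht, inv_map e h W.2.2⟩
        invFun := fun W => ⟨W.1.map e.symm.toLinearMap, by
          intro ht
          apply W.2.1
          rw [← Submodule.map_top e.symm.toLinearMap |>.trans (LinearMap.range_eq_top.2 e.symm.surjective)] at ht
          exact Submodule.map_injective_of_injective e.symm.injective ht, inv_map e.symm h' W.2.2⟩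
        left_inv := fun W => by
          apply Subtype.ext
          ext v
          simp
        right_inv := fun W => by
          apply Subtype.ext
          ext v
          simp }
    refine Fintype.sum_equiv σ _ _ fun W => ?_
    refine ih (e.submoduleMap W.1) _ _ fun w => Subtype.ext ?_
    exact h w

theorem phiAux_stable : ∀ (k k' : ℕ) (V : Type) [AddCommGroup V] [Module F V] [Finite V] (y : Module.End F V),
    finrank F V ≤ k → finrank F V ≤ k' → phiAux F k V y = phiAux F k' V y := by
  have hz : ∀ (k : ℕ) (V : Type) [AddCommGroup V] [Module F V] [Finite V] (y : Module.End F V),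
    finrank F V = 0 → phiAux F k V y = 0 := by
    intro k V _ _ _ y h
    cases k with
    | zero => rfl
    | succ k =>
      unfold phiAux
      rw [h, Nat.cast_zero, zero_sub, neg_eq_zero]
      refine Finset.sum_eq_zero fun W _ => ?_
      exfalso
      apply W.2.1
      have : Subsingleton V := finrank_zero_iff.1 h
      exact Subsingleton.elim _ _
  intro k
  induction k with
  | zero =>
    intro k' V _ _ _ y h h'
    rw [hz _ _ _ (by omega), hz _ _ _ (by omega)]
  | succ k ih =>
    intro k' V _ _ _ y h h'
    cases k' with
    | zero => rw [hz _ _ _ (by omega), hz _ _ _ (by omega)]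
    | succ k' =>
      unfold phiAux
      congr 1
      refine Finset.sum_congr rfl fun W _ => ?_
      have := Submodule.finrank_lt W.2.1
      exact ih k' _ _ (by omega) (by omega)

/-- the function `Φ'` -/
noncomputable def phi {V : Type} [AddCommGroup V] [Module F V] [Finite V] (y : Module.End F V) : ℂ :=
  phiAux F (finrank F V) V y

theorem phi_congr {V V' : Type} [AddCommGroup V] [Module F V] [Finite V] [AddCommGroup V'] [Module F V']
    [Finite V'] (e : V ≃ₗ[F] V') (y : Module.End F V) (y' : Module.End F V') (h : ∀ v, e (y v) = y' (e v)) :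
    phi y = phi y' := by
  unfold phi
  rw [e.finrank_eq]
  exact phiAux_congr _ e y y' h

theorem phi_rec {V : Type} [AddCommGroup V] [Module F V] [Finite V] (y : Module.End F V) [Fintype (PI F y)] :
    phi y = (finrank F V : ℂ) - ∑ W : PI F y, phi (y.restrict W.2.2) := by
  have : phi y = phiAux F (finrank F V + 1) V y := phiAux_stable _ _ _ _ le_rfl (by omega)
  rw [this, phiAux]
  congr 1
  refine Finset.sum_congr (by congr 1; exact Subsingleton.elim _ _) fun W _ => ?_
  exact phiAux_stable _ _ _ _ (Submodule.finrank_le _) le_rfl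

/-- value of `Φ'` on an invariant subspace, zero otherwise -/
noncomputable def phiW {V : Type} [AddCommGroup V] [Module F V] [Finite V] (y : Module.End F V)
    (W : Submodule F V) : ℂ := if h : Inv y W then phi (y.restrict h) else 0

theorem phiW_of {V : Type} [AddCommGroup V] [Module F V] [Finite V] {y : Module.End F V}
    {W : Submodule F V} (h : Inv y W) : phiW y W = phi (y.restrict h) := dif_pos h

theorem phiW_not {V : Type} [AddCommGroup V] [Module F V] [Finite V] {y : Module.End F V}
    {W : Submodule F V} (h : ¬ Inv y W) : phiW y W = 0 := dif_neg h

theorem inv_top {V : Type} [AddCommGroup V] [Module F V] (y : Module.End F V) : Inv y ⊤ := fun _ _ => trivial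
theorem inv_bot {V : Type} [AddCommGroup V] [Module F V] (y : Module.End F V) : Inv y ⊥ := by
  intro v hv
  rw [Submodule.mem_bot] at hv
  subst hv
  simp

theorem phiW_top {V : Type} [AddCommGroup V] [Module F V] [Finite V] (y : Module.End F V) :
    phiW y ⊤ = phi y := by
  rw [phiW_of (inv_top y)]
  exact phi_congr Submodule.topEquiv _ _ fun v => rfl

theorem phi_sum {V : Type} [AddCommGroup V] [Module F V] [Finite V] [Fintype (Submodule F V)] (y : Module.End F V) :
    ∑ W : Submodule F V, phiW y W = (finrank F V : ℂ) := by
  have h1 : ∑ W : PI F y, phi (y.restrict W.2.2) = ∑ W ∈ Finset.univ.filter (fun W : Submodule F V => W ≠ ⊤ ∧ Inv y W), phiW y W := by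
    rw [Finset.sum_subtype (p := fun W : Submodule F V => W ≠ ⊤ ∧ Inv y W) (F := inferInstance)]
    · refine Finset.sum_congr rfl fun W _ => (phiW_of W.2.2).symm
    · intro W; simp
  have h2 := phi_rec y
  rw [h1] at h2
  have h3 : ∑ W : Submodule F V, phiW y W = phiW y ⊤ + ∑ W ∈ Finset.univ.filter (fun W : Submodule F V => W ≠ ⊤ ∧ Inv y W), phiW y W := by
    rw [← Finset.add_sum_erase _ _ (Finset.mem_univ (⊤ : Submodule F V))]
    congr 1
    symm
    refine Finset.sum_subset ?_ ?_
    · intro W hW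
      simp only [Finset.mem_filter, Finset.mem_univ, true_and, Finset.mem_erase, and_true] at hW ⊢
      exact hW.1
    · intro W hW hW'
      apply phiW_not
      intro hi
      apply hW'
      simp only [Finset.mem_filter, Finset.mem_univ, true_and, Finset.mem_erase, and_true] at hW ⊢
      exact ⟨hW, hi⟩
  rw [h3, phiW_top, h2]
  ring

theorem phiW_zero_dim {V : Type} [AddCommGroup V] [Module F V] [Finite V] (y : Module.End F V) : phiW y ⊥ = 0 := by
  rw [phiW_of (inv_bot y), phi_rec]
  rw [finrank_bot, Nat.cast_zero, zero_sub, neg_eq_zero]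
  refine Finset.sum_eq_zero fun W _ => ?_
  exact (W.2.1 (Subsingleton.elim _ _)).elim

/-- sub of sub -/
theorem phiW_sub {V : Type} [AddCommGroup V] [Module F V] [Finite V] {y : Module.End F V} {U : Submodule F V}
    (hU : Inv y U) (W : Submodule F U) : phiW (y.restrict hU) W = phiW y (W.map U.subtype) := by
  by_cases h : Inv (y.restrict hU) W
  · have h' : Inv y (W.map U.subtype) := by
      rintro _ ⟨w, hw, rfl⟩
      exact ⟨y.restrict hU w, h hw, rfl⟩
    rw [phiW_of h, phiW_of h']
    refine phi_congr (Submodule.equivMapOfInjective _ U.injective_subtype W) _ _ fun v => Subtype.ext ?_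
    rfl
  · rw [phiW_not h, phiW_not]
    intro h'
    apply h
    intro w hw
    obtain ⟨w', hw', hh⟩ := h' ⟨w, hw, rfl⟩
    have : w' = y.restrict hU w := Subtype.ext hh
    rw [Submodule.mem_comap, ← this]
    exact hw'

theorem phi_sum_le {V : Type} [AddCommGroup V] [Module F V] [Finite V] {y : Module.End F V} {U : Submodule F V}
    (hU : Inv y U) : ∑ W ∈ Finset.univ.filter (fun W => W ≤ U), phiW y W = (finrank F U : ℂ) := by
  rw [← phi_sum (y.restrict hU)]
  symm
  refine Finset.sum_bij (fun W _ => W.map U.subtype) ?_ ?_ ?_ ?_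
  · intro W _
    simp [Submodule.map_subtype_le]
  · intro W _ W' _ h
    exact Submodule.map_injective_of_injective U.injective_subtype h
  · intro W hW
    rw [Finset.mem_filter] at hW
    exact ⟨W.comap U.subtype, Finset.mem_univ _, by rw [Submodule.map_comap_subtype, inf_eq_right.2 hW.2]⟩
  · intro W _
    exact phiW_sub hU W

end phi
end MK

set_option linter.all false

namespace MK
open Module Polynomial
open scoped BigOperators Classical

section phiprim
variable {F : Type} [Field F] {V : Type} [AddCommGroup V] [Module F V]

theorem phiW_add_nil_le [Finite V] {y : Module.End F V} {U W : Submodule F V} (hW : W ≤ U) {N : Module.End F V}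
    (hN : N ∈ nil U) : phiW (y + N) W = phiW y W := by
  have e : ∀ w ∈ W, (y + N) w = y w := fun w hw => by
    rw [LinearMap.add_apply, hN.2 w (hW hw), add_zero]
  by_cases h : Inv y W
  · have h' : Inv (y + N) W := fun w hw => by
      rw [Submodule.mem_comap, e w hw]; exact h hw
    rw [phiW_of h, phiW_of h']
    congr 1
    exact LinearMap.ext fun w => Subtype.ext (e w w.2)
  · rw [phiW_not h, phiW_not]
    intro h'
    apply h
    intro w hw
    rw [Submodule.mem_comap, ← e w hw]; exact h' hw

theorem exists_proj (U W : Submodule F V) : ∃ π : V →ₗ[F] W, (∀ w : W, π w = w) ∧ ∀ u ∈ U, (π u : V) ∈ U := by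
  obtain ⟨q, hq⟩ := Submodule.exists_isCompl (W ⊓ U)
  have hd : Disjoint (q ⊓ U) W := by
    rw [disjoint_iff, inf_assoc, inf_comm U W, inf_comm, hq.inf_eq_bot]
  obtain ⟨C, hC, hC'⟩ := hd.exists_isCompl
  refine ⟨W.projectionOnto C hC'.symm, fun w => Submodule.projectionOnto_apply_left _ w, fun u hu => ?_⟩
  have hu' : u ∈ (W ⊓ U) ⊔ (q ⊓ U) := by
    rw [← sup_inf_assoc_of_le q (inf_le_right : W ⊓ U ≤ U), hq.sup_eq_top, top_inf_eq]
    exact hu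
  obtain ⟨a, ha, b, hb, rfl⟩ := Submodule.mem_sup.1 hu'
  have hb0 : W.projectionOnto C hC'.symm b = 0 := (Submodule.projectionOnto_apply_eq_zero_iff _).2 (hC hb)
  rw [map_add, hb0, add_zero]
  have := Submodule.projectionOnto_apply_of_mem_left hC'.symm ha.1
  rw [this]
  exact ha.2

/-- middle case -/
theorem phiW_mid [Finite V] {y : Module.End F V} {U W : Submodule F V} (hU : Inv y U)
    (hWU : ¬ W ≤ U) (hd : W ⊓ U ≠ ⊥) (ih : Prim (fun z : Module.End F W => phi z)) [Fintype (nil U)] :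
    ∑ N : nil U, phiW (y + N.1) W = 0 := by
  obtain ⟨π, hπ, hπU⟩ := exists_proj U W
  set D : Submodule F W := U.comap W.subtype with hD
  let ext : nil D → nil U := fun N => ⟨W.subtype ∘ₗ N.1 ∘ₗ π, fun v => N.2.1 (π v), fun u hu => by
    have : N.1 (π u) = 0 := N.2.2 (π u) (hπU u hu)
    simp [this]⟩
  have h1 : ∀ M : nil D, ∑ N : nil U, phiW (y + N.1) W = ∑ N : nil U, phiW (y + N.1 + (ext M).1) W := by
    intro M
    rw [← Equiv.sum_comp (Equiv.addRight (ext M))]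
    refine Finset.sum_congr rfl fun N _ => ?_
    simp [add_assoc]
  have h2 : ∀ N : nil U, ∑ M : nil D, phiW (y + N.1 + (ext M).1) W = 0 := by
    intro N
    by_cases h : Inv (y + N.1) W
    · have h' : ∀ M : nil D, Inv (y + N.1 + (ext M).1) W := fun M w hw => by
        rw [Submodule.mem_comap, LinearMap.add_apply]
        exact W.add_mem (h hw) (M.1 (π w)).2
      have h3 : ∀ M : nil D, phiW (y + N.1 + (ext M).1) W = phi ((y + N.1).restrict h + M.1) := by
        intro M
        rw [phiW_of (h' M)]
        congr 1
        refine LinearMap.ext fun w => Subtype.ext ?_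
        change (y + N.1) w + M.1 (π w) = (y + N.1) w + M.1 w
        rw [hπ]
      rw [Finset.sum_congr rfl fun M _ => h3 M]
      refine ih D ?_ ?_ _ ?_
      · intro hb
        apply hd
        rw [eq_bot_iff]
        rintro w ⟨hw, hw'⟩
        have : (⟨w, hw⟩ : W) ∈ D := hw'
        rw [hb, Submodule.mem_bot] at this
        simpa using congrArg Subtype.val this
      · intro ht
        apply hWU
        intro w hw
        have : (⟨w, hw⟩ : W) ∈ D := by rw [ht]; trivial
        exact this
      · intro w hw
        exact inv_add_nil hU N.2 hw
    · refine Finset.sum_eq_zero fun M _ => phiW_not fun h' => h ?_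
      intro w hw
      have := W.sub_mem (h' hw) (M.1 (π w)).2
      rw [Submodule.mem_comap]
      convert this using 1
      change _ = (y + N.1) w + M.1 (π w) - M.1 (π w)
      simp
  have h4 : ∑ _M : nil D, ∑ N : nil U, phiW (y + N.1) W = 0 := by
    rw [Finset.sum_congr rfl fun M _ => h1 M, Finset.sum_comm]
    exact Finset.sum_eq_zero fun N _ => h2 N
  rw [Finset.sum_const, nsmul_eq_mul, mul_eq_zero] at h4
  rcases h4 with h4 | h4
  · simp at h4
  · exact h4

/-- `U`-projection killing `W` -/
theorem exists_proj' {U W : Submodule F V} (h : W ⊓ U = ⊥) : ∃ p : V →ₗ[F] V, (∀ v, p v ∈ U) ∧ (∀ u ∈ U, p u = u) ∧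
    ∀ w ∈ W, p w = 0 := by
  have hd : Disjoint W U := disjoint_iff.2 h
  obtain ⟨C, hC, hC'⟩ := hd.exists_isCompl
  exact ⟨U.projection C hC'.symm, fun v => Submodule.projection_apply_mem _ _,
    fun u hu => Submodule.projection_apply_of_mem_left _ hu, fun w hw =>
    (Submodule.projection_apply_eq_zero_iff _).2 (hC hw)⟩

theorem card_coset {A : Type} [AddCommGroup A] [Finite A] (H : AddSubgroup A) (T : Set A) {t : A} (ht : t ∈ T)
    (h : ∀ s, s ∈ T ↔ s - t ∈ H) : Nat.card T = Nat.card H := by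
  refine Nat.card_congr ⟨fun s => ⟨s - t, (h s).1 s.2⟩, fun s => ⟨s + t, (h _).2 (by simp)⟩, fun s => by simp, fun s => by simp⟩

theorem mem_of_map_eq {U W W' : Submodule F V} (h : W.map U.mkQ = W'.map U.mkQ) {w : V} (hw : w ∈ W) :
    ∃ u ∈ U, ∃ w' ∈ W', w = u + w' := by
  have : U.mkQ w ∈ W'.map U.mkQ := h ▸ ⟨w, hw, rfl⟩
  obtain ⟨w', hw', e⟩ := this
  refine ⟨w - w', ?_, w', hw', by simp⟩
  rw [← Submodule.ker_mkQ U, LinearMap.mem_ker, map_sub, e, sub_self]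

/-- elements of `nil U` killing `W` -/
def nilW (U W : Submodule F V) : AddSubgroup (nil U) where
  carrier := {N | ∀ w ∈ W, N.1 w = 0}
  add_mem' := by
    intro a b ha hb w hw
    simp [ha w hw, hb w hw]
  zero_mem' := fun w hw => rfl
  neg_mem' := by
    intro a ha w hw
    simp [ha w hw]

theorem nilW_congr {U W W' : Submodule F V} (h : W.map U.mkQ = W'.map U.mkQ) : nilW U W = nilW U W' := by
  have : ∀ W W' : Submodule F V, W.map U.mkQ = W'.map U.mkQ → nilW U W ≤ nilW U W' := by
    intro W W' h N hN w hw
    obtain ⟨u, hu, w', hw', rfl⟩ := mem_of_map_eq h.symm hw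
    rw [map_add, N.2.2 u hu, hN w' hw', add_zero]
  exact le_antisymm (this _ _ h) (this _ _ h.symm)

theorem card_inv [Finite V] {y : Module.End F V} {U W : Submodule F V} (hU : Inv y U) (hW : W ⊓ U = ⊥)
    (hB : Inv (U.mapQ U y hU) (W.map U.mkQ)) :
    Nat.card {N : nil U | Inv (y + N.1) W} = Nat.card (nilW U W) := by
  obtain ⟨p, hp1, hp2, hp3⟩ := exists_proj' hW
  let N0 : nil U := ⟨-(p * y * (1 - p)), fun v => by
    exact U.neg_mem (hp1 _), fun u hu => by simp [hp2 u hu]⟩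
  have hN0 : Inv (y + N0.1) W := by
    intro w hw
    have h1 : U.mkQ (y w) ∈ W.map U.mkQ := hB (x := U.mkQ w) ⟨w, hw, rfl⟩
    obtain ⟨w', hw', e⟩ := h1
    have hu : y w - w' ∈ U := by
      rw [← Submodule.ker_mkQ U, LinearMap.mem_ker, map_sub, e, sub_self]
    have h2 : p (y w) = y w - w' := by
      have := hp2 _ hu
      rwa [map_sub, hp3 w' hw', sub_zero] at this
    have : (y + N0.1) w = w' := by
      simp [N0, hp3 w hw, h2]
    rw [Submodule.mem_comap, this]
    exact hw'
  refine card_coset (nilW U W) _ (t := N0) hN0 fun N => ?_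
  constructor
  · intro hN w hw
    have h1 := W.sub_mem (hN hw) (hN0 hw)
    have h2 : (y + N.1) w - (y + N0.1) w = (N - N0).1 w := by simp
    rw [h2] at h1
    have : (N - N0).1 w ∈ W ⊓ U := ⟨h1, (N - N0).2.1 w⟩
    rwa [hW, Submodule.mem_bot] at this
  · intro hN w hw
    have h2 : (y + N.1) w = (y + N0.1) w + (N - N0).1 w := by simp
    rw [Submodule.mem_comap, h2, hN w hw, add_zero]
    exact hN0 hw

theorem card_trans [Finite V] {U W W' : Submodule F V} (hW : W ⊓ U = ⊥) (hW' : W' ⊓ U = ⊥)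
    (h : W.map U.mkQ = W'.map U.mkQ) :
    Nat.card {N : nil U | W.map (1 + N.1) = W'} = Nat.card (nilW U W) := by
  obtain ⟨p, hp1, hp2, hp3⟩ := exists_proj' hW
  obtain ⟨p', hp1', hp2', hp3'⟩ := exists_proj' hW'
  let N0 : nil U := ⟨-(p' * (1 - p)), fun v => by
    exact U.neg_mem (hp1' _), fun u hu => by simp [hp2 u hu]⟩
  have key : ∀ w ∈ W, (1 + N0.1) w = w - p' w := by
    intro w hw
    simp [N0, hp3 w hw, sub_eq_add_neg]
  have hN0 : W.map (1 + N0.1) = W' := by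
    apply le_antisymm
    · rintro _ ⟨w, hw, rfl⟩
      rw [key w hw]
      obtain ⟨u, hu, w', hw', rfl⟩ := mem_of_map_eq h hw
      rw [map_add, hp2' u hu, hp3' w' hw', add_zero, add_sub_cancel_left]
      exact hw'
    · intro w' hw'
      obtain ⟨u, hu, w, hw, rfl⟩ := mem_of_map_eq h.symm hw'
      refine ⟨w, hw, ?_⟩
      rw [key w hw]
      have := hp3' _ hw'
      rw [map_add, hp2' u hu] at this
      rw [sub_eq_add_neg, add_comm, ← eq_neg_of_add_eq_zero_left this]
  refine card_coset (nilW U W) _ (t := N0) hN0 fun N => ?_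
  constructor
  · intro (hN : W.map (1 + N.1) = W') w hw
    have a1 : (1 + N.1) w ∈ W' := hN ▸ ⟨w, hw, rfl⟩
    have a2 : (1 + N0.1) w ∈ W' := hN0 ▸ ⟨w, hw, rfl⟩
    have h1 := W'.sub_mem a1 a2
    have h2 : (1 + N.1) w - (1 + N0.1) w = (N - N0).1 w := by simp
    rw [h2] at h1
    have : (N - N0).1 w ∈ W' ⊓ U := ⟨h1, (N - N0).2.1 w⟩
    rwa [hW', Submodule.mem_bot] at this
  · intro hN
    change W.map (1 + N.1) = W'
    rw [← hN0]
    have : ∀ w ∈ W, (1 + N.1) w = (1 + N0.1) w := by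
      intro w hw
      have h2 : (1 + N.1) w = (1 + N0.1) w + (N - N0).1 w := by simp
      rw [h2, hN w hw, add_zero]
    ext v
    constructor
    · rintro ⟨w, hw, rfl⟩
      exact ⟨w, hw, (this w hw).symm⟩
    · rintro ⟨w, hw, rfl⟩
      exact ⟨w, hw, this w hw⟩

theorem natcard_ite {A : Type} [Fintype A] (p : A → Prop) [DecidablePred p] : (Nat.card {a : A | p a} : ℂ) = ∑ a, if p a then (1 : ℂ) else 0 := by
  rw [Finset.sum_boole, Nat.card_eq_fintype_card, Fintype.card_ofFinset]
  congr 2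

theorem phiW_transverse [Finite V] {y : Module.End F V} {U W : Submodule F V} (hU : Inv y U) (hW : W ⊓ U = ⊥) [Fintype (nil U)] :
    ∑ N : nil U, phiW (y + N.1) W = (Nat.card (nilW U W) : ℂ) * phiW (U.mapQ U y hU) (W.map U.mkQ) := by
  have hB : ∀ N : nil U, Inv (y + N.1) W → Inv (U.mapQ U y hU) (W.map U.mkQ) := by
    rintro N hN _ ⟨w, hw, rfl⟩
    refine ⟨(y + N.1) w, hN hw, ?_⟩
    rw [LinearMap.add_apply, map_add]
    have : U.mkQ (N.1 w) = 0 := by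
      rw [← LinearMap.mem_ker, Submodule.ker_mkQ]; exact N.2.1 w
    rw [this, add_zero]
    rfl
  by_cases hb : Inv (U.mapQ U y hU) (W.map U.mkQ)
  · rw [← card_inv hU hW hb, natcard_ite, Finset.sum_mul]
    refine Finset.sum_congr rfl fun N _ => ?_
    by_cases h : Inv (y + N.1) W
    · rw [if_pos h, one_mul, phiW_of h, phiW_of hb]
      have hinj : Function.Injective (U.mkQ.domRestrict W) := by
        rw [← LinearMap.ker_eq_bot, eq_bot_iff]
        intro w hw
        have h1 : (w : V) ∈ U := by
          rw [← Submodule.ker_mkQ U]; exact hw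
        have : (w : V) ∈ W ⊓ U := ⟨w.2, h1⟩
        rw [hW, Submodule.mem_bot] at this
        exact (Submodule.mem_bot F).2 (Subtype.ext this)
      let e : W ≃ₗ[F] W.map U.mkQ := LinearEquiv.ofBijective ((U.mkQ).submoduleMap W)
        ⟨fun a b hab => hinj (congrArg Subtype.val hab), LinearMap.submoduleMap_surjective _ _⟩
      refine phi_congr e _ _ fun w => Subtype.ext ?_
      change U.mkQ ((y + N.1) w) = U.mkQ (y w)
      have : U.mkQ (N.1 w) = 0 := by
        rw [← LinearMap.mem_ker, Submodule.ker_mkQ]; exact N.2.1 w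
      rw [LinearMap.add_apply, map_add, this, add_zero]
    · rw [if_neg h, zero_mul, phiW_not h]
  · rw [phiW_not hb, mul_zero]
    exact Finset.sum_eq_zero fun N _ => phiW_not fun h => hb (hB N h)

theorem map_one_add_nil {U W : Submodule F V} (hW : W ⊓ U = ⊥) (N : nil U) :
    (W.map (1 + N.1)) ⊓ U = ⊥ ∧ (W.map (1 + N.1)).map U.mkQ = W.map U.mkQ := by
  have h0 : ∀ v, U.mkQ (N.1 v) = 0 := fun v => by
    rw [← LinearMap.mem_ker, Submodule.ker_mkQ]; exact N.2.1 v
  constructor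
  · rw [eq_bot_iff]
    rintro _ ⟨⟨w, hw, rfl⟩, h⟩
    have h1 : w ∈ U := by
      have := U.sub_mem h (N.2.1 w)
      simpa using this
    have : w ∈ W ⊓ U := ⟨hw, h1⟩
    rw [hW, Submodule.mem_bot] at this
    rw [this, map_zero]; exact Submodule.zero_mem _
  · rw [← Submodule.map_comp]
    congr 1
    ext v
    change U.mkQ (v + N.1 v) = U.mkQ v
    rw [map_add, h0, add_zero]

theorem card_compl [Finite V] (U : Submodule F V) (B : Submodule F (V ⧸ U)) [Fintype (Submodule F V)] :
    ∑ W ∈ (Finset.univ.filter (fun W : Submodule F V => W ⊓ U = ⊥)).filter (fun W => W.map U.mkQ = B), (Nat.card (nilW U W) : ℂ) = Nat.card (nil U) := by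
  obtain ⟨C, hC⟩ := Submodule.exists_isCompl U
  set W0 := C ⊓ B.comap U.mkQ with hW0
  have h1 : W0 ⊓ U = ⊥ := by
    rw [eq_bot_iff, hW0]
    rintro v ⟨⟨h, _⟩, h'⟩
    rw [← hC.inf_eq_bot]; exact ⟨h', h⟩
  have h2 : W0.map U.mkQ = B := by
    apply le_antisymm
    · rintro _ ⟨w, ⟨_, h⟩, rfl⟩
      exact h
    · intro b hb
      obtain ⟨v, rfl⟩ := U.mkQ_surjective b
      have : v ∈ U ⊔ C := by rw [hC.sup_eq_top]; trivial
      obtain ⟨u, hu, c, hc, rfl⟩ := Submodule.mem_sup.1 this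
      have hu0 : U.mkQ u = 0 := by rw [← LinearMap.mem_ker, Submodule.ker_mkQ]; exact hu
      rw [map_add, hu0, zero_add] at hb ⊢
      exact ⟨c, ⟨hc, hb⟩, rfl⟩
  have h3 : ∀ W ∈ (Finset.univ.filter (fun W : Submodule F V => W ⊓ U = ⊥)).filter (fun W => W.map U.mkQ = B),
      (Nat.card (nilW U W) : ℂ) = ∑ N : nil U, if W0.map (1 + N.1) = W then (1 : ℂ) else 0 := by
    intro W hW
    simp only [Finset.mem_filter, Finset.mem_univ, true_and] at hW
    rw [← nilW_congr (h2.trans hW.2.symm), ← card_trans h1 hW.1 (h2.trans hW.2.symm), natcard_ite]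
  rw [Finset.sum_congr rfl h3, Finset.sum_comm]
  have h4 : ∀ N : nil U, (∑ W ∈ (Finset.univ.filter (fun W : Submodule F V => W ⊓ U = ⊥)).filter (fun W => W.map U.mkQ = B),
     if W0.map (1 + N.1) = W then (1 : ℂ) else 0) = 1 := by
    intro N
    rw [Finset.sum_ite_eq, if_pos]
    simp only [Finset.mem_filter, Finset.mem_univ, true_and]
    exact ⟨(map_one_add_nil h1 N).1, (map_one_add_nil h1 N).2.trans h2⟩
  rw [Finset.sum_congr rfl fun N _ => h4 N]
  simp

theorem phi_prim_aux : ∀ (n : ℕ) (V : Type) [AddCommGroup V] [Module F V] [Finite V], finrank F V = n →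
    Prim (fun y : Module.End F V => phi y) := by
  intro n
  induction n using Nat.strong_induction_on with
  | _ n ih =>
  intro V _ _ _ hn U hU0 hU1 y hy
  have hfin : Module.Finite F V := inferInstance
  have tot : ∑ W : Submodule F V, ∑ N : nil U, phiW (y + N.1) W = (Nat.card (nil U) : ℂ) * (finrank F V : ℂ) := by
    rw [Finset.sum_comm, Finset.sum_congr rfl fun N _ => phi_sum (y + N.1)]
    simp
  have hle : ∑ W ∈ Finset.univ.filter (fun W => W ≤ U), ∑ N : nil U, phiW (y + N.1) W = (Nat.card (nil U) : ℂ) * (finrank F U : ℂ) := by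
    rw [← phi_sum_le hy, Finset.mul_sum]
    refine Finset.sum_congr rfl fun W hW => ?_
    rw [Finset.mem_filter] at hW
    rw [Finset.sum_congr rfl fun N _ => phiW_add_nil_le hW.2 N.2]
    simp
  have htr : ∑ W ∈ Finset.univ.filter (fun W : Submodule F V => W ⊓ U = ⊥), ∑ N : nil U, phiW (y + N.1) W = (Nat.card (nil U) : ℂ) * (finrank F (V ⧸ U) : ℂ) := by
    rw [Finset.sum_congr rfl fun W hW => phiW_transverse hy (Finset.mem_filter.1 hW).2]
    rw [← Finset.sum_fiberwise (g := fun W : Submodule F V => W.map U.mkQ), ← phi_sum (U.mapQ U y hy), Finset.mul_sum]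
    refine Finset.sum_congr rfl fun B _ => ?_
    rw [← card_compl U B, Finset.sum_mul]
    refine Finset.sum_congr rfl fun W hW => ?_
    rw [(Finset.mem_filter.1 hW).2]
  have hsplit : ∑ W : Submodule F V, ∑ N : nil U, phiW (y + N.1) W = ∑ N : nil U, phi (y + N.1)
      + ∑ W ∈ Finset.univ.filter (fun W => W ≤ U), ∑ N : nil U, phiW (y + N.1) W
      + ∑ W ∈ Finset.univ.filter (fun W : Submodule F V => W ⊓ U = ⊥), ∑ N : nil U, phiW (y + N.1) W := by
    have e0 : ∑ N : nil U, phi (y + N.1) = ∑ W : Submodule F V, if W = ⊤ then ∑ N : nil U, phiW (y + N.1) W else 0 := by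
      rw [Finset.sum_ite_eq' , if_pos (Finset.mem_univ _)]
      exact Finset.sum_congr rfl fun N _ => (phiW_top _).symm
    rw [e0, Finset.sum_filter, Finset.sum_filter, ← Finset.sum_add_distrib, ← Finset.sum_add_distrib]
    refine Finset.sum_congr rfl fun W _ => ?_
    by_cases ht : W = ⊤
    · subst ht
      rw [if_pos rfl, if_neg (by rwa [top_le_iff]), if_neg (by rwa [top_inf_eq]), add_zero, add_zero]
    rw [if_neg ht, zero_add]
    by_cases hl : W ≤ U
    · rw [if_pos hl]
      by_cases hb : W ⊓ U = ⊥
      · rw [if_pos hb]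
        rw [inf_eq_left.2 hl] at hb
        subst hb
        simp [phiW_zero_dim]
      · rw [if_neg hb, add_zero]
    rw [if_neg hl, zero_add]
    by_cases hb : W ⊓ U = ⊥
    · rw [if_pos hb]
    · rw [if_neg hb]
      exact phiW_mid hy hl hb (ih (finrank F W) (hn ▸ Submodule.finrank_lt ht) W rfl)
  rw [tot, hle, htr] at hsplit
  have hr := Submodule.finrank_quotient_add_finrank U
  rw [← hr] at hsplit
  push_cast at hsplit
  linear_combination -hsplit

theorem phi_prim [Finite V] : Prim (fun y : Module.End F V => phi y) := phi_prim_aux _ V rfl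

theorem phi_class [Finite V] : ClassFn (fun y : Module.End F V => phi y) := by
  intro g y
  exact (phi_congr g y (g.conj y) fun v => by simp [LinearEquiv.conj_apply]).symm

end phiprim
end MK

set_option linter.all false

namespace MK
open Module Polynomial
open scoped BigOperators Classical

section phival
variable {F : Type} [Field F] {V : Type} [AddCommGroup V] [Module F V] [Finite V]

theorem cyc_dvd [Nontrivial V] {y : Module.End F V} {v : V} (hv : cyc y v = ⊤) (p : F[X]) :
    aeval y p v = 0 ↔ y.charpoly ∣ p := by
  constructor
  · intro h
    obtain ⟨e, ⟨h1, h2⟩, -⟩ := A4aux (LinearMap.charpoly_monic y) (LinearMap.charpoly_natDegree y) y v rfl hv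
    rw [← AdjoinRoot.mk_eq_zero]
    apply e.injective
    rw [map_zero, ← h]
    have h3 : aeval (e.conj (rootMul y.charpoly)) p v = aeval y p v := by rw [h1]
    rw [← h3, aeval_conj, ← h2, LinearEquiv.conj_apply_apply, e.symm_apply_apply, aeval_rootMul, mul_one]
  · rintro ⟨r, rfl⟩
    rw [mul_comm, map_mul, LinearMap.aeval_self_charpoly]
    simp

theorem inv_range_aeval (y : Module.End F V) (p : F[X]) : Inv y (LinearMap.range (aeval y p)) := by
  rintro _ ⟨u, rfl⟩
  refine ⟨y u, ?_⟩
  have h : aeval y (p * X) = aeval y (X * p) := by rw [mul_comm]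
  rw [map_mul, map_mul, aeval_X] at h
  exact LinearMap.congr_fun h u

theorem inv_eq_top_of_coprime {y : Module.End F V} {v : V} (hv : cyc y v = ⊤) {W : Submodule F V}
    (hW : Inv y W) {p : F[X]} (hp : aeval y p v ∈ W) (hc : IsCoprime p y.charpoly) : W = ⊤ := by
  obtain ⟨a, b, hab⟩ := hc
  have h1 : v ∈ W := by
    have : aeval y (a * p + b * y.charpoly) v = v := by rw [hab]; simp
    rw [map_add, map_mul, map_mul, LinearMap.aeval_self_charpoly, mul_zero, add_zero] at this
    rw [← this]
    exact hW.aeval a hp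
  rw [eq_top_iff, ← hv]
  rintro _ ⟨q, rfl⟩
  exact hW.aeval q h1

/-- quotient by `range ℓ(y)` for cyclic `y`. -/
theorem finrank_range_aeval [Nontrivial V] {y : Module.End F V} {v : V} (hv : cyc y v = ⊤) {p : F[X]} (hp : p.Monic)
    (hd : p ∣ y.charpoly) : finrank F (LinearMap.range (aeval y p)) + p.natDegree = finrank F V := by
  set U := LinearMap.range (aeval y p) with hU
  have hsurj : Function.Surjective (U.mkQ ∘ₗ ev y v) := by
    intro u
    obtain ⟨w, rfl⟩ := U.mkQ_surjective u
    have : w ∈ cyc y v := hv ▸ trivial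
    obtain ⟨r, rfl⟩ := this
    exact ⟨r, rfl⟩
  have hker : LinearMap.ker (U.mkQ ∘ₗ ev y v) = LinearMap.ker (AdjoinRoot.mkₐ p : F[X] →ₐ[F] AdjoinRoot p).toLinearMap := by
    ext r
    rw [LinearMap.mem_ker, LinearMap.mem_ker, LinearMap.comp_apply]
    change _ ↔ AdjoinRoot.mk p r = 0
    rw [AdjoinRoot.mk_eq_zero, ← LinearMap.mem_ker, Submodule.ker_mkQ]
    constructor
    · rintro ⟨w, hw⟩
      have : w ∈ cyc y v := hv ▸ trivial
      obtain ⟨s, rfl⟩ := this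
      rw [ev_apply, ev_apply, ← Module.End.mul_apply, ← map_mul] at hw
      have h3 : aeval y (p * s - r) v = 0 := by rw [map_sub, LinearMap.sub_apply, hw, sub_self]
      rw [cyc_dvd hv] at h3
      have h4 := hd.trans h3
      exact (dvd_sub_right (dvd_mul_right p s)).1 h4
    · rintro ⟨s, rfl⟩
      exact ⟨aeval y s v, by rw [ev_apply, map_mul]; rfl⟩
  have e1 := (LinearMap.quotKerEquivOfSurjective _ hsurj).symm
  have e2 := (LinearMap.quotKerEquivOfSurjective (AdjoinRoot.mkₐ p : F[X] →ₐ[F] AdjoinRoot p).toLinearMap AdjoinRoot.mk_surjective)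
  have e3 := Submodule.quotEquivOfEq _ _ hker
  have h5 := (e1.trans (e3.trans e2)).finrank_eq
  rw [finrank_adjoinRoot hp] at h5
  have := Submodule.finrank_quotient_add_finrank U
  omega

theorem phi_cyclic [Nontrivial V] {y : Module.End F V} {v : V} (hv : cyc y v = ⊤) {ℓ : F[X]} (hm : ℓ.Monic)
    (hℓ : Irreducible ℓ) {j : ℕ} (hc : y.charpoly = ℓ ^ (j + 1)) : phi y = ℓ.natDegree := by
  have hr := finrank_range_aeval hv hm (hc ▸ dvd_pow_self ℓ (by omega))
  set U := LinearMap.range (aeval y ℓ) with hU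
  have h1 := phi_sum_le (inv_range_aeval y ℓ)
  have h2 := phi_sum y
  have hUt : ¬ (⊤ : Submodule F V) ≤ U := by
    intro h
    have : U = ⊤ := top_le_iff.1 h
    have h3 : finrank F U = finrank F V := by rw [this, finrank_top]
    have := hℓ.natDegree_pos
    omega
  have h3 : ∑ W : Submodule F V, phiW y W = phiW y ⊤ + ∑ W ∈ Finset.univ.filter (fun W => W ≤ U), phiW y W := by
    rw [Finset.sum_filter]
    have : phiW y ⊤ = ∑ W : Submodule F V, if W = ⊤ then phiW y W else 0 := by
      rw [Finset.sum_ite_eq', if_pos (Finset.mem_univ _)]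
    rw [this, ← Finset.sum_add_distrib]
    refine Finset.sum_congr rfl fun W _ => ?_
    by_cases ht : W = ⊤
    · subst ht
      rw [if_pos rfl, if_neg hUt, add_zero]
    rw [if_neg ht, zero_add]
    split_ifs with hl
    · rfl
    · apply phiW_not
      intro hi
      apply ht
      obtain ⟨w, hw, hw'⟩ := Set.not_subset.1 hl
      have : w ∈ cyc y v := hv ▸ trivial
      obtain ⟨p, rfl⟩ := this
      refine inv_eq_top_of_coprime hv hi hw ?_
      rw [hc]
      refine IsCoprime.pow_right ?_
      refine ((hℓ.coprime_iff_not_dvd).2 ?_).symm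
      rintro ⟨r, rfl⟩
      apply hw'
      exact ⟨aeval y r v, by rw [ev_apply, map_mul]; rfl⟩
  rw [h2, h1, phiW_top, ← hr] at h3
  push_cast at h3
  linear_combination -h3

theorem phi_pair {e : Module.End F V → ℂ} (he : Prim e) : ∑ y, phi y * e y = (finrank F V : ℂ) * ∑ y, e y := by
  have h1 : ∀ W : Submodule F V, W ≠ ⊤ → ∑ y, e y * phiW y W = 0 := by
    intro W hW
    by_cases hb : W = ⊥
    · subst hb
      simp [phiW_zero_dim]
    refine prim_sum_zero he hb hW _ (fun y hy => phiW_not hy) fun y hy N hN => phiW_add_nil_le le_rfl hN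
  have h2 : ∑ y, e y * ∑ W : Submodule F V, phiW y W = (finrank F V : ℂ) * ∑ y, e y := by
    rw [Finset.mul_sum]
    refine Finset.sum_congr rfl fun y _ => ?_
    rw [phi_sum, mul_comm]
  rw [← h2]
  rw [Finset.sum_congr rfl (fun y _ => Finset.mul_sum _ _ _), Finset.sum_comm]
  rw [Finset.sum_eq_single ⊤ (fun W _ hW => h1 W hW) (by simp)]
  refine Finset.sum_congr rfl fun y _ => ?_
  rw [phiW_top, mul_comm]

end phival
end MK

set_option linter.all false

namespace MK
open Module Polynomial
open scoped BigOperators Classical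

section cps
variable {F : Type} [Field F] {E : Type} [Field E] [Algebra F E]

/-- multiplication by `η` -/
noncomputable abbrev Lm (F : Type) [Field F] {E : Type} [Field E] [Algebra F E] (η : E) : Module.End F E := LinearMap.mulLeft F η

theorem aeval_Lm (η : E) (p : F[X]) : aeval (Lm F η) p = Lm F (aeval η p) := by
  have : Lm F η = Algebra.lmul F E η := rfl
  rw [this, aeval_algHom_apply]
  rfl

/-- characteristic polynomial of `η` -/
noncomputable def cp (F : Type) [Field F] {E : Type} [Field E] [Algebra F E] [Finite E] (η : E) : F[X] := (Lm F η).charpoly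

variable [Finite E]

theorem aeval_cp (η : E) : aeval η (cp F η) = 0 := by
  have := LinearMap.aeval_self_charpoly (Lm F η)
  rw [aeval_Lm] at this
  have h := LinearMap.congr_fun this (1 : E)
  simpa [cp] using h

theorem natDegree_cp (η : E) : (cp F η).natDegree = finrank F E := LinearMap.charpoly_natDegree _

theorem cp_monic (η : E) : (cp F η).Monic := LinearMap.charpoly_monic _

theorem cp_ne_one (η : E) : cp F η ≠ 1 := by
  intro h
  have := natDegree_cp (F := F) η
  rw [h, natDegree_one] at this
  exact finrank_pos.ne this

theorem aeval_eq_zero_of_ker {η : E} {p : F[X]} (h : LinearMap.ker (aeval (Lm F η) p) ≠ ⊥) : aeval η p = 0 := by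
  obtain ⟨v, hv, h0⟩ := Submodule.exists_mem_ne_zero_of_ne_bot h
  rw [LinearMap.mem_ker, aeval_Lm] at hv
  exact (mul_eq_zero.1 hv).resolve_right h0

theorem isInt (η : E) : IsIntegral F η := by
  haveI : FiniteDimensional F E := inferInstance
  exact Algebra.IsIntegral.isIntegral (R := F) η

theorem cp_eq (η : E) : ∃ j, cp F η = (minpoly F η) ^ (j + 1) := by
  rcases primary_or (cp_monic (F := F) η) (cp_ne_one (F := F) η) with ⟨ℓ, j, hm, hℓ, h⟩ | ⟨p₁, p₂, hc, h1, h2, h01, h02, h⟩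
  · refine ⟨j, ?_⟩
    rw [h]
    congr 1
    have h3 := aeval_cp (F := F) η
    rw [h, map_pow] at h3
    exact minpoly.eq_of_irreducible_of_monic hℓ (pow_eq_zero_iff (by omega) |>.1 h3) hm
  · exfalso
    have a1 := aeval_eq_zero_of_ker (ker_aeval_ne_bot' h1 h01 (y := Lm F η) (by change p₁ ∣ cp F η; rw [h]; exact dvd_mul_right _ _))
    have a2 := aeval_eq_zero_of_ker (ker_aeval_ne_bot' h2 h02 (y := Lm F η) (by change p₂ ∣ cp F η; rw [h]; exact dvd_mul_left _ _))
    obtain ⟨a, b, hab⟩ := hc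
    have := congrArg (aeval η) hab
    simp [a1, a2] at this

theorem eq_of_pow_eq {p q : F[X]} (hp : p.Monic) (hq : q.Monic) (ip : Irreducible p) (iq : Irreducible q) {i j : ℕ}
    (h : p ^ (i + 1) = q ^ (j + 1)) : p = q := by
  have h1 : p ∣ q ^ (j + 1) := h ▸ dvd_pow_self p (by omega)
  have h2 : p ∣ q := ip.prime.dvd_of_dvd_pow h1
  exact Polynomial.eq_of_monic_of_associated hp hq (ip.associated_of_dvd iq h2)

theorem cp_eq_iff (η η' : E) : cp F η = cp F η' ↔ minpoly F η = minpoly F η' := by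
  constructor
  · intro h
    obtain ⟨i, hi⟩ := cp_eq (F := F) η
    obtain ⟨j, hj⟩ := cp_eq (F := F) η'
    rw [hi, hj] at h
    exact eq_of_pow_eq (minpoly.monic (isInt η)) (minpoly.monic (isInt η')) (minpoly.irreducible (isInt η)) (minpoly.irreducible (isInt η')) h
  · intro h
    obtain ⟨i, hi⟩ := cp_eq (F := F) η
    obtain ⟨j, hj⟩ := cp_eq (F := F) η'
    have d1 := natDegree_cp (F := F) η
    have d2 := natDegree_cp (F := F) η'
    rw [hi, natDegree_pow] at d1
    rw [hj, natDegree_pow, ← d1, h] at d2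
    have := Nat.eq_of_mul_eq_mul_right (minpoly.natDegree_pos (isInt η')) d2
    rw [hi, hj, h, this]

theorem cp_eq_iff_root (η η' : E) : cp F η' = cp F η ↔ aeval η' (minpoly F η) = 0 := by
  rw [cp_eq_iff]
  constructor
  · intro h; rw [← h]; exact minpoly.aeval _ _
  · intro h
    exact (minpoly.eq_of_irreducible_of_monic (minpoly.irreducible (isInt η)) h (minpoly.monic (isInt η))).symm

/-- degree -/
noncomputable def dg (F : Type) [Field F] {E : Type} [Field E] [Algebra F E] (η : E) : ℕ := (minpoly F η).natDegree

theorem dg_pos (η : E) : 0 < dg F η := minpoly.natDegree_pos (isInt η)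

theorem dg_congr {η η' : E} (h : cp F η = cp F η') : dg F η = dg F η' := by
  unfold dg; rw [(cp_eq_iff η η').1 h]

theorem card_class [Finite F] (η : E) : (Finset.univ.filter fun η' : E => cp F η' = cp F η).card = dg F η := by
  have hn : Normal F E := inferInstance
  have hs : Algebra.IsSeparable F E := inferInstance
  have := card_rootSet_eq_natDegree (K := E) (hs.isSeparable' η) (hn.splits η)
  rw [dg, ← this, ← Fintype.card_coe]
  refine Fintype.card_congr (Equiv.subtypeEquivRight fun x => ?_)
  rw [Finset.mem_filter, cp_eq_iff_root, mem_rootSet]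
  simp [minpoly.ne_zero (isInt η)]

theorem exists_cp {ℓ : F[X]} (hm : ℓ.Monic) (hℓ : Irreducible ℓ) {j : ℕ} (h : (ℓ ^ (j + 1)).natDegree = finrank F E) :
    ∃ η : E, cp F η = ℓ ^ (j + 1) := by
  haveI : Fact (Irreducible ℓ) := ⟨hℓ⟩
  obtain ⟨f⟩ := FiniteField.nonempty_algHom_of_finrank_dvd (F := F) (K := AdjoinRoot ℓ) (L := E) (by
    rw [finrank_adjoinRoot hm, ← h, natDegree_pow]
    exact dvd_mul_left _ _)
  set η := f (AdjoinRoot.root ℓ)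
  have h1 : aeval η ℓ = 0 := by
    rw [aeval_algHom_apply, AdjoinRoot.aeval_eq, AdjoinRoot.mk_self, map_zero]
  have h2 := minpoly.eq_of_irreducible_of_monic hℓ h1 hm
  obtain ⟨i, hi⟩ := cp_eq (F := F) η
  refine ⟨η, ?_⟩
  have := natDegree_cp (F := F) η
  rw [hi, ← h2, ← h, natDegree_pow, natDegree_pow] at this
  rw [hi, ← h2, Nat.eq_of_mul_eq_mul_right hℓ.natDegree_pos this]

/-- class sum -/
noncomputable def cs (Φ : Module.End F E → ℂ) (c : F[X]) : ℂ := ∑ y, Φ y * (if y.charpoly = c then 1 else 0)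

theorem cs_no_root {Φ : Module.End F E → ℂ} (hΦ : Prim Φ) {c : F[X]} (h : ∀ η : E, cp F η ≠ c) : cs Φ c = 0 := by
  by_cases he : ∃ y : Module.End F E, y.charpoly = c
  · obtain ⟨y, rfl⟩ := he
    have hd := LinearMap.charpoly_natDegree y
    rcases primary_or (LinearMap.charpoly_monic y) (by
      intro h1
      rw [h1, natDegree_one] at hd
      exact finrank_pos.ne hd) with ⟨ℓ, j, hm, hℓ, h'⟩ | ⟨p₁, p₂, hc, h1, h2, h01, h02, h'⟩
    · rw [h'] at hd
      obtain ⟨η, hη⟩ := exists_cp hm hℓ hd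
      exact (h η (hη.trans h'.symm)).elim
    · unfold cs
      rw [h']
      exact A5 hΦ hc h1 h2 h01 h02
  · refine Finset.sum_eq_zero fun y _ => ?_
    rw [if_neg (fun h => he ⟨y, h⟩), mul_zero]

/-- normalized class sum at `η` -/
noncomputable def sg (Φ : Module.End F E → ℂ) (η : E) : ℂ := cs Φ (cp F η) / dg F η

theorem sg_congr (Φ : Module.End F E → ℂ) {η η' : E} (h : cp F η = cp F η') : sg Φ η = sg Φ η' := by
  unfold sg; rw [h, dg_congr h]

theorem dg_ne (η : E) : (dg F η : ℂ) ≠ 0 := by exact_mod_cast (dg_pos η).ne'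

theorem sum_class [Finite F] (f : E → ℂ) (hf : ∀ η η', cp F η = cp F η' → f η = f η') (η : E) :
    ∑ η' : E, (if cp F η' = cp F η then f η' else 0) = dg F η * f η := by
  rw [← Finset.sum_filter, Finset.sum_congr rfl (g := fun _ => f η), Finset.sum_const, card_class, nsmul_eq_mul]
  intro x hx
  exact hf _ _ (Finset.mem_filter.1 hx).2

/-- A5' -/
theorem sum_charpoly [Finite F] {Φ : Module.End F E → ℂ} (hΦ : Prim Φ) (h : F[X] → ℂ) :
    ∑ y, Φ y * h y.charpoly = ∑ η : E, sg Φ η * h (cp F η) := by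
  set S : Finset F[X] := Finset.univ.image (fun y : Module.End F E => y.charpoly) with hS
  have h1 : ∑ y, Φ y * h y.charpoly = ∑ c ∈ S, cs Φ c * h c := by
    rw [← Finset.sum_fiberwise_of_maps_to (t := S) (g := fun y : Module.End F E => y.charpoly) (fun y _ => Finset.mem_image_of_mem _ (Finset.mem_univ y))]
    refine Finset.sum_congr rfl fun c _ => ?_
    rw [cs, Finset.sum_mul, Finset.sum_filter]
    refine Finset.sum_congr rfl fun y _ => ?_
    split_ifs with hy
    · rw [hy, mul_one]
    · simp
  have h2 : ∑ η : E, sg Φ η * h (cp F η) = ∑ c ∈ S, ∑ η ∈ Finset.univ.filter (fun η : E => cp F η = c), sg Φ η * h (cp F η) := by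
    rw [Finset.sum_fiberwise_of_maps_to]
    intro η _
    exact Finset.mem_image_of_mem (fun y : Module.End F E => y.charpoly) (Finset.mem_univ (Lm F η))
  rw [h1, h2]
  refine Finset.sum_congr rfl fun c _ => ?_
  by_cases hc : ∃ η : E, cp F η = c
  · obtain ⟨η, rfl⟩ := hc
    rw [Finset.sum_filter, sum_class (fun η => sg Φ η * h (cp F η)) (fun a b hab => by rw [sg_congr Φ hab, hab]), sg]
    field_simp [dg_ne (F := F) η]
  · push Not at hc
    rw [cs_no_root hΦ hc, zero_mul, Finset.filter_false_of_mem (fun η _ => hc η), Finset.sum_empty]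

/-- `G` constant -/
noncomputable def GG (F E : Type) [Field F] [Field E] [Algebra F E] : ℂ := (Nat.card (E ≃ₗ[F] E) : ℂ) / ((Nat.card E : ℂ) - 1)

theorem cardE_ne : ((Nat.card E : ℂ) - 1) ≠ 0 := by
  have : 1 < Nat.card E := Finite.one_lt_card
  rw [sub_ne_zero]
  exact_mod_cast this.ne'

theorem GG_ne : GG F E ≠ 0 := by
  unfold GG
  refine div_ne_zero ?_ cardE_ne
  have : 0 < Nat.card (E ≃ₗ[F] E) := Nat.card_pos
  exact_mod_cast this.ne'

theorem cs_cyclic {Φ : Module.End F E → ℂ} (hΦ : Prim Φ) (hcl : ClassFn Φ) {y : Module.End F E} {v : E} (hv : cyc y v = ⊤) :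
    cs Φ y.charpoly = GG F E * Φ y := by
  have := A4class hΦ hcl y v hv
  unfold cs GG
  rw [div_mul_eq_mul_div, eq_div_iff cardE_ne, ← this]
  ring

theorem phi_reg {y : Module.End F E} {v : E} (hv : cyc y v = ⊤) {η : E} (h : y.charpoly = cp F η) : phi y = dg F η := by
  obtain ⟨j, hj⟩ := cp_eq (F := F) η
  exact phi_cyclic hv (minpoly.monic (isInt η)) (minpoly.irreducible (isInt η)) (h.trans hj)

/-- the coefficient function -/
noncomputable def Hc (Φ : Module.End F E → ℂ) (c : F[X]) : ℂ := if h : ∃ η : E, cp F η = c then sg Φ h.choose / GG F E else 0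

theorem Hc_cp (Φ : Module.End F E → ℂ) (η : E) : Hc Φ (cp F η) = sg Φ η / GG F E := by
  have h : ∃ η' : E, cp F η' = cp F η := ⟨η, rfl⟩
  rw [Hc, dif_pos h, sg_congr Φ h.choose_spec]

theorem Prim.sub {V : Type} [AddCommGroup V] [Module F V] [Finite V] {Φ Ψ : Module.End F V → ℂ} (h1 : Prim Φ) (h2 : Prim Ψ) : Prim (fun y => Φ y - Ψ y) := by
  intro U h0 h1' y hy
  rw [Finset.sum_sub_distrib, h1 U h0 h1' y hy, h2 U h0 h1' y hy, sub_zero]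

theorem charpoly_conj' {V : Type} [AddCommGroup V] [Module F V] [Finite V] (g : V ≃ₗ[F] V) (y : Module.End F V) : (g.conj y).charpoly = y.charpoly :=
  LinearEquiv.charpoly_conj g y

theorem structure_thm {Φ : Module.End F E → ℂ} (hΦ : Prim Φ) (hcl : ClassFn Φ) (y : Module.End F E) :
    Φ y = Hc Φ y.charpoly * phi y := by
  rw [← sub_eq_zero]
  refine A2 (Φ := fun y => Φ y - Hc Φ y.charpoly * phi y) (hΦ.sub (phi_prim.mul_stable (fun y => Hc Φ y.charpoly) fun y z h => by rw [h])) ?_ ?_ y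
  · intro g y
    change Φ (g.conj y) - Hc Φ (g.conj y).charpoly * phi (g.conj y) = _
    have := phi_class g y
    beta_reduce at this
    rw [this, hcl, charpoly_conj']
  · intro y v hv
    have h1 := cs_cyclic hΦ hcl hv
    by_cases h : ∃ η : E, cp F η = y.charpoly
    · obtain ⟨η, hη⟩ := h
      rw [← hη, Hc_cp, phi_reg hv hη.symm, sg, hη, h1]
      field_simp [dg_ne (F := F) η, GG_ne (F := F) (E := E)]
      ring
    · rw [Hc, dif_neg h, zero_mul, sub_zero]
      push Not at h
      rw [cs_no_root hΦ h] at h1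
      exact (mul_eq_zero.1 h1.symm).resolve_left GG_ne

theorem S1 [Finite F] {Φ Ψ : Module.End F E → ℂ} (hΦ : Prim Φ) (hcl : ClassFn Φ) (hΨ : Prim Ψ) :
    ∑ y, Φ y * Ψ y = finrank F E / GG F E * ∑ η : E, sg Φ η * sg Ψ η := by
  have h1 : ∑ y, Φ y * Ψ y = ∑ y, phi y * (Hc Φ y.charpoly * Ψ y) := by
    refine Finset.sum_congr rfl fun y _ => ?_
    rw [structure_thm hΦ hcl y]; ring
  rw [h1, phi_pair (hΨ.mul_stable (fun y => Hc Φ y.charpoly) fun y z h => by rw [h])]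
  have h2 := sum_charpoly hΨ (Hc Φ)
  rw [Finset.sum_congr rfl (g := fun y => Ψ y * Hc Φ y.charpoly) (fun y _ => mul_comm _ _), h2, Finset.mul_sum, Finset.mul_sum]
  refine Finset.sum_congr rfl fun η _ => ?_
  rw [Hc_cp]
  ring

end cps
end MK

set_option linter.all false

namespace MK
open Module Polynomial
open scoped BigOperators Classical

section nc
variable {F : Type} [Field F] {E : Type} [Field E] [Algebra F E] [Finite E]

theorem dvd_of_nilp {V : Type} [AddCommGroup V] [Module F V] [Finite V] {y : Module.End F V} {ℓ r : F[X]} (hℓ : Irreducible ℓ)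
    (h : IsNilpotent (aeval y ℓ)) (hr : Irreducible r) (hd : r ∣ y.charpoly) : r ∣ ℓ := by
  by_contra hn
  have hc : IsCoprime r ℓ := (hr.coprime_iff_not_dvd).2 hn
  obtain ⟨k, hk⟩ := h
  obtain ⟨a, b, hab⟩ := hc.pow_right (n := k)
  obtain ⟨v, hv, h0⟩ := Submodule.exists_mem_ne_zero_of_ne_bot (ker_aeval_ne_bot hr hd)
  have h1 := LinearMap.congr_fun (congrArg (aeval y) hab) v
  rw [map_add, map_mul, map_mul, map_pow, hk, mul_zero, add_zero, map_one, Module.End.mul_apply,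
    LinearMap.mem_ker.1 hv, map_zero] at h1
  exact h0 h1.symm

theorem charpoly_eq_cp_iff (y : Module.End F E) (η : E) : y.charpoly = cp F η ↔ IsNilpotent (aeval y (minpoly F η)) := by
  obtain ⟨j, hj⟩ := cp_eq (F := F) η
  have irr := minpoly.irreducible (isInt (F := F) η)
  have mon := minpoly.monic (isInt (F := F) η)
  constructor
  · intro h
    refine ⟨j + 1, ?_⟩
    rw [← map_pow, ← hj, ← h, LinearMap.aeval_self_charpoly]
  · intro h
    have hd := LinearMap.charpoly_natDegree y
    have hone : y.charpoly ≠ 1 := by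
      intro h1
      rw [h1, natDegree_one] at hd
      exact finrank_pos.ne hd
    rcases primary_or (LinearMap.charpoly_monic y) hone with ⟨ℓ, i, hm, hℓ, hc⟩ | ⟨p₁, p₂, hc, h1, h2, h01, h02, h'⟩
    · have h1 := dvd_of_nilp irr h hℓ (hc ▸ dvd_pow_self ℓ (by omega))
      have h2 : ℓ = minpoly F η := Polynomial.eq_of_monic_of_associated hm mon (hℓ.associated_of_dvd irr h1)
      have h3 := natDegree_cp (F := F) η
      rw [hj, ← hd, hc, h2, natDegree_pow, natDegree_pow] at h3
      rw [hc, hj, h2, Nat.eq_of_mul_eq_mul_right irr.natDegree_pos h3]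
    · exfalso
      obtain ⟨r, hr, hr'⟩ := WfDvdMonoid.exists_irreducible_factor h1 h01
      obtain ⟨s, hs, hs'⟩ := WfDvdMonoid.exists_irreducible_factor h2 h02
      have a1 := dvd_of_nilp irr h hr (hr'.trans (h' ▸ dvd_mul_right _ _))
      have a2 := dvd_of_nilp irr h hs (hs'.trans (h' ▸ dvd_mul_left _ _))
      have a3 : r ∣ s := (hr.associated_of_dvd irr a1).dvd.trans (hs.associated_of_dvd irr a2).symm.dvd
      exact hr.not_isUnit (hc.isUnit_of_dvd' hr' (a3.trans hs'))

theorem charpoly_aeval {y : Module.End F E} {η : E} (h : y.charpoly = cp F η) (p : F[X]) :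
    (aeval y p).charpoly = cp F (aeval η p) := by
  rw [charpoly_eq_cp_iff] at h ⊢
  have h1 : minpoly F η ∣ (minpoly F (aeval η p)).comp p := by
    apply minpoly.dvd
    rw [aeval_comp]
    exact minpoly.aeval _ _
  obtain ⟨s, hs⟩ := h1
  rw [← aeval_comp, hs, map_mul]
  refine Commute.isNilpotent_mul_right ?_ h
  unfold Commute SemiconjBy
  rw [← map_mul, ← map_mul, mul_comm]

theorem charpoly_affine (t z : F) (ht : t ≠ 0) (y : Module.End F E) (η : E) :
    (t • y + z • (1 : Module.End F E)).charpoly = cp F (t • η + algebraMap F E z) ↔ y.charpoly = cp F η := by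
  have key : ∀ (t z : F) (y : Module.End F E) (η : E), y.charpoly = cp F η → (t • y + z • (1 : Module.End F E)).charpoly = cp F (t • η + algebraMap F E z) := by
    intro t z y η h
    have := charpoly_aeval h (C t * X + C z)
    simpa [Algebra.smul_def] using this
  refine ⟨fun h => ?_, key t z y η⟩
  have := key t⁻¹ (-(t⁻¹ * z)) _ _ h
  have h1 : t⁻¹ • (t • y + z • (1 : Module.End F E)) + (-(t⁻¹ * z)) • (1 : Module.End F E) = y := by
    rw [smul_add, smul_smul, smul_smul, inv_mul_cancel₀ ht, one_smul, add_assoc, ← add_smul]; simp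
  have h2 : t⁻¹ • (t • η + algebraMap F E z) + algebraMap F E (-(t⁻¹ * z)) = η := by
    rw [smul_add, smul_smul, inv_mul_cancel₀ ht, map_neg, map_mul, Algebra.smul_def t⁻¹]; simp
  rw [h1, h2] at this
  exact this

theorem cp_affine (t z : F) (ht : t ≠ 0) (η η' : E) :
    cp F (t • η' + algebraMap F E z) = cp F (t • η + algebraMap F E z) ↔ cp F η' = cp F η := by
  have h0 := charpoly_affine t z ht (Lm F η') η
  have : t • Lm F η' + z • (1 : Module.End F E) = Lm F (t • η' + algebraMap F E z) := by
    ext v; simp [add_mul, Algebra.smul_def, mul_assoc]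
  rw [this] at h0; exact h0

theorem trace_of_charpoly_eq {V : Type} [AddCommGroup V] [Module F V] [Module.Finite F V] {y z : Module.End F V} (h : y.charpoly = z.charpoly) :
    LinearMap.trace F V y = LinearMap.trace F V z := by
  have key : ∀ w : Module.End F V, LinearMap.trace F V w = - w.charpoly.nextCoeff := by
    intro w
    rw [LinearMap.trace_eq_matrix_trace F (Module.Free.chooseBasis F V), Matrix.trace_eq_neg_charpoly_nextCoeff, LinearMap.charpoly_toMatrix]
  rw [key, key, h]

theorem trace_cp {y : Module.End F E} {η : E} (h : y.charpoly = cp F η) : LinearMap.trace F E y = Algebra.trace F E η :=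
  trace_of_charpoly_eq h

end nc

section ops
variable {F : Type} [Field F] {E : Type} [Field E] [Algebra F E] [Finite E]

/-- invariant functions -/
def IsInv (F : Type) [Field F] {E : Type} [Field E] [Algebra F E] [Finite E] (s : E → ℂ) : Prop := ∀ η η' : E, cp F η = cp F η' → s η = s η'

/-- coefficient function of an invariant function -/
noncomputable def Hs (F : Type) [Field F] {E : Type} [Field E] [Algebra F E] [Finite E] (s : E → ℂ) (c : F[X]) : ℂ := if h : ∃ η : E, cp F η = c then s h.choose / GG F E else 0

theorem Hs_cp {s : E → ℂ} (hs : IsInv F s) (η : E) : Hs F s (cp F η) = s η / GG F E := by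
  have h : ∃ η' : E, cp F η' = cp F η := ⟨η, rfl⟩
  rw [Hs, dif_pos h, hs _ _ h.choose_spec]

/-- the primitive class function attached to an invariant function -/
noncomputable def lift (F : Type) [Field F] {E : Type} [Field E] [Algebra F E] [Finite E] (s : E → ℂ) : Module.End F E → ℂ := fun y => Hs F s y.charpoly * phi y

theorem lift_prim (s : E → ℂ) : Prim (lift F s) := phi_prim.mul_stable (fun y => Hs F s y.charpoly) fun y z h => by rw [h]

theorem lift_class (s : E → ℂ) : ClassFn (lift F s) := by
  intro g y
  have := phi_class g y
  beta_reduce at this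
  rw [lift, lift, charpoly_conj', this]

theorem lift_sg {Φ : Module.End F E → ℂ} (hΦ : Prim Φ) (hcl : ClassFn Φ) : lift F (sg Φ) = Φ := by
  funext y
  exact (structure_thm hΦ hcl y).symm

theorem sg_inv (Φ : Module.End F E → ℂ) : IsInv F (sg Φ) := fun _ _ h => sg_congr Φ h

theorem sg_reg {Φ : Module.End F E → ℂ} (hΦ : Prim Φ) (hcl : ClassFn Φ) {y : Module.End F E} {v : E} (hv : cyc y v = ⊤) {η : E}
    (h : y.charpoly = cp F η) : sg Φ η = GG F E * Φ y / dg F η := by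
  rw [sg, ← h, cs_cyclic hΦ hcl hv]

theorem sg_lift {s : E → ℂ} (hs : IsInv F s) (η : E) : sg (lift F s) η = s η := by
  obtain ⟨y, v, hy, hv⟩ := exists_cyclic (V := E) (cp_monic (F := F) η) (natDegree_cp η)
  rw [sg_reg (lift_prim s) (lift_class s) hv hy, lift, hy, Hs_cp hs, phi_reg hv hy]
  field_simp [dg_ne (F := F) η, GG_ne (F := F) (E := E)]

/-- `A` -/
noncomputable def AA (F E : Type) [Field F] [Field E] [Algebra F E] : ℂ := (-1) ^ (finrank F E - 1) * (Nat.card F : ℂ) ^ (finrank F E * (finrank F E - 1) / 2)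

variable [Finite F] (ψ : AddChar F ℂ)

theorem AA_ne : AA F E ≠ 0 := by
  unfold AA
  have : 0 < Nat.card F := Nat.card_pos
  refine mul_ne_zero (pow_ne_zero _ (by norm_num)) (pow_ne_zero _ (by exact_mod_cast this.ne'))

theorem AA_conj : starRingEnd ℂ (AA F E) = AA F E := by
  simp [AA]

theorem card_pow : (Nat.card E : ℂ) = (Nat.card F : ℂ) ^ finrank F E := by
  rw [Module.natCard_eq_pow_finrank (K := F) (V := E)]; push_cast; rfl

theorem AA_sq : AA F E * AA F E * Nat.card E = Nat.card (Module.End F E) := by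
  have h0 : 0 < finrank F E := finrank_pos
  have h1 : 2 ∣ finrank F E * (finrank F E - 1) := (Nat.even_mul_pred_self _).two_dvd
  rw [Module.natCard_eq_pow_finrank (K := F) (V := Module.End F E), card_pow (F := F), AA]
  have h2 : finrank F (Module.End F E) = finrank F E * finrank F E := by
    simp [Module.finrank_linearMap]
  obtain ⟨m, hm⟩ := h1
  rw [h2, hm, Nat.mul_div_cancel_left _ (by norm_num)]
  have h3 : finrank F E * finrank F E = m + m + finrank F E := by
    obtain ⟨k, hk⟩ : ∃ k, finrank F E = k + 1 := ⟨finrank F E - 1, by omega⟩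
    rw [hk] at hm ⊢
    simp only [Nat.add_sub_cancel] at hm
    nlinarith
  rw [h3]
  push_cast
  rw [pow_add, pow_add]
  have h4 : ((-1 : ℂ) ^ (finrank F E - 1)) * (-1) ^ (finrank F E - 1) = 1 := by
    rw [← mul_pow]; simp
  linear_combination (Nat.card F : ℂ) ^ m * (Nat.card F : ℂ) ^ m * (Nat.card F : ℂ) ^ finrank F E * h4

/-- normalized transform -/
noncomputable def TT (s : E → ℂ) : E → ℂ := fun η => sg (four ψ (lift F s)) η / AA F E

/-- plain Fourier transform -/
noncomputable def RR (s : E → ℂ) : E → ℂ := fun η => ∑ ξ : E, s ξ * ψ (Algebra.trace F E (ξ * η))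

theorem TT_inv (s : E → ℂ) : IsInv F (TT ψ s) := by
  intro a b h
  rw [TT, TT, sg_congr _ h]

theorem four_symm (Φ Ψ : Module.End F E → ℂ) : ∑ y, four ψ Φ y * Ψ y = ∑ y, Φ y * four ψ Ψ y := by
  unfold four
  simp only [Finset.sum_mul, Finset.mul_sum]
  rw [Finset.sum_comm]
  refine Finset.sum_congr rfl fun y _ => Finset.sum_congr rfl fun z _ => ?_
  rw [LinearMap.trace_mul_comm]; ring

theorem finrank_ne : (finrank F E : ℂ) ≠ 0 := by
  have : 0 < finrank F E := finrank_pos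
  exact_mod_cast this.ne'

theorem TT_symm (hψ : ψ ≠ 1) {s s' : E → ℂ} (hs : IsInv F s) (hs' : IsInv F s') : ∑ η, TT ψ s η * s' η = ∑ η, s η * TT ψ s' η := by
  have h := four_symm ψ (lift F s) (lift F s')
  have c1 := ClassFn.four ψ (lift_class (F := F) s)
  have p1 := Prim.four ψ hψ (lift_prim (F := F) s)
  have p2 := Prim.four ψ hψ (lift_prim (F := F) s')
  rw [S1 p1 c1 (lift_prim s'), S1 (lift_prim s) (lift_class s) p2] at h
  have h2 := mul_left_cancel₀ (div_ne_zero finrank_ne GG_ne) h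
  simp only [sg_lift hs, sg_lift hs'] at h2
  simp only [TT, div_mul_eq_mul_div, mul_div_assoc']
  rw [← Finset.sum_div, ← Finset.sum_div, h2]

theorem Prim.conj {V : Type} [AddCommGroup V] [Module F V] [Finite V] {Φ : Module.End F V → ℂ} (h : Prim Φ) : Prim (fun y => starRingEnd ℂ (Φ y)) := by
  intro U h0 h1 y hy
  rw [← map_sum, h U h0 h1 y hy, map_zero]

theorem sg_conj (Φ : Module.End F E → ℂ) (η : E) : sg (fun y => starRingEnd ℂ (Φ y)) η = starRingEnd ℂ (sg Φ η) := by
  unfold sg cs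
  rw [map_div₀, map_sum, map_natCast]
  congr 1
  refine Finset.sum_congr rfl fun y _ => ?_
  rw [map_mul]; split_ifs <;> simp

theorem TT_iso (hψ : ψ ≠ 1) {s s' : E → ℂ} (hs : IsInv F s) (hs' : IsInv F s') :
    ∑ η, TT ψ s η * starRingEnd ℂ (TT ψ s' η) = Nat.card E * ∑ η, s η * starRingEnd ℂ (s' η) := by
  have h := plancherel ψ hψ (lift F s) (lift F s')
  have c1 := ClassFn.four ψ (lift_class (F := F) s)
  have p1 := Prim.four ψ hψ (lift_prim (F := F) s)
  have p2 := (Prim.four ψ hψ (lift_prim (F := F) s')).conj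
  rw [S1 p1 c1 p2, S1 (lift_prim s) (lift_class s) (lift_prim s').conj, mul_left_comm] at h
  have h2 := mul_left_cancel₀ (div_ne_zero finrank_ne GG_ne) h
  simp only [sg_conj, sg_lift hs, sg_lift hs'] at h2
  simp only [TT, map_div₀, AA_conj, div_mul_div_comm]
  rw [← Finset.sum_div, h2, ← AA_sq, div_eq_iff (mul_ne_zero AA_ne AA_ne)]
  ring

theorem trace_sum (hψ : ψ ≠ 1) (η : E) : ∑ ξ : E, ψ (Algebra.trace F E (ξ * η)) = if η = 0 then (Nat.card E : ℂ) else 0 := by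
  let l : E →ₗ[F] F := Algebra.trace F E ∘ₗ LinearMap.mulRight F η
  have h := sum_psi_linear ψ hψ l
  have h1 : l = 0 ↔ η = 0 := by
    constructor
    · intro h
      by_contra h0
      obtain ⟨x, hx⟩ := Algebra.trace_surjective F E 1
      have := LinearMap.congr_fun h (x * η⁻¹)
      simp only [l, LinearMap.comp_apply, LinearMap.mulRight_apply, LinearMap.zero_apply, mul_assoc, inv_mul_cancel₀ h0, mul_one, hx] at this
      exact one_ne_zero this
    · rintro rfl
      ext x; simp [l]
  simp only [h1] at h
  exact h

theorem psi_star (a : F) : starRingEnd ℂ (ψ a) = ψ (-a) := by rw [AddChar.map_neg_eq_conj]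

theorem RR_iso (hψ : ψ ≠ 1) (s s' : E → ℂ) :
    ∑ η, RR ψ s η * starRingEnd ℂ (RR ψ s' η) = Nat.card E * ∑ η, s η * starRingEnd ℂ (s' η) := by
  simp only [RR, map_sum, map_mul, psi_star, Finset.sum_mul_sum]
  rw [Finset.sum_comm, Finset.mul_sum]
  refine Finset.sum_congr rfl fun ξ _ => ?_
  rw [Finset.sum_comm, Finset.sum_eq_single ξ]
  · rw [Finset.sum_congr rfl (g := fun _ => s ξ * starRingEnd ℂ (s' ξ))]
    · simp
    · intro x _
      have : ψ (Algebra.trace F E (ξ * x)) * ψ (-Algebra.trace F E (ξ * x)) = 1 := by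
        rw [← AddChar.map_add_eq_mul, add_neg_cancel, AddChar.map_zero_eq_one]
      linear_combination s ξ * starRingEnd ℂ (s' ξ) * this
  · intro ξ' _ hne
    have h := trace_sum ψ hψ (ξ - ξ')
    rw [if_neg (sub_ne_zero.2 hne.symm)] at h
    have h2 : ∀ x : E, s ξ * ψ (Algebra.trace F E (ξ * x)) * (starRingEnd ℂ (s' ξ') * ψ (-Algebra.trace F E (ξ' * x))) =
        s ξ * starRingEnd ℂ (s' ξ') * ψ (Algebra.trace F E (x * (ξ - ξ'))) := by
      intro x
      have : Algebra.trace F E (x * (ξ - ξ')) = Algebra.trace F E (ξ * x) + -Algebra.trace F E (ξ' * x) := by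
        rw [mul_sub, map_sub, sub_eq_add_neg, mul_comm x, mul_comm x]
      rw [this, AddChar.map_add_eq_mul]; ring
    rw [Finset.sum_congr rfl fun x _ => h2 x, ← Finset.mul_sum, h, mul_zero]
  · simp

theorem RR_symm (s s' : E → ℂ) : ∑ η, RR ψ s η * s' η = ∑ η, s η * RR ψ s' η := by
  simp only [RR, Finset.sum_mul, Finset.mul_sum]
  rw [Finset.sum_comm]
  refine Finset.sum_congr rfl fun y _ => Finset.sum_congr rfl fun z _ => ?_
  rw [mul_comm z y]; ring

/-- class indicator -/
noncomputable def cl (F : Type) [Field F] {E : Type} [Field E] [Algebra F E] [Finite E] (η : E) : E → ℂ := fun η' => if cp F η' = cp F η then 1 else 0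

theorem cl_inv (η : E) : IsInv F (cl F η) := fun a b h => by simp [cl, h]

theorem cl_pair (η : E) {s : E → ℂ} (hs : IsInv F s) : ∑ η', s η' * cl F η η' = dg F η * s η := by
  rw [← sum_class s hs η]
  refine Finset.sum_congr rfl fun x _ => ?_
  unfold cl; split_ifs <;> simp

end ops
end MK

set_option linter.all false

namespace MK
open Module Polynomial
open scoped BigOperators Classical

section phizero
variable {F : Type} [Field F] {E : Type} [Field E] [Algebra F E] [Finite E] [Finite F]

theorem sg_phi (η : E) : sg (fun y : Module.End F E => phi y) η = GG F E := by
  obtain ⟨y, v, hy, hv⟩ := exists_cyclic (V := E) (cp_monic (F := F) η) (natDegree_cp η)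
  rw [sg_reg phi_prim phi_class hv hy, phi_reg hv hy, mul_div_assoc, div_self (dg_ne η), mul_one]

theorem sum_phi : ∑ y : Module.End F E, phi y = GG F E * Nat.card E := by
  have h := sum_charpoly (phi_prim (F := F) (V := E)) (fun _ => 1)
  simp only [mul_one, sg_phi] at h
  rw [h]; simp [mul_comm]

theorem cp_coeff_zero (η : E) : (cp F η).coeff 0 ≠ 0 ↔ η ≠ 0 := by
  have h1 := LinearMap.det_eq_sign_charpoly_coeff (Lm F η)
  have h2 : LinearMap.det (Lm F η) = Algebra.norm F η := rfl
  rw [h2] at h1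
  have h3 : Algebra.norm F η ≠ 0 ↔ η ≠ 0 := by simp [Algebra.norm_eq_zero_iff]
  rw [← h3, h1, cp]
  simp

theorem sum_phi_det : ∑ y : Module.End F E, phi y * (if LinearMap.det y ≠ 0 then 1 else 0) = GG F E * (Nat.card E - 1) := by
  have h := sum_charpoly (phi_prim (F := F) (V := E)) (fun c => if c.coeff 0 ≠ 0 then 1 else 0)
  simp only [sg_phi, cp_coeff_zero] at h
  have h1 : ∀ y : Module.End F E, (LinearMap.det y ≠ 0 ↔ y.charpoly.coeff 0 ≠ 0) := by
    intro y
    rw [LinearMap.det_eq_sign_charpoly_coeff]; simp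
  simp only [h1]
  rw [h, ← Finset.mul_sum]
  congr 1
  have : ∑ i : E, (if i ≠ 0 then (1 : ℂ) else 0) = ∑ i : E, ((1 : ℂ) - if i = 0 then 1 else 0) := by
    refine Finset.sum_congr rfl fun i _ => ?_
    split_ifs <;> simp_all
  rw [this, Finset.sum_sub_distrib]
  simp

/-- corank -/
noncomputable def crk (y : Module.End F E) : ℕ := finrank F (E ⧸ LinearMap.range y)

theorem card_ann (j : ℕ) (y : Module.End F E) :
    ∑ f : E →ₗ[F] (Fin j → F), (if f ∘ₗ y = 0 then (1 : ℂ) else 0) = ((Nat.card F : ℂ) ^ j) ^ crk y := by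
  rw [Finset.sum_boole]
  have e : {f : E →ₗ[F] (Fin j → F) // f ∘ₗ y = 0} ≃ ((E ⧸ LinearMap.range y) →ₗ[F] (Fin j → F)) :=
    { toFun := fun f => (LinearMap.range y).liftQ f.1 (LinearMap.range_le_ker_iff.2 f.2)
      invFun := fun g => ⟨g ∘ₗ (LinearMap.range y).mkQ, by
        ext v : 1
        simp only [LinearMap.comp_apply, Submodule.mkQ_apply, LinearMap.zero_apply]
        rw [(Submodule.Quotient.mk_eq_zero _).2 (LinearMap.mem_range_self y v), map_zero]⟩
      left_inv := fun f => by
        apply Subtype.ext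
        exact Submodule.liftQ_mkQ _ _ _
      right_inv := fun g => by
        apply Submodule.linearMap_qext
        exact Submodule.liftQ_mkQ _ _ _ }
  have h1 : (Finset.univ.filter fun f : E →ₗ[F] (Fin j → F) => f ∘ₗ y = 0).card = Nat.card ((E ⧸ LinearMap.range y) →ₗ[F] (Fin j → F)) := by
    rw [← Nat.card_congr e, Nat.card_eq_fintype_card, Fintype.card_subtype]
  rw [h1, Module.natCard_eq_pow_finrank (K := F), Module.finrank_linearMap, crk]
  push_cast
  rw [← pow_mul, mul_comm]
  simp

theorem card_inj (j : ℕ) (hj : finrank F E ≤ j) :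
    ∑ f : E →ₗ[F] (Fin j → F), (if LinearMap.ker f = ⊥ then (1 : ℂ) else 0) = ∏ i ∈ Finset.range (finrank F E), ((Nat.card F : ℂ) ^ j - (Nat.card F : ℂ) ^ i) := by
  rw [Finset.sum_boole]
  haveI : Fintype F := Fintype.ofFinite F
  have h0 := card_linearIndependent (K := F) (V := Fin j → F) (k := finrank F E) (by simpa using hj)
  let b := Module.finBasis F E
  have e : {f : E →ₗ[F] (Fin j → F) // LinearMap.ker f = ⊥} ≃ {s : Fin (finrank F E) → (Fin j → F) // LinearIndependent F s} :=
    (b.constr F).symm.toEquiv.subtypeEquiv (fun f => by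
      have : (b.constr F).symm.toEquiv f = f ∘ b := by
        funext i; rfl
      rw [this]
      constructor
      · intro h
        exact b.linearIndependent.map' f h
      · intro h
        rw [LinearMap.ker_eq_bot]
        have h2 := h
        rw [← Module.Basis.constr_self b (S := F) f, LinearMap.ker_eq_bot.symm]
        apply LinearMap.ker_eq_bot'.2
        intro m hm
        rw [Module.Basis.constr_self] at hm
        have h3 : ∑ i, b.repr m i • (f ∘ b) i = 0 := by
          rw [← hm]
          conv_rhs => rw [← b.sum_repr m]
          rw [map_sum]
          exact Finset.sum_congr rfl fun i _ => (map_smul f _ _).symm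
        have h4 := Fintype.linearIndependent_iff.1 h2 _ h3
        apply b.repr.injective
        ext i; simpa using h4 i)
  have h1 : (Finset.univ.filter fun f : E →ₗ[F] (Fin j → F) => LinearMap.ker f = ⊥).card = Nat.card {s : Fin (finrank F E) → (Fin j → F) // LinearIndependent F s} := by
    rw [← Nat.card_congr e, Nat.card_eq_fintype_card, Fintype.card_subtype]
  rw [h1, h0, Nat.cast_prod, Finset.prod_range]
  refine Finset.prod_congr rfl fun i _ => ?_
  rw [Nat.cast_sub]
  · push_cast; simp [Nat.card_eq_fintype_card]
  · simp only [Module.finrank_fin_fun]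
    exact Nat.pow_le_pow_right Fintype.card_pos (i.2.le.trans hj)

theorem phi_eval (j : ℕ) (hj : finrank F E ≤ j) :
    ∑ y : Module.End F E, phi y * ((Nat.card F : ℂ) ^ j) ^ crk y =
      GG F E * Nat.card E + phi (0 : Module.End F E) * ∏ i ∈ Finset.range (finrank F E), ((Nat.card F : ℂ) ^ j - (Nat.card F : ℂ) ^ i) := by
  have h1 : ∀ f : E →ₗ[F] (Fin j → F), ∑ y : Module.End F E, phi y * (if f ∘ₗ y = 0 then (1 : ℂ) else 0) =
      (if f = 0 then GG F E * Nat.card E else 0) + phi (0 : Module.End F E) * (if LinearMap.ker f = ⊥ then 1 else 0) := by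
    intro f
    by_cases h0 : f = 0
    · subst h0
      have : LinearMap.ker (0 : E →ₗ[F] (Fin j → F)) ≠ ⊥ := by
        rw [LinearMap.ker_zero]; exact top_ne_bot
      rw [if_pos rfl, if_neg this]
      simp [sum_phi]
    rw [if_neg h0, zero_add]
    by_cases hk : LinearMap.ker f = ⊥
    · rw [if_pos hk, mul_one, Finset.sum_eq_single 0]
      · simp
      · intro y _ hy
        rw [if_neg, mul_zero]
        intro h
        apply hy
        ext v
        have := LinearMap.congr_fun h v
        exact (LinearMap.ker_eq_bot'.1 hk) _ this
      · simp
    · rw [if_neg hk, mul_zero]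
      refine prim_sum_zero phi_prim hk (fun h => h0 (LinearMap.ker_eq_top.1 h)) _ ?_ ?_
      · intro y hy
        rw [if_neg]
        intro h
        apply hy
        intro v _
        rw [Submodule.mem_comap, LinearMap.mem_ker]
        exact LinearMap.congr_fun h v
      · intro y hy N hN
        have : f ∘ₗ (y + N) = f ∘ₗ y := by
          ext v
          simp only [LinearMap.comp_apply, LinearMap.add_apply, map_add]
          rw [LinearMap.mem_ker.1 (hN.1 v), add_zero]
        rw [this]
  have h2 : ∑ y : Module.End F E, phi y * ((Nat.card F : ℂ) ^ j) ^ crk y = ∑ f : E →ₗ[F] (Fin j → F), ∑ y : Module.End F E, phi y * (if f ∘ₗ y = 0 then (1 : ℂ) else 0) := by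
    rw [Finset.sum_comm]
    refine Finset.sum_congr rfl fun y _ => ?_
    rw [← Finset.mul_sum, card_ann]
  rw [h2, Finset.sum_congr rfl fun f _ => h1 f, Finset.sum_add_distrib, ← Finset.mul_sum, card_inj j hj]
  simp

theorem phi_zero : phi (0 : Module.End F E) * AA F E = GG F E := by
  let P : ℂ[X] := ∑ y : Module.End F E, C (phi y) * X ^ crk y
  let Q : ℂ[X] := C (GG F E * Nat.card E) + C (phi (0 : Module.End F E)) * ∏ i ∈ Finset.range (finrank F E), (X - C ((Nat.card F : ℂ) ^ i))
  have hq : 1 < Nat.card F := Finite.one_lt_card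
  have hPQ : P = Q := by
    apply Polynomial.eq_of_infinite_eval_eq
    have hinj : Function.Injective (fun j : ℕ => ((Nat.card F : ℂ) ^ (finrank F E + j))) := by
      intro a b h
      have h2 : (Nat.card F : ℂ) ^ (finrank F E + a) = (Nat.card F : ℂ) ^ (finrank F E + b) := h
      have h' : (Nat.card F) ^ (finrank F E + a) = (Nat.card F) ^ (finrank F E + b) := by exact_mod_cast h2
      have := Nat.pow_right_injective hq h'
      omega
    refine (Set.infinite_range_of_injective hinj).mono ?_
    rintro _ ⟨j, rfl⟩
    have := phi_eval (F := F) (E := E) (finrank F E + j) (by omega)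
    simp only [Set.mem_setOf_eq, P, Q, eval_finset_sum, eval_mul, eval_C, eval_pow, eval_X, eval_add, eval_prod, eval_sub]
    exact this
  have h0 := congrArg (Polynomial.eval 0) hPQ
  simp only [P, Q, eval_finset_sum, eval_mul, eval_C, eval_pow, eval_X, eval_add, eval_prod, eval_sub] at h0
  have h1 : ∀ y : Module.End F E, (0 : ℂ) ^ crk y = if LinearMap.det y ≠ 0 then 1 else 0 := by
    intro y
    rw [zero_pow_eq]
    have : crk y = 0 ↔ LinearMap.det y ≠ 0 := by
      rw [crk, Module.finrank_zero_iff, Submodule.Quotient.subsingleton_iff, ← LinearMap.isUnit_iff_range_eq_top, ← isUnit_iff_ne_zero]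
      constructor
      · exact fun h => LinearMap.isUnit_det y h
      · intro h
        by_contra hc
        rw [LinearMap.isUnit_iff_ker_eq_bot] at hc
        have := LinearMap.det_eq_zero_iff_ker_ne_bot.2 hc
        rw [this] at h
        exact not_isUnit_zero h
    simp only [this]
  simp only [h1] at h0
  rw [sum_phi_det] at h0
  have h2 : ∏ i ∈ Finset.range (finrank F E), ((0 : ℂ) - (Nat.card F : ℂ) ^ i) = - AA F E := by
    have h3 : ∀ m, ∏ i ∈ Finset.range m, ((0 : ℂ) - (Nat.card F : ℂ) ^ i) = (-1) ^ m * (Nat.card F : ℂ) ^ (m * (m - 1) / 2) := by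
      intro m
      rw [← Finset.sum_range_id, ← Finset.prod_pow_eq_pow_sum, Finset.prod_congr rfl (g := fun i => (-1 : ℂ) * (Nat.card F : ℂ) ^ i) (fun i _ => by ring),
        Finset.prod_mul_distrib]
      simp
    obtain ⟨k, hk⟩ : ∃ k, finrank F E = k + 1 := ⟨finrank F E - 1, by have : 0 < finrank F E := finrank_pos; omega⟩
    rw [h3, AA, hk, pow_succ]
    simp
  rw [h2] at h0
  linear_combination h0

variable (ψ : AddChar F ℂ)

theorem TT_zero (hψ : ψ ≠ 1) {s : E → ℂ} (hs : IsInv F s) : TT ψ s 0 = ∑ ξ, s ξ := by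
  have p := Prim.four ψ hψ (lift_prim (F := F) s)
  have c := ClassFn.four ψ (lift_class (F := F) s)
  have h1 := structure_thm p c 0
  have h2 : four ψ (lift F s) 0 = ∑ ξ, s ξ := by
    have h := sum_charpoly (lift_prim (F := F) s) (fun _ => 1)
    simp only [mul_one, sg_lift hs] at h
    rw [← h]
    simp [four]
  have h3 : (0 : Module.End F E).charpoly = cp F (0 : E) := by
    unfold cp; congr 1; ext v; simp
  rw [h2, h3, Hc_cp] at h1
  rw [TT, h1, div_eq_iff AA_ne, div_mul_eq_mul_div, div_mul_eq_mul_div, eq_div_iff GG_ne, mul_assoc, phi_zero]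

theorem sg_shift (Φ : Module.End F E → ℂ) (z : F) (η : E) : sg (fun y => Φ (y + z • 1)) η = sg Φ (η + algebraMap F E z) := by
  unfold sg cs
  have h : ∀ (y : Module.End F E) (η : E), (y + z • (1 : Module.End F E)).charpoly = cp F (η + algebraMap F E z) ↔ y.charpoly = cp F η := by
    intro y η
    have := charpoly_affine 1 z one_ne_zero y η
    simpa using this
  have hd : dg F (η + algebraMap F E z) = dg F η := by
    rw [← card_class, ← card_class]
    symm
    refine Finset.card_bij (fun a _ => a + algebraMap F E z) ?_ ?_ ?_
    · intro a ha
      have := cp_affine 1 z one_ne_zero η a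
      simp only [one_smul] at this
      simpa [this] using ha
    · intro a _ b _ hab
      exact add_right_cancel hab
    · intro b hb
      have := cp_affine 1 z one_ne_zero η (b - algebraMap F E z)
      simp only [one_smul, sub_add_cancel] at this
      refine ⟨b - algebraMap F E z, ?_, by simp⟩
      simpa [← this] using hb
  rw [hd]
  congr 1
  rw [← Equiv.sum_comp (Equiv.addRight (z • (1 : Module.End F E))) (fun y => Φ y * (if y.charpoly = cp F (η + algebraMap F E z) then 1 else 0))]
  refine Finset.sum_congr rfl fun y _ => ?_
  simp only [Equiv.coe_addRight, h]

theorem psi_inv (z : F) {s : E → ℂ} (hs : IsInv F s) : IsInv F (fun ξ => s ξ * ψ (z * Algebra.trace F E ξ)) := by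
  intro a b h
  have : Algebra.trace F E a = Algebra.trace F E b := by
    change LinearMap.trace F E (Lm F a) = _
    exact trace_cp h
  beta_reduce
  rw [this, hs a b h]

theorem TT_shift {s : E → ℂ} (hs : IsInv F s) (z : F) (η : E) :
    TT ψ s (η + algebraMap F E z) = TT ψ (fun ξ => s ξ * ψ (z * Algebra.trace F E ξ)) η := by
  unfold TT
  rw [← sg_shift]
  congr 2
  funext y
  unfold four
  refine Finset.sum_congr rfl fun w _ => ?_
  rw [mul_add, map_add, AddChar.map_add_eq_mul]
  by_cases h : ∃ η : E, cp F η = w.charpoly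
  · obtain ⟨η, hη⟩ := h
    rw [lift, lift, ← hη, Hs_cp hs, Hs_cp (psi_inv ψ z hs)]
    have : LinearMap.trace F E (w * z • 1) = z * Algebra.trace F E η := by
      rw [mul_smul_comm, mul_one, map_smul, trace_cp hη.symm, smul_eq_mul]
    rw [this]
    ring
  · rw [lift, lift, Hs, Hs, dif_neg h, dif_neg h]
    ring

theorem TT_scalar (hψ : ψ ≠ 1) {s : E → ℂ} (hs : IsInv F s) (z : F) : TT ψ s (algebraMap F E z) = RR ψ s (algebraMap F E z) := by
  have := TT_shift ψ hs z 0
  rw [zero_add] at this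
  rw [this, TT_zero ψ hψ (psi_inv ψ z hs), RR]
  refine Finset.sum_congr rfl fun ξ _ => ?_
  rw [mul_comm ξ, ← Algebra.smul_def, map_smul, smul_eq_mul]

end phizero
end MK

set_option linter.all false
namespace MK
open Module Polynomial
open scoped BigOperators Classical

/-! integrality of traces -/

theorem isIntegral_of_root {ι : Type} [Fintype ι] [DecidableEq ι] (A : Matrix ι ι ℂ) (hA : ∀ i j, IsIntegral ℤ (A i j))
    (μ : ℂ) (hμ : A.charpoly.IsRoot μ) : IsIntegral ℤ μ := by
  let B : Matrix ι ι (integralClosure ℤ ℂ) := fun i j => ⟨A i j, hA i j⟩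
  have hB : A = B.map (algebraMap (integralClosure ℤ ℂ) ℂ) := by ext i j; rfl
  have h1 : IsIntegral (integralClosure ℤ ℂ) μ := by
    refine ⟨B.charpoly, B.charpoly_monic, ?_⟩
    have : A.charpoly = B.charpoly.map (algebraMap (integralClosure ℤ ℂ) ℂ) := by
      rw [hB]; exact Matrix.charpoly_map B (algebraMap (integralClosure ℤ ℂ) ℂ)
    rw [this, IsRoot.def, eval_map] at hμ
    exact hμ
  exact isIntegral_trans μ h1

theorem trace_integral {V ι : Type} [AddCommGroup V] [Module ℂ V] [FiniteDimensional ℂ V] [Fintype ι]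
    (S : Module.End ℂ V) (l : ι → V →ₗ[ℂ] ℂ) (hl : ∀ v, (∀ i, l i v = 0) → v = 0)
    (A : ι → ι → ℂ) (hA : ∀ i j, IsIntegral ℤ (A i j)) (h : ∀ i v, l i (S v) = ∑ j, A i j * l j v) :
    IsIntegral ℤ (LinearMap.trace ℂ V S) := by
  have hs : S.charpoly.Splits := IsAlgClosed.splits _
  have : LinearMap.trace ℂ V S = S.charpoly.roots.sum := by
    rw [Module.End.trace_eq_sum_roots_charpoly_of_splits hs]
  rw [this]
  apply IsIntegral.multiset_sum
  intro μ hμ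
  have hμ' : S.HasEigenvalue μ := by
    rw [Module.End.hasEigenvalue_iff_isRoot_charpoly]
    exact (mem_roots'.1 hμ).2
  obtain ⟨v, hv⟩ := hμ'.exists_hasEigenvector
  have hv0 := hv.2
  have hv1 := hv.apply_eq_smul
  apply isIntegral_of_root (Matrix.of A) hA
  rw [← Matrix.mem_spectrum_iff_isRoot_charpoly, ← Matrix.spectrum_toLin', ← Module.End.hasEigenvalue_iff_mem_spectrum]
  apply Module.End.hasEigenvalue_of_hasEigenvector (x := fun i => l i v)
  constructor
  · rw [Module.End.mem_eigenspace_iff]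
    funext i
    have := h i v
    rw [hv1, map_smul] at this
    simp only [Matrix.toLin'_apply, Matrix.mulVec, dotProduct, Matrix.of_apply, Pi.smul_apply]
    exact this.symm
  · intro h0
    exact hv0 (hl v fun i => congrFun h0 i)

section spanning
variable {F : Type} [Field F] [Finite F] {n : ℕ}

/-- strictly upper triangular matrices with columns `≥ k` -/
def nn (F : Type) [Field F] (n k : ℕ) : Submodule F (Matrix (Fin n) (Fin n) F) where
  carrier := {N | ∀ i j : Fin n, ¬ (i < j ∧ k ≤ (j : ℕ)) → N i j = 0}
  add_mem' := by
    intro a b ha hb i j h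
    rw [Matrix.add_apply, ha i j h, hb i j h, add_zero]
  zero_mem' := by intro i j _; rfl
  smul_mem' := by
    intro c a ha i j h
    rw [Matrix.smul_apply, ha i j h, smul_zero]

def cc (F : Type) [Field F] (n k : ℕ) : Submodule F (Matrix (Fin n) (Fin n) F) where
  carrier := {N | ∀ i j : Fin n, ¬ (i < j ∧ k = (j : ℕ)) → N i j = 0}
  add_mem' := by
    intro a b ha hb i j h
    rw [Matrix.add_apply, ha i j h, hb i j h, add_zero]
  zero_mem' := by intro i j _; rfl
  smul_mem' := by
    intro c a ha i j h
    rw [Matrix.smul_apply, ha i j h, smul_zero]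

theorem mem_nn {k : ℕ} {N : Matrix (Fin n) (Fin n) F} : N ∈ nn F n k ↔ ∀ i j : Fin n, ¬ (i < j ∧ k ≤ (j : ℕ)) → N i j = 0 := Iff.rfl
theorem mem_cc {k : ℕ} {N : Matrix (Fin n) (Fin n) F} : N ∈ cc F n k ↔ ∀ i j : Fin n, ¬ (i < j ∧ k = (j : ℕ)) → N i j = 0 := Iff.rfl

def sd (c : Fin n → F) (N : Matrix (Fin n) (Fin n) F) : F := ∑ i : Fin n, ∑ j : Fin n, if (i : ℕ) + 1 = j then c j * N i j else 0

theorem sd_add (c : Fin n → F) (N M : Matrix (Fin n) (Fin n) F) : sd c (N + M) = sd c N + sd c M := by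
  unfold sd
  rw [← Finset.sum_add_distrib]
  refine Finset.sum_congr rfl fun i _ => ?_
  rw [← Finset.sum_add_distrib]
  refine Finset.sum_congr rfl fun j _ => ?_
  split_ifs
  · rw [Matrix.add_apply]; ring
  · ring

theorem sd_zero' (c : Fin n → F) (N : Matrix (Fin n) (Fin n) F) (h : ∀ i j : Fin n, (i : ℕ) + 1 = j → c j * N i j = 0) : sd c N = 0 := by
  unfold sd
  refine Finset.sum_eq_zero fun i _ => Finset.sum_eq_zero fun j _ => ?_
  split_ifs with h1
  · exact h i j h1
  · rfl

theorem mul_eq_zero_of {A B : Matrix (Fin n) (Fin n) F} (i j : Fin n) (h : ∀ l, A i l = 0 ∨ B l j = 0) : (A * B) i j = 0 := by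
  rw [Matrix.mul_apply]
  refine Finset.sum_eq_zero fun l _ => ?_
  rcases h l with h | h <;> rw [h] <;> ring

theorem cc_sq {k : ℕ} {W W' : Matrix (Fin n) (Fin n) F} (hW : W ∈ cc F n k) (hW' : W' ∈ cc F n k) : W * W' = 0 := by
  ext i j
  apply mul_eq_zero_of
  intro l
  by_cases h : i < l ∧ k = (l : ℕ)
  · right
    apply hW'
    rintro ⟨h1, h2⟩
    rw [Fin.lt_def] at h1; omega
  · left; exact hW _ _ h

theorem cc_mul_nn {k : ℕ} {W N : Matrix (Fin n) (Fin n) F} (hW : W ∈ cc F n k) (hN : N ∈ nn F n (k+1)) : W * N ∈ nn F n (k+1) := by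
  intro i j h
  apply mul_eq_zero_of
  intro l
  by_cases h1 : i < l ∧ k = (l : ℕ)
  · right
    apply hN
    rintro ⟨h2, h3⟩
    apply h
    exact ⟨h1.1.trans h2, h3⟩
  · left; exact hW _ _ h1

theorem sd_cc_mul_nn (c : Fin n → F) {k : ℕ} {W N : Matrix (Fin n) (Fin n) F} (hW : W ∈ cc F n k) (hN : N ∈ nn F n (k+1)) : sd c (W * N) = 0 := by
  apply sd_zero'
  intro i j hij
  rw [mul_eq_zero_of, mul_zero]
  intro l
  by_cases h1 : i < l ∧ k = (l : ℕ)
  · right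
    apply hN
    rintro ⟨h2, h3⟩
    have := h1.1
    rw [Fin.lt_def] at *
    omega
  · left; exact hW _ _ h1

def colk (k : ℕ) (M : Matrix (Fin n) (Fin n) F) : Matrix (Fin n) (Fin n) F := fun i j => if k = (j : ℕ) then M i j else 0

theorem colk_cc {k : ℕ} {W : Matrix (Fin n) (Fin n) F} (hW : W ∈ cc F n k) : colk k W = W := by
  ext i j
  unfold colk
  split_ifs with h
  · rfl
  · exact (hW i j (fun h' => h h'.2)).symm

theorem colk_nn {k : ℕ} {W : Matrix (Fin n) (Fin n) F} (hW : W ∈ nn F n (k+1)) : colk k W = 0 := by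
  ext i j
  unfold colk
  split_ifs with h
  · exact (hW i j (fun h' => by omega))
  · rfl

theorem colk_add {k : ℕ} (A B : Matrix (Fin n) (Fin n) F) : colk k (A + B) = colk k A + colk k B := by
  ext i j
  simp only [colk, Matrix.add_apply]
  split_ifs <;> simp

theorem colk_mem {k : ℕ} {M : Matrix (Fin n) (Fin n) F} (hM : M ∈ nn F n k) : colk k M ∈ cc F n k := by
  intro i j h
  unfold colk
  split_ifs with h1
  · exact hM _ _ (fun h2 => h ⟨h2.1, h1⟩)
  · rfl

theorem nn_mono {k : ℕ} {M : Matrix (Fin n) (Fin n) F} (hM : M ∈ nn F n (k+1)) : M ∈ nn F n k := fun i j h => hM i j (fun h' => h ⟨h'.1, by omega⟩)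
theorem cc_nn {k : ℕ} {M : Matrix (Fin n) (Fin n) F} (hM : M ∈ cc F n k) : M ∈ nn F n k := fun i j h => hM i j (fun h' => h ⟨h'.1, by omega⟩)

theorem nn_of_colk {k : ℕ} {M : Matrix (Fin n) (Fin n) F} (hM : M ∈ nn F n k) (h : colk k M = 0) : M ∈ nn F n (k+1) := by
  intro i j hij
  by_cases h1 : k = (j : ℕ)
  · have := congrFun (congrFun h i) j
    simpa [colk, h1] using this
  · apply hM
    rintro ⟨h2, h3⟩
    exact hij ⟨h2, by omega⟩

theorem cc_mul_nn' {k : ℕ} {W N : Matrix (Fin n) (Fin n) F} (hW : W ∈ cc F n k) (hN : N ∈ nn F n k) : W * N ∈ nn F n (k+1) := by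
  intro i j h
  apply mul_eq_zero_of
  intro l
  by_cases h1 : i < l ∧ k = (l : ℕ)
  · right
    apply hN
    rintro ⟨h2, h3⟩
    apply h
    rw [Fin.lt_def] at *
    exact ⟨by omega, by omega⟩
  · left; exact hW _ _ h1

def nnEquiv (k : ℕ) : cc F n k × nn F n (k+1) ≃ nn F n k where
  toFun p := ⟨p.1.1 + p.2.1 + p.1.1 * p.2.1, add_mem (add_mem (cc_nn p.1.2) (nn_mono p.2.2)) (nn_mono (cc_mul_nn p.1.2 p.2.2))⟩
  invFun M := ⟨⟨colk k M.1, colk_mem M.2⟩, ⟨M.1 - colk k M.1 - colk k M.1 * M.1, by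
    refine sub_mem ?_ (cc_mul_nn' (colk_mem M.2) M.2)
    refine nn_of_colk (sub_mem M.2 (cc_nn (colk_mem M.2))) ?_
    have := colk_add (k := k) (M.1 - colk k M.1) (colk k M.1)
    rw [sub_add_cancel, colk_cc (colk_mem M.2)] at this
    simpa using this⟩⟩
  left_inv := by
    rintro ⟨⟨W, hW⟩, ⟨N, hN⟩⟩
    have h1 : colk k (W + N + W * N) = W := by
      rw [colk_add, colk_add, colk_cc hW, colk_nn hN, colk_nn (cc_mul_nn hW hN), add_zero, add_zero]
    simp only [Prod.mk.injEq, Subtype.mk.injEq]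
    refine ⟨h1, ?_⟩
    rw [h1, mul_add, mul_add, ← mul_assoc, cc_sq hW hW]
    simp only [zero_add, zero_mul, add_zero]
    abel
  right_inv := by
    rintro ⟨M, hM⟩
    have h0 := cc_sq (colk_mem hM) (colk_mem hM)
    simp only [Subtype.mk.injEq]
    rw [mul_sub, mul_sub, ← mul_assoc, h0]
    simp only [zero_mul, sub_zero]
    abel

end spanning
end MK

set_option linter.all false
namespace MK
open Module Polynomial
open scoped BigOperators Classical

section span2
variable {F : Type} [Field F] [Finite F] {n : ℕ}

theorem fourier_zero (ψ : AddChar F ℂ) (hψ : ψ ≠ 1) {M : Type} [AddCommGroup M] [Module F M] [Fintype M]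
    (Θ : M → ℂ) (h : ∀ r : M →ₗ[F] F, ∑ w, ψ (r w) * Θ w = 0) (w0 : M) : Θ w0 = 0 := by
  have h1 : ∑ r : M →ₗ[F] F, ψ (-(r w0)) * ∑ w, ψ (r w) * Θ w = 0 := Finset.sum_eq_zero fun r _ => by rw [h r, mul_zero]
  have h2 : ∑ r : M →ₗ[F] F, ψ (-(r w0)) * ∑ w, ψ (r w) * Θ w = ∑ w, Θ w * ∑ r : M →ₗ[F] F, ψ (r (w - w0)) := by
    simp only [Finset.mul_sum]
    rw [Finset.sum_comm]
    refine Finset.sum_congr rfl fun w _ => Finset.sum_congr rfl fun r _ => ?_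
    rw [map_sub, sub_eq_add_neg, AddChar.map_add_eq_mul]; ring
  have h3 : ∀ w : M, ∑ r : M →ₗ[F] F, ψ (r (w - w0)) = if w = w0 then (Nat.card (M →ₗ[F] F) : ℂ) else 0 := by
    intro w
    have := sum_psi_linear ψ hψ (LinearMap.applyₗ (R := F) (M₂ := F) (w - w0))
    simp only [LinearMap.applyₗ_apply_apply] at this
    rw [this]
    have : (LinearMap.applyₗ (R := F) (M₂ := F) (w - w0)) = 0 ↔ w = w0 := by
      rw [← sub_eq_zero (a := w), ← Module.forall_dual_apply_eq_zero_iff F (w - w0)]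
      constructor
      · intro h f; exact LinearMap.congr_fun h f
      · intro h; ext f; exact h f
    simp only [this]
  rw [h2] at h1
  simp only [h3] at h1
  rw [Finset.sum_eq_single w0] at h1
  · rw [if_pos rfl] at h1
    rcases mul_eq_zero.1 h1 with h | h
    · exact h
    · exfalso
      have : Nat.card (M →ₗ[F] F) ≠ 0 := Nat.card_pos.ne'
      exact this (by exact_mod_cast h)
  · intro b _ hb; rw [if_neg hb, mul_zero]
  · intro h; exact absurd (Finset.mem_univ _) h

/-- the property at level `k` -/
def SP (ψ : AddChar F ℂ) (H : Matrix (Fin n) (Fin n) F → ℂ) (k : ℕ) : Prop :=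
  ∀ (g h : (Matrix (Fin n) (Fin n) F)ˣ) (c : Fin n → F), ∑ N : nn F n k, ψ (sd c N.1) * H (g * (1 + N.1) * h) = 0

def Good (ψ : AddChar F ℂ) (H : Matrix (Fin n) (Fin n) F → ℂ) (k : ℕ) (r : cc F n k → F) : Prop :=
  ∀ (g h : (Matrix (Fin n) (Fin n) F)ˣ) (c : Fin n → F), ∑ W : cc F n k, ∑ N : nn F n (k+1),
    ψ (r W) * (ψ (sd c N.1) * H (g * ((1 + W.1) * (1 + N.1)) * h)) = 0

def sm (n k : ℕ) (v : Matrix (Fin n) (Fin n) F) : Prop := ∀ i j : Fin n, ¬ ((i : ℕ) < k ∧ (j : ℕ) < k) → v i j = 0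

theorem sm_mul_cc {k : ℕ} {v W : Matrix (Fin n) (Fin n) F} (hv : sm n k v) (hW : W ∈ cc F n k) : v * W ∈ cc F n k := by
  intro i j h
  apply mul_eq_zero_of
  intro l
  by_cases h1 : (i : ℕ) < k ∧ (l : ℕ) < k
  · right
    apply hW
    rintro ⟨h2, h3⟩
    exact h ⟨by rw [Fin.lt_def]; omega, h3⟩
  · left; exact hv _ _ h1

theorem sm_mul_nn {k : ℕ} {v W : Matrix (Fin n) (Fin n) F} (hv : sm n k v) (hW : W ∈ nn F n (k+1)) : v * W ∈ nn F n (k+1) := by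
  intro i j h
  apply mul_eq_zero_of
  intro l
  by_cases h1 : (i : ℕ) < k ∧ (l : ℕ) < k
  · right
    apply hW
    rintro ⟨h2, h3⟩
    exact h ⟨by rw [Fin.lt_def]; omega, h3⟩
  · left; exact hv _ _ h1

theorem nn_mul_sm {k : ℕ} {v W : Matrix (Fin n) (Fin n) F} (hv : sm n k v) (hW : W ∈ nn F n k) : W * v = 0 := by
  ext i j
  apply mul_eq_zero_of
  intro l
  by_cases h1 : (l : ℕ) < k ∧ (j : ℕ) < k
  · left
    apply hW
    rintro ⟨h2, h3⟩
    omega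
  · right; exact hv _ _ h1

theorem sd_sm_mul {k : ℕ} {v W : Matrix (Fin n) (Fin n) F} (c : Fin n → F) (hv : sm n k v) (hW : W ∈ nn F n (k+1)) : sd c (v * W) = 0 := by
  apply sd_zero'
  intro i j hij
  rw [mul_eq_zero_of, mul_zero]
  intro l
  by_cases h1 : (i : ℕ) < k ∧ (l : ℕ) < k
  · right
    apply hW
    rintro ⟨h2, h3⟩
    omega
  · left; exact hv _ _ h1

def unip (v : Matrix (Fin n) (Fin n) F) (h : v * v = 0) : (Matrix (Fin n) (Fin n) F)ˣ where
  val := 1 + v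
  inv := 1 - v
  val_inv := by rw [add_mul, mul_sub, mul_sub, h]; simp
  inv_val := by rw [sub_mul, mul_add, mul_add, h]; simp

theorem good_conj (ψ : AddChar F ℂ) (H : Matrix (Fin n) (Fin n) F → ℂ) {k : ℕ} (r : cc F n k → F)
    (v : Matrix (Fin n) (Fin n) F) (hv : sm n k v) (h2 : v * v = 0)
    (hg : Good ψ H k (fun W => r ⟨W.1 + v * W.1, add_mem W.2 (sm_mul_cc hv W.2)⟩)) : Good ψ H k r := by
  intro g h c
  have key := hg (g * unip v h2) ((unip v h2)⁻¹ * h) c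
  rw [← key]
  have h2' : ∀ A : Matrix (Fin n) (Fin n) F, v * (v * A) = 0 := by intro A; rw [← mul_assoc, h2, zero_mul]
  have hvn : sm n k (-v) := fun i j hij => by rw [Matrix.neg_apply, hv i j hij, neg_zero]
  let e1 : cc F n k ≃ cc F n k :=
    { toFun := fun W => ⟨W.1 + v * W.1, add_mem W.2 (sm_mul_cc hv W.2)⟩
      invFun := fun W => ⟨W.1 - v * W.1, sub_mem W.2 (sm_mul_cc hv W.2)⟩
      left_inv := by intro W; apply Subtype.ext; simp only [mul_add, h2']; abel
      right_inv := by intro W; apply Subtype.ext; simp only [mul_sub, h2']; abel }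
  let e2 : nn F n (k+1) ≃ nn F n (k+1) :=
    { toFun := fun W => ⟨W.1 + v * W.1, add_mem W.2 (sm_mul_nn hv W.2)⟩
      invFun := fun W => ⟨W.1 - v * W.1, sub_mem W.2 (sm_mul_nn hv W.2)⟩
      left_inv := by intro W; apply Subtype.ext; simp only [mul_add, h2']; abel
      right_inv := by intro W; apply Subtype.ext; simp only [mul_sub, h2']; abel }
  symm
  apply Fintype.sum_equiv e1
  intro W
  apply Fintype.sum_equiv e2
  intro N
  have e1W : e1 W = ⟨W.1 + v * W.1, add_mem W.2 (sm_mul_cc hv W.2)⟩ := rfl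
  have e2N : (e2 N).1 = N.1 + v * N.1 := rfl
  rw [e2N, e1W, sd_add, sd_sm_mul c hv N.2, add_zero]
  congr 3
  have hW : W.1 * v = 0 := nn_mul_sm hv (cc_nn W.2)
  have hN : N.1 * v = 0 := nn_mul_sm hv (nn_mono N.2)
  have e3 : (1 + (W.1 + v * W.1)) = (1 + v) * (1 + W.1) * (1 - v) := by
    simp only [mul_add, add_mul, mul_sub, mul_one, one_mul, mul_assoc, hW, h2]
    simp
    abel
  have e4 : (1 + (N.1 + v * N.1)) = (1 + v) * (1 + N.1) * (1 - v) := by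
    simp only [mul_add, add_mul, mul_sub, mul_one, one_mul, mul_assoc, hN, h2]
    simp
    abel
  simp only [Units.val_mul]
  have u1 : ((unip v h2 : (Matrix (Fin n) (Fin n) F)ˣ) : Matrix (Fin n) (Fin n) F) = 1 + v := rfl
  have u2 : (((unip v h2)⁻¹ : (Matrix (Fin n) (Fin n) F)ˣ) : Matrix (Fin n) (Fin n) F) = 1 - v := rfl
  have u3 : (1 - v) * (1 + v) = 1 := (unip v h2).inv_val
  rw [u1, u2, e3, e4]
  have : (1 + v) * (1 + W.1) * (1 - v) * ((1 + v) * (1 + N.1) * (1 - v)) = (1 + v) * (1 + W.1) * (((1 - v) * (1 + v)) * ((1 + N.1) * (1 - v))) := by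
    simp only [mul_assoc]
  rw [this, u3, one_mul]
  simp only [mul_assoc]

/-- functionals supported at the last coordinate are good -/
theorem good_last (ψ : AddChar F ℂ) (H : Matrix (Fin n) (Fin n) F → ℂ) {k : ℕ} (hk : k < n) (hSP : SP ψ H k)
    (r : cc F n k → F) (t : F) (hr : ∀ W, r W = ∑ i : Fin n, if (i : ℕ) + 1 = k then t * W.1 i ⟨k, hk⟩ else 0) : Good ψ H k r := by
  intro g h c
  have key := hSP g h (Function.update c ⟨k, hk⟩ t)
  rw [← key, ← (nnEquiv k).sum_comp, Fintype.sum_prod_type]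
  refine Finset.sum_congr rfl fun W _ => Finset.sum_congr rfl fun N _ => ?_
  have e : ((nnEquiv k) (W, N)).1 = W.1 + N.1 + W.1 * N.1 := rfl
  rw [e, sd_add, sd_add, sd_cc_mul_nn _ W.2 N.2, add_zero, AddChar.map_add_eq_mul, mul_assoc]
  have e1 : (1 : Matrix (Fin n) (Fin n) F) + (W.1 + N.1 + W.1 * N.1) = (1 + W.1) * (1 + N.1) := by
    simp only [mul_add, add_mul, mul_one, one_mul]; abel
  have e2 : sd (Function.update c ⟨k, hk⟩ t) W.1 = r W := by
    rw [hr, sd]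
    refine Finset.sum_congr rfl fun i _ => ?_
    rw [Finset.sum_eq_single ⟨k, hk⟩]
    · simp
    · intro j _ hj
      rw [W.2 i j, mul_zero, ite_self]
      rintro ⟨_, h⟩
      exact hj (Fin.ext h.symm)
    · intro h; exact absurd (Finset.mem_univ _) h
  have e3 : sd (Function.update c ⟨k, hk⟩ t) N.1 = sd c N.1 := by
    unfold sd
    refine Finset.sum_congr rfl fun i _ => Finset.sum_congr rfl fun j _ => ?_
    by_cases hj : j = ⟨k, hk⟩
    · rw [N.2 i j, mul_zero, mul_zero]
      rintro ⟨_, h⟩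
      rw [hj] at h
      simp at h
    · rw [Function.update_of_ne hj]
  rw [e1, e2, e3]
  simp only [mul_assoc]

def rr {k : ℕ} (hk : k < n) (ρ : Fin n → F) (W : cc F n k) : F := ∑ i, ρ i * W.1 i ⟨k, hk⟩

theorem good_rr_conj (ψ : AddChar F ℂ) (H : Matrix (Fin n) (Fin n) F → ℂ) {k : ℕ} (hk : k < n) (ρ : Fin n → F)
    (v : Matrix (Fin n) (Fin n) F) (hv : sm n k v) (h2 : v * v = 0)
    (hg : Good ψ H k (rr hk (fun l => ρ l + ∑ i, ρ i * v i l))) : Good ψ H k (rr hk ρ) := by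
  apply good_conj ψ H (rr hk ρ) v hv h2
  convert hg using 1
  funext W
  simp only [rr, Matrix.add_apply, Matrix.mul_apply, mul_add, add_mul, Finset.sum_add_distrib, Finset.mul_sum, Finset.sum_mul]
  rw [Finset.sum_comm (s := Finset.univ)]
  simp only [mul_assoc]

theorem good_A (ψ : AddChar F ℂ) (H : Matrix (Fin n) (Fin n) F → ℂ) {k : ℕ} (hk : k < n) (hSP : SP ψ H k) (ρ : Fin n → F)
    (h : ∀ i : Fin n, (i : ℕ) + 1 < k → ρ i = 0) : Good ψ H k (rr hk ρ) := by
  apply good_last ψ H hk hSP (rr hk ρ) (∑ i : Fin n, if (i : ℕ) + 1 = k then ρ i else 0)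
  intro W
  unfold rr
  refine Finset.sum_congr rfl fun i _ => ?_
  split_ifs with h1
  · rw [Finset.sum_eq_single i]
    · rw [if_pos h1]
    · intro j _ hj
      rw [if_neg]
      intro h2; exact hj (Fin.ext (by omega))
    · intro h; exact absurd (Finset.mem_univ _) h
  · by_cases h2 : (i : ℕ) + 1 < k
    · rw [h i h2, zero_mul]
    · rw [W.2 i, mul_zero]
      rintro ⟨h3, _⟩
      rw [Fin.lt_def] at h3
      simp at h3
      omega

theorem good_B (ψ : AddChar F ℂ) (H : Matrix (Fin n) (Fin n) F → ℂ) {k : ℕ} (hk : k < n) (hSP : SP ψ H k) (ρ : Fin n → F)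
    (p : Fin n) (hp : (p : ℕ) + 1 = k) (h : ρ p ≠ 0) : Good ψ H k (rr hk ρ) := by
  apply good_rr_conj ψ H hk ρ (fun i j => if i = p ∧ j < p then - ρ j / ρ p else 0)
  · intro i j hij
    beta_reduce
    rw [if_neg]
    rintro ⟨rfl, h2⟩
    rw [Fin.lt_def] at h2
    omega
  · ext i j
    apply mul_eq_zero_of
    intro l
    beta_reduce
    by_cases hl : l < p
    · right; rw [if_neg]; rintro ⟨rfl, _⟩; exact lt_irrefl _ hl
    · left; rw [if_neg]; rintro ⟨_, h⟩; exact hl h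
  · apply good_A ψ H hk hSP
    intro i hi
    have hip : i < p := by rw [Fin.lt_def]; omega
    rw [Finset.sum_eq_single p]
    · rw [if_pos ⟨rfl, hip⟩]; field_simp; ring
    · intro j _ hj
      rw [if_neg (fun h => hj h.1), mul_zero]
    · intro h; exact absurd (Finset.mem_univ _) h

theorem good_rr (ψ : AddChar F ℂ) (H : Matrix (Fin n) (Fin n) F → ℂ) {k : ℕ} (hk : k < n) (hSP : SP ψ H k) (ρ : Fin n → F) :
    Good ψ H k (rr hk ρ) := by
  by_cases h : ∀ i : Fin n, (i : ℕ) + 1 < k → ρ i = 0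
  · exact good_A ψ H hk hSP ρ h
  push Not at h
  obtain ⟨i0, hi0, h0⟩ := h
  let p : Fin n := ⟨k - 1, by omega⟩
  have hp : (p : ℕ) + 1 = k := by simp only [p]; omega
  by_cases h1 : ρ p = 0
  · apply good_rr_conj ψ H hk ρ (Matrix.single i0 p 1)
    · intro i j hij
      rw [Matrix.single_apply, if_neg]
      rintro ⟨rfl, rfl⟩
      omega
    · rw [Matrix.single_mul_single_of_ne]
      intro h; rw [← h] at hi0; omega
    · apply good_B ψ H hk hSP _ p hp
      rw [h1, zero_add, Finset.sum_eq_single i0]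
      · simpa using h0
      · intro j _ hj
        rw [Matrix.single_apply, if_neg (fun h => hj h.1.symm), mul_zero]
      · intro h; exact absurd (Finset.mem_univ _) h
  · exact good_B ψ H hk hSP ρ p hp h1

theorem SP_step (ψ : AddChar F ℂ) (hψ : ψ ≠ 1) (H : Matrix (Fin n) (Fin n) F → ℂ) {k : ℕ} (hk : k < n) (hSP : SP ψ H k) :
    SP ψ H (k + 1) := by
  intro g h c
  have := fourier_zero ψ hψ (M := cc F n k) (fun W => ∑ N : nn F n (k+1), ψ (sd c N.1) * H (g * ((1 + W.1) * (1 + N.1)) * h)) (by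
    intro r
    have hr : (fun W => r W) = rr hk (fun i => if hi : (i : ℕ) < k then r ⟨Matrix.single i ⟨k, hk⟩ 1, by
        intro a b hab
        rw [Matrix.single_apply, if_neg]
        rintro ⟨rfl, rfl⟩
        exact hab ⟨by rw [Fin.lt_def]; exact hi, rfl⟩⟩ else 0) := by
      funext W
      have hW : W = ∑ i : Fin n, if hi : (i : ℕ) < k then W.1 i ⟨k, hk⟩ • (⟨Matrix.single i ⟨k, hk⟩ 1, by
        intro a b hab
        rw [Matrix.single_apply, if_neg]
        rintro ⟨rfl, rfl⟩
        exact hab ⟨by rw [Fin.lt_def]; exact hi, rfl⟩⟩ : cc F n k) else 0 := by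
        apply Subtype.ext
        ext a b
        rw [AddSubmonoidClass.coe_finset_sum, Matrix.sum_apply]
        rw [Finset.sum_eq_single a]
        · by_cases ha : (a : ℕ) < k
          · rw [dif_pos ha]
            by_cases hb : b = ⟨k, hk⟩
            · subst hb; simp
            · rw [W.2 a b (fun h => hb (Fin.ext h.2.symm))]
              simp [Matrix.single_apply, Ne.symm hb]
          · rw [dif_neg ha]
            rw [W.2 a b]
            · rfl
            · rintro ⟨h1, h2⟩
              rw [Fin.lt_def] at h1
              omega
        · intro i _ hi
          split_ifs with h1
          · simp [Matrix.single_apply, hi]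
          · rfl
        · intro h; exact absurd (Finset.mem_univ _) h
      conv_lhs => rw [hW]
      rw [map_sum, rr]
      refine Finset.sum_congr rfl fun i _ => ?_
      split_ifs with h1
      · rw [map_smul, smul_eq_mul, mul_comm]
      · simp
    have h0 : Good ψ H k (fun W => r W) := by
      rw [hr]; exact good_rr ψ H hk hSP _
    have h1 := h0 g h c
    rw [← h1]
    refine Finset.sum_congr rfl fun W _ => ?_
    rw [Finset.mul_sum]) 0
  simpa using this

theorem SP_zero (ψ : AddChar F ℂ) (hψ : ψ ≠ 1) (H : Matrix (Fin n) (Fin n) F → ℂ) (hSP : SP ψ H 0) (g : (Matrix (Fin n) (Fin n) F)ˣ) :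
    H g = 0 := by
  have h : ∀ k, k ≤ n → SP ψ H k := by
    intro k
    induction k with
    | zero => exact fun _ => hSP
    | succ k ih => exact fun hk => SP_step ψ hψ H (by omega) (ih (by omega))
  have h1 := h n le_rfl g 1 0
  have : Subsingleton (nn F n n) := by
    refine ⟨fun a b => ?_⟩
    apply Subtype.ext
    ext i j
    rw [a.2 i j, b.2 i j]
    · rintro ⟨_, h⟩; have := j.2; omega
    · rintro ⟨_, h⟩; have := j.2; omega
  rw [Fintype.sum_subsingleton _ (0 : nn F n n)] at h1
  simpa [sd] using h1

end span2
end MK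

set_option linter.all false
namespace MK
open Module Polynomial
open scoped BigOperators Classical

section Btwo
variable {F : Type} [Field F] [Finite F] {n : ℕ}

theorem nn_mul {k : ℕ} {A B : Matrix (Fin n) (Fin n) F} (hA : A ∈ nn F n k) (hB : B ∈ nn F n k) : A * B ∈ nn F n k := by
  intro i j h
  apply mul_eq_zero_of
  intro l
  by_cases h1 : i < l ∧ k ≤ (l : ℕ)
  · right
    apply hB
    rintro ⟨h2, h3⟩
    exact h ⟨h1.1.trans h2, h3⟩
  · left; exact hA _ _ h1

theorem sd_nn_mul (c : Fin n → F) {k : ℕ} {A B : Matrix (Fin n) (Fin n) F} (hA : A ∈ nn F n k) (hB : B ∈ nn F n k) : sd c (A * B) = 0 := by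
  apply sd_zero'
  intro i j hij
  rw [mul_eq_zero_of, mul_zero]
  intro l
  by_cases h1 : i < l ∧ k ≤ (l : ℕ)
  · right
    apply hB
    rintro ⟨h2, h3⟩
    have := h1.1
    rw [Fin.lt_def] at *
    omega
  · left; exact hA _ _ h1

def UU (F : Type) [Field F] [Finite F] (n : ℕ) : Subgroup (Matrix (Fin n) (Fin n) F)ˣ where
  carrier := {g | g.1 - 1 ∈ nn F n 0}
  one_mem' := by
    change ((1 : (Matrix (Fin n) (Fin n) F)ˣ) : Matrix (Fin n) (Fin n) F) - 1 ∈ nn F n 0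
    simp
  mul_mem' := by
    intro a b ha hb
    change ((a * b : (Matrix (Fin n) (Fin n) F)ˣ) : Matrix (Fin n) (Fin n) F) - 1 ∈ nn F n 0
    have : ((a * b : (Matrix (Fin n) (Fin n) F)ˣ) : Matrix (Fin n) (Fin n) F) - 1 = (a.1 - 1) + (b.1 - 1) + (a.1 - 1) * (b.1 - 1) := by
      rw [Units.val_mul]; noncomm_ring
    rw [this]
    exact add_mem (add_mem ha hb) (nn_mul ha hb)
  inv_mem' := by
    intro a ha
    have hpow : ∀ m : ℕ, ((a ^ m : (Matrix (Fin n) (Fin n) F)ˣ) : Matrix (Fin n) (Fin n) F) - 1 ∈ nn F n 0 := by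
      intro m
      induction m with
      | zero => simp
      | succ m ih =>
        have : ((a ^ (m+1) : (Matrix (Fin n) (Fin n) F)ˣ) : Matrix (Fin n) (Fin n) F) - 1 = ((a ^ m : (Matrix (Fin n) (Fin n) F)ˣ).1 - 1) + (a.1 - 1) + ((a ^ m : (Matrix (Fin n) (Fin n) F)ˣ).1 - 1) * (a.1 - 1) := by
          rw [pow_succ, Units.val_mul]; noncomm_ring
        rw [this]
        exact add_mem (add_mem ih ha) (nn_mul ih ha)
    have h1 := hpow (orderOf a - 1)
    have h2 : a ^ (orderOf a - 1) = a⁻¹ := by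
      rw [eq_inv_iff_mul_eq_one, ← pow_succ, Nat.sub_add_cancel (orderOf_pos a), pow_orderOf_eq_one]
    rw [h2] at h1
    exact h1

theorem mem_UU {g : (Matrix (Fin n) (Fin n) F)ˣ} : g ∈ UU F n ↔ g.1 - 1 ∈ nn F n 0 := Iff.rfl

theorem unit_nn {N : Matrix (Fin n) (Fin n) F} (hN : N ∈ nn F n 0) : IsUnit (1 + N) := by
  rw [Matrix.isUnit_iff_isUnit_det, Matrix.det_of_upperTriangular]
  · have : ∀ i, (1 + N) i i = 1 := by
      intro i
      rw [Matrix.add_apply, hN i i (fun h => lt_irrefl _ h.1)]; simp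
    simp [this]
  · intro i j h
    simp only [id] at h
    rw [Matrix.add_apply, hN i j (fun h' => lt_asymm h h'.1), Matrix.one_apply_ne h.ne', add_zero]

noncomputable def UE : nn F n 0 ≃ UU F n where
  toFun N := ⟨(unit_nn N.2).unit, by rw [mem_UU]; simp⟩
  invFun u := ⟨u.1.1 - 1, u.2⟩
  left_inv := by intro N; simp
  right_inv := by intro u; apply Subtype.ext; apply Units.ext; simp

def chi (ψ : AddChar F ℂ) (c : Fin n → F) (u : UU F n) : ℂ := ψ (sd c (u.1.1 - 1))

theorem chi_mul (ψ : AddChar F ℂ) (c : Fin n → F) (u v : UU F n) : chi ψ c (u * v) = chi ψ c u * chi ψ c v := by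
  unfold chi
  rw [← AddChar.map_add_eq_mul]
  have : ((u * v : UU F n).1.1 - 1) = (u.1.1 - 1) + (v.1.1 - 1) + (u.1.1 - 1) * (v.1.1 - 1) := by
    rw [Subgroup.coe_mul, Units.val_mul]; noncomm_ring
  rw [this, sd_add, sd_add, sd_nn_mul c u.2 v.2, add_zero]

theorem chi_inv (ψ : AddChar F ℂ) (c : Fin n → F) (u : UU F n) : chi ψ c u⁻¹ * chi ψ c u = 1 := by
  rw [← chi_mul]; simp [chi, sd]

def XX (c : Fin n → F) (w : (Matrix (Fin n) (Fin n) F)ˣ) : Prop := ∀ N : nn F n 0, Matrix.trace (w.1 * N.1) = sd c N.1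

theorem XX_mul (c : Fin n → F) (w : (Matrix (Fin n) (Fin n) F)ˣ) (u : UU F n) (h : XX c w) : XX c (w * u.1) := by
  intro N
  have h1 := h ⟨u.1.1 * N.1, by
    have : u.1.1 * N.1 = N.1 + (u.1.1 - 1) * N.1 := by noncomm_ring
    rw [this]; exact add_mem N.2 (nn_mul u.2 N.2)⟩
  have : u.1.1 * N.1 = N.1 + (u.1.1 - 1) * N.1 := by noncomm_ring
  rw [Units.val_mul, mul_assoc, h1]
  simp only
  rw [this, sd_add, sd_nn_mul c u.2 N.2, add_zero]

theorem XX_mul_iff (c : Fin n → F) (w : (Matrix (Fin n) (Fin n) F)ˣ) (u : UU F n) : XX c (w * u.1) ↔ XX c w := by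
  refine ⟨fun h => ?_, XX_mul c w u⟩
  have := XX_mul c _ u⁻¹ h
  simpa using this

theorem psi_XX (ψ : AddChar F ℂ) (c : Fin n → F) (w : (Matrix (Fin n) (Fin n) F)ˣ) (u : UU F n) (h : XX c w) :
    ψ (Matrix.trace (w * u.1 : (Matrix (Fin n) (Fin n) F)ˣ).1) = ψ (Matrix.trace w.1) * chi ψ c u := by
  rw [chi, ← h ⟨u.1.1 - 1, u.2⟩, ← AddChar.map_add_eq_mul, ← Matrix.trace_add, Units.val_mul]
  congr 2
  noncomm_ring

theorem kappa (ψ : AddChar F ℂ) (hψ : ψ ≠ 1) (c : Fin n → F) (w : (Matrix (Fin n) (Fin n) F)ˣ) :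
    ∑ u : UU F n, chi ψ c u * ψ (Matrix.trace (w * u.1⁻¹ : (Matrix (Fin n) (Fin n) F)ˣ).1) =
      if XX c w then (Nat.card (nn F n 0) : ℂ) * ψ (Matrix.trace w.1) else 0 := by
  let l : nn F n 0 →ₗ[F] F :=
    { toFun := fun N => Matrix.trace (w.1 * N.1) - sd c N.1
      map_add' := by
        intro a b
        rw [Submodule.coe_add, mul_add, Matrix.trace_add, sd_add]; ring
      map_smul' := by
        intro t a
        rw [Submodule.coe_smul, Matrix.mul_smul, Matrix.trace_smul]
        have : sd c (t • a.1) = t * sd c a.1 := by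
          unfold sd
          simp only [Finset.mul_sum, Matrix.smul_apply, smul_eq_mul]
          refine Finset.sum_congr rfl fun i _ => Finset.sum_congr rfl fun j _ => ?_
          split_ifs <;> ring
        rw [this]
        simp only [smul_eq_mul, RingHom.id_apply]; ring }
  have hl : l = 0 ↔ XX c w := by
    constructor
    · intro h N
      have := LinearMap.congr_fun h N
      exact sub_eq_zero.1 this
    · intro h; ext N; exact sub_eq_zero.2 (h N)
  have h1 := sum_psi_linear ψ hψ l
  simp only [hl] at h1
  have h2 : ∑ u : UU F n, chi ψ c u * ψ (Matrix.trace (w * u.1⁻¹ : (Matrix (Fin n) (Fin n) F)ˣ).1) = ψ (Matrix.trace w.1) * ∑ N : nn F n 0, ψ (l N) := by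
    rw [← Equiv.sum_comp (Equiv.inv (UU F n)), ← Equiv.sum_comp UE, Finset.mul_sum]
    refine Finset.sum_congr rfl fun N _ => ?_
    set u := UE N with hu
    have huN : u.1.1 = 1 + N.1 := by rw [hu]; simp [UE]
    have h3 : chi ψ c u⁻¹ = ψ (- sd c N.1) := by
      have h4 := chi_inv ψ c u
      have h5 : chi ψ c u = ψ (sd c N.1) := by rw [chi, huN]; simp
      rw [h5] at h4
      have h6 : ψ (- sd c N.1) * ψ (sd c N.1) = 1 := by rw [← AddChar.map_add_eq_mul]; simp
      have h7 : ψ (sd c N.1) ≠ 0 := right_ne_zero_of_mul_eq_one h6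
      exact mul_right_cancel₀ h7 (h4.trans h6.symm)
    have h8 : l N = Matrix.trace (w.1 * N.1) - sd c N.1 := rfl
    simp only [Equiv.inv_apply]
    rw [h3, h8]
    have h9 : ((w * (u⁻¹).1⁻¹ : (Matrix (Fin n) (Fin n) F)ˣ)).1 = w.1 + w.1 * N.1 := by
      rw [Subgroup.coe_inv, inv_inv, Units.val_mul, huN, mul_add, mul_one]
    rw [h9, Matrix.trace_add, ← AddChar.map_add_eq_mul, ← AddChar.map_add_eq_mul]
    congr 1; ring
  rw [h2, h1]
  split_ifs <;> ring

/-- the functionals -/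
noncomputable def lam (ψ : AddChar F ℂ) (g : (Matrix (Fin n) (Fin n) F)ˣ) (c : Fin n → F) (h : (Matrix (Fin n) (Fin n) F)ˣ) :
    ((Matrix (Fin n) (Fin n) F)ˣ → ℂ) →ₗ[ℂ] ℂ where
  toFun φ := ∑ u : UU F n, chi ψ c u * φ (g * u.1 * h)
  map_add' := by intro a b; simp only [Pi.add_apply, mul_add, Finset.sum_add_distrib]
  map_smul' := by
    intro t a
    simp only [Pi.smul_apply, smul_eq_mul, Finset.mul_sum, RingHom.id_apply]
    exact Finset.sum_congr rfl fun u _ => by ring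

theorem lam_apply (ψ : AddChar F ℂ) (g : (Matrix (Fin n) (Fin n) F)ˣ) (c : Fin n → F) (h : (Matrix (Fin n) (Fin n) F)ˣ) (φ) :
    lam ψ g c h φ = ∑ u : UU F n, chi ψ c u * φ (g * u.1 * h) := rfl

theorem lam_sep (ψ : AddChar F ℂ) (hψ : ψ ≠ 1) (φ : (Matrix (Fin n) (Fin n) F)ˣ → ℂ) (h : ∀ g c k, lam ψ g c k φ = 0) : φ = 0 := by
  let H : Matrix (Fin n) (Fin n) F → ℂ := fun m => if hm : IsUnit m then φ hm.unit else 0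
  have hH : ∀ g : (Matrix (Fin n) (Fin n) F)ˣ, H g.1 = φ g := by
    intro g
    simp only [H]
    rw [dif_pos g.isUnit]
    congr 1
    exact Units.ext rfl
  funext g
  rw [← hH g]
  apply SP_zero ψ hψ H
  intro a b c
  rw [← h a c b, lam_apply, ← Equiv.sum_comp UE]
  refine Finset.sum_congr rfl fun N _ => ?_
  have huN : (UE N).1.1 = 1 + N.1 := by simp [UE]
  rw [← hH, chi, Units.val_mul, Units.val_mul, huN]
  simp

noncomputable def SS (ψ : AddChar F ℂ) (a b : (Matrix (Fin n) (Fin n) F)ˣ) : Module.End ℂ ((Matrix (Fin n) (Fin n) F)ˣ → ℂ) where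
  toFun φ := fun x => ∑ t : (Matrix (Fin n) (Fin n) F)ˣ, ψ (Matrix.trace t.1) * φ (t * a * x * b)
  map_add' := by intro p q; funext x; simp only [Pi.add_apply, mul_add, Finset.sum_add_distrib]
  map_smul' := by
    intro t p
    funext x
    simp only [Pi.smul_apply, smul_eq_mul, Finset.mul_sum, RingHom.id_apply]
    exact Finset.sum_congr rfl fun u _ => by ring

theorem SS_apply (ψ : AddChar F ℂ) (a b : (Matrix (Fin n) (Fin n) F)ˣ) (φ) (x) :
  SS ψ a b φ x = ∑ t : (Matrix (Fin n) (Fin n) F)ˣ, ψ (Matrix.trace t.1) * φ (t * a * x * b) := rfl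

theorem SS_trace (ψ : AddChar F ℂ) (a b : (Matrix (Fin n) (Fin n) F)ˣ) : LinearMap.trace ℂ _ (SS ψ a b) =
    ∑ x : (Matrix (Fin n) (Fin n) F)ˣ, ψ (Matrix.trace (x * b⁻¹ * x⁻¹ * a⁻¹ : (Matrix (Fin n) (Fin n) F)ˣ).1) := by
  rw [LinearMap.trace_eq_matrix_trace ℂ (Pi.basisFun ℂ (Matrix (Fin n) (Fin n) F)ˣ), Matrix.trace]
  refine Finset.sum_congr rfl fun x _ => ?_
  rw [Matrix.diag_apply, LinearMap.toMatrix_apply, Pi.basisFun_apply, Pi.basisFun_repr, SS_apply, Finset.sum_eq_single (x * b⁻¹ * x⁻¹ * a⁻¹)]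
  · have : x * b⁻¹ * x⁻¹ * a⁻¹ * a * x * b = x := by group
    rw [this]; simp
  · intro t _ ht
    rw [Pi.single_eq_of_ne, mul_zero]
    intro h
    apply ht
    have : t = (t * a * x * b) * b⁻¹ * x⁻¹ * a⁻¹ := by group
    rw [this, h]
  · intro h; exact absurd (Finset.mem_univ _) h

theorem lam_SS (ψ : AddChar F ℂ) (hψ : ψ ≠ 1) (a b g h : (Matrix (Fin n) (Fin n) F)ˣ) (c : Fin n → F) (φ : (Matrix (Fin n) (Fin n) F)ˣ → ℂ) :
    lam ψ g c h (SS ψ a b φ) = ∑ w : (Matrix (Fin n) (Fin n) F)ˣ, if XX c w then ψ (Matrix.trace w.1) * lam ψ (a * g * w) c (h * b) φ else 0 := by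
  have h1 : lam ψ g c h (SS ψ a b φ) = ∑ w : (Matrix (Fin n) (Fin n) F)ˣ,
      (∑ u : UU F n, chi ψ c u * ψ (Matrix.trace (w * u.1⁻¹ : (Matrix (Fin n) (Fin n) F)ˣ).1)) * φ (a * g * w * h * b) := by
    rw [lam_apply]
    simp only [SS_apply, Finset.sum_mul, Finset.mul_sum]
    rw [Finset.sum_comm' (s := Finset.univ (α := (Matrix (Fin n) (Fin n) F)ˣ)) (t' := Finset.univ (α := UU F n)) (s' := fun _ => Finset.univ) (t := fun _ => Finset.univ) (by simp)]
    refine Finset.sum_congr rfl fun u _ => ?_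
    apply Fintype.sum_equiv ((MulAut.conj (a * g)⁻¹).toEquiv.trans (Equiv.mulRight u.1))
    intro t
    simp only [Equiv.trans_apply, Equiv.coe_mulRight, MulEquiv.toEquiv_eq_coe, EquivLike.coe_coe, MulAut.conj_apply]
    have e1 : a * g * ((a * g)⁻¹ * t * (a * g)⁻¹⁻¹ * u.1) * h * b = t * a * (g * u.1 * h) * b := by group
    have e2 : (a * g)⁻¹ * t * (a * g)⁻¹⁻¹ * u.1 * u.1⁻¹ = (a * g)⁻¹ * t * (a * g) := by group
    rw [e1, e2]
    have e3 : Matrix.trace ((a * g)⁻¹ * t * (a * g) : (Matrix (Fin n) (Fin n) F)ˣ).1 = Matrix.trace t.1 := by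
      rw [Units.val_mul, Units.val_mul, Matrix.trace_mul_comm, ← mul_assoc, Units.mul_inv, one_mul]
    rw [e3]; ring
  rw [h1]
  simp only [kappa ψ hψ]
  have h2 : ∀ w : (Matrix (Fin n) (Fin n) F)ˣ, (if XX c w then ψ (Matrix.trace w.1) * lam ψ (a * g * w) c (h * b) φ else 0) =
      ∑ u : UU F n, (if XX c (w * u.1) then ψ (Matrix.trace (w * u.1).1) * φ (a * g * (w * u.1) * h * b) else 0) := by
    intro w
    simp only [XX_mul_iff]
    split_ifs with hw
    · rw [lam_apply, Finset.mul_sum]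
      refine Finset.sum_congr rfl fun u _ => ?_
      rw [psi_XX ψ c w u hw]
      have : a * g * w * u.1 * (h * b) = a * g * (w * u.1) * h * b := by group
      rw [this]; ring
    · simp
  simp only [h2]
  rw [Finset.sum_comm]
  have h3 : ∀ u : UU F n, (∑ w : (Matrix (Fin n) (Fin n) F)ˣ, (if XX c (w * u.1) then ψ (Matrix.trace (w * u.1).1) * φ (a * g * (w * u.1) * h * b) else 0)) =
      ∑ w : (Matrix (Fin n) (Fin n) F)ˣ, (if XX c w then ψ (Matrix.trace w.1) * φ (a * g * w * h * b) else 0) := by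
    intro u
    exact Equiv.sum_comp (Equiv.mulRight u.1) (fun w => if XX c w then ψ (Matrix.trace w.1) * φ (a * g * w * h * b) else 0)
  simp only [h3]
  rw [Finset.sum_const, nsmul_eq_mul, Finset.mul_sum]
  refine Finset.sum_congr rfl fun w _ => ?_
  have : Nat.card (nn F n 0) = (Finset.univ : Finset (UU F n)).card := by
    rw [Nat.card_congr (UE (F := F) (n := n)), Nat.card_eq_fintype_card, Finset.card_univ]
  rw [this]
  split_ifs
  · ring
  · ring

theorem psi_integral (ψ : AddChar F ℂ) (x : F) : IsIntegral ℤ (ψ x) := by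
  have h : ψ x ^ Nat.card F = 1 := by
    rw [← AddChar.map_nsmul_eq_pow]
    have : Nat.card F • x = 0 := by
      rw [Nat.card_eq_fintype_card]; exact card_nsmul_eq_zero
    rw [this, AddChar.map_zero_eq_one]
  refine IsIntegral.of_pow Nat.card_pos (n := Nat.card F) ?_
  rw [h]; exact isIntegral_one

theorem sum_cosets {G : Type} [Group G] [Fintype G] (U : Subgroup G) [Fintype U] [Fintype (G ⧸ U)] (k : G → ℂ) (hk : ∀ g (u : U), k (g * u) = k g) :
    ∑ g, k g = Nat.card U * ∑ q : G ⧸ U, k q.out := by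
  have key : ∀ (q : G ⧸ U) (u : U), (((q.out * u : G)) : G ⧸ U) = q := by
    intro q u
    rw [QuotientGroup.mk_mul_of_mem _ u.2]
    exact Quotient.out_eq' q
  let e : (G ⧸ U) × U → G := fun p => p.1.out * p.2
  have he : Function.Bijective e := by
    constructor
    · rintro ⟨q, u⟩ ⟨q', u'⟩ h
      have h' : q.out * (u : G) = q'.out * u' := h
      have h1 : q = q' := by rw [← key q u, ← key q' u', h']
      subst h1
      have := mul_left_cancel h'
      rw [Prod.mk.injEq]
      exact ⟨rfl, Subtype.ext this⟩
    · intro g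
      have h2 : (((g : G ⧸ U).out : G) : G ⧸ U) = g := Quotient.out_eq' _
      exact ⟨⟨(g : G ⧸ U), ⟨_, QuotientGroup.eq.1 h2⟩⟩, by simp [e]⟩
  rw [← Equiv.sum_comp (Equiv.ofBijective e he), Fintype.sum_prod_type, Finset.mul_sum]
  refine Finset.sum_congr rfl fun q _ => ?_
  rw [Finset.sum_congr rfl fun (u : U) _ => (show k (Equiv.ofBijective e he (q, u)) = k q.out from hk _ u)]
  simp

theorem B2mat (ψ : AddChar F ℂ) (hψ : ψ ≠ 1) (a b : (Matrix (Fin n) (Fin n) F)ˣ) :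
    IsIntegral ℤ ((∑ x : (Matrix (Fin n) (Fin n) F)ˣ, ψ (Matrix.trace (x * b⁻¹ * x⁻¹ * a⁻¹ : (Matrix (Fin n) (Fin n) F)ˣ).1)) / Nat.card (nn F n 0)) := by
  have hc : (Nat.card (nn F n 0) : ℂ) ≠ 0 := by exact_mod_cast Nat.card_pos.ne'
  have key : ∀ g c h φ, lam ψ g c h (SS ψ a b φ) = Nat.card (nn F n 0) * ∑ q : (Matrix (Fin n) (Fin n) F)ˣ ⧸ UU F n,
      (if XX c q.out then ψ (Matrix.trace (q.out).1) * lam ψ (a * g * q.out) c (h * b) φ else 0) := by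
    intro g c h φ
    rw [lam_SS ψ hψ, sum_cosets (UU F n), Nat.card_congr (UE (F := F) (n := n)).symm]
    intro w u
    simp only [XX_mul_iff]
    split_ifs with hw
    · rw [psi_XX ψ c w u hw]
      have : lam ψ (a * g * w) c (h * b) φ = chi ψ c u * lam ψ (a * g * (w * u.1)) c (h * b) φ := by
        rw [lam_apply, lam_apply, ← Equiv.sum_comp (Equiv.mulLeft u), Finset.mul_sum]
        refine Finset.sum_congr rfl fun v _ => ?_
        rw [Equiv.coe_mulLeft, chi_mul]
        have : a * g * w * (u * v : UU F n).1 * (h * b) = a * g * (w * u.1) * v.1 * (h * b) := by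
          rw [Subgroup.coe_mul]; group
        rw [this, mul_assoc]
      rw [this]; ring
    · rfl
  have hIntg := trace_integral ((Nat.card (nn F n 0) : ℂ)⁻¹ • SS ψ a b)
    (fun p : (Matrix (Fin n) (Fin n) F)ˣ × (Fin n → F) × (Matrix (Fin n) (Fin n) F)ˣ => lam ψ p.1 p.2.1 p.2.2)
    (fun φ h => lam_sep ψ hψ φ fun g c k => h (g, c, k))
    (fun p p' => ∑ q : (Matrix (Fin n) (Fin n) F)ˣ ⧸ UU F n, if XX p.2.1 q.out ∧ p' = (a * p.1 * q.out, p.2.1, p.2.2 * b) then ψ (Matrix.trace (q.out).1) else 0)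
    (by
      intro p p'
      refine IsIntegral.sum _ fun q _ => ?_
      split_ifs
      · exact psi_integral ψ _
      · exact isIntegral_zero)
    (by
      intro p φ
      rw [LinearMap.smul_apply, map_smul, key, smul_eq_mul, ← mul_assoc, inv_mul_cancel₀ hc, one_mul]
      simp only [Finset.sum_mul]
      rw [Finset.sum_comm]
      refine Finset.sum_congr rfl fun q _ => ?_
      rw [Finset.sum_eq_single (a * p.1 * q.out, p.2.1, p.2.2 * b)]
      · by_cases hx : XX p.2.1 q.out
        · rw [if_pos hx, if_pos ⟨hx, rfl⟩]
        · rw [if_neg hx, if_neg (fun h => hx h.1), zero_mul]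
      · intro p' _ hp'
        rw [if_neg (fun h => hp' h.2), zero_mul]
      · intro h; exact absurd (Finset.mem_univ _) h)
  rw [map_smul, SS_trace, smul_eq_mul] at hIntg
  rw [div_eq_inv_mul]
  exact hIntg

end Btwo
end MK

set_option linter.all false
namespace MK
open Module Polynomial
open scoped BigOperators Classical

section gen
variable {F : Type} [Field F] [Finite F] {E : Type} [Field E] [Algebra F E] [Finite E]

theorem card_nn (F : Type) [Field F] [Finite F] (n : ℕ) : Nat.card (nn F n 0) = Nat.card F ^ (n * (n - 1) / 2) := by
  let e : nn F n 0 ≃ ({p : Fin n × Fin n // p.1 < p.2} → F) :=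
    { toFun := fun N p => N.1 p.1.1 p.1.2
      invFun := fun f => ⟨fun i j => if h : i < j then f ⟨(i, j), h⟩ else 0, by
        intro i j h
        have : ¬ i < j := fun h' => h ⟨h', Nat.zero_le _⟩
        simp [this]⟩
      left_inv := by
        intro N
        ext i j
        by_cases h : i < j
        · simp [h]
        · simp only [h, dite_false]
          exact (N.2 i j (fun h' => h h'.1)).symm
      right_inv := by
        intro f
        funext p
        have := p.2
        simp [this] }
  rw [Nat.card_congr e, Nat.card_fun]
  congr 1
  let e2 : {p : Fin n × Fin n // p.1 < p.2} ≃ Σ j : Fin n, {i : Fin n // i < j} :=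
    { toFun := fun p => ⟨p.1.2, ⟨p.1.1, p.2⟩⟩
      invFun := fun p => ⟨(p.2.1, p.1), p.2.2⟩
      left_inv := fun p => rfl
      right_inv := fun p => rfl }
  rw [Nat.card_congr e2, Nat.card_sigma]
  have : ∀ j : Fin n, Nat.card {i : Fin n // i < j} = j := by
    intro j
    rw [Nat.card_eq_fintype_card, Fintype.card_subtype]
    have : (Finset.univ.filter fun i : Fin n => i < j) = Finset.Iio j := by ext; simp
    rw [this, Fin.card_Iio]
  rw [Finset.sum_congr rfl fun j _ => this j, Fin.sum_univ_eq_sum_range (fun i => i), Finset.sum_range_id]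

theorem bezout {x : ℂ} {a b : ℤ} (h : IsCoprime a b) (ha : IsIntegral ℤ ((a : ℂ) * x)) (hb : IsIntegral ℤ ((b : ℂ) * x)) : IsIntegral ℤ x := by
  obtain ⟨u, v, huv⟩ := h
  have h1 : x = (u : ℂ) * (a * x) + (v : ℂ) * (b * x) := by
    have : ((u * a + v * b : ℤ) : ℂ) = 1 := by rw [huv]; simp
    push_cast at this
    linear_combination (-x) * this
  rw [h1]
  have hi : ∀ u : ℤ, IsIntegral ℤ (u : ℂ) := fun u => isIntegral_algebraMap (R := ℤ) (A := ℂ) (x := u)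
  exact ((hi u).mul ha).add ((hi v).mul hb)

theorem isIntegral_int (u : ℤ) : IsIntegral ℤ (u : ℂ) := isIntegral_algebraMap (R := ℤ) (A := ℂ) (x := u)

variable (ψ : AddChar F ℂ)

noncomputable def NN (η ξ : E) : ℂ := ∑ y : Module.End F E, ψ (LinearMap.trace F E (y * Lm F ξ)) * (if y.charpoly = cp F η then 1 else 0)

theorem gen_adjoin {ξ : E} (h : dg F ξ = finrank F E) (v : E) : ∃ p : F[X], aeval ξ p = v := by
  have h1 := (Field.primitive_element_iff_minpoly_natDegree_eq F ξ).2 h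
  have h2 : Algebra.adjoin F {ξ} = ⊤ := by
    rw [← IntermediateField.adjoin_simple_toSubalgebra_of_isAlgebraic (isInt ξ).isAlgebraic, h1]
    rfl
  have h3 : v ∈ Algebra.adjoin F {ξ} := by rw [h2]; trivial
  rw [Algebra.adjoin_singleton_eq_range_aeval] at h3
  exact h3

theorem gen_inv {ξ : E} (h : dg F ξ = finrank F E) {U : Submodule F E} (hU : Inv (Lm F ξ) U) (hb : U ≠ ⊥) : U = ⊤ := by
  obtain ⟨u, hu, h0⟩ := Submodule.exists_mem_ne_zero_of_ne_bot hb
  rw [eq_top_iff]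
  intro v _
  obtain ⟨p, hp⟩ := gen_adjoin h (v * u⁻¹)
  have := hU.aeval p hu
  rw [Submodule.mem_comap, aeval_Lm, hp] at this
  simpa [h0] using this

theorem gen_prim (hψ : ψ ≠ 1) {ξ : E} (h : dg F ξ = finrank F E) : Prim (fun y : Module.End F E => ψ (LinearMap.trace F E (y * Lm F ξ))) := by
  intro U hb ht y hy
  have h1 := sum_nil ψ hψ (Lm F ξ) U
  rw [if_neg (fun h' => ht (gen_inv h h' hb))] at h1
  have h2 : ∀ N : nil U, ψ (LinearMap.trace F E ((y + N) * Lm F ξ)) = ψ (LinearMap.trace F E (y * Lm F ξ)) * ψ (LinearMap.trace F E (Lm F ξ * N)) := by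
    intro N
    rw [add_mul, map_add, AddChar.map_add_eq_mul, LinearMap.trace_mul_comm F N.1]
  simp only [h2]
  rw [← Finset.mul_sum, h1, mul_zero]

theorem gen_cyc {ξ : E} (h : dg F ξ = finrank F E) : cyc (Lm F ξ) (1 : E) = ⊤ :=
  gen_inv h (inv_cyc _ _) (cyc_ne_bot one_ne_zero)

theorem TT_gen (hψ : ψ ≠ 1) {ξ : E} (h : dg F ξ = finrank F E) (η : E) : TT ψ (cl F η) ξ = NN ψ η ξ / AA F E := by
  have hP := gen_prim ψ hψ h
  have hP2 : Prim (fun y : Module.End F E => (if y.charpoly = cp F η then (1 : ℂ) else 0) * ψ (LinearMap.trace F E (y * Lm F ξ))) :=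
    hP.mul_stable (fun y => if y.charpoly = cp F η then 1 else 0) fun y z h => by rw [h]
  rw [TT, sg_reg ((lift_prim _).four ψ hψ) ((lift_class _).four ψ) (gen_cyc h) rfl]
  have h1 : ∀ z : Module.End F E, lift F (cl F η) z = phi z * (if z.charpoly = cp F η then 1 else 0) / GG F E := by
    intro z
    rw [lift]
    by_cases hz : ∃ η' : E, cp F η' = z.charpoly
    · obtain ⟨η', hη'⟩ := hz
      rw [← hη', Hs_cp (cl_inv η), cl]
      ring
    · rw [Hs, dif_neg hz, if_neg (fun h' => hz ⟨η, h'.symm⟩)]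
      simp
  have h2 : four ψ (lift F (cl F η)) (Lm F ξ) = finrank F E * NN ψ η ξ / GG F E := by
    rw [four]
    have := phi_pair hP2
    have hN : NN ψ η ξ = ∑ y : Module.End F E, (if y.charpoly = cp F η then (1 : ℂ) else 0) * ψ (LinearMap.trace F E (y * Lm F ξ)) := by
      rw [NN]; exact Finset.sum_congr rfl fun y _ => mul_comm _ _
    rw [hN, ← this, Finset.sum_div]
    refine Finset.sum_congr rfl fun z _ => ?_
    rw [h1]; ring
  rw [h2, h]
  have := GG_ne (F := F) (E := E)
  have := finrank_ne (F := F) (E := E)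
  have := AA_ne (F := F) (E := E)
  field_simp

theorem NN_integral (η ξ : E) : IsIntegral ℤ (NN ψ η ξ) := by
  refine IsIntegral.sum _ fun y _ => (psi_integral ψ _).mul ?_
  split_ifs
  · exact isIntegral_one
  · exact isIntegral_zero

theorem NN_A4 (hψ : ψ ≠ 1) {ξ : E} (h : dg F ξ = finrank F E) (h0 : ξ ≠ 0) {η : E} (hη : η ≠ 0) :
    IsIntegral ℤ (((Nat.card E : ℂ) - 1) * NN ψ η ξ / Nat.card (nn F (finrank F E) 0)) := by
  set c := cp F η with hc
  have hm : c.Monic := cp_monic η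
  have hd : c.natDegree = finrank F E := natDegree_cp η
  haveI := finite_adjoinRoot hm
  haveI : Finite (AdjoinRoot c) := Module.finite_of_finite F
  rw [NN, A4 (gen_prim ψ hψ h) hm hd]
  let e0 : AdjoinRoot c ≃ₗ[F] E := LinearEquiv.ofFinrankEq _ _ (by rw [finrank_adjoinRoot hm, hd])
  haveI : Nontrivial (AdjoinRoot c) := e0.toEquiv.nontrivial
  let bE := Module.finBasis F E
  let φ := LinearMap.toMatrixAlgEquiv bE
  have hu1 : IsUnit (e0.conj (rootMul c)) := by
    rw [LinearMap.isUnit_iff_isUnit_det, isUnit_iff_ne_zero]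
    rw [LinearMap.det_eq_sign_charpoly_coeff, LinearEquiv.charpoly_conj, charpoly_rootMul hm]
    exact mul_ne_zero (pow_ne_zero _ (by norm_num)) ((cp_coeff_zero η).2 hη)
  have hu2 : IsUnit (Lm F ξ) := by
    rw [LinearMap.isUnit_iff_isUnit_det, isUnit_iff_ne_zero]
    rw [LinearMap.det_eq_sign_charpoly_coeff]
    exact mul_ne_zero (pow_ne_zero _ (by norm_num)) ((cp_coeff_zero ξ).2 h0)
  obtain ⟨r, hr⟩ := hu1
  obtain ⟨l, hl⟩ := hu2
  let M := Units.mapEquiv φ.toMulEquiv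
  have := B2mat ψ hψ (M l)⁻¹ (M r)⁻¹
  convert this using 2
  symm
  let e1 : (AdjoinRoot c ≃ₗ[F] E) ≃ (E ≃ₗ[F] E) :=
    { toFun := fun e => e0.symm.trans e
      invFun := fun g => e0.trans g
      left_inv := fun e => by ext; simp
      right_inv := fun e => by ext; simp }
  let e2 := e1.trans ((LinearMap.GeneralLinearGroup.generalLinearEquiv F E).symm.toEquiv.trans M.toEquiv)
  symm
  apply Fintype.sum_equiv e2
  intro e
  have h1 : e2 e * (M r)⁻¹⁻¹ * (e2 e)⁻¹ * (M l)⁻¹⁻¹ = M ((LinearMap.GeneralLinearGroup.generalLinearEquiv F E).symm (e1 e) * r * ((LinearMap.GeneralLinearGroup.generalLinearEquiv F E).symm (e1 e))⁻¹ * l) := by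
    simp [e2]
  rw [h1]
  congr 1
  rw [LinearMap.trace_eq_matrix_trace F bE]
  congr 1
  change φ _ = φ _
  congr 1
  rw [Units.val_mul, Units.val_mul, Units.val_mul, hr, hl]
  congr 1
  apply LinearMap.ext
  intro v
  change _ = e (e0.symm (e0 (rootMul c (e0.symm (e0 (e.symm v))))))
  simp [LinearEquiv.conj_apply]

theorem cop_card : IsCoprime ((Nat.card E : ℤ) - 1) (Nat.card (nn F (finrank F E) 0)) := by
  rw [card_nn]
  push_cast
  apply IsCoprime.pow_right
  have : (Nat.card E : ℤ) = (Nat.card F : ℤ) ^ finrank F E := by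
    rw [Module.natCard_eq_pow_finrank (K := F) (V := E)]; push_cast; rfl
  rw [this]
  obtain ⟨k, hk⟩ : ∃ k, finrank F E = k + 1 := ⟨finrank F E - 1, by have := finrank_pos (R := F) (M := E); omega⟩
  rw [hk]
  exact ⟨-1, (Nat.card F : ℤ) ^ k, by ring⟩

theorem NN_U (hψ : ψ ≠ 1) {ξ : E} (h : dg F ξ = finrank F E) (h0 : ξ ≠ 0) {η : E} (hη : η ≠ 0) :
    IsIntegral ℤ (NN ψ η ξ / Nat.card (nn F (finrank F E) 0)) := by
  have hc : (Nat.card (nn F (finrank F E) 0) : ℂ) ≠ 0 := by exact_mod_cast Nat.card_pos.ne'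
  apply bezout (cop_card (F := F) (E := E))
  · have := NN_A4 ψ hψ h h0 hη
    push_cast
    rwa [← mul_div_assoc]
  · push_cast
    rw [mul_div_cancel₀ _ hc]
    exact NN_integral ψ η ξ

theorem AA_eq : AA F E = (-1) ^ (finrank F E - 1) * Nat.card (nn F (finrank F E) 0) := by
  rw [AA, card_nn]; push_cast; rfl

theorem dg_le (η : E) : dg F η ≤ finrank F E := minpoly.natDegree_le η

theorem TT_cl_symm (hψ : ψ ≠ 1) (ξ η : E) : dg F η * TT ψ (cl F ξ) η = dg F ξ * TT ψ (cl F η) ξ := by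
  rw [← cl_pair η (TT_inv ψ _), ← cl_pair ξ (TT_inv ψ _), TT_symm ψ hψ (cl_inv ξ) (cl_inv η)]
  exact Finset.sum_congr rfl fun _ _ => mul_comm _ _

theorem exists_conj {η η' : E} (h : cp F η = cp F η') : ∃ σ : E ≃ₐ[F] E, σ η = η' := by
  rw [cp_eq_iff] at h
  obtain ⟨σ, hσ⟩ := (isConjRoot_iff_exists_algEquiv (K := F) (x := η') (y := η)).1 h.symm
  exact ⟨σ, hσ⟩

theorem cp_alg (σ : E ≃ₐ[F] E) (η : E) : cp F (σ η) = cp F η := by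
  rw [cp_eq_iff, minpoly.algEquiv_eq]

theorem RR_inv {s : E → ℂ} (hs : IsInv F s) : IsInv F (RR ψ s) := by
  intro η η' h
  obtain ⟨σ, rfl⟩ := exists_conj h
  unfold RR
  symm
  rw [← Equiv.sum_comp σ.toEquiv]
  refine Finset.sum_congr rfl fun ξ _ => ?_
  have h1 : σ.toEquiv ξ = σ ξ := rfl
  rw [h1, ← map_mul, hs _ _ (cp_alg σ ξ), Algebra.trace_eq_of_algEquiv]

theorem RR_cl_symm (ξ η : E) : dg F η * RR ψ (cl F ξ) η = dg F ξ * RR ψ (cl F η) ξ := by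
  rw [← cl_pair η (RR_inv ψ (cl_inv _)), ← cl_pair ξ (RR_inv ψ (cl_inv _)), RR_symm ψ]
  exact Finset.sum_congr rfl fun _ _ => mul_comm _ _

theorem NN_scalar (hψ : ψ ≠ 1) {ξ : E} (h : dg F ξ = finrank F E) (z : F) : NN ψ (algebraMap F E z) ξ = AA F E * RR ψ (cl F (algebraMap F E z)) ξ := by
  have h1 := TT_cl_symm ψ hψ ξ (algebraMap F E z)
  have h2 := RR_cl_symm ψ ξ (algebraMap F E z)
  rw [TT_scalar ψ hψ (cl_inv ξ), h2, TT_gen ψ hψ h] at h1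
  have h3 := mul_left_cancel₀ (dg_ne ξ) h1
  rw [h3, mul_div_cancel₀ _ AA_ne]

end gen
end MK

set_option linter.all false
namespace MK
open Module Polynomial
open scoped BigOperators Classical

section bthree
variable {F : Type} [Field F] [Finite F] {E : Type} [Field E] [Algebra F E] [Finite E]

theorem cardE_nat : Nat.card E = Nat.card F ^ finrank F E := Module.natCard_eq_pow_finrank

theorem dg_dvd_iff (η : E) (j : ℕ) : dg F η ∣ j ↔ η ^ (Nat.card F ^ j) = η := by
  rw [dg, (minpoly.irreducible (isInt (F := F) η)).natDegree_dvd_iff_dvd_X_pow_card_pow_sub_X, minpoly.dvd_iff]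
  simp [sub_eq_zero]

theorem dg_dvd (η : E) : dg F η ∣ finrank F E := minpoly.degree_dvd (isInt η)

theorem card_fix_units (j : ℕ) (hj : j ∣ finrank F E) : (Finset.univ.filter fun a : Eˣ => dg F (a : E) ∣ j).card = Nat.card F ^ j - 1 := by
  have h1 := IsCyclic.card_powMonoidHom_ker (G := Eˣ) (Nat.card F ^ j - 1)
  have hq : 0 < Nat.card F ^ j := pow_pos Nat.card_pos _
  rw [Nat.card_units, cardE_nat (F := F) (E := E)] at h1
  have h2 : Nat.gcd (Nat.card F ^ finrank F E - 1) (Nat.card F ^ j - 1) = Nat.card F ^ j - 1 := by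
    apply Nat.gcd_eq_right
    obtain ⟨m, hm⟩ := hj
    rw [hm, pow_mul]
    exact Nat.sub_one_dvd_pow_sub_one _ _
  rw [h2] at h1
  rw [← h1, Nat.card_eq_fintype_card, Fintype.card_subtype]
  congr 1
  ext a
  simp only [Finset.mem_filter, Finset.mem_univ, true_and, dg_dvd_iff, MonoidHom.mem_ker, powMonoidHom_apply]
  rw [← Units.val_pow_eq_pow_val, Units.val_inj]
  constructor
  · intro h
    have : a ^ (Nat.card F ^ j - 1) * a = 1 * a := by
      rw [← pow_succ, Nat.sub_add_cancel hq, h, one_mul]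
    exact mul_right_cancel this
  · intro h
    have : a ^ (Nat.card F ^ j - 1) * a = a := by rw [h, one_mul]
    rwa [← pow_succ, Nat.sub_add_cancel hq] at this

/-- the integer version of the constant `AA` for the field `F(a)` -/
noncomputable def AI (F : Type) [Field F] {E : Type} [Field E] [Algebra F E] (a : E) : ℤ :=
  (-1) ^ (finrank F E / dg F a - 1) * ((Nat.card F : ℤ) ^ dg F a) ^ ((finrank F E / dg F a) * (finrank F E / dg F a - 1) / 2)

theorem AI_mod (a : E) : AI F a ≡ (if 2 ∣ finrank F E / dg F a then -(Nat.card F : ℤ) ^ (finrank F E / 2) else 1) [ZMOD ((Nat.card F : ℤ) ^ finrank F E - 1)] := by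
  obtain ⟨m, hm⟩ := dg_dvd (F := F) a
  have hd := dg_pos (F := F) a
  have hm0 : 0 < m := by
    rcases Nat.eq_zero_or_pos m with h | h
    · rw [h] at hm; have := finrank_pos (R := F) (M := E); omega
    · exact h
  have hdiv : finrank F E / dg F a = m := by rw [hm, Nat.mul_div_cancel_left _ hd]
  rw [AI, hdiv]
  have hone : (Nat.card F : ℤ) ^ finrank F E ≡ 1 [ZMOD ((Nat.card F : ℤ) ^ finrank F E - 1)] := by
    have := Int.modEq_sub ((Nat.card F : ℤ) ^ finrank F E) 1
    exact this
  split_ifs with h2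
  · obtain ⟨r, rfl⟩ := h2
    have e1 : 2 * r * (2 * r - 1) / 2 = r * (2 * r - 1) := by
      rw [mul_assoc, Nat.mul_div_cancel_left _ (by norm_num)]
    have e2 : finrank F E / 2 = dg F a * r := by
      rw [hm]; rw [show dg F a * (2 * r) = 2 * (dg F a * r) by ring, Nat.mul_div_cancel_left _ (by norm_num)]
    obtain ⟨s, rfl⟩ : ∃ s, r = s + 1 := ⟨r - 1, by omega⟩
    have e3 : 2 * (s + 1) - 1 = 2 * s + 1 := by omega
    rw [e1, e2, e3, ← pow_mul]
    have e4 : dg F a * ((s + 1) * (2 * s + 1)) = finrank F E * s + dg F a * (s + 1) := by rw [hm]; ring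
    rw [e4, pow_add (Nat.card F : ℤ), pow_mul (Nat.card F : ℤ)]
    have := ((hone.pow s).mul_right ((Nat.card F : ℤ) ^ (dg F a * (s + 1)))).neg
    simpa [pow_add, pow_mul] using this
  · obtain ⟨r, rfl⟩ : ∃ r, m = 2 * r + 1 := ⟨m / 2, by omega⟩
    have e1 : (2 * r + 1) * (2 * r + 1 - 1) / 2 = (2 * r + 1) * r := by
      rw [Nat.add_sub_cancel, show (2 * r + 1) * (2 * r) = 2 * ((2 * r + 1) * r) by ring, Nat.mul_div_cancel_left _ (by norm_num)]
    rw [e1, ← pow_mul, ← mul_assoc, ← hm, pow_mul (Nat.card F : ℤ)]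
    simpa [pow_mul] using hone.pow r

theorem AI_sum : ((Nat.card F : ℤ) ^ finrank F E - 1) ∣ ∑ a : Eˣ, AI F (a : E) := by
  have h1 : ∑ a : Eˣ, AI F (a : E) ≡ ∑ a : Eˣ, (if 2 ∣ finrank F E / dg F (a : E) then -(Nat.card F : ℤ) ^ (finrank F E / 2) else 1) [ZMOD ((Nat.card F : ℤ) ^ finrank F E - 1)] := by
    apply Int.ModEq.sum
    intro a _
    exact AI_mod _
  apply (Int.modEq_zero_iff_dvd).1
  refine h1.trans ?_
  have hc : (Fintype.card Eˣ : ℤ) = (Nat.card F : ℤ) ^ finrank F E - 1 := by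
    rw [← Nat.card_eq_fintype_card, Nat.card_units, cardE_nat (F := F) (E := E), Nat.cast_sub (Nat.one_le_pow _ _ Nat.card_pos)]
    push_cast; rfl
  by_cases h2 : 2 ∣ finrank F E
  · have h3 : ∀ a : E, (2 ∣ finrank F E / dg F a ↔ dg F a ∣ finrank F E / 2) := by
      intro a
      obtain ⟨m, hm⟩ := dg_dvd (F := F) a
      have hd := dg_pos (F := F) a
      rw [hm, Nat.mul_div_cancel_left _ hd]
      constructor
      · rintro ⟨r, rfl⟩
        exact ⟨r, by rw [show dg F a * (2 * r) = 2 * (dg F a * r) by ring, Nat.mul_div_cancel_left _ (by norm_num)]⟩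
      · rintro ⟨r, hr⟩
        have : dg F a * m = dg F a * (2 * r) := by
          have : dg F a * m = 2 * (dg F a * r) := by rw [← hr, ← hm]; omega
          rw [this]; ring
        exact ⟨r, Nat.eq_of_mul_eq_mul_left hd this⟩
    have h4 := card_fix_units (F := F) (E := E) (finrank F E / 2) (Nat.div_dvd_of_dvd h2)
    simp only [h3]
    rw [Int.modEq_zero_iff_dvd]
    have h5 : ∑ a : Eˣ, (if dg F (a : E) ∣ finrank F E / 2 then -(Nat.card F : ℤ) ^ (finrank F E / 2) else 1) =
        ∑ a : Eˣ, (1 - (if dg F (a : E) ∣ finrank F E / 2 then ((Nat.card F : ℤ) ^ (finrank F E / 2) + 1) else 0)) := by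
      refine Finset.sum_congr rfl fun a _ => ?_
      split_ifs <;> ring
    rw [h5, Finset.sum_sub_distrib, ← Finset.sum_filter, Finset.sum_const, Finset.sum_const, h4, Finset.card_univ, nsmul_eq_mul, nsmul_eq_mul, hc,
      Nat.cast_sub (Nat.one_le_pow _ _ Nat.card_pos)]
    push_cast
    have : finrank F E = finrank F E / 2 + finrank F E / 2 := by omega
    generalize hh : finrank F E / 2 = h at *
    rw [this, pow_add]
    apply Dvd.intro 0
    ring
  · have h3 : ∀ a : E, ¬ 2 ∣ finrank F E / dg F a := fun a h => h2 (h.trans (Nat.div_dvd_of_dvd (dg_dvd a)))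
    simp only [h3, if_false]
    rw [Finset.sum_const, Finset.card_univ, nsmul_eq_mul, hc, mul_one, Int.modEq_zero_iff_dvd]

theorem burnside {G X : Type} [Group G] [Finite G] [Fintype G] [Fintype X] [MulAction G X] (f : X → ℂ) (hf : ∀ x, IsIntegral ℤ (f x)) (hi : ∀ (g : G) x, f (g • x) = f x) :
    ∃ z : ℂ, IsIntegral ℤ z ∧ ∑ g : G, ∑ x : X, (if g • x = x then f x else 0) = Nat.card G * z := by
  let Ω := MulAction.orbitRel.Quotient G X
  refine ⟨∑ ω : Ω, f ω.out, IsIntegral.sum _ fun ω _ => hf _, ?_⟩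
  rw [Finset.sum_comm]
  have h1 : ∀ x : X, ∑ g : G, (if g • x = x then f x else 0) = Nat.card (MulAction.stabilizer G x) * f x := by
    intro x
    rw [← Finset.sum_filter, Finset.sum_const, nsmul_eq_mul, Nat.card_eq_fintype_card, Fintype.card_subtype]
    rfl
  simp only [h1]
  rw [← Finset.sum_fiberwise (s := Finset.univ) (g := fun x : X => (Quotient.mk'' x : Ω)), Finset.mul_sum]
  refine Finset.sum_congr rfl fun ω _ => ?_
  have h2 : ∀ x ∈ Finset.univ.filter (fun x : X => (Quotient.mk'' x : Ω) = ω), (Nat.card (MulAction.stabilizer G x) : ℂ) * f x = Nat.card (MulAction.stabilizer G ω.out) * f ω.out := by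
    intro x hx
    rw [Finset.mem_filter] at hx
    have h3 : (Quotient.mk'' x : Ω) = Quotient.mk'' ω.out := by rw [hx.2]; exact (Quotient.out_eq' ω).symm
    have h4 : x ∈ MulAction.orbit G ω.out := MulAction.orbitRel_apply.1 (Quotient.eq''.1 h3)
    obtain ⟨g, rfl⟩ := h4
    simp only
    rw [hi]
    congr 2
    exact Nat.card_congr (MulAction.stabilizerEquivStabilizer rfl).toEquiv.symm
  rw [Finset.sum_congr rfl h2, Finset.sum_const, nsmul_eq_mul, ← mul_assoc]
  congr 1
  have h5 := MulAction.card_orbit_mul_card_stabilizer_eq_card_group G ω.out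
  have h6 : (Finset.univ.filter (fun x : X => (Quotient.mk'' x : Ω) = ω)).card = Fintype.card (MulAction.orbit G ω.out) := by
    rw [Fintype.card_of_subtype]
    intro x
    rw [Finset.mem_filter]
    have : (Quotient.mk'' x : Ω) = ω ↔ x ∈ MulAction.orbit G ω.out := by
      rw [← MulAction.orbitRel_apply]
      conv_lhs => rw [← Quotient.out_eq' ω]
      exact Quotient.eq''
    simp [this]
  rw [h6, Nat.card_eq_fintype_card, Nat.card_eq_fintype_card, ← h5]
  push_cast; rfl

end bthree
end MK

set_option linter.all false
namespace MK
open Module Polynomial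
open scoped BigOperators Classical

section tower
variable {F : Type} [Field F] [Finite F] {E : Type} [Field E] [Algebra F E] [Finite E]
variable {K : Type} [Field K] [Finite K] [Algebra F K] [Algebra K E] [IsScalarTower F K E]

theorem trace_restrict (y : Module.End K E) : LinearMap.trace F E (y.restrictScalars F) = Algebra.trace F K (LinearMap.trace K E y) := by
  let bK := Module.finBasis F K
  let bE := Module.finBasis K E
  rw [LinearMap.trace_eq_matrix_trace F (bK.smulTower' bE), LinearMap.restrictScalars_toMatrix,
    LinearMap.trace_eq_matrix_trace K bE, Algebra.trace_eq_matrix_trace bK]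
  simp only [Matrix.trace, Matrix.diag_apply, map_sum, Matrix.comp_apply, Matrix.map_apply, Fintype.sum_prod_type]
  have hs : ∀ i, (∑ x, (Algebra.leftMulMatrix bK) ((LinearMap.toMatrix bE bE) y x x)) i i = ∑ x, (Algebra.leftMulMatrix bK) ((LinearMap.toMatrix bE bE) y x x) i i :=
    fun i => Matrix.sum_apply _ _ _ _
  rw [Finset.sum_congr rfl fun i _ => hs i, Finset.sum_comm]

theorem nilp_iff (y : Module.End K E) (P : K[X]) : IsNilpotent (aeval y P) ↔ ∀ r : K[X], Irreducible r → r ∣ y.charpoly → r ∣ P := by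
  constructor
  · intro h r hr hd
    by_contra hn
    have hc : IsCoprime r P := (hr.coprime_iff_not_dvd).2 hn
    obtain ⟨k, hk⟩ := h
    obtain ⟨a, b, hab⟩ := hc.pow_right (n := k)
    obtain ⟨v, hv, h0⟩ := Submodule.exists_mem_ne_zero_of_ne_bot (ker_aeval_ne_bot hr hd)
    have h1 := LinearMap.congr_fun (congrArg (aeval y) hab) v
    rw [map_add, map_mul, map_mul, map_pow, hk, mul_zero, add_zero, map_one, Module.End.mul_apply,
      LinearMap.mem_ker.1 hv, map_zero] at h1
    exact h0 h1.symm
  · intro h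
    have key : ∀ c : K[X], c ≠ 0 → (∀ r : K[X], Irreducible r → r ∣ c → r ∣ P) → ∃ k, c ∣ P ^ k := by
      intro c
      induction c using WfDvdMonoid.induction_on_irreducible with
      | zero => intro h; exact absurd rfl h
      | unit u hu => intro _ _; exact ⟨0, hu.dvd⟩
      | mul c i hc hi ih =>
        intro _ h2
        obtain ⟨k, hk⟩ := ih hc fun r hr hd => h2 r hr (hd.mul_left _)
        exact ⟨k + 1, by rw [pow_succ, mul_comm]; exact mul_dvd_mul hk (h2 i hi (dvd_mul_right _ _))⟩
    obtain ⟨k, s, hs⟩ := key _ (LinearMap.charpoly_monic y).ne_zero h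
    refine ⟨k, ?_⟩
    rw [← map_pow, hs, map_mul, LinearMap.aeval_self_charpoly, zero_mul]

theorem aeval_restrict (y : Module.End K E) (p : F[X]) : aeval (y.restrictScalars F : Module.End F E) p = (aeval y (p.map (algebraMap F K))).restrictScalars F := by
  induction p using Polynomial.induction_on' with
  | add p q hp hq => rw [map_add, hp, hq, Polynomial.map_add, map_add]; rfl
  | monomial n a =>
    rw [Polynomial.map_monomial, aeval_monomial, aeval_monomial]
    have h1 : ∀ n, (y.restrictScalars F : Module.End F E) ^ n = ((y ^ n : Module.End K E).restrictScalars F) := by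
      intro n
      induction n with
      | zero => rfl
      | succ n ih => rw [pow_succ, pow_succ, ih]; rfl
    rw [h1]
    apply LinearMap.ext
    intro v
    simp [Module.algebraMap_end_apply]

theorem nilp_restrict (y : Module.End K E) : IsNilpotent (y.restrictScalars F : Module.End F E) ↔ IsNilpotent y := by
  have h1 : ∀ n, (y.restrictScalars F : Module.End F E) ^ n = ((y ^ n : Module.End K E).restrictScalars F) := by
    intro n
    induction n with
    | zero => rfl
    | succ n ih => rw [pow_succ, pow_succ, ih]; rfl
  constructor
  · rintro ⟨k, hk⟩
    refine ⟨k, ?_⟩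
    rw [h1] at hk
    apply LinearMap.ext
    intro v
    exact LinearMap.congr_fun hk v
  · rintro ⟨k, hk⟩
    refine ⟨k, ?_⟩
    rw [h1, hk]; rfl

theorem restrict_class {y y' : Module.End K E} (h : y.charpoly = y'.charpoly) (η : E) :
    (y.restrictScalars F : Module.End F E).charpoly = cp F η ↔ (y'.restrictScalars F : Module.End F E).charpoly = cp F η := by
  rw [charpoly_eq_cp_iff, charpoly_eq_cp_iff, aeval_restrict, aeval_restrict, nilp_restrict, nilp_restrict, nilp_iff, nilp_iff, h]

/-- the indicator as a function of the `K`-characteristic polynomial -/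
noncomputable def hh (F K : Type) [Field F] {E : Type} [Field E] [Algebra F E] [Finite E] [Field K] [Algebra F K] [Algebra K E] [IsScalarTower F K E] (η : E) (c : K[X]) : ℂ :=
  if ∃ y : Module.End K E, y.charpoly = c ∧ (y.restrictScalars F : Module.End F E).charpoly = cp F η then 1 else 0

theorem hh_charpoly (η : E) (y : Module.End K E) : hh F K η y.charpoly = if (y.restrictScalars F : Module.End F E).charpoly = cp F η then 1 else 0 := by
  unfold hh
  congr 1
  apply propext
  constructor
  · rintro ⟨y', h1, h2⟩
    exact (restrict_class h1 η).1 h2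
  · intro h; exact ⟨y, rfl, h⟩

variable (ψ : AddChar F ℂ)

noncomputable def psiK (F K : Type) [Field F] [Field K] [Algebra F K] (ψ : AddChar F ℂ) : AddChar K ℂ := ψ.compAddMonoidHom (Algebra.trace F K).toAddMonoidHom

theorem psiK_apply (x : K) : psiK F K ψ x = ψ (Algebra.trace F K x) := rfl

theorem psiK_ne (hψ : ψ ≠ 1) : psiK F K ψ ≠ 1 := by
  rw [AddChar.ne_one_iff] at hψ ⊢
  obtain ⟨a, ha⟩ := hψ
  obtain ⟨x, rfl⟩ := Algebra.trace_surjective F K a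
  exact ⟨x, ha⟩

theorem dg_tower {ξ : E} (h : dg F ξ = finrank F E) : dg K ξ = finrank K E := by
  have h1 := (Field.primitive_element_iff_minpoly_natDegree_eq F ξ).2 h
  apply (Field.primitive_element_iff_minpoly_natDegree_eq K ξ).1
  rw [eq_top_iff]
  intro x _
  have h2 : IntermediateField.adjoin F {ξ} ≤ (IntermediateField.adjoin K {ξ}).restrictScalars F := by
    rw [IntermediateField.adjoin_le_iff]
    intro z hz
    exact IntermediateField.subset_adjoin K {ξ} hz
  rw [h1] at h2
  exact h2 (IntermediateField.mem_top (x := x))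

theorem T_tower (hψ : ψ ≠ 1) {ξ : E} (h : dg F ξ = finrank F E) (hK : ∀ η' : E, NN (psiK F K ψ) η' ξ = AA K E * RR (psiK F K ψ) (cl K η') ξ) (η : E) :
    ∑ y : Module.End K E, ψ (LinearMap.trace F E (y.restrictScalars F * Lm F ξ)) * (if (y.restrictScalars F : Module.End F E).charpoly = cp F η then 1 else 0) =
      AA K E * RR ψ (cl F η) ξ := by
  have hP := gen_prim (psiK F K ψ) (psiK_ne ψ hψ) (dg_tower (K := K) h)
  have h1 := sum_charpoly hP (hh F K η)
  have h2 : ∀ y : Module.End K E, psiK F K ψ (LinearMap.trace K E (y * Lm K ξ)) = ψ (LinearMap.trace F E (y.restrictScalars F * Lm F ξ)) := by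
    intro y
    rw [psiK_apply, ← trace_restrict]; rfl
  simp only [h2, hh_charpoly] at h1
  rw [h1]
  have h3 : ∀ η' : E, sg (fun y : Module.End K E => psiK F K ψ (LinearMap.trace K E (y * Lm K ξ))) η' = AA K E * RR (psiK F K ψ) (cl K η') ξ / dg K η' := by
    intro η'
    rw [← hK, sg, cs]; rfl
  simp only [h2] at h3
  simp only [h3]
  have h4 : ∀ η' : E, RR (psiK F K ψ) (cl K η') ξ = ∑ z : E, (if cp K z = cp K η' then 1 else 0) * ψ (Algebra.trace F E (z * ξ)) := by
    intro η'
    unfold RR cl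
    refine Finset.sum_congr rfl fun z _ => ?_
    rw [psiK_apply, Algebra.trace_trace]
  have h5 : ∀ η' : E, hh F K η (cp K η') = cl F η η' := by
    intro η'
    unfold cp
    rw [hh_charpoly]; rfl
  simp only [h4, h5]
  rw [RR, Finset.mul_sum]
  have h6 : ∀ x : E, AA K E * (∑ z : E, (if cp K z = cp K x then 1 else 0) * ψ (Algebra.trace F E (z * ξ))) / dg K x * cl F η x =
      ∑ z : E, (AA K E * ψ (Algebra.trace F E (z * ξ)) * cl F η z / dg K z) * (if cp K x = cp K z then 1 else 0) := by
    intro x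
    rw [Finset.mul_sum, Finset.sum_div, Finset.sum_mul]
    refine Finset.sum_congr rfl fun z _ => ?_
    by_cases hz : cp K z = cp K x
    · rw [if_pos hz, if_pos hz.symm, dg_congr hz]
      have : cl F η z = cl F η x := by rw [← h5, ← h5, hz]
      rw [this]; ring
    · rw [if_neg hz, if_neg (fun h => hz h.symm)]; simp
  simp only [h6]
  rw [Finset.sum_comm]
  refine Finset.sum_congr rfl fun z _ => ?_
  rw [← Finset.mul_sum]
  have h7 : ∑ x : E, (if cp K x = cp K z then (1 : ℂ) else 0) = dg K z := by
    rw [← Finset.sum_filter, Finset.sum_const, card_class, nsmul_eq_mul, mul_one]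
  rw [h7]
  have := dg_ne (F := K) z
  field_simp

end tower
end MK

set_option linter.all false
namespace MK
open Module Polynomial
open scoped BigOperators Classical

theorem burnside' {G X : Type} [Group G] [Finite G] [Fintype G] [Fintype X] (ρ : G →* Equiv.Perm X) (f : X → ℂ) (hf : ∀ x, IsIntegral ℤ (f x)) (hi : ∀ (g : G) x, f (ρ g x) = f x) :
    ∃ z : ℂ, IsIntegral ℤ z ∧ ∑ g : G, ∑ x : X, (if ρ g x = x then f x else 0) = Nat.card G * z := by
  letI : MulAction G X := MulAction.compHom X ρ
  exact burnside f hf hi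

section bthree
variable {F : Type} [Field F] [Finite F] {E : Type} [Field E] [Algebra F E] [Finite E]

theorem Lm_mul (a b : E) : Lm F (a * b) = Lm F a * Lm F b := by
  apply LinearMap.ext; intro v; simp [mul_assoc]

theorem Lm_one : Lm F (1 : E) = 1 := by
  apply LinearMap.ext; intro v; simp

theorem Lm_inv_mul (g : Eˣ) : Lm F (g⁻¹ : Eˣ).1 * Lm F g.1 = 1 := by
  rw [← Lm_mul, ← Units.val_mul]; simp; rfl

theorem Lm_mul_inv (g : Eˣ) : Lm F g.1 * Lm F (g⁻¹ : Eˣ).1 = 1 := by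
  rw [← Lm_mul, ← Units.val_mul]; simp; rfl

noncomputable def rho (F : Type) [Field F] (E : Type) [Field E] [Algebra F E] : Eˣ →* Equiv.Perm (Module.End F E) :=
  MonoidHom.mk' (fun g =>
    { toFun := fun y => Lm F g.1 * y * Lm F (g⁻¹ : Eˣ).1
      invFun := fun y => Lm F (g⁻¹ : Eˣ).1 * y * Lm F g.1
      left_inv := by
        intro y
        apply LinearMap.ext; intro v
        simp
      right_inv := by
        intro y
        apply LinearMap.ext; intro v
        simp })
    (by
      intro a b
      apply Equiv.ext
      intro y
      apply LinearMap.ext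
      intro v
      simp [mul_assoc, mul_comm, mul_left_comm])

theorem rho_apply (g : Eˣ) (y : Module.End F E) : rho F E g y = Lm F g.1 * y * Lm F (g⁻¹ : Eˣ).1 := rfl

theorem rho_fix (g : Eˣ) (y : Module.End F E) : rho F E g y = y ↔ Lm F g.1 * y = y * Lm F g.1 := by
  rw [rho_apply]
  constructor
  · intro h
    conv_rhs => rw [← h]
    rw [mul_assoc (Lm F g.1 * y), Lm_inv_mul, mul_one]
  · intro h
    rw [h, mul_assoc, Lm_mul_inv, mul_one]

variable (ψ : AddChar F ℂ)

theorem rho_charpoly (g : Eˣ) (y : Module.End F E) : (rho F E g y).charpoly = y.charpoly := by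
  exact charpoly_conj' (LinearEquiv.ofLinear (Lm F g.1) (Lm F (g⁻¹ : Eˣ).1) (Lm_mul_inv g) (Lm_inv_mul g)) y

theorem comm_aeval {A : Type} [Ring A] [Algebra F A] {y x : A} (h : Commute y x) (p : F[X]) : Commute y (aeval x p) := by
  induction p using Polynomial.induction_on' with
  | add p q hp hq => rw [map_add]; exact hp.add_right hq
  | monomial n a =>
    rw [aeval_monomial]
    exact Commute.mul_right (Algebra.commutes a y).symm (h.pow_right n)

theorem comm_sum (a : E) (f : Module.End F E → ℂ) :
    ∑ y : Module.End F E, (if Lm F a * y = y * Lm F a then f y else 0) =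
      ∑ y : Module.End (IntermediateField.adjoin F {a}) E, f (y.restrictScalars F) := by
  rw [← Finset.sum_filter]
  symm
  refine Finset.sum_bij (fun y _ => y.restrictScalars F) ?_ ?_ ?_ ?_
  · intro y _
    rw [Finset.mem_filter]
    refine ⟨Finset.mem_univ _, ?_⟩
    apply LinearMap.ext
    intro v
    have := y.map_smul ⟨a, IntermediateField.mem_adjoin_simple_self F a⟩ v
    exact this.symm
  · intro y _ y' _ h
    apply LinearMap.ext
    intro v
    exact LinearMap.congr_fun h v
  · intro y hy
    rw [Finset.mem_filter] at hy
    refine ⟨{ toFun := y, map_add' := y.map_add, map_smul' := ?_ }, Finset.mem_univ _, rfl⟩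
    rintro ⟨k, hk⟩ v
    have hk' : k ∈ Algebra.adjoin F {a} := by
      rw [← IntermediateField.adjoin_simple_toSubalgebra_of_isAlgebraic (isInt a).isAlgebraic]
      exact hk
    rw [Algebra.adjoin_singleton_eq_range_aeval] at hk'
    obtain ⟨p, hp⟩ := hk'
    have h1 : Commute y (aeval (Lm F a) p) := by
      have : Commute y (Lm F a) := hy.2.symm
      exact (comm_aeval this p)
    rw [aeval_Lm] at h1
    have h2 := LinearMap.congr_fun h1.eq v
    change y (k * v) = k * y v
    have hp' : aeval a p = k := hp
    rw [← hp']
    exact h2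
  · intro y _; rfl

theorem dg_one_iff (a : E) : dg F a = 1 ↔ ∃ z : F, algebraMap F E z = a := by
  rw [dg, minpoly.natDegree_eq_one_iff]; rfl

theorem finrank_adj (a : E) : finrank F (IntermediateField.adjoin F {a}) = dg F a := IntermediateField.adjoin.finrank (isInt a)

theorem finrank_adj' (a : E) : finrank (IntermediateField.adjoin F {a}) E = finrank F E / dg F a := by
  have := Module.finrank_mul_finrank F (IntermediateField.adjoin F {a}) E
  rw [finrank_adj] at this
  rw [← this, Nat.mul_div_cancel_left _ (dg_pos a)]

theorem AA_adj (a : E) : AA (IntermediateField.adjoin F {a}) E = AI F a := by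
  rw [AA, AI, finrank_adj', cardE_nat (F := F) (E := IntermediateField.adjoin F {a}), finrank_adj]
  push_cast; rfl

theorem B3 (hψ : ψ ≠ 1) {ξ : E} (h : dg F ξ = finrank F E)
    (ih : ∀ (K : Type) [Field K] [Finite K] [Algebra K E] (ψ' : AddChar K ℂ), ψ' ≠ 1 → finrank K E < finrank F E → dg K ξ = finrank K E → ∀ η' : E, NN ψ' η' ξ = AA K E * RR ψ' (cl K η') ξ) (η : E) :
    ∃ z : ℂ, IsIntegral ℤ z ∧ ((Nat.card F : ℂ) - 1) * (NN ψ η ξ - AA F E * RR ψ (cl F η) ξ) = ((Nat.card F : ℂ) ^ finrank F E - 1) * z := by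
  let f : Module.End F E → ℂ := fun y => ψ (LinearMap.trace F E (y * Lm F ξ)) * (if y.charpoly = cp F η then 1 else 0)
  obtain ⟨z, hz, hs⟩ := burnside' (rho F E) f (by
    intro y
    refine (psi_integral ψ _).mul ?_
    split_ifs
    · exact isIntegral_one
    · exact isIntegral_zero) (by
    intro g y
    simp only [f]
    rw [rho_charpoly, rho_apply]
    have : LinearMap.trace F E (Lm F g.1 * y * Lm F (g⁻¹ : Eˣ).1 * Lm F ξ) = LinearMap.trace F E (y * Lm F ξ) := by
      rw [mul_assoc, ← Lm_mul, mul_comm _ ξ, Lm_mul, ← mul_assoc, LinearMap.trace_mul_comm, ← mul_assoc, ← mul_assoc, Lm_inv_mul, one_mul]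
    rw [this])
  simp only [rho_fix] at hs
  set X := RR ψ (cl F η) ξ with hX
  have h1 : ∀ a : Eˣ, ∑ y : Module.End F E, (if Lm F a.1 * y = y * Lm F a.1 then f y else 0) =
      AI F a.1 * X + (if dg F a.1 ∣ 1 then NN ψ η ξ - AA F E * X else 0) := by
    intro a
    split_ifs with hd
    · rw [Nat.dvd_one] at hd
      have hA : (AI F a.1 : ℂ) = AA F E := by
        rw [AA, AI, hd]; push_cast; simp
      obtain ⟨t, ht⟩ := (dg_one_iff a.1).1 hd
      have : ∀ y : Module.End F E, Lm F a.1 * y = y * Lm F a.1 := by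
        intro y
        apply LinearMap.ext
        intro v
        rw [Module.End.mul_apply, Module.End.mul_apply, LinearMap.mulLeft_apply, LinearMap.mulLeft_apply, ← ht, ← Algebra.smul_def, ← Algebra.smul_def, map_smul]
      simp only [this, if_true]
      rw [hA]
      change NN ψ η ξ = _
      ring
    · rw [Nat.dvd_one] at hd
      rw [comm_sum, add_zero, ← AA_adj]
      apply T_tower ψ hψ h
      intro η'
      apply ih _ _ (psiK_ne ψ hψ) _ (dg_tower h)
      rw [finrank_adj']
      apply Nat.div_lt_self finrank_pos
      have := dg_pos (F := F) a.1
      omega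
  simp only [h1] at hs
  rw [Finset.sum_add_distrib, ← Finset.sum_mul, ← Finset.sum_filter, Finset.sum_const, card_fix_units 1 (one_dvd _), nsmul_eq_mul, pow_one,
    Nat.card_units, cardE_nat (F := F) (E := E), Nat.cast_sub (Nat.one_le_pow _ _ Nat.card_pos), Nat.cast_sub Nat.card_pos] at hs
  obtain ⟨u, hu⟩ := AI_sum (F := F) (E := E)
  have hu' : ∑ a : Eˣ, (AI F a.1 : ℂ) = ((Nat.card F : ℂ) ^ finrank F E - 1) * u := by
    have := congrArg (fun x : ℤ => (x : ℂ)) hu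
    push_cast at this
    exact this
  rw [hu'] at hs
  push_cast at hs
  refine ⟨z - u * X, hz.sub ((isIntegral_int u).mul ?_), by linear_combination hs⟩
  rw [hX, RR]
  refine IsIntegral.sum _ fun x _ => IsIntegral.mul ?_ (psi_integral ψ _)
  unfold cl
  split_ifs
  · exact isIntegral_one
  · exact isIntegral_zero

end bthree
end MK

set_option linter.all false
namespace MK
open Module Polynomial
open scoped BigOperators Classical

section bfour
variable {F : Type} [Field F] [Finite F] {E : Type} [Field E] [Algebra F E] [Finite E]
variable (ψ : AddChar F ℂ)

noncomputable def del (ξ η : E) : ℂ := NN ψ η ξ - AA F E * RR ψ (cl F η) ξ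

noncomputable def nc (F : Type) [Field F] {E : Type} [Field E] [Algebra F E] [Finite E] [Finite F] (ξ η : E) (c : F) : ℤ :=
  (∑ y : Module.End F E, if LinearMap.trace F E (y * Lm F ξ) = c ∧ y.charpoly = cp F η then 1 else 0) -
  ((-1) ^ (finrank F E - 1) * (Nat.card (nn F (finrank F E) 0) : ℤ)) * ∑ x : E, if Algebra.trace F E (x * ξ) = c ∧ cp F x = cp F η then 1 else 0

theorem sum_fib {X : Type} [Fintype X] [Fintype F] (T : X → F) (P : X → Prop) [DecidablePred P] [∀ x c, Decidable (T x = c ∧ P x)] (t : F) :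
    ∑ c : F, ((∑ x : X, if T x = c ∧ P x then (1 : ℂ) else 0)) * ψ (t * c) = ∑ x : X, ψ (t * T x) * (if P x then 1 else 0) := by
  simp only [Finset.sum_mul]
  rw [Finset.sum_comm]
  refine Finset.sum_congr rfl fun x _ => ?_
  rw [Finset.sum_eq_single (T x)]
  · by_cases h : P x <;> simp [h]
  · intro c _ hc
    rw [if_neg (fun h => hc h.1.symm), zero_mul]
  · intro h; exact absurd (Finset.mem_univ _) h

theorem smul_Lm (y : Module.End F E) (ξ : E) (t z : F) : LinearMap.trace F E ((t • y + z • (1 : Module.End F E)) * Lm F ξ) = t * LinearMap.trace F E (y * Lm F ξ) + z * Algebra.trace F E ξ := by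
  rw [add_mul, smul_mul_assoc, smul_mul_assoc, one_mul, map_add, map_smul, map_smul, smul_eq_mul, smul_eq_mul]
  rfl

theorem del_affine (ξ η : E) (t z : F) (ht : t ≠ 0) :
    del ψ ξ (t • η + algebraMap F E z) = ψ (z * Algebra.trace F E ξ) * ∑ c : F, (nc F ξ η c : ℂ) * ψ (t * c) := by
  have h1 : NN ψ (t • η + algebraMap F E z) ξ = ψ (z * Algebra.trace F E ξ) * ∑ y : Module.End F E, ψ (t * LinearMap.trace F E (y * Lm F ξ)) * (if y.charpoly = cp F η then 1 else 0) := by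
    let e : Module.End F E ≃ Module.End F E :=
      { toFun := fun y => t • y + z • 1
        invFun := fun y => t⁻¹ • (y - z • 1)
        left_inv := fun y => by simp [smul_smul, ht]
        right_inv := fun y => by simp [smul_smul, ht] }
    rw [NN, ← Equiv.sum_comp e, Finset.mul_sum]
    refine Finset.sum_congr rfl fun y _ => ?_
    change ψ (LinearMap.trace F E ((t • y + z • (1 : Module.End F E)) * Lm F ξ)) * (if (t • y + z • (1 : Module.End F E)).charpoly = cp F (t • η + algebraMap F E z) then 1 else 0) = _
    rw [smul_Lm, AddChar.map_add_eq_mul]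
    simp only [charpoly_affine t z ht]
    ring
  have h2 : RR ψ (cl F (t • η + algebraMap F E z)) ξ = ψ (z * Algebra.trace F E ξ) * ∑ x : E, ψ (t * Algebra.trace F E (x * ξ)) * (if cp F x = cp F η then 1 else 0) := by
    let e : E ≃ E :=
      { toFun := fun y => t • y + algebraMap F E z
        invFun := fun y => t⁻¹ • (y - algebraMap F E z)
        left_inv := fun y => by simp [smul_smul, ht]
        right_inv := fun y => by simp [smul_smul, ht] }
    rw [RR, ← Equiv.sum_comp e, Finset.mul_sum]
    refine Finset.sum_congr rfl fun x _ => ?_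
    change (if cp F (t • x + algebraMap F E z) = cp F (t • η + algebraMap F E z) then (1 : ℂ) else 0) * ψ (Algebra.trace F E ((t • x + algebraMap F E z) * ξ)) = _
    simp only [cp_affine t z ht]
    rw [add_mul, smul_mul_assoc, ← Algebra.smul_def, map_add, map_smul, map_smul, AddChar.map_add_eq_mul, smul_eq_mul, smul_eq_mul]
    ring
  rw [del, h1, h2, ← sum_fib ψ (fun y : Module.End F E => LinearMap.trace F E (y * Lm F ξ)), ← sum_fib ψ (fun x : E => Algebra.trace F E (x * ξ)), AA_eq]
  simp only [nc]
  rw [mul_left_comm, ← mul_sub, Finset.mul_sum (s := Finset.univ) (a := (-1) ^ (finrank F E - 1) * _), ← Finset.sum_sub_distrib]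
  congr 1
  refine Finset.sum_congr rfl fun c _ => ?_
  push_cast
  ring

theorem sq_sum (hψ : ψ ≠ 1) (n : F → ℤ) : ∑ t : Fˣ, (‖∑ c : F, (n c : ℂ) * ψ (t.1 * c)‖ ^ 2 : ℝ) = ((Nat.card F * ∑ c, n c ^ 2 - (∑ c, n c) ^ 2 : ℤ) : ℝ) := by
  have h := RR_iso (F := F) (E := F) ψ hψ (fun c => (n c : ℂ)) (fun c => (n c : ℂ))
  have h1 : ∀ t : F, RR (E := F) ψ (fun c => (n c : ℂ)) t = ∑ c : F, (n c : ℂ) * ψ (t * c) := by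
    intro t
    unfold RR
    refine Finset.sum_congr rfl fun c _ => ?_
    rw [Algebra.trace_self_apply, mul_comm t]
  simp only [h1, Complex.mul_conj'] at h
  have h2 : ∑ t : F, (‖∑ c : F, (n c : ℂ) * ψ (t * c)‖ ^ 2 : ℝ) = Nat.card F * ∑ c, (n c : ℝ) ^ 2 := by
    apply Complex.ofReal_injective
    push_cast
    rw [h]
    congr 1
    refine Finset.sum_congr rfl fun c _ => ?_
    have : ‖(n c : ℂ)‖ = |(n c : ℝ)| := by rw [← Complex.ofReal_intCast, Complex.norm_real]; rfl
    rw [this]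
    rw [← Complex.ofReal_pow, sq_abs]; simp
  rw [← Finset.add_sum_erase _ _ (Finset.mem_univ (0 : F))] at h2
  have h3 : ∑ t : Fˣ, (‖∑ c : F, (n c : ℂ) * ψ (t.1 * c)‖ ^ 2 : ℝ) = ∑ t ∈ Finset.univ.erase (0 : F), (‖∑ c : F, (n c : ℂ) * ψ (t * c)‖ ^ 2 : ℝ) := by
    refine Finset.sum_bij (fun t _ => t.1) ?_ ?_ ?_ ?_
    · intro t _; simp
    · intro t _ s _ h; exact Units.ext h
    · intro t ht
      have : t ≠ 0 := by simpa using ht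
      exact ⟨Units.mk0 t this, Finset.mem_univ _, rfl⟩
    · intro t _; rfl
  rw [h3]
  have h4 : (‖∑ c : F, (n c : ℂ) * ψ (0 * c)‖ ^ 2 : ℝ) = (∑ c, (n c : ℝ)) ^ 2 := by
    have : ∑ c : F, (n c : ℂ) * ψ (0 * c) = ((∑ c, (n c : ℝ) : ℝ) : ℂ) := by
      push_cast
      exact Finset.sum_congr rfl fun c _ => by simp
    rw [this, Complex.norm_real, Real.norm_eq_abs, sq_abs]
  rw [h4] at h2
  push_cast
  linarith

theorem rat_integral {r : ℚ} (h : IsIntegral ℤ (r : ℂ)) (h0 : 0 < r) : 1 ≤ r := by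
  have h1 : IsIntegral ℤ r := by
    have : (r : ℂ) = algebraMap ℚ ℂ r := rfl
    rw [this, isIntegral_algebraMap_iff (algebraMap ℚ ℂ).injective] at h
    exact h
  obtain ⟨m, hm⟩ := IsIntegrallyClosed.isIntegral_iff.1 h1
  have hm' : (m : ℚ) = r := hm
  rw [← hm'] at h0 ⊢
  have : (0 : ℤ) < m := by exact_mod_cast h0
  exact_mod_cast this

noncomputable def MM (F E : Type) [Field F] [Field E] [Algebra F E] : ℕ := ∑ i ∈ Finset.range (finrank F E), Nat.card F ^ i

theorem MM_mul : ((Nat.card F : ℂ) - 1) * MM F E = (Nat.card F : ℂ) ^ finrank F E - 1 := by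
  rw [MM]; push_cast; exact mul_geom_sum _ _

theorem q_ne : ((Nat.card F : ℂ) - 1) ≠ 0 := by
  rw [sub_ne_zero]
  have : 1 < Nat.card F := Finite.one_lt_card
  exact_mod_cast this.ne'

theorem MM_pos : 0 < MM F E := by
  rw [MM]
  apply Finset.sum_pos
  · intro i _; exact pow_pos Nat.card_pos _
  · rw [Finset.nonempty_range_iff]; exact (finrank_pos (R := F) (M := E)).ne'

theorem MM_cop : IsCoprime (MM F E : ℤ) (Nat.card (nn F (finrank F E) 0)) := by
  apply IsCoprime.of_mul_left_right (x := (Nat.card F : ℤ) - 1)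
  have h := cop_card (F := F) (E := E)
  have : ((Nat.card F : ℤ) - 1) * MM F E = (Nat.card E : ℤ) - 1 := by
    rw [MM, cardE_nat (F := F) (E := E)]; push_cast; exact mul_geom_sum _ _
  rwa [this]

theorem del_integral (hψ : ψ ≠ 1) {ξ : E} (h : dg F ξ = finrank F E) (h0 : ξ ≠ 0)
    (ih : ∀ (K : Type) [Field K] [Finite K] [Algebra K E] (ψ' : AddChar K ℂ), ψ' ≠ 1 → finrank K E < finrank F E → dg K ξ = finrank K E → ∀ η' : E, NN ψ' η' ξ = AA K E * RR ψ' (cl K η') ξ) {η : E} (hη : η ≠ 0) :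
    IsIntegral ℤ (del ψ ξ η / (Nat.card (nn F (finrank F E) 0) * MM F E)) := by
  have hc : (Nat.card (nn F (finrank F E) 0) : ℂ) ≠ 0 := by exact_mod_cast Nat.card_pos.ne'
  have hM : (MM F E : ℂ) ≠ 0 := by exact_mod_cast MM_pos.ne'
  apply bezout (MM_cop (F := F) (E := E))
  · have h1 : ((MM F E : ℤ) : ℂ) * (del ψ ξ η / (Nat.card (nn F (finrank F E) 0) * MM F E)) = NN ψ η ξ / Nat.card (nn F (finrank F E) 0) - ((-1) ^ (finrank F E - 1) : ℤ) * RR ψ (cl F η) ξ := by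
      rw [del, AA_eq]; push_cast
      field_simp
    rw [h1]
    refine (NN_U ψ hψ h h0 hη).sub ((isIntegral_int _).mul ?_)
    rw [RR]
    refine IsIntegral.sum _ fun x _ => IsIntegral.mul ?_ (psi_integral ψ _)
    unfold cl
    split_ifs
    · exact isIntegral_one
    · exact isIntegral_zero
  · obtain ⟨z, hz, hs⟩ := B3 ψ hψ h ih η
    have h1 : ((Nat.card (nn F (finrank F E) 0) : ℤ) : ℂ) * (del ψ ξ η / (Nat.card (nn F (finrank F E) 0) * MM F E)) = z := by
      rw [← MM_mul, mul_assoc] at hs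
      have := mul_left_cancel₀ q_ne hs
      rw [del, this]; push_cast
      field_simp
    rw [h1]; exact hz

theorem del_sum_ge (hψ : ψ ≠ 1) {ξ η : E} {C : ℕ} (hC : 0 < C) (hIntg : ∀ t : Fˣ, IsIntegral ℤ (del ψ ξ (t.1 • η) / C)) (hne : del ψ ξ η ≠ 0) :
    (C : ℝ) ^ 2 ≤ ∑ t : Fˣ, ‖del ψ ξ (t.1 • η)‖ ^ 2 := by
  have h1 : ∀ t : Fˣ, del ψ ξ (t.1 • η) = ∑ c : F, (nc F ξ η c : ℂ) * ψ (t.1 * c) := by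
    intro t
    have := del_affine ψ ξ η t.1 0 t.ne_zero
    simpa using this
  have hC' : (C : ℝ) ≠ 0 := by exact_mod_cast hC.ne'
  set s : ℤ := Nat.card F * ∑ c, nc F ξ η c ^ 2 - (∑ c, nc F ξ η c) ^ 2 with hs
  have h2 : ∑ t : Fˣ, ‖del ψ ξ (t.1 • η)‖ ^ 2 = (s : ℝ) := by
    simp only [h1]
    exact sq_sum ψ hψ _
  have hpos : 0 < ∑ t : Fˣ, ‖del ψ ξ (t.1 • η)‖ ^ 2 := by
    refine Finset.sum_pos' (fun t _ => by positivity) ⟨1, Finset.mem_univ _, ?_⟩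
    have : ‖del ψ ξ η‖ ≠ 0 := norm_ne_zero_iff.2 hne
    simp only [Units.val_one, one_smul]
    positivity
  have h3 : IsIntegral ℤ (((s : ℚ) / (C : ℚ) ^ 2 : ℚ) : ℂ) := by
    have : (((s : ℚ) / (C : ℚ) ^ 2 : ℚ) : ℂ) = ∑ t : Fˣ, (del ψ ξ (t.1 • η) / C) * starRingEnd ℂ (del ψ ξ (t.1 • η) / C) := by
      simp only [Complex.mul_conj', norm_div, Complex.norm_natCast]
      have := congrArg (fun x : ℝ => (x : ℂ)) h2
      push_cast at this ⊢
      rw [← this, Finset.sum_div]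
      refine Finset.sum_congr rfl fun t _ => ?_
      rw [div_pow]
    rw [this]
    refine IsIntegral.sum _ fun t _ => (hIntg t).mul ?_
    exact (hIntg t).map (starRingEnd ℂ).toIntAlgHom
  have hsp : (0 : ℤ) < s := by rw [h2] at hpos; exact_mod_cast hpos
  have h4 := rat_integral h3 (by positivity)
  rw [le_div_iff₀ (by positivity), one_mul] at h4
  rw [h2]
  exact_mod_cast h4

end bfour
end MK

set_option linter.all false
namespace MK
open Module Polynomial
open scoped BigOperators Classical

theorem num18 {q n : ℕ} (hq : 2 ≤ q) (hn : 2 ≤ n) : 4 * n * q ^ n < q * (∑ i ∈ Finset.range n, q ^ i) ^ 2 + 4 * n ^ 2 * q := by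
  rcases eq_or_lt_of_le hn with rfl | hn
  · simp [Finset.sum_range_succ]; nlinarith [sq_nonneg ((q:ℤ) - 3)]
  rcases eq_or_lt_of_le (Nat.succ_le_of_lt hn) with rfl | hn
  · simp [Finset.sum_range_succ]
    have h1 : 7 * q ≤ 2 * (1 + q + q ^ 2) := by nlinarith [mul_nonneg (sub_nonneg.2 (show (2:ℤ) ≤ q by exact_mod_cast hq)) (sub_nonneg.2 (show (2:ℤ) ≤ q by exact_mod_cast hq))]
    have h2 : (7 * q) ^ 2 ≤ (2 * (1 + q + q ^ 2)) ^ 2 := Nat.pow_le_pow_left h1 2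
    nlinarith
  obtain ⟨m, rfl⟩ : ∃ m, n = m + 4 := ⟨n - 4, by omega⟩
  have h1 : q ^ (m + 2) * (q + 1) ≤ ∑ i ∈ Finset.range (m + 4), q ^ i := by
    rw [Finset.sum_range_succ, Finset.sum_range_succ]
    have : q ^ (m + 2) * (q + 1) = q ^ (m + 2) + q ^ (m + 3) := by ring
    omega
  have h2 : (q ^ (m + 2) * (q + 1)) ^ 2 ≤ (∑ i ∈ Finset.range (m + 4), q ^ i) ^ 2 := Nat.pow_le_pow_left h1 2
  have h3 : 4 * (m + 4) < 2 ^ (m + 1) * 9 := by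
    clear h1 h2 hn
    induction m with
    | zero => norm_num
    | succ m ih => rw [pow_succ]; omega
  have h4 : 2 ^ (m + 1) ≤ q ^ (m + 1) := Nat.pow_le_pow_left hq _
  have h5 : 9 ≤ (q + 1) ^ 2 := by nlinarith
  have h6 : 4 * (m + 4) < q ^ (m + 1) * (q + 1) ^ 2 := lt_of_lt_of_le h3 (Nat.mul_le_mul h4 h5)
  have h7 : q * (q ^ (m + 2) * (q + 1)) ^ 2 = q ^ (m + 4) * (q ^ (m + 1) * (q + 1) ^ 2) := by ring
  have h8 : 0 < q ^ (m + 4) := by positivity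
  have h9 : 4 * (m + 4) * q ^ (m + 4) < q * (q ^ (m + 2) * (q + 1)) ^ 2 := by
    rw [h7, mul_comm]; exact Nat.mul_lt_mul_of_pos_left h6 h8
  have h10 := Nat.mul_le_mul_left q h2
  omega

section gen
variable {F : Type} [Field F] [Finite F] {E : Type} [Field E] [Algebra F E] [Finite E]
variable (ψ : AddChar F ℂ)

theorem cl_sq (ξ : E) : ∑ η, cl F ξ η * starRingEnd ℂ (cl F ξ η) = dg F ξ := by
  have := cl_pair (F := F) ξ (cl_inv (F := F) ξ)
  have h1 : cl F ξ ξ = 1 := by simp [cl]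
  rw [h1, mul_one] at this
  rw [← this]
  refine Finset.sum_congr rfl fun η _ => ?_
  unfold cl; split_ifs <;> simp

theorem tt_sq (hψ : ψ ≠ 1) (ξ : E) : ∑ η, ‖TT ψ (cl F ξ) η‖ ^ 2 = (Nat.card E : ℝ) * dg F ξ := by
  have h := TT_iso ψ hψ (cl_inv (F := F) ξ) (cl_inv (F := F) ξ)
  rw [cl_sq] at h
  simp only [Complex.mul_conj'] at h
  exact_mod_cast h

theorem rr_sq (hψ : ψ ≠ 1) (ξ : E) : ∑ η, ‖RR ψ (cl F ξ) η‖ ^ 2 = (Nat.card E : ℝ) * dg F ξ := by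
  have h := RR_iso ψ hψ (cl F ξ) (cl F ξ)
  rw [cl_sq] at h
  simp only [Complex.mul_conj'] at h
  exact_mod_cast h

theorem dg_alg (z : F) : dg F (algebraMap F E z) = 1 := (dg_one_iff _).2 ⟨z, rfl⟩

theorem cl_alg (z : F) (x : E) : cl F (algebraMap F E z) x = if x = algebraMap F E z then 1 else 0 := by
  unfold cl
  congr 1
  apply propext
  constructor
  · intro h
    obtain ⟨σ, hσ⟩ := exists_conj h.symm
    rw [← hσ, σ.commutes]
  · rintro rfl; rfl

theorem rr_scalar (ξ : E) (z : F) : ‖RR ψ (cl F ξ) (algebraMap F E z)‖ = dg F ξ := by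
  have h := RR_cl_symm ψ ξ (algebraMap F E z)
  rw [dg_alg, Nat.cast_one, one_mul] at h
  rw [h, RR]
  simp [cl_alg]

theorem tt_sub (hψ : ψ ≠ 1) {ξ : E} (h : dg F ξ = finrank F E) (η : E) :
    (dg F η : ℂ) * (TT ψ (cl F ξ) η - RR ψ (cl F ξ) η) = finrank F E * (del ψ ξ η / AA F E) := by
  rw [mul_sub, TT_cl_symm ψ hψ, RR_cl_symm ψ, TT_gen ψ hψ h, h, del]
  have := AA_ne (F := F) (E := E)
  field_simp

theorem AA_norm : ‖AA F E‖ = Nat.card (nn F (finrank F E) 0) := by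
  rw [AA_eq]; simp

theorem tt_ge (hψ : ψ ≠ 1) {ξ : E} (h : dg F ξ = finrank F E) (η : E) :
    (‖del ψ ξ η‖ / Nat.card (nn F (finrank F E) 0)) ^ 2 ≤ ‖TT ψ (cl F ξ) η - RR ψ (cl F ξ) η‖ ^ 2 := by
  have h1 := congrArg norm (tt_sub ψ hψ h η)
  rw [norm_mul, norm_mul, norm_div, AA_norm, Complex.norm_natCast, Complex.norm_natCast] at h1
  refine pow_le_pow_left₀ (by positivity) ?_ 2
  have h2 : (dg F η : ℝ) ≤ finrank F E := by exact_mod_cast dg_le η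
  have h3 : (0 : ℝ) < finrank F E := by exact_mod_cast (Module.finrank_pos (R := F) (M := E))
  have h4 := mul_le_mul_of_nonneg_right h2 (norm_nonneg (TT ψ (cl F ξ) η - RR ψ (cl F ξ) η))
  rw [h1] at h4
  exact le_of_mul_le_mul_left h4 h3

theorem tt_upper (hψ : ψ ≠ 1) {ξ : E} (h : dg F ξ = finrank F E) :
    ∑ η, ‖TT ψ (cl F ξ) η - RR ψ (cl F ξ) η‖ ^ 2 ≤ 4 * ((Nat.card E : ℝ) * finrank F E - Nat.card F * (finrank F E : ℝ) ^ 2) := by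
  have h1 : ∀ η : E, ‖TT ψ (cl F ξ) η - RR ψ (cl F ξ) η‖ ^ 2 ≤ 2 * ‖TT ψ (cl F ξ) η‖ ^ 2 + 2 * ‖RR ψ (cl F ξ) η‖ ^ 2 - ∑ z : F, if η = algebraMap F E z then 4 * (finrank F E : ℝ) ^ 2 else 0 := by
    intro η
    by_cases hη : ∃ z : F, η = algebraMap F E z
    · obtain ⟨z, rfl⟩ := hη
      rw [TT_scalar ψ hψ (cl_inv ξ), rr_scalar, h, Finset.sum_eq_single z]
      · simp; ring_nf; rfl
      · intro z' _ hz
        rw [if_neg]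
        intro h; exact hz ((algebraMap F E).injective h.symm)
      · simp
    · rw [Finset.sum_eq_zero]
      · have h2 := norm_sub_le (TT ψ (cl F ξ) η) (RR ψ (cl F ξ) η)
        have h3 := pow_le_pow_left₀ (norm_nonneg _) h2 2
        nlinarith [sq_nonneg (‖TT ψ (cl F ξ) η‖ - ‖RR ψ (cl F ξ) η‖)]
      · intro z _
        rw [if_neg]
        exact fun h => hη ⟨z, h⟩
  refine (Finset.sum_le_sum fun η _ => h1 η).trans ?_
  rw [Finset.sum_sub_distrib, Finset.sum_add_distrib, ← Finset.mul_sum, ← Finset.mul_sum, tt_sq ψ hψ, rr_sq ψ hψ, h, Finset.sum_comm]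
  simp
  rw [← Nat.card_eq_fintype_card]
  linarith

theorem gen_step (hψ : ψ ≠ 1) {ξ : E} (h : dg F ξ = finrank F E)
    (ih : ∀ (K : Type) [Field K] [Finite K] [Algebra K E] (ψ' : AddChar K ℂ), ψ' ≠ 1 → finrank K E < finrank F E → dg K ξ = finrank K E → ∀ η' : E, NN ψ' η' ξ = AA K E * RR ψ' (cl K η') ξ) (η : E) :
    NN ψ η ξ = AA F E * RR ψ (cl F η) ξ := by
  by_cases hη : ∃ z : F, algebraMap F E z = η
  · obtain ⟨z, rfl⟩ := hη
    exact NN_scalar ψ hψ h z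
  by_contra hne
  have hd : del ψ ξ η ≠ 0 := sub_ne_zero.2 hne
  have hn2 : 2 ≤ finrank F E := by
    have h1 := dg_le (F := F) η
    have h2 := dg_pos (F := F) η
    have h3 : dg F η ≠ 1 := fun h => hη ((dg_one_iff η).1 h)
    omega
  have h0 : ξ ≠ 0 := by
    rintro rfl
    have : dg F (0 : E) = 1 := (dg_one_iff _).2 ⟨0, map_zero _⟩
    omega
  have hη0 : η ≠ 0 := fun h => hη ⟨0, by rw [h, map_zero]⟩
  have hU : 0 < Nat.card (nn F (finrank F E) 0) := Nat.card_pos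
  have hge := del_sum_ge ψ hψ (ξ := ξ) (η := η) (C := Nat.card (nn F (finrank F E) 0) * MM F E) (Nat.mul_pos hU MM_pos)
    (fun t => by
      have := del_integral ψ hψ h h0 ih (η := t.1 • η) (smul_ne_zero t.ne_zero hη0)
      exact_mod_cast this) hd
  have hlow : (Nat.card F : ℝ) * (MM F E : ℝ) ^ 2 ≤ ∑ η, ‖TT ψ (cl F ξ) η - RR ψ (cl F ξ) η‖ ^ 2 := by
    have hinj : Function.Injective (fun p : Fˣ × F => p.1.1 • η + algebraMap F E p.2) := by
      rintro ⟨t, z⟩ ⟨t', z'⟩ heq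
      simp only at heq
      have e1 : (t.1 - t'.1) • η = algebraMap F E (z' - z) := by
        rw [sub_smul, map_sub]; linear_combination heq
      by_cases ht : t.1 - t'.1 = 0
      · rw [ht, zero_smul] at e1
        have e2 := (map_eq_zero_iff _ (algebraMap F E).injective).1 e1.symm
        exact Prod.ext (Units.ext (sub_eq_zero.1 ht)) (sub_eq_zero.1 e2).symm
      · exact absurd ⟨(t.1 - t'.1)⁻¹ * (z' - z), by rw [map_mul, ← e1, ← Algebra.smul_def, smul_smul, inv_mul_cancel₀ ht, one_smul]⟩ hη
    have s1 : ∑ p : Fˣ × F, ‖TT ψ (cl F ξ) (p.1.1 • η + algebraMap F E p.2) - RR ψ (cl F ξ) (p.1.1 • η + algebraMap F E p.2)‖ ^ 2 ≤ ∑ η, ‖TT ψ (cl F ξ) η - RR ψ (cl F ξ) η‖ ^ 2 := by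
      rw [← Finset.sum_image (s := Finset.univ) (f := fun η : E => ‖TT ψ (cl F ξ) η - RR ψ (cl F ξ) η‖ ^ 2) (g := fun p : Fˣ × F => p.1.1 • η + algebraMap F E p.2) (fun _ _ _ _ h => hinj h)]
      exact Finset.sum_le_sum_of_subset_of_nonneg (Finset.subset_univ _) fun _ _ _ => by positivity
    refine le_trans ?_ s1
    refine le_trans ?_ (Finset.sum_le_sum fun p _ => tt_ge ψ hψ h _)
    have s2 : ∀ (t : Fˣ) (z : F), ‖del ψ ξ (t.1 • η + algebraMap F E z)‖ = ‖del ψ ξ (t.1 • η)‖ := by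
      intro t z
      have a1 := del_affine ψ ξ η t.1 z t.ne_zero
      have a2 := del_affine ψ ξ η t.1 0 t.ne_zero
      rw [map_zero, add_zero, zero_mul, AddChar.map_zero_eq_one, one_mul] at a2
      rw [a1, ← a2, norm_mul, AddChar.norm_apply, one_mul]
    rw [Fintype.sum_prod_type]
    simp only [s2, Finset.sum_const, Finset.card_univ, nsmul_eq_mul, ← Nat.card_eq_fintype_card]
    rw [← Finset.mul_sum]
    refine mul_le_mul_of_nonneg_left ?_ (by positivity)
    simp only [div_pow]
    rw [← Finset.sum_div, le_div_iff₀ (by positivity)]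
    push_cast at hge
    linarith [hge]
  have hup := hlow.trans (tt_upper ψ hψ h)
  have hq : 2 ≤ Nat.card F := Finite.one_lt_card
  have hnum := num18 hq hn2
  rw [cardE_nat (F := F) (E := E)] at hup
  have hnum' : (4 * finrank F E * Nat.card F ^ finrank F E : ℝ) < Nat.card F * (MM F E : ℝ) ^ 2 + 4 * (finrank F E : ℝ) ^ 2 * Nat.card F := by
    unfold MM; exact_mod_cast hnum
  push_cast at hup
  linarith

end gen

theorem GEN_aux {E : Type} [Field E] [Finite E] (ξ : E) : ∀ (n : ℕ) (F : Type) [Field F] [Finite F] [Algebra F E] (ψ : AddChar F ℂ), ψ ≠ 1 → finrank F E = n → dg F ξ = finrank F E →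
    ∀ η : E, NN ψ η ξ = AA F E * RR ψ (cl F η) ξ := by
  intro n
  induction n using Nat.strong_induction_on with
  | _ n ih =>
    intro F _ _ _ ψ hψ hn h η
    refine gen_step ψ hψ h (fun K _ _ _ ψ' hψ' hlt hK η' => ?_) η
    exact ih _ (hn ▸ hlt) K ψ' hψ' rfl hK η'

theorem GEN {F : Type} [Field F] [Finite F] {E : Type} [Field E] [Algebra F E] [Finite E] (ψ : AddChar F ℂ) (hψ : ψ ≠ 1) {ξ : E} (h : dg F ξ = finrank F E) (η : E) :
    NN ψ η ξ = AA F E * RR ψ (cl F η) ξ := GEN_aux ξ _ F ψ hψ rfl h η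
end MK

set_option linter.all false
namespace MK
open Module Polynomial
open scoped BigOperators Classical

section low
variable {F : Type} [Field F] [Finite F] {E : Type} [Field E] [Algebra F E] [Finite E]
variable (ψ : AddChar F ℂ)

theorem uncert (hψ : ψ ≠ 1) (f : E → ℂ) (A B : Finset E) (hA : ∀ x, f x ≠ 0 → x ∈ A) (hB : ∀ x, RR ψ f x ≠ 0 → x ∈ B)
    (h : A.card * B.card < Nat.card E) : f = 0 := by
  have h1 : ∑ y, ‖RR ψ f y‖ ^ 2 = (Nat.card E : ℝ) * ∑ x, ‖f x‖ ^ 2 := by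
    have := RR_iso ψ hψ f f
    simp only [Complex.mul_conj'] at this
    exact_mod_cast this
  have hsA : ∑ x ∈ A, ‖f x‖ ^ 2 = ∑ x, ‖f x‖ ^ 2 := by
    refine Finset.sum_subset (Finset.subset_univ _) fun x _ hx => ?_
    have : f x = 0 := by by_contra h; exact hx (hA x h)
    simp [this]
  have h2 : ∀ y, ‖RR ψ f y‖ ^ 2 ≤ A.card * ∑ x, ‖f x‖ ^ 2 := by
    intro y
    have e1 : RR ψ f y = ∑ x ∈ A, f x * ψ (Algebra.trace F E (x * y)) := by
      rw [RR]
      symm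
      refine Finset.sum_subset (Finset.subset_univ _) fun x _ hx => ?_
      have : f x = 0 := by by_contra h; exact hx (hA x h)
      simp [this]
    have e2 : ‖RR ψ f y‖ ≤ ∑ x ∈ A, ‖f x‖ := by
      rw [e1]
      refine (norm_sum_le _ _).trans (le_of_eq ?_)
      refine Finset.sum_congr rfl fun x _ => ?_
      rw [norm_mul, AddChar.norm_apply, mul_one]
    calc _ ≤ (∑ x ∈ A, ‖f x‖) ^ 2 := pow_le_pow_left₀ (norm_nonneg _) e2 2
      _ ≤ A.card * ∑ x ∈ A, ‖f x‖ ^ 2 := sq_sum_le_card_mul_sum_sq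
      _ = _ := by rw [hsA]
  have hsB : ∑ x ∈ B, ‖RR ψ f x‖ ^ 2 = ∑ x, ‖RR ψ f x‖ ^ 2 := by
    refine Finset.sum_subset (Finset.subset_univ _) fun x _ hx => ?_
    have : RR ψ f x = 0 := by by_contra h; exact hx (hB x h)
    simp [this]
  have h3 : (Nat.card E : ℝ) * ∑ x, ‖f x‖ ^ 2 ≤ (B.card * A.card) * ∑ x, ‖f x‖ ^ 2 := by
    rw [← h1, ← hsB]
    refine (Finset.sum_le_sum fun y _ => h2 y).trans (le_of_eq ?_)
    rw [Finset.sum_const, nsmul_eq_mul, mul_assoc]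
  have h4 : (A.card * B.card : ℝ) < Nat.card E := by exact_mod_cast h
  have h5 : 0 ≤ ∑ x, ‖f x‖ ^ 2 := Finset.sum_nonneg fun _ _ => by positivity
  have h6 : ∑ x, ‖f x‖ ^ 2 = 0 := by
    by_contra hne
    have : 0 < ∑ x, ‖f x‖ ^ 2 := lt_of_le_of_ne h5 (Ne.symm hne)
    have := mul_lt_mul_of_pos_right h4 this
    linarith [mul_comm (A.card : ℝ) B.card ▸ this]
  ext x
  have := (Finset.sum_eq_zero_iff_of_nonneg (fun i _ => by positivity)).1 h6 x (Finset.mem_univ _)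
  simpa using this

theorem RR_RR (hψ : ψ ≠ 1) (f : E → ℂ) (y : E) : RR ψ (RR ψ f) y = Nat.card E * f (-y) := by
  simp only [RR, Finset.sum_mul]
  rw [Finset.sum_comm, Finset.sum_eq_single (-y)]
  · have : ∀ x : E, f (-y) * ψ (Algebra.trace F E (-y * x)) * ψ (Algebra.trace F E (x * y)) = f (-y) := by
      intro x
      rw [mul_assoc, ← AddChar.map_add_eq_mul, ← map_add]
      have : -y * x + x * y = 0 := by ring
      rw [this]; simp
    rw [Finset.sum_congr rfl fun x _ => this x]; simp
  · intro z _ hz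
    have : ∀ x : E, f z * ψ (Algebra.trace F E (z * x)) * ψ (Algebra.trace F E (x * y)) = f z * ψ (Algebra.trace F E (x * (z + y))) := by
      intro x
      rw [mul_assoc, ← AddChar.map_add_eq_mul, ← map_add]
      congr 4; ring
    rw [Finset.sum_congr rfl fun x _ => this x, ← Finset.mul_sum, trace_sum ψ hψ, if_neg, mul_zero]
    intro h; exact hz (by linear_combination h)
  · simp

theorem dg_neg (η : E) : dg F (-η) = dg F η := by
  rw [← finrank_adj, ← finrank_adj]
  have : IntermediateField.adjoin F {-η} = IntermediateField.adjoin F {η} := by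
    apply le_antisymm
    · rw [IntermediateField.adjoin_simple_le_iff]
      exact neg_mem (IntermediateField.mem_adjoin_simple_self F η)
    · rw [IntermediateField.adjoin_simple_le_iff]
      have := neg_mem (IntermediateField.mem_adjoin_simple_self F (-η))
      rwa [neg_neg] at this
  rw [this]

def Bad (F : Type) [Field F] {E : Type} [Field E] [Algebra F E] [Finite E] (η : E) : Prop := dg F η ≠ 1 ∧ dg F η ≠ finrank F E

theorem bad_neg {η : E} : Bad F (-η) ↔ Bad F η := by rw [Bad, Bad, dg_neg]

theorem D_cl (hψ : ψ ≠ 1) {ξ : E} (h : ¬ Bad F ξ) (η : E) : TT ψ (cl F ξ) η = RR ψ (cl F ξ) η := by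
  have hd : (dg F η : ℂ) ≠ 0 := by exact_mod_cast (dg_pos (F := F) η).ne'
  apply mul_left_cancel₀ hd
  by_cases h1 : dg F ξ = 1
  · obtain ⟨z, rfl⟩ := (dg_one_iff ξ).1 h1
    rw [TT_cl_symm ψ hψ, RR_cl_symm, TT_scalar ψ hψ (cl_inv η)]
  · have h2 : dg F ξ = finrank F E := by by_contra h3; exact h ⟨h1, h3⟩
    rw [TT_cl_symm ψ hψ, RR_cl_symm, TT_gen ψ hψ h2, GEN ψ hψ h2, mul_div_cancel_left₀ _ AA_ne]

theorem D_inv {s : E → ℂ} (hs : IsInv F s) : IsInv F (fun η => TT ψ s η - RR ψ s η) := fun a b h => by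
  simp only [TT_inv ψ s a b h, RR_inv ψ hs a b h]

theorem D_good (hψ : ψ ≠ 1) {s : E → ℂ} (hs : IsInv F s) {ξ : E} (h : ¬ Bad F ξ) : TT ψ s ξ - RR ψ s ξ = 0 := by
  have hd : (dg F ξ : ℂ) ≠ 0 := by exact_mod_cast (dg_pos (F := F) ξ).ne'
  apply mul_left_cancel₀ hd
  rw [← cl_pair ξ (D_inv ψ hs)]
  simp only [sub_mul]
  rw [Finset.sum_sub_distrib, TT_symm ψ hψ hs (cl_inv ξ), RR_symm, ← Finset.sum_sub_distrib, mul_zero]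
  exact Finset.sum_eq_zero fun η _ => by rw [D_cl ψ hψ h, sub_self]

theorem RD_good (hψ : ψ ≠ 1) {s : E → ℂ} (hs : IsInv F s) {ξ : E} (h : ¬ Bad F ξ) : RR ψ (fun η => TT ψ s η - RR ψ s η) ξ = 0 := by
  set f : E → ℂ := fun η => TT ψ s η - RR ψ s η with hf
  have h' : ¬ Bad F (-ξ) := by rwa [bad_neg]
  have hd : (dg F (-ξ) : ℂ) ≠ 0 := by exact_mod_cast (dg_pos (F := F) (-ξ)).ne'
  have e1 : ∑ η, f η * starRingEnd ℂ (RR ψ (cl F (-ξ)) η) = 0 := by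
    have a1 := TT_iso ψ hψ hs (cl_inv (F := F) (-ξ))
    have a2 := RR_iso ψ hψ s (cl F (-ξ))
    rw [← a2] at a1
    simp only [D_cl ψ hψ h'] at a1
    simp only [hf, sub_mul]
    rw [Finset.sum_sub_distrib, a1, sub_self]
  have e2 : ∑ η, f η * starRingEnd ℂ (RR ψ (cl F (-ξ)) η) = ∑ η', RR ψ f (-η') * cl F (-ξ) η' := by
    simp only [RR, map_sum, map_mul, psi_star, Finset.mul_sum, Finset.sum_mul]
    rw [Finset.sum_comm]
    refine Finset.sum_congr rfl fun y _ => Finset.sum_congr rfl fun x _ => ?_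
    have : starRingEnd ℂ (cl F (-ξ) y) = cl F (-ξ) y := by unfold cl; split_ifs <;> simp
    rw [this, mul_neg, map_neg (Algebra.trace F E), mul_comm y x]; ring
  have e3 : IsInv F (fun η' => RR ψ f (-η')) := by
    intro a b hab
    obtain ⟨σ, rfl⟩ := exists_conj hab
    apply RR_inv ψ (D_inv ψ hs)
    rw [← map_neg, cp_alg]
  rw [e2, cl_pair (-ξ) e3, neg_neg] at e1
  exact (mul_eq_zero.1 e1).resolve_left hd

theorem cardC (j : ℕ) (hj : 1 ≤ j) : (Finset.univ.filter fun η : E => dg F η ∣ j ∧ dg F η ≠ 1).card + Nat.card F ≤ Nat.card F ^ j := by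
  have hq : 1 < Nat.card F := Finite.one_lt_card
  have h1 : (Finset.univ.filter fun η : E => dg F η ∣ j).card ≤ Nat.card F ^ j := by
    have hne := FiniteField.X_pow_card_pow_sub_X_ne_zero E (n := j) (by omega) hq
    have hdeg := FiniteField.X_pow_card_pow_sub_X_natDegree_eq E (n := j) (by omega) hq
    rw [← hdeg]
    refine le_trans (Finset.card_le_card (t := (X ^ Nat.card F ^ j - X : E[X]).roots.toFinset) ?_) ((Multiset.toFinset_card_le _).trans (Polynomial.card_roots' _))
    intro η hη
    rw [Finset.mem_filter, dg_dvd_iff] at hη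
    rw [Multiset.mem_toFinset, Polynomial.mem_roots hne]
    rw [Polynomial.IsRoot, Polynomial.eval_sub, Polynomial.eval_pow, Polynomial.eval_X, hη.2, sub_self]
  refine le_trans ?_ h1
  have h2 : Nat.card F = (Finset.univ.image fun z : F => algebraMap F E z).card := by
    rw [Finset.card_image_of_injective _ (algebraMap F E).injective, Finset.card_univ, Nat.card_eq_fintype_card]
  rw [h2, ← Finset.card_union_of_disjoint]
  · apply Finset.card_le_card
    intro η hη
    rw [Finset.mem_union, Finset.mem_filter, Finset.mem_image] at hη
    rw [Finset.mem_filter]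
    refine ⟨Finset.mem_univ _, ?_⟩
    rcases hη with h | ⟨z, _, rfl⟩
    · exact h.2.1
    · rw [dg_alg]; exact one_dvd _
  · rw [Finset.disjoint_left]
    intro η hη h
    rw [Finset.mem_image] at h
    obtain ⟨z, _, rfl⟩ := h
    rw [Finset.mem_filter, dg_alg] at hη
    exact hη.2.2 rfl

/-- the half-degree subfield as a submodule -/
def KK (F : Type) [Field F] [Finite F] (E : Type) [Field E] [Algebra F E] [Finite E] (N : ℕ) : Submodule F E where
  carrier := {η | dg F η ∣ N}
  add_mem' := by
    intro a b ha hb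
    have : Algebra.IsIntegral F E := inferInstance
    simp only [Set.mem_setOf_eq, dg_dvd_iff] at *
    obtain ⟨p, hp⟩ := CharP.exists E
    haveI := hp
    haveI : CharP F p := (RingHom.charP_iff (algebraMap F E) (algebraMap F E).injective p).2 hp
    haveI : Fact p.Prime := ⟨CharP.char_is_prime E p⟩
    obtain ⟨m, _, hm⟩ := FiniteField.card F p
    have hm' : Nat.card F ^ N = p ^ (m * N) := by rw [Nat.card_eq_fintype_card, hm, ← pow_mul]
    rw [hm'] at ha hb ⊢
    rw [add_pow_char_pow, ha, hb]
  zero_mem' := by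
    rw [Set.mem_setOf_eq, dg_dvd_iff, zero_pow (pow_pos Nat.card_pos _).ne']
  smul_mem' := by
    intro c a ha
    simp only [Set.mem_setOf_eq, dg_dvd_iff] at *
    rw [Algebra.smul_def, mul_pow, ha]
    congr 1
    have := (dg_dvd_iff (F := F) (algebraMap F E c) N).1 (by rw [dg_alg]; exact one_dvd _)
    exact this

theorem perp_perp (hψ : ψ ≠ 1) (W : Submodule F E) (x : E) (h : ∀ u : E, (∀ k ∈ W, Algebra.trace F E (u * k) = 0) → ψ (Algebra.trace F E (u * x)) = 1) : x ∈ W := by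
  have hr : (Algebra.traceForm F E).IsRefl := (Algebra.traceForm_isSymm F).isRefl
  rw [← LinearMap.BilinForm.orthogonal_orthogonal (traceForm_nondegenerate F E) hr W, LinearMap.BilinForm.mem_orthogonal_iff]
  intro u hu
  rw [LinearMap.BilinForm.mem_orthogonal_iff] at hu
  change Algebra.trace F E (u * x) = 0
  by_contra hne
  apply hψ
  ext c
  have := h ((c / Algebra.trace F E (u * x)) • u) (fun k hk => by
    have := hu k hk
    change Algebra.trace F E (k * u) = 0 at this
    rw [smul_mul_assoc, map_smul, mul_comm u k, this, smul_zero])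
  rw [smul_mul_assoc, map_smul, smul_eq_mul, div_mul_cancel₀ _ hne] at this
  simpa using this

theorem half_step (hψ : ψ ≠ 1) (f : E → ℂ) (hf : ∀ x, f x ≠ 0 → Bad F x) (hg : ∀ x, RR ψ f x ≠ 0 → Bad F x) (N : ℕ)
    (hc : 2 * ((Finset.univ.filter fun η : E => Bad F η ∧ ¬ dg F η ∣ N).card * (Finset.univ.filter fun η : E => Bad F η).card) < Nat.card E)
    (x : E) (hx : f x ≠ 0) : dg F x ∣ N := by
  change x ∈ KK F E N
  apply perp_perp ψ hψ
  intro u hu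
  have h0 : (fun x => (ψ (Algebra.trace F E (u * x)) - 1) * f x) = 0 := by
    have hR : ∀ y, RR ψ (fun x => (ψ (Algebra.trace F E (u * x)) - 1) * f x) y = RR ψ f (y + u) - RR ψ f y := by
      intro y
      simp only [RR]
      rw [← Finset.sum_sub_distrib]
      refine Finset.sum_congr rfl fun z _ => ?_
      rw [mul_add, map_add, AddChar.map_add_eq_mul, mul_comm u z]; ring
    refine uncert ψ hψ _ (Finset.univ.filter fun η : E => Bad F η ∧ ¬ dg F η ∣ N) ((Finset.univ.filter fun η : E => Bad F η) ∪ (Finset.univ.filter fun η : E => Bad F η).image (fun y => y - u)) ?_ ?_ ?_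
    · intro y hy
      rw [Finset.mem_filter]
      refine ⟨Finset.mem_univ _, hf y (right_ne_zero_of_mul hy), fun hd => ?_⟩
      apply left_ne_zero_of_mul hy
      rw [hu y hd]; simp
    · intro y hy
      rw [hR] at hy
      rw [Finset.mem_union, Finset.mem_filter, Finset.mem_image]
      by_cases h1 : RR ψ f y = 0
      · right
        refine ⟨y + u, ?_, by ring⟩
        rw [Finset.mem_filter]
        refine ⟨Finset.mem_univ _, hg _ fun h2 => hy (by rw [h1, h2, sub_zero])⟩
      · left
        exact ⟨Finset.mem_univ _, hg _ h1⟩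
    · refine lt_of_le_of_lt ?_ hc
      refine (Nat.mul_le_mul_left _ ((Finset.card_union_le _ _).trans (Nat.add_le_add_left Finset.card_image_le _))).trans (le_of_eq ?_)
      ring
  have h1 := congrFun h0 x
  simp only [Pi.zero_apply, mul_eq_zero] at h1
  exact sub_eq_zero.1 (h1.resolve_right hx)

end low
end MK

set_option linter.all false
namespace MK
open Module Polynomial
open scoped BigOperators Classical

theorem geo1 {q : ℕ} (hq : 2 ≤ q) (m : ℕ) : ∑ j ∈ Finset.range (m + 1), q ^ j < 2 * q ^ m := by
  induction m with
  | zero => simp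
  | succ m ih =>
    rw [Finset.sum_range_succ]
    have : 2 * q ^ m ≤ q ^ (m + 1) := by rw [pow_succ, mul_comm]; exact Nat.mul_le_mul_left _ hq
    omega

theorem geo2 {q : ℕ} (hq : 2 ≤ q) (m : ℕ) : 3 * ∑ j ∈ Finset.range (m + 1), q ^ (2 * j) ≤ 4 * q ^ (2 * m) := by
  induction m with
  | zero => simp
  | succ m ih =>
    rw [Finset.sum_range_succ, mul_add]
    have h2 : 4 ≤ q ^ 2 := by nlinarith
    have : 4 * q ^ (2 * m) ≤ q ^ (2 * (m + 1)) := by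
      rw [show 2 * (m + 1) = 2 * m + 2 by ring, pow_add, mul_comm]; exact Nat.mul_le_mul_left _ h2
    omega

section low
variable {F : Type} [Field F] [Finite F] {E : Type} [Field E] [Algebra F E] [Finite E]
variable (ψ : AddChar F ℂ)

theorem card_le_of_cover {S : Finset E} (I : Finset ℕ) (hI : ∀ j ∈ I, 1 ≤ j) (h : ∀ η ∈ S, dg F η ≠ 1 ∧ dg F η ∈ I) : S.card ≤ ∑ j ∈ I, Nat.card F ^ j := by
  calc S.card ≤ (I.biUnion fun j => Finset.univ.filter fun η : E => dg F η ∣ j ∧ dg F η ≠ 1).card := by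
        apply Finset.card_le_card
        intro η hη
        rw [Finset.mem_biUnion]
        refine ⟨dg F η, (h η hη).2, ?_⟩
        rw [Finset.mem_filter]
        exact ⟨Finset.mem_univ _, dvd_rfl, (h η hη).1⟩
    _ ≤ ∑ j ∈ I, (Finset.univ.filter fun η : E => dg F η ∣ j ∧ dg F η ≠ 1).card := Finset.card_biUnion_le
    _ ≤ _ := Finset.sum_le_sum fun j hj => (Nat.le_add_right _ _).trans (cardC j (hI j hj))

theorem low_odd (hψ : ψ ≠ 1) (f : E → ℂ) (hf : ∀ x, f x ≠ 0 → Bad F x) (hg : ∀ x, RR ψ f x ≠ 0 → Bad F x) (hodd : ¬ 2 ∣ finrank F E) : f = 0 := by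
  have hq : 2 ≤ Nat.card F := Finite.one_lt_card
  have hb : ∀ η : E, Bad F η → 2 ≤ dg F η ∧ dg F η ≤ finrank F E / 3 := by
    intro η hη
    obtain ⟨c, hc⟩ := dg_dvd (F := F) η
    have h1 := dg_pos (F := F) η
    have h2 := hη.1
    have h3 := hη.2
    refine ⟨by omega, ?_⟩
    have hc1 : c ≠ 1 := by rintro rfl; rw [mul_one] at hc; exact h3 hc.symm
    have hc0 : c ≠ 0 := by rintro rfl; rw [mul_zero] at hc; exact (Module.finrank_pos (R := F) (M := E)).ne' hc
    have hc2 : c ≠ 2 := by rintro rfl; exact hodd ⟨_, by rw [hc, mul_comm]⟩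
    rw [Nat.le_div_iff_mul_le (by norm_num), hc]
    exact Nat.mul_le_mul_left _ (by omega)
  refine uncert ψ hψ f (Finset.univ.filter fun η : E => Bad F η) (Finset.univ.filter fun η : E => Bad F η) (by simpa using hf) (by simpa using hg) ?_
  set l := (Finset.univ.filter fun η : E => Bad F η).card with hl
  by_cases hm : finrank F E / 3 ≤ 1
  · have : l = 0 := by
      rw [hl, Finset.card_eq_zero, Finset.filter_eq_empty_iff]
      intro η _ hη
      have := hb η hη
      omega
    rw [this, mul_zero]; exact Nat.card_pos
  · have h1 : l ≤ ∑ j ∈ Finset.Icc 2 (finrank F E / 3), Nat.card F ^ j := by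
      apply card_le_of_cover (F := F)
      · intro j hj; rw [Finset.mem_Icc] at hj; omega
      · intro η hη
        rw [Finset.mem_filter] at hη
        exact ⟨hη.2.1, Finset.mem_Icc.2 (hb η hη.2)⟩
    have h2 : ∑ j ∈ Finset.Icc 2 (finrank F E / 3), Nat.card F ^ j ≤ ∑ j ∈ Finset.range (finrank F E / 3 + 1), Nat.card F ^ j := by
      apply Finset.sum_le_sum_of_subset
      intro j hj; rw [Finset.mem_Icc] at hj; rw [Finset.mem_range]; omega
    have h3 := geo1 hq (finrank F E / 3)
    have h4 : l < 2 * Nat.card F ^ (finrank F E / 3) := by omega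
    have h5 : l * l < (2 * Nat.card F ^ (finrank F E / 3)) * (2 * Nat.card F ^ (finrank F E / 3)) := Nat.mul_lt_mul'' h4 h4
    refine h5.trans_le ?_
    rw [cardE_nat (F := F) (E := E)]
    obtain ⟨e, he⟩ : ∃ e, finrank F E = finrank F E / 3 + finrank F E / 3 + 2 + e := ⟨finrank F E - (finrank F E / 3 + finrank F E / 3 + 2), by omega⟩
    set m := finrank F E / 3
    rw [he, pow_add, pow_add, pow_add]
    have h6 : 4 ≤ Nat.card F ^ 2 := by nlinarith
    have h7 : 1 ≤ Nat.card F ^ e := Nat.one_le_pow _ _ (by omega)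
    calc _ = (Nat.card F ^ m * Nat.card F ^ m * 4) * 1 := by ring
      _ ≤ _ := Nat.mul_le_mul (Nat.mul_le_mul_left _ h6) h7

theorem even_num {N : ℕ} (hN : finrank F E = 2 * N) :
    2 * ((Finset.univ.filter fun η : E => Bad F η ∧ ¬ dg F η ∣ N).card * (Finset.univ.filter fun η : E => Bad F η).card) < Nat.card E := by
  have hq : 2 ≤ Nat.card F := Finite.one_lt_card
  have hn0 : 0 < finrank F E := Module.finrank_pos (R := F) (M := E)
  have hb : ∀ η : E, Bad F η → ¬ dg F η ∣ N → 2 ≤ dg F η ∧ 3 * dg F η ≤ finrank F E ∧ 2 ∣ dg F η := by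
    intro η hη hd
    obtain ⟨c, hc⟩ := dg_dvd (F := F) η
    have h1 := dg_pos (F := F) η
    have h2 := hη.1
    have h3 := hη.2
    have hc1 : c ≠ 1 := by rintro rfl; rw [mul_one] at hc; exact h3 hc.symm
    have hc0 : c ≠ 0 := by rintro rfl; rw [mul_zero] at hc; exact hn0.ne' hc
    have hc2 : ¬ 2 ∣ c := by
      rintro ⟨c', rfl⟩
      exact hd ⟨c', by rw [hN] at hc; linarith [mul_left_comm 2 (dg F η) c']⟩
    refine ⟨by omega, ?_, ?_⟩
    · rw [hc, mul_comm]; exact Nat.mul_le_mul_left _ (by omega)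
    · have : 2 ∣ dg F η * c := ⟨N, by rw [← hc, hN]⟩
      exact (Nat.prime_two.dvd_mul.1 this).resolve_right hc2
  set R := (Finset.univ.filter fun η : E => Bad F η ∧ ¬ dg F η ∣ N) with hR
  have hL : (Finset.univ.filter fun η : E => Bad F η).card + Nat.card F ≤ R.card + Nat.card F ^ N := by
    have h1 := cardC (F := F) (E := E) N (by omega)
    have h2 : (Finset.univ.filter fun η : E => Bad F η) ⊆ R ∪ (Finset.univ.filter fun η : E => dg F η ∣ N ∧ dg F η ≠ 1) := by
      intro η hη
      rw [Finset.mem_filter] at hη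
      rw [Finset.mem_union, hR, Finset.mem_filter, Finset.mem_filter]
      by_cases h : dg F η ∣ N
      · right; exact ⟨Finset.mem_univ _, h, hη.2.1⟩
      · left; exact ⟨Finset.mem_univ _, hη.2, h⟩
    have h3 := (Finset.card_le_card h2).trans (Finset.card_union_le _ _)
    omega
  set l := (Finset.univ.filter fun η : E => Bad F η).card
  set r := R.card with hr
  rw [cardE_nat (F := F) (E := E), hN, two_mul N, pow_add]
  set H := Nat.card F ^ N with hH
  have hHpos : 0 < H := by positivity
  by_cases hm : N ≤ 2
  · have : r = 0 := by
      rw [hr, hR, Finset.card_eq_zero, Finset.filter_eq_empty_iff]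
      intro η _ hη
      have := hb η hη.1 hη.2
      omega
    rw [this]; simp; positivity
  by_cases h3 : N = 3
  · have h1 : r + Nat.card F ≤ Nat.card F ^ 2 := by
      refine le_trans (Nat.add_le_add_right (Finset.card_le_card ?_) _) (cardC (F := F) (E := E) 2 (by omega))
      intro η hη
      rw [hR, Finset.mem_filter] at hη
      have := hb η hη.2.1 hη.2.2
      rw [Finset.mem_filter]
      have h2 : dg F η = 2 := by omega
      refine ⟨Finset.mem_univ _, ?_, ?_⟩ <;> rw [h2] <;> omega
    have hH3 : H = Nat.card F ^ 3 := by rw [hH, h3]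
    rw [hH3] at hL ⊢
    generalize Nat.card F = q at h1 hL hq ⊢
    obtain ⟨u, rfl⟩ : ∃ u, q = u + 2 := ⟨q - 2, by omega⟩
    have g1 : r ≤ (u + 2) * (u + 1) := by nlinarith
    have g2 : l ≤ (u + 2) * (u + 1) * (u + 4) := by nlinarith
    have g3 := Nat.mul_le_mul g1 g2
    have g4 : 2 * ((u + 2) * (u + 1) * ((u + 2) * (u + 1) * (u + 4))) < (u + 2) ^ 3 * (u + 2) ^ 3 := by
      have : 2 * ((u + 1) * (u + 1) * (u + 4)) < (u + 2) ^ 4 := by ring_nf; nlinarith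
      calc _ = (u + 2) ^ 2 * (2 * ((u + 1) * (u + 1) * (u + 4))) := by ring
        _ < (u + 2) ^ 2 * (u + 2) ^ 4 := Nat.mul_lt_mul_of_pos_left this (by positivity)
        _ = _ := by ring
    omega
  · set m := finrank F E / 3 with hm'
    have h1 : 3 * r ≤ 4 * Nat.card F ^ m := by
      have a1 : r ≤ ∑ j ∈ (Finset.Icc 1 (m / 2)).image (fun i => 2 * i), Nat.card F ^ j := by
        apply card_le_of_cover (F := F)
        · intro j hj; rw [Finset.mem_image] at hj; obtain ⟨i, hi, rfl⟩ := hj; rw [Finset.mem_Icc] at hi; omega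
        · intro η hη
          rw [hR, Finset.mem_filter] at hη
          have := hb η hη.2.1 hη.2.2
          refine ⟨hη.2.1.1, ?_⟩
          rw [Finset.mem_image]
          refine ⟨dg F η / 2, ?_, by omega⟩
          rw [Finset.mem_Icc]; omega
      rw [Finset.sum_image (fun a _ b _ h => by omega)] at a1
      have a2 : ∑ i ∈ Finset.Icc 1 (m / 2), Nat.card F ^ (2 * i) ≤ ∑ j ∈ Finset.range (m / 2 + 1), Nat.card F ^ (2 * j) := by
        apply Finset.sum_le_sum_of_subset
        intro j hj; rw [Finset.mem_Icc] at hj; rw [Finset.mem_range]; omega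
      have a3 := geo2 hq (m / 2)
      have a4 : Nat.card F ^ (2 * (m / 2)) ≤ Nat.card F ^ m := Nat.pow_le_pow_right (by omega) (by omega)
      omega
    have h2 : 4 * Nat.card F ^ m ≤ H := by
      rw [hH]
      obtain ⟨e, he⟩ : ∃ e, N = m + 2 + e := ⟨N - (m + 2), by omega⟩
      rw [he, pow_add, pow_add]
      have h6 : 4 ≤ Nat.card F ^ 2 := by nlinarith
      have h7 : 1 ≤ Nat.card F ^ e := Nat.one_le_pow _ _ (by omega)
      calc _ = (Nat.card F ^ m * 4) * 1 := by ring
        _ ≤ _ := Nat.mul_le_mul (Nat.mul_le_mul_left _ h6) h7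
    have h4 : 3 * r ≤ H := by omega
    have h5 : 3 * l ≤ 4 * H := by omega
    have h6 := Nat.mul_le_mul h4 h5
    nlinarith

theorem low_even (hψ : ψ ≠ 1) (f : E → ℂ) (hf : ∀ x, f x ≠ 0 → Bad F x) (hg : ∀ x, RR ψ f x ≠ 0 → Bad F x) {N : ℕ} (hN : finrank F E = 2 * N) : f = 0 := by
  have hq : 2 ≤ Nat.card F := Finite.one_lt_card
  have hn0 : 0 < finrank F E := Module.finrank_pos (R := F) (M := E)
  have h1 := half_step ψ hψ f hf hg N (even_num hN)
  have h2 := half_step ψ hψ (RR ψ f) hg (fun x hx => by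
    rw [RR_RR ψ hψ] at hx
    rw [← bad_neg]
    exact hf _ (right_ne_zero_of_mul hx)) N (even_num hN)
  refine uncert ψ hψ f (Finset.univ.filter fun η : E => dg F η ∣ N ∧ dg F η ≠ 1) (Finset.univ.filter fun η : E => dg F η ∣ N ∧ dg F η ≠ 1) ?_ ?_ ?_
  · intro x hx; rw [Finset.mem_filter]; exact ⟨Finset.mem_univ _, h1 x hx, (hf x hx).1⟩
  · intro x hx; rw [Finset.mem_filter]; exact ⟨Finset.mem_univ _, h2 x hx, (hg x hx).1⟩
  · have h3 := cardC (F := F) (E := E) N (by omega)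
    rw [cardE_nat (F := F) (E := E), hN, two_mul N, pow_add]
    exact Nat.mul_lt_mul'' (by omega) (by omega)

/-- Core theorem -/
theorem CORE (hψ : ψ ≠ 1) {s : E → ℂ} (hs : IsInv F s) : TT ψ s = RR ψ s := by
  have hf : ∀ x, (fun η => TT ψ s η - RR ψ s η) x ≠ 0 → Bad F x := fun x hx => by
    by_contra h; exact hx (D_good ψ hψ hs h)
  have hg : ∀ x, RR ψ (fun η => TT ψ s η - RR ψ s η) x ≠ 0 → Bad F x := fun x hx => by
    by_contra h; exact hx (RD_good ψ hψ hs h)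
  have h0 : (fun η => TT ψ s η - RR ψ s η) = 0 := by
    by_cases h2 : 2 ∣ finrank F E
    · obtain ⟨N, hN⟩ := h2
      exact low_even ψ hψ _ hf hg hN
    · exact low_odd ψ hψ _ hf hg h2
  ext η
  exact sub_eq_zero.1 (congrFun h0 η)

/-- Gauss-sum type identity for primitive class functions -/
theorem sg_four (hψ : ψ ≠ 1) {Φ : Module.End F E → ℂ} (hΦ : Prim Φ) (hcl : ClassFn Φ) (η : E) :
    sg (four ψ Φ) η = AA F E * RR ψ (sg Φ) η := by
  have h := congrFun (CORE ψ hψ (sg_inv Φ)) η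
  rw [TT, lift_sg hΦ hcl, div_eq_iff AA_ne] at h
  rw [h, mul_comm]

end low
end MK

set_option linter.all false
namespace MK
open Module Polynomial
open scoped BigOperators Classical

theorem sum_dite_subtype {A : Type} [Fintype A] {p : A → Prop} [DecidablePred p] [Fintype {a // p a}] (f : ∀ a, p a → ℂ) :
    ∑ a : A, (if h : p a then f a h else 0) = ∑ a : {a // p a}, f a.1 a.2 := by
  have h1 : ∑ a : {a // p a}, f a.1 a.2 = ∑ a : {a // p a}, (fun a => if h : p a then f a h else 0) a.1 :=
    Finset.sum_congr rfl fun a _ => (dif_pos a.2).symm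
  rw [h1, ← Finset.sum_subtype (Finset.univ.filter p) (by simp) (fun a => if h : p a then f a h else 0), Finset.sum_filter]
  refine Finset.sum_congr rfl fun a _ => ?_
  split_ifs <;> rfl

section parab
variable {F : Type} [Field F] [Finite F] {V : Type} [AddCommGroup V] [Module F V] [Finite V]

theorem exists_split (W : Submodule F V) : ∃ (s : (V ⧸ W) →ₗ[F] V) (π : V →ₗ[F] W),
    (∀ q, W.mkQ (s q) = q) ∧ (∀ w : W, π w = w) ∧ (∀ v, (π v : V) + s (W.mkQ v) = v) ∧ (∀ q, π (s q) = 0) := by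
  obtain ⟨s, hs⟩ := W.mkQ.exists_rightInverse_of_surjective (LinearMap.range_eq_top.2 W.mkQ_surjective)
  have hs' : ∀ q, W.mkQ (s q) = q := fun q => LinearMap.congr_fun hs q
  let π : V →ₗ[F] W := LinearMap.codRestrict W (LinearMap.id - s ∘ₗ W.mkQ) (by
    intro v
    refine (Submodule.Quotient.mk_eq_zero W).1 ?_
    change W.mkQ _ = 0
    simp only [LinearMap.sub_apply, LinearMap.id_apply, LinearMap.comp_apply, map_sub, hs', sub_self])
  have hπ : ∀ v, (π v : V) = v - s (W.mkQ v) := fun v => rfl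
  refine ⟨s, π, hs', fun w => ?_, fun v => ?_, fun q => ?_⟩
  · apply Subtype.ext
    have : W.mkQ (w : V) = 0 := by rw [← LinearMap.mem_ker, Submodule.ker_mkQ]; exact w.2
    rw [hπ, this, map_zero, sub_zero]
  · rw [hπ, sub_add_cancel]
  · apply Subtype.ext
    rw [hπ, hs', sub_self]; rfl

theorem card_nil (W : Submodule F V) : Nat.card (nil W) = Nat.card F ^ (finrank F W * finrank F (V ⧸ W)) := by
  have e : nil W ≃ ((V ⧸ W) →ₗ[F] W) :=
    { toFun := fun N => W.liftQ (N.1.codRestrict W N.2.1) (fun w hw => by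
        rw [LinearMap.mem_ker]; exact Subtype.ext (N.2.2 w hw))
      invFun := fun f => ⟨W.subtype ∘ₗ f ∘ₗ W.mkQ, fun v => (f (W.mkQ v)).2, fun u hu => by
        have : W.mkQ u = 0 := by rw [← LinearMap.mem_ker, Submodule.ker_mkQ]; exact hu
        simp only [LinearMap.comp_apply, this, map_zero]⟩
      left_inv := fun N => by
        apply Subtype.ext; ext v; rfl
      right_inv := fun f => by
        ext v; rfl }
  rw [Nat.card_congr e, Module.natCard_eq_pow_finrank (K := F), Module.finrank_linearMap, mul_comm]

/-- Gluing map for the parabolic -/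
noncomputable def glue (W : Submodule F V) (s : (V ⧸ W) →ₗ[F] V) (π : V →ₗ[F] W)
    (a : Module.End F W) (b : Module.End F (V ⧸ W)) : Module.End F V :=
  W.subtype ∘ₗ a ∘ₗ π + s ∘ₗ b ∘ₗ W.mkQ

theorem glue_apply (W : Submodule F V) (s : (V ⧸ W) →ₗ[F] V) (π : V →ₗ[F] W)
    (a : Module.End F W) (b : Module.End F (V ⧸ W)) (v : V) :
    glue W s π a b v = (a (π v) : V) + s (b (W.mkQ v)) := rfl

theorem mkQ_mem {W : Submodule F V} {v : V} (h : v ∈ W) : W.mkQ v = 0 := by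
  rw [← LinearMap.mem_ker, Submodule.ker_mkQ]; exact h

theorem mem_mkQ {W : Submodule F V} {v : V} (h : W.mkQ v = 0) : v ∈ W := by
  rwa [← LinearMap.mem_ker, Submodule.ker_mkQ] at h

variable (ψ : AddChar F ℂ)

theorem parab_sum (hψ : ψ ≠ 1) (W : Submodule F V) (G1 : Module.End F W → ℂ) (G2 : Module.End F (V ⧸ W) → ℂ)
    (x : Module.End F V) :
    ∑ w : Module.End F V, (if h : Inv w W then G1 (w.restrict h) * G2 (W.mapQ W w h) * ψ (LinearMap.trace F V (w * x)) else 0)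
    = if h : Inv x W then (Nat.card F : ℂ) ^ (finrank F W * finrank F (V ⧸ W)) * four ψ G1 (x.restrict h) * four ψ G2 (W.mapQ W x h) else 0 := by
  obtain ⟨s, π, h1, h2, h3, h4⟩ := exists_split W
  have hg : ∀ a b, Inv (glue W s π a b) W := by
    intro a b u hu
    rw [Submodule.mem_comap, glue_apply, mkQ_mem hu, map_zero, map_zero, add_zero]
    exact (a _).2
  have hgr : ∀ a b, (glue W s π a b).restrict (hg a b) = a := by
    intro a b
    refine LinearMap.ext fun u => Subtype.ext ?_
    change glue W s π a b u = _
    rw [glue_apply, mkQ_mem u.2, map_zero, map_zero, add_zero, h2]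
  have hgq : ∀ a b, W.mapQ W (glue W s π a b) (hg a b) = b := by
    intro a b
    ext v
    change W.mkQ (glue W s π a b v) = b (W.mkQ v)
    rw [glue_apply, map_add, h1, mkQ_mem (a _).2, zero_add]
  let e : (Module.End F W × Module.End F (V ⧸ W)) × nil W ≃ {w : Module.End F V // Inv w W} :=
    { toFun := fun p => ⟨glue W s π p.1.1 p.1.2 + p.2, inv_add_nil (hg _ _) p.2.2⟩
      invFun := fun w => ⟨⟨w.1.restrict w.2, W.mapQ W w.1 w.2⟩, ⟨w.1 - glue W s π (w.1.restrict w.2) (W.mapQ W w.1 w.2), by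
        refine ⟨fun v => mem_mkQ ?_, fun u hu => ?_⟩
        · rw [LinearMap.sub_apply, map_sub, glue_apply, map_add, h1, mkQ_mem (Submodule.coe_mem _), zero_add, sub_eq_zero]
          rfl
        · rw [LinearMap.sub_apply, glue_apply, mkQ_mem hu, map_zero, map_zero, add_zero, sub_eq_zero]
          have := h2 ⟨u, hu⟩
          dsimp only at this
          rw [this]; rfl⟩⟩
      left_inv := fun p => by
        obtain ⟨⟨a, b⟩, N⟩ := p
        have e1 := (restrict_add_nil (hg a b) N.2).trans (hgr a b)
        have e2 := (mapQ_add_nil (hg a b) N.2).trans (hgq a b)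
        refine Prod.ext (Prod.ext e1 e2) (Subtype.ext ?_)
        dsimp only
        rw [e1, e2, add_sub_cancel_left]
      right_inv := fun w => Subtype.ext (by dsimp only; rw [add_sub_cancel]) }
  have hsub : ∑ w : Module.End F V, (if h : Inv w W then G1 (w.restrict h) * G2 (W.mapQ W w h) * ψ (LinearMap.trace F V (w * x)) else 0)
      = ∑ w : {w : Module.End F V // Inv w W}, G1 (w.1.restrict w.2) * G2 (W.mapQ W w.1 w.2) * ψ (LinearMap.trace F V (w.1 * x)) := by
    exact sum_dite_subtype (p := fun w : Module.End F V => Inv w W) (fun w h => G1 (w.restrict h) * G2 (W.mapQ W w h) * ψ (LinearMap.trace F V (w * x)))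
  rw [hsub, ← Equiv.sum_comp e, Fintype.sum_prod_type]
  have hin : ∀ p : Module.End F W × Module.End F (V ⧸ W), ∑ N : nil W, G1 ((e (p, N)).1.restrict (e (p, N)).2) * G2 (W.mapQ W (e (p, N)).1 (e (p, N)).2) * ψ (LinearMap.trace F V ((e (p, N)).1 * x))
      = G1 p.1 * G2 p.2 * ψ (LinearMap.trace F V (glue W s π p.1 p.2 * x)) * (if Inv x W then (Nat.card (nil W) : ℂ) else 0) := by
    rintro ⟨a, b⟩
    rw [← sum_nil ψ hψ, Finset.mul_sum]
    refine Finset.sum_congr rfl fun N _ => ?_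
    have e1 : (e ((a, b), N)).1.restrict (e ((a, b), N)).2 = a := (restrict_add_nil (hg a b) N.2).trans (hgr a b)
    have e2 : W.mapQ W (e ((a, b), N)).1 (e ((a, b), N)).2 = b := (mapQ_add_nil (hg a b) N.2).trans (hgq a b)
    have e3 : (e ((a, b), N)).1 = glue W s π a b + N := rfl
    rw [e1, e2, e3, add_mul, map_add, AddChar.map_add_eq_mul, LinearMap.trace_mul_comm F x (N : Module.End F V), mul_assoc (G1 a * G2 b)]
  rw [Finset.sum_congr rfl fun p _ => hin p]
  by_cases hx : Inv x W
  · rw [dif_pos hx, if_pos hx, ← Finset.sum_mul, card_nil, Nat.cast_pow, mul_comm, mul_assoc]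
    congr 1
    unfold four
    rw [Finset.sum_mul_sum, Fintype.sum_prod_type]
    refine Finset.sum_congr rfl fun a _ => Finset.sum_congr rfl fun b _ => ?_
    have hm : Inv (glue W s π a b * x) W := fun u hu => hg a b (hx hu)
    have e1 : (glue W s π a b * x).restrict hm = a * x.restrict hx := by
      refine LinearMap.ext fun u => ?_
      exact LinearMap.congr_fun (hgr a b) (x.restrict hx u)
    have e2 : W.mapQ W (glue W s π a b * x) hm = b * W.mapQ W x hx := by
      ext v
      exact LinearMap.congr_fun (hgq a b) (W.mkQ (x v))
    rw [trace_add W _ hm, e1, e2, AddChar.map_add_eq_mul]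
    ring
  · rw [dif_neg hx]; simp [hx]

end parab
end MK

set_option linter.all false
namespace MK
open Module Polynomial
open scoped BigOperators Classical

section hall
variable {F : Type} [Field F] [Finite F] {V : Type} [AddCommGroup V] [Module F V] [Finite V]

theorem ring_inverse_of {M : Type} [MonoidWithZero M] {a b : M} (h : a * b = 1) (h' : b * a = 1) : Ring.inverse a = b :=
  Ring.inverse_unit ⟨a, b, h, h'⟩

theorem inv_inverse_aux {w : Module.End F V} (hw : IsUnit w) {W : Submodule F V} (h : Inv w W) : Inv (Ring.inverse w) W := by
  have hinj : Function.Injective (w.restrict h) := by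
    intro u v huv
    apply Subtype.ext
    have h1 : w u = w v := congrArg Subtype.val huv
    have h2 := congrArg (fun z => (Ring.inverse w : Module.End F V) z) h1
    rwa [← Module.End.mul_apply, ← Module.End.mul_apply, Ring.inverse_mul_cancel _ hw] at h2
  have hsur := Finite.surjective_of_injective hinj
  intro u hu
  obtain ⟨v, hv⟩ := hsur ⟨u, hu⟩
  have h1 : w v = u := congrArg Subtype.val hv
  rw [Submodule.mem_comap, ← h1, ← Module.End.mul_apply, Ring.inverse_mul_cancel _ hw]
  exact v.2

theorem inverse_inverse' {w : Module.End F V} (hw : IsUnit w) : Ring.inverse (Ring.inverse w) = w :=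
  ring_inverse_of (Ring.inverse_mul_cancel _ hw) (Ring.mul_inverse_cancel _ hw)

theorem inv_inverse {w : Module.End F V} (hw : IsUnit w) {W : Submodule F V} : Inv (Ring.inverse w) W ↔ Inv w W := by
  refine ⟨fun h => ?_, inv_inverse_aux hw⟩
  have := inv_inverse_aux (hw.ringInverse) h
  rwa [inverse_inverse' hw] at this

theorem restrict_inverse {w : Module.End F V} (hw : IsUnit w) {W : Submodule F V} (h : Inv w W) (h' : Inv (Ring.inverse w) W) :
    Ring.inverse (w.restrict h) = (Ring.inverse w).restrict h' := by
  refine ring_inverse_of ?_ ?_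
  · refine LinearMap.ext fun u => Subtype.ext ?_
    exact LinearMap.congr_fun (Ring.mul_inverse_cancel _ hw) (u : V)
  · refine LinearMap.ext fun u => Subtype.ext ?_
    exact LinearMap.congr_fun (Ring.inverse_mul_cancel _ hw) (u : V)

theorem mapQ_inverse {w : Module.End F V} (hw : IsUnit w) {W : Submodule F V} (h : Inv w W) (h' : Inv (Ring.inverse w) W) :
    Ring.inverse (W.mapQ W w h) = W.mapQ W (Ring.inverse w) h' := by
  refine ring_inverse_of ?_ ?_
  · ext v
    exact congrArg W.mkQ (LinearMap.congr_fun (Ring.mul_inverse_cancel _ hw) (v : V))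
  · ext v
    exact congrArg W.mkQ (LinearMap.congr_fun (Ring.inverse_mul_cancel _ hw) (v : V))

theorem det_mul_inv (w : Module.End F V) {W : Submodule F V} (h : Inv w W) :
    LinearMap.det w = LinearMap.det (w.restrict h) * LinearMap.det (W.mapQ W w h) := by
  rw [LinearMap.det_eq_sign_charpoly_coeff, LinearMap.det_eq_sign_charpoly_coeff, LinearMap.det_eq_sign_charpoly_coeff,
    charpoly_mul W w h, mul_coeff_zero, ← Submodule.finrank_quotient_add_finrank W]
  ring

theorem isUnit_of_chi {χ : MulChar F ℂ} {w : Module.End F V} (h : χ (LinearMap.det w) ≠ 0) : IsUnit w := by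
  rw [LinearMap.isUnit_iff_isUnit_det]
  by_contra h'
  exact h (χ.map_nonunit h')

/-- twisted inversion -/
noncomputable def iot (χ : MulChar F ℂ) (φ : Module.End F V → ℂ) : Module.End F V → ℂ :=
  fun w => χ (LinearMap.det w) * φ (Ring.inverse w)

theorem iot_glue (χ : MulChar F ℂ) (W : Submodule F V) (A : Module.End F W → ℂ) (B : Module.End F (V ⧸ W) → ℂ) (w : Module.End F V) :
    χ (LinearMap.det w) * (if h : Inv (Ring.inverse w) W then A ((Ring.inverse w).restrict h) * B (W.mapQ W (Ring.inverse w) h) else 0)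
    = if h : Inv w W then iot χ A (w.restrict h) * iot χ B (W.mapQ W w h) else 0 := by
  by_cases h : Inv w W
  · rw [dif_pos h]
    unfold iot
    by_cases h0 : χ (LinearMap.det w) = 0
    · have h1 := h0
      rw [det_mul_inv w h, map_mul] at h1
      rw [h0, zero_mul]
      symm
      calc _ = (χ (LinearMap.det (w.restrict h)) * χ (LinearMap.det (W.mapQ W w h))) * (A (Ring.inverse (w.restrict h)) * B (Ring.inverse (W.mapQ W w h))) := by ring
        _ = 0 := by rw [h1, zero_mul]
    · have hw := isUnit_of_chi h0
      have h' := (inv_inverse hw).2 h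
      rw [dif_pos h', restrict_inverse hw h h', mapQ_inverse hw h h', det_mul_inv w h, map_mul]
      ring
  · rw [dif_neg h]
    by_cases h0 : χ (LinearMap.det w) = 0
    · rw [h0, zero_mul]
    · rw [dif_neg, mul_zero]
      rwa [inv_inverse (isUnit_of_chi h0)]

variable (ψ : AddChar F ℂ)

/-- multiplicative convolution with a twisted additive character -/
noncomputable def DD (χ : MulChar F ℂ) (φ : Module.End F V → ℂ) : Module.End F V → ℂ :=
  fun x => χ (LinearMap.det x) * four ψ (iot χ φ) x

noncomputable def KL (χ₀ : MulChar F ℂ) : List (MulChar F ℂ) → Module.End F V → ℂ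
  | [] => fun x => χ₀ (LinearMap.det x) * ψ (LinearMap.trace F V x)
  | χ :: l => DD ψ χ (KL χ₀ l)

noncomputable def PL (χ₀ : MulChar F ℂ) : List (MulChar F ℂ) → Module.End F V → ℂ
  | [] => fun x => χ₀ (LinearMap.det x) * ψ (LinearMap.trace F V x) * phi x
  | χ :: l => DD ψ χ (PL χ₀ l)

theorem hall (hψ : ψ ≠ 1) (χ₀ : MulChar F ℂ) (l : List (MulChar F ℂ)) [Fintype (Submodule F V)] (x : Module.End F V) :
    (finrank F V : ℂ) * KL ψ χ₀ l x = ∑ W : Submodule F V, if h : Inv x W then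
      (Nat.card F : ℂ) ^ (l.length * (finrank F W * finrank F (V ⧸ W))) * (PL ψ χ₀ l (x.restrict h) * KL ψ χ₀ l (W.mapQ W x h)) else 0 := by
  induction l generalizing x with
  | nil =>
    rw [← phi_sum x, Finset.sum_mul]
    refine Finset.sum_congr rfl fun W _ => ?_
    by_cases h : Inv x W
    · rw [dif_pos h, phiW_of h]
      simp only [KL, PL]
      rw [det_mul_inv x h, trace_add W x h, map_mul, AddChar.map_add_eq_mul]
      simp only [List.length_nil, zero_mul, pow_zero]
      ring
    · rw [dif_neg h, phiW_not h, zero_mul]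
  | cons χ l ih =>
    have key : ∀ w : Module.End F V, (finrank F V : ℂ) * iot χ (KL ψ χ₀ l) w =
        ∑ W : Submodule F V, (Nat.card F : ℂ) ^ (l.length * (finrank F W * finrank F (V ⧸ W))) *
          (if h : Inv w W then iot χ (PL ψ χ₀ l) (w.restrict h) * iot χ (KL ψ χ₀ l) (W.mapQ W w h) else 0) := by
      intro w
      rw [iot, mul_left_comm, ih, Finset.mul_sum]
      refine Finset.sum_congr rfl fun W _ => ?_
      rw [← iot_glue χ W (PL ψ χ₀ l) (KL ψ χ₀ l) w]
      by_cases h : Inv (Ring.inverse w) W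
      · rw [dif_pos h, dif_pos h]; ring
      · rw [dif_neg h, dif_neg h]; ring
    change (finrank F V : ℂ) * DD ψ χ (KL ψ χ₀ l) x = _
    rw [DD, mul_left_comm, four, Finset.mul_sum]
    have h2 : ∀ w : Module.End F V, (finrank F V : ℂ) * (iot χ (KL ψ χ₀ l) w * ψ (LinearMap.trace F V (w * x))) =
        ∑ W : Submodule F V, (Nat.card F : ℂ) ^ (l.length * (finrank F W * finrank F (V ⧸ W))) *
          (if h : Inv w W then iot χ (PL ψ χ₀ l) (w.restrict h) * iot χ (KL ψ χ₀ l) (W.mapQ W w h) * ψ (LinearMap.trace F V (w * x)) else 0) := by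
      intro w
      rw [← mul_assoc, key, Finset.sum_mul]
      refine Finset.sum_congr rfl fun W _ => ?_
      rw [mul_assoc, dite_mul, zero_mul]
    rw [Finset.sum_congr rfl fun w _ => h2 w, Finset.sum_comm, Finset.mul_sum]
    refine Finset.sum_congr rfl fun W _ => ?_
    rw [← Finset.mul_sum, parab_sum ψ hψ W]
    by_cases h : Inv x W
    · rw [dif_pos h, dif_pos h]
      change _ = _ * (DD ψ χ (PL ψ χ₀ l) (x.restrict h) * DD ψ χ (KL ψ χ₀ l) (W.mapQ W x h))
      rw [DD, DD, det_mul_inv x h, map_mul, List.length_cons, Nat.add_mul, pow_add, one_mul]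
      ring
    · rw [dif_neg h, dif_neg h, mul_zero, mul_zero]

end hall
end MK

set_option linter.all false
namespace MK
open Module Polynomial
open scoped BigOperators Classical

section primk
variable {F : Type} [Field F] [Finite F] {V : Type} [AddCommGroup V] [Module F V] [Finite V]
variable {V' : Type} [AddCommGroup V'] [Module F V'] [Finite V']

theorem conj_mul' (g : V ≃ₗ[F] V') (y z : Module.End F V) :
    g.conj (y * z) = g.conj y * g.conj z := by
  ext v; simp [LinearEquiv.conj_apply]

theorem conj_one' (g : V ≃ₗ[F] V') : g.conj (1 : Module.End F V) = 1 := by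
  ext v; simp [LinearEquiv.conj_apply]

theorem inverse_conj (g : V ≃ₗ[F] V') {w : Module.End F V} (hw : IsUnit w) :
    Ring.inverse (g.conj w) = g.conj (Ring.inverse w) := by
  refine ring_inverse_of ?_ ?_
  · rw [← conj_mul', Ring.mul_inverse_cancel _ hw, conj_one']
  · rw [← conj_mul', Ring.inverse_mul_cancel _ hw, conj_one']

theorem det_conj' (g : V ≃ₗ[F] V') (w : Module.End F V) : LinearMap.det (g.conj w) = LinearMap.det w :=
  LinearMap.det_conj w g

theorem iot_conj (g : V ≃ₗ[F] V') (χ : MulChar F ℂ) {φ : Module.End F V → ℂ} {φ' : Module.End F V' → ℂ}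
    (h : ∀ y, φ' (g.conj y) = φ y) (w : Module.End F V) : iot χ φ' (g.conj w) = iot χ φ w := by
  unfold iot
  rw [det_conj']
  by_cases h0 : χ (LinearMap.det w) = 0
  · rw [h0, zero_mul, zero_mul]
  · rw [inverse_conj g (isUnit_of_chi h0), h]

variable (ψ : AddChar F ℂ)

theorem DD_conj (g : V ≃ₗ[F] V') (χ : MulChar F ℂ) {φ : Module.End F V → ℂ} {φ' : Module.End F V' → ℂ}
    (h : ∀ y, φ' (g.conj y) = φ y) (x : Module.End F V) : DD ψ χ φ' (g.conj x) = DD ψ χ φ x := by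
  unfold DD four
  rw [det_conj']
  congr 1
  rw [← Equiv.sum_comp (g.conj.toEquiv)]
  refine Finset.sum_congr rfl fun z _ => ?_
  have : (g.conj.toEquiv z : Module.End F V') = g.conj z := rfl
  rw [this, iot_conj g χ h z, ← conj_mul', LinearMap.trace_conj']

theorem phi_conj (g : V ≃ₗ[F] V') (x : Module.End F V) : phi (g.conj x) = phi x :=
  (phi_congr g x (g.conj x) (fun v => by simp [LinearEquiv.conj_apply])).symm

theorem KL_conj (g : V ≃ₗ[F] V') (χ₀ : MulChar F ℂ) (l : List (MulChar F ℂ)) (x : Module.End F V) :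
    KL ψ χ₀ l (g.conj x) = KL ψ χ₀ l x := by
  induction l generalizing x with
  | nil => simp only [KL]; rw [det_conj', LinearMap.trace_conj']
  | cons χ l ih => exact DD_conj ψ g χ ih x

theorem PL_conj (g : V ≃ₗ[F] V') (χ₀ : MulChar F ℂ) (l : List (MulChar F ℂ)) (x : Module.End F V) :
    PL ψ χ₀ l (g.conj x) = PL ψ χ₀ l x := by
  induction l generalizing x with
  | nil => simp only [PL]; rw [det_conj', LinearMap.trace_conj', phi_conj]
  | cons χ l ih => exact DD_conj ψ g χ ih x

theorem eq_conj (g : V ≃ₗ[F] V') {x : Module.End F V} {x' : Module.End F V'} (h : ∀ v, g (x v) = x' (g v)) : x' = g.conj x := by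
  ext v
  rw [LinearEquiv.conj_apply_apply, h, g.apply_symm_apply]

theorem Prim.iot {Φ : Module.End F V → ℂ} (hΦ : Prim Φ) (χ : MulChar F ℂ) : Prim (iot χ Φ) := by
  intro U h0 h1 y hy
  unfold MK.iot
  have hdet : ∀ N : nil U, LinearMap.det (y + (N : Module.End F V)) = LinearMap.det y := fun N =>
    det_of_charpoly_eq (charpoly_add_nil hy N.2)
  simp only [hdet]
  by_cases h2 : χ (LinearMap.det y) = 0
  · simp only [h2, zero_mul, Finset.sum_const_zero]
  have hu := isUnit_of_chi h2
  rw [← Finset.mul_sum]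
  have hyi : Inv (Ring.inverse y) U := (inv_inverse hu).2 hy
  have c1 := Ring.mul_inverse_cancel _ hu
  have c2 := Ring.inverse_mul_cancel _ hu
  set z := Ring.inverse y with hz
  have hinv : ∀ N : nil U, Ring.inverse (y + (N : Module.End F V)) = z + -(z * (N : Module.End F V) * z) := by
    intro N
    have hN0 : (N : Module.End F V) * z * N = 0 := by
      ext v
      exact N.2.2 _ (hyi (N.2.1 v))
    refine ring_inverse_of ?_ ?_
    · rw [mul_add, add_mul, c1, mul_neg, add_mul, ← mul_assoc, ← mul_assoc, c1, one_mul, ← mul_assoc, ← mul_assoc, hN0, zero_mul, add_zero]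
      abel
    · rw [add_mul, mul_add, c2, neg_mul, mul_add, mul_assoc (z * (N : Module.End F V)), c2, mul_one, mul_assoc z, mul_assoc z, hN0, mul_zero, add_zero]
      abel
  have hmem : ∀ (t : Module.End F V), Inv t U → ∀ N : nil U, -(t * (N : Module.End F V) * t) ∈ nil U := by
    intro t ht N
    refine (nil U).neg_mem ⟨fun v => ht (N.2.1 _), fun u hu => ?_⟩
    change t (N.1 (t u)) = 0
    rw [N.2.2 _ (ht hu), map_zero]
  let e : nil U ≃ nil U :=
    { toFun := fun N => ⟨-(z * N * z), hmem z hyi N⟩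
      invFun := fun N => ⟨-(y * N * y), hmem y hy N⟩
      left_inv := fun N => Subtype.ext (by
        change -(y * (-(z * (N : Module.End F V) * z)) * y) = N
        rw [mul_neg, neg_mul, neg_neg, mul_assoc, mul_assoc (z * (N : Module.End F V)), c2, mul_one, ← mul_assoc, c1, one_mul])
      right_inv := fun N => Subtype.ext (by
        change -(z * (-(y * (N : Module.End F V) * y)) * z) = N
        rw [mul_neg, neg_mul, neg_neg, mul_assoc, mul_assoc (y * (N : Module.End F V)), c1, mul_one, ← mul_assoc, c2, one_mul]) }
  have h3 : ∑ N : nil U, Φ (Ring.inverse (y + (N : Module.End F V))) = ∑ N : nil U, Φ (z + ((e N : nil U) : Module.End F V)) :=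
    Finset.sum_congr rfl fun N _ => by rw [hinv]; rfl
  rw [h3, Equiv.sum_comp e (fun N : nil U => Φ (z + (N : Module.End F V))), hΦ U h0 h1 z hyi, mul_zero]

theorem Prim.DD (hψ : ψ ≠ 1) {Φ : Module.End F V → ℂ} (hΦ : Prim Φ) (χ : MulChar F ℂ) : Prim (DD ψ χ Φ) :=
  ((hΦ.iot χ).four ψ hψ).mul_stable _ (fun y z h => by rw [det_of_charpoly_eq h])

theorem PL_prim (hψ : ψ ≠ 1) (χ₀ : MulChar F ℂ) (l : List (MulChar F ℂ)) : Prim (PL ψ χ₀ l : Module.End F V → ℂ) := by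
  induction l with
  | nil =>
    exact phi_prim.mul_stable (F := F) (V := V) (fun x => χ₀ (LinearMap.det x) * ψ (LinearMap.trace F V x)) (fun y z h => by rw [det_of_charpoly_eq h, trace_of_charpoly_eq h])
  | cons χ l ih => exact ih.DD ψ hψ χ

theorem PL_class (χ₀ : MulChar F ℂ) (l : List (MulChar F ℂ)) : ClassFn (PL ψ χ₀ l : Module.End F V → ℂ) :=
  fun g y => PL_conj ψ g χ₀ l y

end primk
end MK

set_option linter.all false
namespace MK
open Module Polynomial
open scoped BigOperators Classical

section fieldk
variable {F : Type} [Field F] [Finite F] {E : Type} [Field E] [Algebra F E] [Finite E]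

theorem det_cp {y : Module.End F E} {η : E} (h : y.charpoly = cp F η) : LinearMap.det y = Algebra.norm F η :=
  det_of_charpoly_eq h

theorem charpoly_inverse {y : Module.End F E} {η : E} (h : y.charpoly = cp F η) (h0 : η ≠ 0) :
    IsUnit y ∧ (Ring.inverse y).charpoly = cp F η⁻¹ := by
  have hc : IsCoprime (X : F[X]) (cp F η) := by
    refine (irreducible_X.coprime_iff_not_dvd).2 fun hd => ?_
    exact (cp_coeff_zero η).2 h0 (X_dvd_iff.1 hd)
  obtain ⟨p, c, hpc⟩ := hc
  have h1 : aeval y p * y = 1 := by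
    have := congrArg (aeval y) hpc
    rwa [map_add, map_mul, map_mul, aeval_X, ← h, LinearMap.aeval_self_charpoly, mul_zero, add_zero, map_one] at this
  have h2 : y * aeval y p = 1 := by
    have := congrArg (aeval y) (mul_comm p X)
    rw [map_mul, map_mul, aeval_X] at this
    rw [← this, h1]
  have h3 : aeval η p * η = 1 := by
    have := congrArg (aeval η) hpc
    rwa [map_add, map_mul, map_mul, aeval_X, aeval_cp, mul_zero, add_zero, map_one] at this
  refine ⟨⟨⟨y, aeval y p, h2, h1⟩, rfl⟩, ?_⟩
  rw [ring_inverse_of h2 h1, charpoly_aeval h, eq_inv_of_mul_eq_one_left h3]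

theorem dg_inv (η : E) : dg F η⁻¹ = dg F η := by
  unfold dg
  rw [← IntermediateField.adjoin.finrank (isInt (F := F) η), ← IntermediateField.adjoin.finrank (isInt (F := F) η⁻¹)]
  have : IntermediateField.adjoin F {η⁻¹} = IntermediateField.adjoin F {η} := by
    refine le_antisymm ?_ ?_
    · rw [IntermediateField.adjoin_simple_le_iff]
      exact inv_mem (IntermediateField.mem_adjoin_simple_self F η)
    · rw [IntermediateField.adjoin_simple_le_iff]
      have := inv_mem (IntermediateField.mem_adjoin_simple_self F η⁻¹)
      rwa [inv_inv] at this
  rw [this]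

theorem sg_mul_of {Φ h : Module.End F E → ℂ} {η : E} {c : ℂ} (hh : ∀ y, y.charpoly = cp F η → h y = c) :
    sg (fun y => h y * Φ y) η = c * sg Φ η := by
  unfold sg cs
  rw [← mul_div_assoc, Finset.mul_sum]
  congr 1
  refine Finset.sum_congr rfl fun y _ => ?_
  by_cases hy : y.charpoly = cp F η
  · beta_reduce; rw [if_pos hy, hh y hy]; ring
  · rw [if_neg hy]; ring

/-- inversion as an involution of `End` -/
noncomputable def invEquiv (F E : Type) [Field F] [Finite F] [Field E] [Algebra F E] [Finite E] : Module.End F E ≃ Module.End F E where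
  toFun y := if IsUnit y then Ring.inverse y else y
  invFun y := if IsUnit y then Ring.inverse y else y
  left_inv y := by
    by_cases h : IsUnit y
    · simp only [if_pos h, if_pos h.ringInverse]; exact inverse_inverse' h
    · simp only [if_neg h]
  right_inv y := by
    by_cases h : IsUnit y
    · simp only [if_pos h, if_pos h.ringInverse]; exact inverse_inverse' h
    · simp only [if_neg h]

theorem sg_iot (χ : MulChar F ℂ) (Φ : Module.End F E → ℂ) (η : E) : sg (iot χ Φ) η = χ (Algebra.norm F η) * sg Φ η⁻¹ := by
  have h1 : sg (iot χ Φ) η = χ (Algebra.norm F η) * sg (fun y => Φ (Ring.inverse y)) η :=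
    sg_mul_of (fun y hy => by rw [det_cp hy])
  rw [h1]
  by_cases h0 : η = 0
  · rw [h0, Algebra.norm_zero, MulChar.map_zero, zero_mul, zero_mul]
  congr 1
  unfold sg cs
  rw [dg_inv]
  congr 1
  rw [← Equiv.sum_comp (invEquiv F E) (fun y => Φ y * (if y.charpoly = cp F η⁻¹ then 1 else 0))]
  refine Finset.sum_congr rfl fun y _ => ?_
  have h0' : η⁻¹ ≠ 0 := inv_ne_zero h0
  by_cases hy : IsUnit y
  · have he : invEquiv F E y = Ring.inverse y := if_pos hy
    rw [he]
    congr 1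
    have : y.charpoly = cp F η ↔ (Ring.inverse y).charpoly = cp F η⁻¹ := by
      refine ⟨fun h => (charpoly_inverse h h0).2, fun h => ?_⟩
      have := (charpoly_inverse h h0').2
      rwa [inverse_inverse' hy, inv_inv] at this
    simp only [this]
  · have he : invEquiv F E y = y := if_neg hy
    rw [he, if_neg (fun h => hy (charpoly_inverse h h0).1), if_neg (fun h => hy (charpoly_inverse h h0').1), mul_zero, mul_zero]

variable (ψ : AddChar F ℂ)

theorem sg_DD (hψ : ψ ≠ 1) (χ : MulChar F ℂ) {Φ : Module.End F E → ℂ} (hΦ : Prim Φ) (hcl : ClassFn Φ) (η : E) :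
    sg (DD ψ χ Φ) η = AA F E * (χ (Algebra.norm F η) * ∑ w : E, χ (Algebra.norm F w) * sg Φ w⁻¹ * ψ (Algebra.trace F E (w * η))) := by
  have h1 : sg (DD ψ χ Φ) η = χ (Algebra.norm F η) * sg (four ψ (iot χ Φ)) η :=
    sg_mul_of (fun y hy => by rw [det_cp hy])
  rw [h1, sg_four ψ hψ (hΦ.iot χ) (fun g y => iot_conj g χ (hcl g) y), RR, mul_left_comm]
  simp only [sg_iot]

noncomputable def KE (χ₀ : MulChar F ℂ) : List (MulChar F ℂ) → E → ℂ
  | [] => fun η => χ₀ (Algebra.norm F η) * ψ (Algebra.trace F E η)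
  | χ :: l => fun η => χ (Algebra.norm F η) * ∑ w : E, χ (Algebra.norm F w) * KE χ₀ l w⁻¹ * ψ (Algebra.trace F E (w * η))

theorem sg_PL (hψ : ψ ≠ 1) (χ₀ : MulChar F ℂ) (l : List (MulChar F ℂ)) (η : E) :
    sg (PL ψ χ₀ l) η = AA F E ^ l.length * GG F E * KE ψ χ₀ l η := by
  induction l generalizing η with
  | nil =>
    have h1 : sg (PL ψ χ₀ []) η = (χ₀ (Algebra.norm F η) * ψ (Algebra.trace F E η)) * sg (fun y : Module.End F E => phi y) η :=
      sg_mul_of (fun y hy => by rw [det_cp hy, trace_cp hy])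
    rw [h1, sg_phi, KE, List.length_nil, pow_zero]; ring
  | cons χ l ih =>
    have h1 := sg_DD ψ hψ χ (PL_prim ψ hψ χ₀ l) (PL_class ψ χ₀ l) η
    change sg (DD ψ χ (PL ψ χ₀ l)) η = _
    rw [h1, KE, List.length_cons, pow_succ]
    simp only [ih]
    rw [Finset.mul_sum, Finset.mul_sum, Finset.mul_sum, Finset.mul_sum]
    refine Finset.sum_congr rfl fun w _ => ?_
    ring

theorem PL_reg (hψ : ψ ≠ 1) (χ₀ : MulChar F ℂ) (l : List (MulChar F ℂ)) {y : Module.End F E} {v : E} (hv : cyc y v = ⊤) {η : E}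
    (h : y.charpoly = cp F η) : PL ψ χ₀ l y = dg F η * AA F E ^ l.length * KE ψ χ₀ l η := by
  have h1 := sg_reg (PL_prim ψ hψ χ₀ l) (PL_class ψ χ₀ l) hv h
  rw [sg_PL ψ hψ, eq_div_iff (dg_ne η)] at h1
  have h2 := GG_ne (F := F) (E := E)
  refine mul_left_cancel₀ h2 ?_
  rw [← h1]; ring

end fieldk
end MK

set_option linter.all false
namespace MK
open Module Polynomial
open scoped BigOperators Classical

section cyclicJ
variable {F : Type} [Field F] [Finite F] {V : Type} [AddCommGroup V] [Module F V] [Finite V]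

/-- cyclic operator with characteristic polynomial `ℓ ^ b` -/
def IsJ (ℓ : F[X]) (b : ℕ) (y : Module.End F V) : Prop := y.charpoly = ℓ ^ b ∧ ∃ v, cyc y v = ⊤

theorem IsJ.finrank {ℓ : F[X]} {b : ℕ} {y : Module.End F V} (h : IsJ ℓ b y) : finrank F V = b * ℓ.natDegree := by
  rw [← LinearMap.charpoly_natDegree y, h.1, natDegree_pow]

theorem nontrivial_of_finrank (h : 0 < Module.finrank F V) : Nontrivial V := Module.nontrivial_of_finrank_pos h

theorem inv_class {ℓ : F[X]} (hℓ : Irreducible ℓ) {b : ℕ} {y : Module.End F V} (hc : y.charpoly = ℓ ^ b) {v : V} (hv : cyc y v = ⊤)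
    {W : Submodule F V} (hW : Inv y W) : ∃ j ≤ b, W = LinearMap.range (aeval y (ℓ ^ j)) := by
  have hex : ∃ j, aeval y (ℓ ^ j) v ∈ W := ⟨b, by rw [← hc, LinearMap.aeval_self_charpoly]; exact W.zero_mem⟩
  have hj : aeval y (ℓ ^ Nat.find hex) v ∈ W := Nat.find_spec hex
  have hmin : ∀ i, aeval y (ℓ ^ i) v ∈ W → Nat.find hex ≤ i := fun i hi => Nat.find_min' hex hi
  set j := Nat.find hex
  have hall : ∀ u : V, ∃ p : F[X], aeval y p v = u := fun u => by
    have : u ∈ cyc y v := hv ▸ trivial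
    exact this
  have hcomm : ∀ p q : F[X], aeval y p (aeval y q v) = aeval y (p * q) v := fun p q => by rw [map_mul]; rfl
  refine ⟨j, hmin b (by rw [← hc, LinearMap.aeval_self_charpoly]; exact W.zero_mem), le_antisymm ?_ ?_⟩
  · intro u hu
    obtain ⟨p, rfl⟩ := hall u
    have hg := EuclideanDomain.gcd_dvd_right p (ℓ ^ b)
    obtain ⟨i, hib, hi⟩ := (dvd_prime_pow hℓ.prime _).1 hg
    have hgW : aeval y (EuclideanDomain.gcd p (ℓ ^ b)) v ∈ W := by
      rw [EuclideanDomain.gcd_eq_gcd_ab, map_add, LinearMap.add_apply, mul_comm p, mul_comm (ℓ ^ b), ← hcomm, ← hcomm]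
      refine W.add_mem (hW.aeval _ hu) (hW.aeval _ ?_)
      rw [← hc, LinearMap.aeval_self_charpoly]; exact W.zero_mem
    have hiW : aeval y (ℓ ^ i) v ∈ W := by
      obtain ⟨r, hr⟩ := hi.dvd
      rw [hr, mul_comm, ← hcomm]
      exact hW.aeval _ hgW
    have hd : ℓ ^ j ∣ p := ((pow_dvd_pow ℓ (hmin i hiW)).trans hi.symm.dvd).trans (EuclideanDomain.gcd_dvd_left p (ℓ ^ b))
    obtain ⟨r, hr⟩ := hd
    exact ⟨aeval y r v, by rw [hcomm, hr]⟩
  · rintro _ ⟨u, rfl⟩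
    obtain ⟨p, rfl⟩ := hall u
    rw [hcomm, mul_comm, ← hcomm]
    exact hW.aeval _ hj

theorem aeval_restrict' {y : Module.End F V} {W : Submodule F V} (hW : Inv y W) (p : F[X]) (w : W) :
    ((aeval (y.restrict hW) p w : W) : V) = aeval y p (w : V) := by
  induction p using Polynomial.induction_on' generalizing w with
  | add p q hp hq => simp [map_add, hp, hq]
  | monomial n c =>
    rw [aeval_monomial, aeval_monomial]
    simp only [Module.End.mul_apply, Module.algebraMap_end_apply, Submodule.coe_smul]
    congr 1
    induction n generalizing w with
    | zero => simp
    | succ n ih =>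
      rw [pow_succ, pow_succ, Module.End.mul_apply, Module.End.mul_apply, ih]
      rfl

theorem aeval_mapQ {y : Module.End F V} {W : Submodule F V} (hW : Inv y W) (p : F[X]) (v : V) :
    aeval (W.mapQ W y hW) p (W.mkQ v) = W.mkQ (aeval y p v) := by
  induction p using Polynomial.induction_on' generalizing v with
  | add p q hp hq => rw [map_add, map_add, LinearMap.add_apply, LinearMap.add_apply, hp, hq, map_add]
  | monomial n c =>
    rw [aeval_monomial, aeval_monomial]
    simp only [Module.End.mul_apply, Module.algebraMap_end_apply, map_smul]
    congr 1
    induction n generalizing v with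
    | zero => simp
    | succ n ih =>
      rw [pow_succ, pow_succ, Module.End.mul_apply, Module.End.mul_apply, ← ih]
      rfl

theorem monic_pow_of_dvd {ℓ p : F[X]} (hm : ℓ.Monic) (hℓ : Irreducible ℓ) {b j : ℕ} (hp : p.Monic) (hd : p ∣ ℓ ^ b)
    (hdeg : p.natDegree = j * ℓ.natDegree) : p = ℓ ^ j := by
  obtain ⟨i, -, hi⟩ := (dvd_prime_pow hℓ.prime _).1 hd
  have h := Polynomial.eq_of_monic_of_associated hp (hm.pow i) hi
  rw [h, natDegree_pow] at hdeg
  rw [h, Nat.eq_of_mul_eq_mul_right hℓ.natDegree_pos hdeg]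

theorem range_J {ℓ : F[X]} (hm : ℓ.Monic) (hℓ : Irreducible ℓ) {b j : ℕ} (hb : 1 ≤ b) (hj : j ≤ b) {y : Module.End F V} (h : IsJ ℓ b y)
    {W : Submodule F V} (hW : W = LinearMap.range (aeval y (ℓ ^ j))) (hi : Inv y W) :
    Module.finrank F W = (b - j) * ℓ.natDegree ∧ Module.finrank F (V ⧸ W) = j * ℓ.natDegree ∧
      IsJ ℓ (b - j) (y.restrict hi) ∧ IsJ ℓ j (W.mapQ W y hi) := by
  obtain ⟨hc, v, hv⟩ := h
  have hfr : finrank F V = b * ℓ.natDegree := IsJ.finrank ⟨hc, v, hv⟩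
  haveI : Nontrivial V := nontrivial_of_finrank (F := F) (by rw [hfr]; exact Nat.mul_pos hb hℓ.natDegree_pos)
  have h1 := finrank_range_aeval hv (hm.pow j) (hc ▸ pow_dvd_pow ℓ hj)
  rw [← hW, natDegree_pow, hfr] at h1
  have h1' : finrank F W = (b - j) * ℓ.natDegree := by rw [Nat.sub_mul]; omega
  have h2 := Submodule.finrank_quotient_add_finrank W
  have h2' : finrank F (V ⧸ W) = j * ℓ.natDegree := by omega
  have hcm := charpoly_mul W y hi
  rw [hc] at hcm
  refine ⟨h1', h2', ⟨?_, ?_⟩, ⟨?_, ?_⟩⟩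
  · refine monic_pow_of_dvd hm hℓ (LinearMap.charpoly_monic _) ⟨_, hcm⟩ ?_
    rw [LinearMap.charpoly_natDegree, h1']
  · have hmem : aeval y (ℓ ^ j) v ∈ W := hW ▸ ⟨v, rfl⟩
    refine ⟨⟨_, hmem⟩, ?_⟩
    rw [eq_top_iff]
    rintro ⟨u, hu⟩ -
    have hu' := hu
    rw [hW] at hu'
    obtain ⟨w, rfl⟩ := hu'
    have : w ∈ cyc y v := hv ▸ trivial
    obtain ⟨p, rfl⟩ := this
    refine ⟨p, Subtype.ext ?_⟩
    refine (aeval_restrict' hi p _).trans ?_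
    change aeval y p (aeval y (ℓ ^ j) v) = aeval y (ℓ ^ j) (aeval y p v)
    have : aeval y (p * ℓ ^ j) v = aeval y (ℓ ^ j * p) v := by rw [mul_comm]
    rwa [map_mul, map_mul] at this
  · refine monic_pow_of_dvd hm hℓ (LinearMap.charpoly_monic _) ⟨_, hcm.trans (mul_comm _ _)⟩ ?_
    rw [LinearMap.charpoly_natDegree, h2']
  · refine ⟨W.mkQ v, ?_⟩
    rw [eq_top_iff]
    rintro u -
    obtain ⟨w, rfl⟩ := W.mkQ_surjective u
    have : w ∈ cyc y v := hv ▸ trivial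
    obtain ⟨p, rfl⟩ := this
    exact ⟨p, aeval_mapQ hi p v⟩

theorem sum_inv {ℓ : F[X]} (hm : ℓ.Monic) (hℓ : Irreducible ℓ) {b : ℕ} (hb : 1 ≤ b) {y : Module.End F V} (h : IsJ ℓ b y)
    [Fintype (Submodule F V)] (f : Submodule F V → ℂ) (hf : ∀ W, ¬ Inv y W → f W = 0) :
    ∑ W, f W = ∑ j ∈ Finset.range (b + 1), f (LinearMap.range (aeval y (ℓ ^ j))) := by
  have hinj : Set.InjOn (fun j => LinearMap.range (aeval y (ℓ ^ j))) (Finset.range (b + 1) : Finset ℕ) := by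
    intro i hi j hj hij
    have hi' : i ≤ b := by simpa [Nat.lt_succ_iff] using hi
    have hj' : j ≤ b := by simpa [Nat.lt_succ_iff] using hj
    have h1 := (range_J hm hℓ hb hi' h rfl (inv_range_aeval y _)).2.1
    have h2 := (range_J hm hℓ hb hj' h rfl (inv_range_aeval y _)).2.1
    dsimp only at hij
    rw [hij, h2] at h1
    exact (Nat.eq_of_mul_eq_mul_right hℓ.natDegree_pos h1).symm
  rw [← Finset.sum_image (f := f) hinj]
  symm
  refine Finset.sum_subset (Finset.subset_univ _) fun W _ hW => ?_
  apply hf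
  intro hi
  obtain ⟨hc, v, hv⟩ := h
  obtain ⟨j, hj, rfl⟩ := inv_class hℓ hc hv hi
  exact hW (Finset.mem_image.2 ⟨j, by rw [Finset.mem_range]; omega, rfl⟩)

end cyclicJ
end MK

set_option linter.all false
namespace MK
open Module Polynomial
open scoped BigOperators Classical

section recur
variable {F : Type} [Field F] [Finite F] (ψ : AddChar F ℂ) (χ₀ : MulChar F ℂ)

theorem PL_J {V : Type} [AddCommGroup V] [Module F V] [Finite V] (hψ : ψ ≠ 1) (l : List (MulChar F ℂ)) {ℓ : F[X]} {j : ℕ} {y : Module.End F V} (h : IsJ ℓ j y)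
    {E : Type} [Field E] [Algebra F E] [Finite E] {η : E} (hη : cp F η = ℓ ^ j) :
    PL ψ χ₀ l y = dg F η * AA F E ^ l.length * KE ψ χ₀ l η := by
  obtain ⟨hc, v, hv⟩ := h
  have hn : (cp F η).natDegree = finrank F V := by
    rw [← LinearMap.charpoly_natDegree y, hc, hη]
  haveI : Nontrivial V := nontrivial_of_finrank (F := F) (by rw [← hn, natDegree_cp]; exact finrank_pos)
  obtain ⟨e, ⟨he, -⟩, -⟩ := A4aux (cp_monic η) hn y v (hc.trans hη.symm) hv
  obtain ⟨y', v', hy', hv'⟩ := exists_cyclic (V := E) (cp_monic (F := F) η) (natDegree_cp η)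
  obtain ⟨e', ⟨he', -⟩, -⟩ := A4aux (cp_monic η) (natDegree_cp η) y' v' hy' hv'
  rw [← PL_reg ψ hψ χ₀ l hv' hy']
  have : y' = (e.symm.trans e').conj y := by
    rw [← he, ← he']
    ext u
    simp [LinearEquiv.conj_apply]
  rw [this, PL_conj]

theorem det_sub {V : Type} [AddCommGroup V] [Module F V] [Subsingleton V] (y : Module.End F V) : LinearMap.det y = 1 := by
  rw [Subsingleton.elim y 1, map_one]

theorem sum_subs {X : Type} {_ : Fintype X} [Subsingleton X] (f : X → ℂ) (a : X) : ∑ z, f z = f a :=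
  Fintype.sum_subsingleton f a

theorem KL_zero {V : Type} [AddCommGroup V] [Module F V] [Finite V] [Subsingleton V] (l : List (MulChar F ℂ)) (y : Module.End F V) :
    KL ψ χ₀ l y = 1 := by
  induction l generalizing y with
  | nil => rw [KL]; beta_reduce; rw [det_sub, Subsingleton.elim y 0]; simp
  | cons χ l ih =>
    change DD ψ χ (KL ψ χ₀ l) y = 1
    unfold DD four iot
    rw [sum_subs _ (0 : Module.End F V)]
    rw [det_sub, det_sub, ih, zero_mul]; simp

theorem PL_zero {V : Type} [AddCommGroup V] [Module F V] [Finite V] [Subsingleton V] (l : List (MulChar F ℂ)) (y : Module.End F V) :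
    PL ψ χ₀ l y = 0 := by
  induction l generalizing y with
  | nil =>
    have : phi y = 0 := by
      rw [← phiW_top, Subsingleton.elim (⊤ : Submodule F V) ⊥, phiW_zero_dim]
    rw [PL]; beta_reduce; rw [this, mul_zero]
  | cons χ l ih =>
    change DD ψ χ (PL ψ χ₀ l) y = 0
    unfold DD four iot
    simp only [ih, mul_zero, zero_mul, Finset.sum_const_zero]

theorem tri (M N : ℕ) : (M + N) * (M + N - 1) / 2 = M * (M - 1) / 2 + N * (N - 1) / 2 + M * N := by
  rw [← Nat.choose_two_right, ← Nat.choose_two_right, ← Nat.choose_two_right]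
  induction N with
  | zero => simp
  | succ N ih =>
    rw [← Nat.add_assoc, Nat.choose_succ_succ' (M + N) 1, Nat.choose_succ_succ' N 1, ih, Nat.choose_one_right, Nat.choose_one_right]
    ring

theorem main_rec (hψ : ψ ≠ 1) (l : List (MulChar F ℂ)) {ℓ : F[X]} (hm : ℓ.Monic) (hℓ : Irreducible ℓ)
    (Em : ℕ → Type) [∀ m, Field (Em m)] [∀ m, Finite (Em m)] [∀ m, Algebra F (Em m)]
    (η : ∀ m, Em m) (hcp : ∀ m, 1 ≤ m → cp F (η m) = ℓ ^ m) (hdg : ∀ m, 1 ≤ m → dg F (η m) = ℓ.natDegree)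
    (p h : ℕ → ℂ) (hp : ∀ m, 1 ≤ m → KE ψ χ₀ l (η m) = (-1) ^ l.length * p m)
    (h0 : h 0 = 1) (hh : ∀ b : ℕ, 1 ≤ b → (b : ℂ) * h b = ∑ j ∈ Finset.range b, p (b - j) * h j)
    (b : ℕ) : ∀ (V : Type) [AddCommGroup V] [Module F V] [Finite V] (y : Module.End F V), IsJ ℓ b y →
      KL ψ χ₀ l y = (-1) ^ (l.length * (b * ℓ.natDegree)) *
        (Nat.card F : ℂ) ^ (l.length * ((b * ℓ.natDegree) * (b * ℓ.natDegree - 1) / 2)) * h b := by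
  induction b using Nat.strong_induction_on with
  | _ b ih =>
  intro V _ _ _ y hy
  rcases Nat.eq_zero_or_pos b with rfl | hb
  · have : Subsingleton V := by
      have := hy.finrank
      rw [zero_mul] at this
      exact Module.finrank_zero_iff.1 this
    rw [KL_zero, h0]; simp
  haveI : Fintype (Submodule F V) := Fintype.ofFinite _
  have H := hall ψ hψ χ₀ l y
  rw [sum_inv hm hℓ hb hy _ (fun W hW => dif_neg hW), Finset.sum_range_succ] at H
  have ha : (ℓ.natDegree : ℂ) ≠ 0 := by exact_mod_cast hℓ.natDegree_pos.ne'
  have hb' : (b : ℂ) ≠ 0 := by exact_mod_cast hb.ne'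
  have hlast : (if hi : Inv y (LinearMap.range (aeval y (ℓ ^ b))) then
      (Nat.card F : ℂ) ^ (l.length * (finrank F (LinearMap.range (aeval y (ℓ ^ b))) * finrank F (V ⧸ (LinearMap.range (aeval y (ℓ ^ b)))))) * (PL ψ χ₀ l (y.restrict hi) * KL ψ χ₀ l ((LinearMap.range (aeval y (ℓ ^ b))).mapQ (LinearMap.range (aeval y (ℓ ^ b))) y hi)) else 0) = 0 := by
    have hi := inv_range_aeval y (ℓ ^ b)
    obtain ⟨f1, -, -, -⟩ := range_J hm hℓ hb le_rfl hy rfl hi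
    rw [Nat.sub_self, zero_mul] at f1
    haveI : Subsingleton (LinearMap.range (aeval y (ℓ ^ b))) := Module.finrank_zero_iff.1 f1
    rw [dif_pos hi, PL_zero, zero_mul, mul_zero]
  rw [hlast, add_zero] at H
  set a := ℓ.natDegree with ha_def
  have hterm : ∀ j ∈ Finset.range b, (if hi : Inv y (LinearMap.range (aeval y (ℓ ^ j))) then
      (Nat.card F : ℂ) ^ (l.length * (finrank F (LinearMap.range (aeval y (ℓ ^ j))) * finrank F (V ⧸ (LinearMap.range (aeval y (ℓ ^ j)))))) * (PL ψ χ₀ l (y.restrict hi) * KL ψ χ₀ l ((LinearMap.range (aeval y (ℓ ^ j))).mapQ (LinearMap.range (aeval y (ℓ ^ j))) y hi)) else 0)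
      = (a : ℂ) * ((-1) ^ (l.length * (b * a)) * (Nat.card F : ℂ) ^ (l.length * ((b * a) * (b * a - 1) / 2))) * (p (b - j) * h j) := by
    intro j hj
    have hjb : j < b := Finset.mem_range.1 hj
    have hi := inv_range_aeval y (ℓ ^ j)
    obtain ⟨f1, f2, f3, f4⟩ := range_J hm hℓ hb hjb.le hy rfl hi
    have hbj : 1 ≤ b - j := by omega
    rw [dif_pos hi, f1, f2, PL_J ψ χ₀ hψ l f3 (hcp _ hbj), ih j hjb _ _ f4, hdg _ hbj, hp _ hbj]
    have hfE : finrank F (Em (b - j)) = (b - j) * a := by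
      rw [← natDegree_cp (η (b - j)), hcp _ hbj, natDegree_pow]
    rw [AA, hfE]
    have hM : 1 ≤ (b - j) * a := Nat.mul_pos hbj hℓ.natDegree_pos
    have hMN : (b - j) * a + j * a = b * a := by rw [← Nat.add_mul, Nat.sub_add_cancel hjb.le]
    generalize (b - j) * a = M at hM hMN
    generalize j * a = N at hMN
    rw [← hMN, tri]
    have hs : ((-1 : ℂ)) ^ M = (-1) ^ (M - 1) * (-1) := by rw [← pow_succ, Nat.sub_add_cancel hM]
    rw [mul_pow, ← pow_mul, ← pow_mul, Nat.mul_add l.length M N, pow_add (-1 : ℂ), mul_comm l.length M, pow_mul (-1 : ℂ) M, hs, mul_pow, ← pow_mul]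
    rw [Nat.mul_add, Nat.mul_add, pow_add, pow_add, mul_comm (M * (M - 1) / 2) l.length]
    ring
  rw [Finset.sum_congr rfl hterm, ← Finset.mul_sum, ← hh b hb, hy.finrank] at H
  push_cast at H
  refine mul_left_cancel₀ (mul_ne_zero hb' ha) ?_
  rw [H]; ring

end recur
end MK

set_option linter.all false
namespace MK
open Module Polynomial
open scoped BigOperators Classical

/-- complete homogeneous symmetric sums -/
noncomputable def hs {k : ℕ} (ω : Fin k → ℂ) (b : ℕ) : ℂ := ∑ d ∈ Finset.Nat.antidiagonalTuple k b, ∏ i, ω i ^ d i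

theorem hs_zero {k : ℕ} (ω : Fin k → ℂ) : hs ω 0 = 1 := by
  unfold hs
  rw [Finset.Nat.antidiagonalTuple_zero_right, Finset.sum_singleton]; simp

noncomputable def geo (c : ℂ) : PowerSeries ℂ := PowerSeries.mk (fun n => c ^ n)

theorem hs_coeff {k : ℕ} (ω : Fin k → ℂ) : PowerSeries.mk (hs ω) = ∏ i, geo (ω i) := by
  ext b
  rw [PowerSeries.coeff_mk]
  unfold hs
  induction k generalizing b with
  | zero =>
    cases b with
    | zero => simp
    | succ b => simp [PowerSeries.coeff_one]
  | succ k ih =>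
    have e1 : ∀ p ∈ Finset.HasAntidiagonal.antidiagonal b, PowerSeries.coeff p.1 (geo (ω 0)) * PowerSeries.coeff p.2 (∏ i : Fin k, geo (ω i.succ))
        = ∑ d ∈ Finset.Nat.antidiagonalTuple k p.2, ω 0 ^ p.1 * ∏ i : Fin k, ω i.succ ^ d i := by
      intro p hp
      rw [← ih (fun i => ω i.succ) p.2, geo, PowerSeries.coeff_mk, Finset.mul_sum]
    rw [Fin.prod_univ_succ, PowerSeries.coeff_mul, Finset.sum_congr rfl e1, Finset.sum_sigma']
    refine Finset.sum_bij' (fun d _ => ⟨(d 0, ∑ i : Fin k, d i.succ), fun i => d i.succ⟩) (fun q _ => Fin.cons q.1.1 q.2) ?_ ?_ ?_ ?_ ?_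
    · intro d hd
      rw [Finset.Nat.mem_antidiagonalTuple, Fin.sum_univ_succ] at hd
      rw [Finset.mem_sigma, Finset.HasAntidiagonal.mem_antidiagonal, Finset.Nat.mem_antidiagonalTuple]
      exact ⟨hd, rfl⟩
    · rintro ⟨⟨p1, p2⟩, d⟩ hq
      rw [Finset.mem_sigma, Finset.HasAntidiagonal.mem_antidiagonal, Finset.Nat.mem_antidiagonalTuple] at hq
      rw [Finset.Nat.mem_antidiagonalTuple, Fin.sum_cons]
      simpa [hq.2] using hq.1
    · intro d hd
      exact Fin.cons_self_tail d
    · rintro ⟨⟨p1, p2⟩, d⟩ hq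
      rw [Finset.mem_sigma, Finset.HasAntidiagonal.mem_antidiagonal, Finset.Nat.mem_antidiagonalTuple] at hq
      have h2 : ∑ i, d i = p2 := hq.2
      subst h2
      simp
    · intro d hd
      rw [Fin.prod_univ_succ]

theorem geo_deriv (c : ℂ) : PowerSeries.mk (fun n : ℕ => (n : ℂ) * c ^ n) = PowerSeries.mk (fun n => if n = 0 then 0 else c ^ n) * geo c := by
  ext n
  rw [PowerSeries.coeff_mul, Finset.Nat.sum_antidiagonal_eq_sum_range_succ_mk, PowerSeries.coeff_mk]
  simp only [geo, PowerSeries.coeff_mk]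
  rw [Finset.sum_range_succ', if_pos rfl, zero_mul, add_zero, Finset.sum_congr rfl (g := fun _ => c ^ n)]
  · simp
  · intro j hj
    rw [if_neg (by omega), ← pow_add]
    congr 1
    have := Finset.mem_range.1 hj
    omega

/-- Euler operator -/
noncomputable def eul (f : PowerSeries ℂ) : PowerSeries ℂ := PowerSeries.mk (fun n : ℕ => (n : ℂ) * PowerSeries.coeff n f)

theorem eul_mul (f g : PowerSeries ℂ) : eul (f * g) = eul f * g + f * eul g := by
  ext n
  rw [map_add, PowerSeries.coeff_mul, PowerSeries.coeff_mul, eul, PowerSeries.coeff_mk, PowerSeries.coeff_mul, Finset.mul_sum, ← Finset.sum_add_distrib]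
  refine Finset.sum_congr rfl fun p hp => ?_
  rw [eul, eul, PowerSeries.coeff_mk, PowerSeries.coeff_mk, ← Finset.HasAntidiagonal.mem_antidiagonal.1 hp]
  push_cast
  ring

noncomputable def pser (c : ℂ) : PowerSeries ℂ := PowerSeries.mk (fun n => if n = 0 then 0 else c ^ n)

theorem eul_geo (c : ℂ) : eul (geo c) = pser c * geo c := by
  unfold pser
  rw [← geo_deriv]
  unfold eul geo
  ext n
  simp only [PowerSeries.coeff_mk]

theorem eul_one : eul 1 = 0 := by
  ext n
  rw [eul, PowerSeries.coeff_mk, PowerSeries.coeff_one]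
  split_ifs with h
  · subst h; simp
  · simp

theorem eul_prod {k : ℕ} (ω : Fin k → ℂ) : eul (∏ i, geo (ω i)) = (∑ i, pser (ω i)) * ∏ i, geo (ω i) := by
  induction k with
  | zero => simp [eul_one]
  | succ k ih =>
    rw [Fin.prod_univ_succ, Fin.sum_univ_succ, eul_mul, ih, eul_geo]
    ring

theorem newton_hs {k : ℕ} (ω : Fin k → ℂ) (b : ℕ) (hb : 1 ≤ b) :
    (b : ℂ) * hs ω b = ∑ j ∈ Finset.range b, (∑ i, ω i ^ (b - j)) * hs ω j := by
  have h := congrArg (PowerSeries.coeff b) (eul_prod ω)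
  rw [← hs_coeff, mul_comm, eul, PowerSeries.coeff_mk, PowerSeries.coeff_mk, PowerSeries.coeff_mul,
    Finset.Nat.sum_antidiagonal_eq_sum_range_succ_mk, Finset.sum_range_succ] at h
  have hl : PowerSeries.coeff (b - b) (∑ i, pser (ω i)) = 0 := by
    rw [map_sum]
    refine Finset.sum_eq_zero fun i _ => ?_
    rw [pser, PowerSeries.coeff_mk, if_pos (Nat.sub_self b)]
  rw [h]
  dsimp only
  rw [hl, mul_zero, add_zero]
  refine Finset.sum_congr rfl fun j hj => ?_
  rw [PowerSeries.coeff_mk, map_sum, mul_comm]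
  congr 1
  refine Finset.sum_congr rfl fun i _ => ?_
  rw [pser, PowerSeries.coeff_mk, if_neg]
  have := Finset.mem_range.1 hj
  omega

end MK

set_option linter.all false
namespace MK
open Module Polynomial
open scoped BigOperators Classical

section transfer

theorem sum_units {M : Type} [Monoid M] {_ : Fintype M} {_ : Fintype Mˣ} (f : M → ℂ) (hf : ∀ z, ¬ IsUnit z → f z = 0) :
    ∑ z, f z = ∑ u : Mˣ, f u :=
  (Fintype.sum_of_injective (fun u : Mˣ => (u : M)) (fun _ _ h => Units.ext h) (fun u => f u) f
    (fun z hz => hf z (fun ⟨u, hu⟩ => hz ⟨u, hu⟩)) (fun _ => rfl)).symm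

theorem addChar_sum {F : Type} [Field F] (ψ : AddChar F ℂ) {k : ℕ} (f : Fin k → F) : ψ (∑ i, f i) = ∏ i, ψ (f i) := by
  induction k with
  | zero => simp
  | succ k ih => rw [Fin.sum_univ_succ, Fin.prod_univ_succ, AddChar.map_add_eq_mul, ih]

noncomputable def GK {G : Type} [Group G] [Fintype G] {k : ℕ} (f : Fin k → G → ℂ) (x : G) : ℂ :=
  ∑ g : Fin k → G, if (List.ofFn g).prod = x then ∏ i, f i (g i) else 0

theorem GK_succ {G : Type} [Group G] [Fintype G] {k : ℕ} (f : Fin (k + 1) → G → ℂ) (x : G) :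
    GK f x = ∑ u : G, f 0 u * GK (fun i => f i.succ) (u⁻¹ * x) := by
  unfold GK
  rw [← (Fin.consEquiv (fun _ : Fin (k + 1) => G)).sum_comp, Fintype.sum_prod_type]
  refine Finset.sum_congr rfl fun u _ => ?_
  rw [Finset.mul_sum]
  refine Finset.sum_congr rfl fun g _ => ?_
  have e : (List.ofFn (Fin.consEquiv (fun _ : Fin (k + 1) => G) (u, g))).prod = u * (List.ofFn g).prod := by
    rw [List.ofFn_succ, List.prod_cons]
    simp [Fin.consEquiv]
  rw [e, mul_ite, mul_zero, eq_inv_mul_iff_mul_eq, Fin.prod_univ_succ]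
  simp [Fin.consEquiv]

theorem GK_one {G : Type} [Group G] [Fintype G] (f : Fin 1 → G → ℂ) (x : G) : GK f x = f 0 x := by
  rw [GK_succ]
  have : ∀ u : G, f 0 u * GK (fun i : Fin 0 => f i.succ) (u⁻¹ * x) = if u = x then f 0 u else 0 := by
    intro u
    unfold GK
    rw [Fintype.sum_unique]
    have : (List.ofFn (default : Fin 0 → G)).prod = u⁻¹ * x ↔ u = x := by
      rw [List.ofFn_zero, List.prod_nil, eq_inv_mul_iff_mul_eq, mul_one]
    simp only [this]
    simp
  rw [Finset.sum_congr rfl (fun u _ => this u), Finset.sum_ite_eq' , if_pos (Finset.mem_univ _)]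

variable {F : Type} [Field F] {A : Type} [Ring A] [Fintype A] (N : A →* F) (T : A →+ F) (ψ : AddChar F ℂ)

noncomputable def GLL (χ₀ : MulChar F ℂ) : List (MulChar F ℂ) → A → ℂ
  | [] => fun x => χ₀ (N x) * ψ (T x)
  | χ :: l => fun x => χ (N x) * ∑ w : A, χ (N w) * GLL χ₀ l (Ring.inverse w) * ψ (T (w * x))

theorem GLL_nil (χ₀ : MulChar F ℂ) (x : A) : GLL N T ψ χ₀ [] x = χ₀ (N x) * ψ (T x) := rfl
theorem GLL_cons (χ₀ χ : MulChar F ℂ) (l) (x : A) : GLL N T ψ χ₀ (χ :: l) x =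
  χ (N x) * ∑ w : A, χ (N w) * GLL N T ψ χ₀ l (Ring.inverse w) * ψ (T (w * x)) := rfl

theorem GLL_GK (hN : ∀ z, N z ≠ 0 → IsUnit z) (hT : ∀ x y, T (x * y) = T (y * x)) [Fintype Aˣ] {k : ℕ} (α : Fin (k + 1) → Fˣ →* ℂˣ) (x : Aˣ) :
    GK (fun i u => (α i (Units.map N u) : ℂ) * ψ (T u)) x =
      GLL N T ψ (MulChar.ofUnitHom (α (Fin.last k))) (List.ofFn fun i : Fin k => MulChar.ofUnitHom (α i.castSucc)) x := by
  have hα : ∀ (β : Fˣ →* ℂˣ) (u : Aˣ), MulChar.ofUnitHom β (N u) = (β (Units.map N u) : ℂ) := fun β u =>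
    MulChar.ofUnitHom_coe β (Units.map N u)
  induction k generalizing x with
  | zero =>
    rw [GK_one, List.ofFn_zero, GLL_nil, hα]
    rfl
  | succ k ih =>
    rw [GK_succ, List.ofFn_succ, GLL_cons, sum_units (M := A) _ (fun z hz => ?_)]
    · rw [← Equiv.sum_comp (Equiv.mulLeft x), Finset.mul_sum]
      refine Finset.sum_congr rfl fun w _ => ?_
      have := ih (fun i => α i.succ) ((x * w)⁻¹ * x)
      simp only [Equiv.coe_mulLeft]
      rw [this, Fin.castSucc_zero, hα, hα, Ring.inverse_unit, map_mul, map_mul]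
      have e : (x * w)⁻¹ * x = w⁻¹ := by group
      rw [e, Units.val_mul, hT]
      push_cast
      simp only [Fin.succ_last, Fin.succ_castSucc]
      ring
    · have : N z = 0 := by
        by_contra h
        exact hz (hN z h)
      rw [this, MulChar.map_zero, zero_mul, zero_mul]

theorem GLL_equiv {B : Type} [Ring B] [Fintype B] (N' : B →* F) (T' : B →+ F) (e : A ≃+* B)
    (hN : ∀ z, N' (e z) = N z) (hT : ∀ z, T' (e z) = T z) (χ₀ : MulChar F ℂ) (l : List (MulChar F ℂ)) (x : A) :
    GLL N' T' ψ χ₀ l (e x) = GLL N T ψ χ₀ l x := by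
  induction l generalizing x with
  | nil => rw [GLL_nil, GLL_nil, hN, hT]
  | cons χ l ih =>
    rw [GLL_cons, GLL_cons, hN, ← e.toEquiv.sum_comp]
    congr 1
    refine Finset.sum_congr rfl fun w _ => ?_
    have : Ring.inverse (e w) = e (Ring.inverse w) := by
      by_cases hw : IsUnit w
      · obtain ⟨u, rfl⟩ := hw
        rw [Ring.inverse_unit]
        exact Ring.inverse_unit (Units.map (e : A →* B) u)
      · rw [Ring.inverse_non_unit _ hw, map_zero, Ring.inverse_non_unit]
        rwa [MulEquiv.isUnit_map e]
    change χ (N' (e w)) * GLL N' T' ψ χ₀ l (Ring.inverse (e w)) * ψ (T' (e w * e x)) = _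
    rw [hN, this, ih, ← map_mul, hT]

end transfer

section field
variable {F : Type} [Field F] [Fintype F] (ψ : AddChar F ℂ)

theorem KE_GLL {E : Type} [Field E] [Algebra F E] [Fintype E] (χ₀ : MulChar F ℂ) (l : List (MulChar F ℂ)) (η : E) :
    KE ψ χ₀ l η = GLL (Algebra.norm F : E →* F) (Algebra.trace F E).toAddMonoidHom ψ χ₀ l η := by
  induction l generalizing η with
  | nil => rfl
  | cons χ l ih =>
    rw [GLL_cons]
    have e : KE ψ χ₀ (χ :: l) η = χ (Algebra.norm F η) * ∑ w : E, χ (Algebra.norm F w) * KE ψ χ₀ l w⁻¹ * ψ (Algebra.trace F E (w * η)) := by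
      rw [KE]
      congr!
    rw [e]
    congr 1
    refine (Finset.sum_congr rfl fun w _ => ?_)
    rw [ih, Ring.inverse_eq_inv]
    rfl

theorem fieldK_eq {E : Type} [Field E] [Algebra F E] [Fintype E] [DecidableEq E] {k : ℕ} (α : Fin (k + 1) → Fˣ →* ℂˣ) (ξ : E) (hξ : ξ ≠ 0) :
    fieldKloosterman α ψ E ξ = KE ψ (MulChar.ofUnitHom (α (Fin.last k))) (List.ofFn fun i : Fin k => MulChar.ofUnitHom (α i.castSucc)) ξ := by
  rw [KE_GLL]
  have := GLL_GK (Algebra.norm F : E →* F) (Algebra.trace F E).toAddMonoidHom ψ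
    (fun z hz => isUnit_iff_ne_zero.2 (fun h => hz (by rw [h, Algebra.norm_zero]))) (fun x y => by rw [mul_comm]) α (Units.mk0 ξ hξ)
  rw [Units.val_mk0] at this
  rw [← this]
  unfold fieldKloosterman GK
  refine Finset.sum_congr (by ext; simp) fun t _ => ?_
  have e : ((∏ i, t i : Eˣ) : E) = ξ ↔ (List.ofFn t).prod = Units.mk0 ξ hξ := by
    rw [List.prod_ofFn, Units.ext_iff, Units.val_mk0]
  simp only [e]
  refine if_congr Iff.rfl ?_ rfl
  rw [Finset.prod_mul_distrib, map_sum, addChar_sum]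
  rfl

theorem KL_GLL {V : Type} [AddCommGroup V] [Module F V] [Finite V] (χ₀ : MulChar F ℂ) (l : List (MulChar F ℂ)) (x : Module.End F V) :
    KL ψ χ₀ l x = GLL (LinearMap.det : Module.End F V →* F) (LinearMap.trace F V).toAddMonoidHom ψ χ₀ l x := by
  induction l generalizing x with
  | nil => rfl
  | cons χ l ih =>
    rw [GLL_cons]
    change χ (LinearMap.det x) * ∑ z, χ (LinearMap.det z) * KL ψ χ₀ l (Ring.inverse z) * ψ (LinearMap.trace F V (z * x)) = _
    congr 1
    refine (Finset.sum_congr rfl fun w _ => ?_)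
    rw [ih]
    rfl

theorem matK_eq [DecidableEq F] {ι : Type} [Fintype ι] [DecidableEq ι] {k : ℕ} (α : Fin (k + 1) → Fˣ →* ℂˣ) (M : Matrix ι ι F) (hM : IsUnit M) :
    matrixKloosterman α ψ M = KL ψ (MulChar.ofUnitHom (α (Fin.last k))) (List.ofFn fun i : Fin k => MulChar.ofUnitHom (α i.castSucc)) (Matrix.toLin' M) := by
  obtain ⟨u, rfl⟩ := hM
  rw [KL_GLL]
  have h1 := GLL_equiv (F := F) (Matrix.detMonoidHom : Matrix ι ι F →* F) (Matrix.traceAddMonoidHom ι F) ψ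
    (LinearMap.det : Module.End F (ι → F) →* F) (LinearMap.trace F (ι → F)).toAddMonoidHom (Matrix.toLinAlgEquiv' : Matrix ι ι F ≃ₐ[F] _).toRingEquiv
    (fun z => LinearMap.det_toLin' z) (fun z => Matrix.trace_toLin'_eq z)
    (MulChar.ofUnitHom (α (Fin.last k))) (List.ofFn fun i : Fin k => MulChar.ofUnitHom (α i.castSucc)) u
  refine Eq.trans ?_ h1.symm
  rw [← GLL_GK (Matrix.detMonoidHom : Matrix ι ι F →* F) (Matrix.traceAddMonoidHom ι F) ψ
    (fun z hz => (Matrix.isUnit_iff_isUnit_det z).2 (isUnit_iff_ne_zero.2 hz)) (fun x y => Matrix.trace_mul_comm x y) α u]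
  unfold matrixKloosterman GK
  refine Finset.sum_congr (by ext; simp) fun t _ => ?_
  have e : ((List.ofFn t).prod : Matrix ι ι F) = u ↔ (List.ofFn t).prod = u := by
    rw [Units.ext_iff]
  simp only [e]
  refine if_congr Iff.rfl ?_ rfl
  rw [Finset.prod_mul_distrib, Matrix.trace_sum, addChar_sum]
  rfl

end field
end MK

set_option linter.all false
namespace MK
open Module Polynomial
open scoped BigOperators Classical

section jordan
variable {F : Type} [Field F] [Finite F]

theorem cyc_of_primary {V : Type} [AddCommGroup V] [Module F V] [Finite V] {ℓ : F[X]} (hm : ℓ.Monic) (hℓ : Irreducible ℓ) {b : ℕ} (hb : 1 ≤ b) {y : Module.End F V}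
    (hc : y.charpoly = ℓ ^ b) {v : V} (hv : aeval y (ℓ ^ (b - 1)) v ≠ 0) : cyc y v = ⊤ := by
  have key : ∀ p : F[X], aeval y p v = 0 → ℓ ^ b ∣ p := by
    intro p hp
    have hg : aeval y (EuclideanDomain.gcd p (ℓ ^ b)) v = 0 := by
      rw [EuclideanDomain.gcd_eq_gcd_ab, mul_comm p, mul_comm (ℓ ^ b), map_add, map_mul, map_mul, LinearMap.add_apply,
        Module.End.mul_apply, Module.End.mul_apply, hp, ← hc, LinearMap.aeval_self_charpoly]
      simp
    obtain ⟨j, hj, hass⟩ := (dvd_prime_pow hℓ.prime b).1 (EuclideanDomain.gcd_dvd_right p (ℓ ^ b))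
    have hjb : j = b := by
      by_contra hne
      apply hv
      have h1 : EuclideanDomain.gcd p (ℓ ^ b) ∣ ℓ ^ (b - 1) := hass.dvd.trans (pow_dvd_pow _ (by omega))
      obtain ⟨r, hr⟩ := h1
      rw [hr, mul_comm, map_mul, Module.End.mul_apply, hg, map_zero]
    subst hjb
    exact hass.symm.dvd.trans (EuclideanDomain.gcd_dvd_left _ _)
  let f : degreeLT F (finrank F V) →ₗ[F] V := (ev y v).comp (Submodule.subtype _)
  have hdeg : (ℓ ^ b).natDegree = finrank F V := by rw [← hc, LinearMap.charpoly_natDegree]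
  have hinj : Function.Injective f := by
    rw [← LinearMap.ker_eq_bot, LinearMap.ker_eq_bot']
    rintro ⟨p, hp⟩ h
    have h1 := key p h
    rw [mem_degreeLT] at hp
    have : p = 0 := by
      refine eq_zero_of_dvd_of_degree_lt h1 ?_
      rw [degree_eq_natDegree (pow_ne_zero _ hm.ne_zero), hdeg]
      exact hp
    exact Subtype.ext this
  haveI : Module.Finite F (degreeLT F (finrank F V)) := Module.Finite.equiv (degreeLTEquiv F (finrank F V)).symm
  have hsur : Function.Surjective f := by
    rw [← LinearMap.injective_iff_surjective_of_finrank_eq_finrank]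
    · exact hinj
    · rw [(degreeLTEquiv F (finrank F V)).finrank_eq]; simp
  rw [eq_top_iff]
  rintro u -
  obtain ⟨p, rfl⟩ := hsur u
  exact ⟨p.1, rfl⟩

/-- shift matrix -/
def shiftM (F : Type) [Field F] (b : ℕ) : Matrix (Fin b) (Fin b) F := fun i j => if (i : ℕ) + 1 = j then 1 else 0

theorem shiftM_pow (b j : ℕ) (i i' : Fin b) : (shiftM F b ^ j) i i' = if (i : ℕ) + j = i' then 1 else 0 := by
  induction j generalizing i i' with
  | zero => rw [pow_zero, Matrix.one_apply]; simp [Fin.ext_iff]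
  | succ j ih =>
    rw [pow_succ, Matrix.mul_apply]
    simp only [ih, shiftM]
    by_cases h : (i : ℕ) + j < b
    · rw [Finset.sum_eq_single (⟨i + j, h⟩ : Fin b)]
      · simp [add_assoc]
      · intro c _ hc
        rw [if_neg, zero_mul]
        intro h'
        exact hc (Fin.ext h'.symm)
      · simp
    · rw [Finset.sum_eq_zero, if_neg]
      · have := i'.2; omega
      · intro c _
        rw [if_neg, zero_mul]
        have := c.2; omega

open scoped Kronecker
variable {a : ℕ}

theorem jordan_eq (x : Matrix (Fin a) (Fin a) F) (b : ℕ) :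
    jordanBlock x b = (1 : Matrix (Fin b) (Fin b) F) ⊗ₖ x + shiftM F b ⊗ₖ (1 : Matrix (Fin a) (Fin a) F) := by
  ext ⟨i, i'⟩ ⟨j, j'⟩
  rw [Matrix.add_apply, Matrix.kronecker_apply, Matrix.kronecker_apply, Matrix.one_apply, Matrix.one_apply]
  unfold jordanBlock shiftM
  dsimp only
  by_cases h : i = j
  · subst h; simp
  · simp only [h, if_false, zero_mul, zero_add]
    split_ifs <;> simp

/-- the embedding of block diagonal matrices -/
noncomputable def dgl (F : Type) [Field F] (a b : ℕ) : Matrix (Fin a) (Fin a) F →ₐ[F] Matrix (Fin b × Fin a) (Fin b × Fin a) F :=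
  AlgHom.ofLinearMap
    { toFun := fun y => (1 : Matrix (Fin b) (Fin b) F) ⊗ₖ y
      map_add' := fun y z => Matrix.kronecker_add _ _ _
      map_smul' := fun r y => Matrix.kronecker_smul _ _ _ }
    (Matrix.one_kronecker_one)
    (fun y z => by
      change (1 : Matrix (Fin b) (Fin b) F) ⊗ₖ (y * z) = ((1 : Matrix (Fin b) (Fin b) F) ⊗ₖ y) * ((1 : Matrix (Fin b) (Fin b) F) ⊗ₖ z)
      rw [← Matrix.mul_kronecker_mul, one_mul])

theorem shift_kron_pow (a b j : ℕ) : (shiftM F b ⊗ₖ (1 : Matrix (Fin a) (Fin a) F)) ^ j = (shiftM F b ^ j) ⊗ₖ (1 : Matrix (Fin a) (Fin a) F) := by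
  induction j with
  | zero => rw [pow_zero, pow_zero, Matrix.one_kronecker_one]
  | succ j ih => rw [pow_succ, ih, ← Matrix.mul_kronecker_mul, one_mul, pow_succ]

theorem taylor_comm {A : Type} [Ring A] [Algebra F A] {X₀ N : A} (hc : Commute X₀ N) (p : F[X]) :
    ∃ k : A, Commute k N ∧ aeval (X₀ + N) p = aeval X₀ p + (aeval X₀ (derivative p) + k * N) * N := by
  have hf : ∀ q : F[X], Commute ((aeval X₀ : F[X] →ₐ[F] A).toRingHom q) N := by
    intro q
    induction q using Polynomial.induction_on' with
    | add p q hp hq => rw [map_add]; exact hp.add_left hq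
    | monomial n r =>
      change Commute (aeval X₀ (monomial n r)) N
      rw [aeval_monomial]
      exact Commute.mul_left (Algebra.commutes r N) (hc.pow_left n)
  let φ : F[X][X] →+* A := eval₂RingHom' (aeval X₀ : F[X] →ₐ[F] A).toRingHom N hf
  have hφC : ∀ q : F[X], φ (C q) = aeval X₀ q := fun q => eval₂_C _ _
  have hφX : φ X = N := eval₂_X _ _
  obtain ⟨k, hk⟩ := binomExpansion (p.map (algebraMap F F[X][X])) (C X) X
  refine ⟨φ k, ?_, ?_⟩
  · rw [← hφX]
    exact (Commute.all k X).map φ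
  have hev : ∀ (q : F[X]) (z : F[X][X]), φ (eval z (q.map (algebraMap F F[X][X]))) = aeval (φ z) q := by
    intro q z
    induction q using Polynomial.induction_on' with
    | add p q hp hq => rw [Polynomial.map_add, eval_add, map_add, map_add, hp, hq]
    | monomial n r =>
      rw [map_monomial, eval_monomial, aeval_monomial, map_mul, map_pow]
      congr 1
      change φ (C (C r)) = _
      rw [hφC, aeval_C]
  have h := congrArg φ hk
  rw [derivative_map, map_add, map_add, map_mul, map_mul, hev, hev, hev, map_add, map_pow, hφX, hφC, aeval_X] at h
  rw [h]
  noncomm_ring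

theorem ell_pow_ne [Fact (0 < a)] {x : Matrix (Fin a) (Fin a) F} (hx : Irreducible x.charpoly) {b : ℕ} (hb : 1 ≤ b) :
    aeval (jordanBlock x b) (x.charpoly ^ (b - 1)) ≠ 0 := by
  set N := shiftM F b ⊗ₖ (1 : Matrix (Fin a) (Fin a) F) with hN
  set X₀ := dgl F a b x with hX
  have hJ : jordanBlock x b = X₀ + N := jordan_eq x b
  have hcm : Commute X₀ N := by
    change ((1 : Matrix (Fin b) (Fin b) F) ⊗ₖ x) * (shiftM F b ⊗ₖ (1 : Matrix (Fin a) (Fin a) F)) = (shiftM F b ⊗ₖ (1 : Matrix (Fin a) (Fin a) F)) * ((1 : Matrix (Fin b) (Fin b) F) ⊗ₖ x)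
    rw [← Matrix.mul_kronecker_mul, ← Matrix.mul_kronecker_mul]
    simp
  have h0 : aeval X₀ x.charpoly = 0 := by
    rw [hX, aeval_algHom_apply, Matrix.aeval_self_charpoly, map_zero]
  obtain ⟨k, hk, hT⟩ := taylor_comm hcm x.charpoly
  rw [h0, zero_add] at hT
  have hsep : IsCoprime x.charpoly (derivative x.charpoly) := PerfectField.separable_of_irreducible hx
  obtain ⟨s, t, hst⟩ := hsep
  set D := aeval X₀ (derivative x.charpoly) with hD
  have hDN : Commute D N := by
    have : ∀ q : F[X], Commute (aeval X₀ q) N := by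
      intro q
      induction q using Polynomial.induction_on' with
      | add p q hp hq => rw [map_add]; exact hp.add_left hq
      | monomial n r =>
        rw [aeval_monomial]
        exact Commute.mul_left (Algebra.commutes r N) (hcm.pow_left n)
    exact this _
  have htD : aeval X₀ t * D = 1 := by
    have := congrArg (aeval X₀) hst
    rwa [map_add, map_mul, map_mul, h0, mul_zero, zero_add, map_one] at this
  have hNb : N ^ b = 0 := by
    rw [hN, shift_kron_pow]
    have : shiftM F b ^ b = 0 := by
      ext i j
      rw [shiftM_pow, if_neg, Matrix.zero_apply]
      have := j.2; omega
    rw [this, Matrix.zero_kronecker]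
  have hU : Commute (D + k * N) N := hDN.add_left (hk.mul_left (Commute.refl N))
  have hpow : ∀ j, (D + k * N) ^ j * N ^ (b - 1) = D ^ j * N ^ (b - 1) := by
    intro j
    induction j with
    | zero => simp
    | succ j ih =>
      have e : (D + k * N) * N ^ (b - 1) = D * N ^ (b - 1) := by
        rw [add_mul, mul_assoc k, ← pow_succ', Nat.sub_add_cancel hb, hNb, mul_zero, add_zero]
      rw [pow_succ, mul_assoc, e, (hDN.pow_right _).eq, ← mul_assoc, ih, mul_assoc, ← (hDN.pow_right _).eq, ← mul_assoc, pow_succ]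
  intro hz
  rw [map_pow, hJ, hT, hU.mul_pow, hpow] at hz
  have hinv : aeval X₀ t ^ (b - 1) * D ^ (b - 1) = 1 := by
    have hcom : Commute (aeval X₀ t) D := by
      rw [hD]; exact (Commute.all t (derivative x.charpoly)).map (aeval X₀ : F[X] →ₐ[F] _)
    rw [← hcom.mul_pow, htD, one_pow]
  have hz' : N ^ (b - 1) = 0 := by
    have := congrArg (fun z => aeval X₀ t ^ (b - 1) * z) hz
    simpa [← mul_assoc, hinv] using this
  have h00 : (0 : ℕ) < a := Fact.out
  have := congrFun (congrFun hz' (⟨0, hb⟩, ⟨0, h00⟩)) (⟨b - 1, by omega⟩, ⟨0, h00⟩)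
  rw [hN, shift_kron_pow, Matrix.kronecker_apply, shiftM_pow] at this
  simp at this

theorem jordan_charpoly (x : Matrix (Fin a) (Fin a) F) (b : ℕ) : (jordanBlock x b).charpoly = x.charpoly ^ b := by
  have hbt : (jordanBlock x b).BlockTriangular Prod.fst := by
    intro p q h
    unfold jordanBlock
    rw [if_neg h.ne', if_neg]
    have : (q.1 : ℕ) < p.1 := h
    omega
  unfold Matrix.charpoly
  rw [(hbt.charmatrix).det_fintype, Finset.prod_congr rfl (g := fun _ => x.charmatrix.det)]
  · simp
  intro i _
  let e : Fin a ≃ {p : Fin b × Fin a // p.1 = i} :=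
    { toFun := fun j => ⟨(i, j), rfl⟩
      invFun := fun p => p.1.2
      left_inv := fun j => rfl
      right_inv := by rintro ⟨⟨p, j⟩, rfl⟩; rfl }
  rw [← Matrix.det_submatrix_equiv_self e]
  congr 1
  ext1 j j'
  change Matrix.charmatrix (jordanBlock x b) (i, j) (i, j') = _
  rw [Matrix.charmatrix_apply, Matrix.charmatrix_apply]
  simp [jordanBlock, Matrix.diagonal_apply]

theorem jordan_IsJ {x : Matrix (Fin a) (Fin a) F} (hx : Irreducible x.charpoly) {b : ℕ} (hb : 1 ≤ b) :
    IsJ x.charpoly b (Matrix.toLin' (jordanBlock x b)) := by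
  have hch : (Matrix.toLin' (jordanBlock x b)).charpoly = x.charpoly ^ b := by
    rw [Matrix.charpoly_toLin', jordan_charpoly]
  have ha : 0 < a := by
    have := hx.natDegree_pos
    rwa [Matrix.charpoly_natDegree_eq_dim, Fintype.card_fin] at this
  haveI : Fact (0 < a) := ⟨ha⟩
  have hne : aeval (Matrix.toLin' (jordanBlock x b)) (x.charpoly ^ (b - 1)) ≠ 0 := by
    intro h
    apply ell_pow_ne hx hb
    have e : Matrix.toLin' (jordanBlock x b) = (Matrix.toLinAlgEquiv' : _ ≃ₐ[F] _) (jordanBlock x b) := rfl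
    rw [e, aeval_algHom_apply] at h
    exact (map_eq_zero_iff _ (AlgEquiv.injective _)).1 h
  refine ⟨hch, ?_⟩
  obtain ⟨v, hv⟩ : ∃ v, aeval (Matrix.toLin' (jordanBlock x b)) (x.charpoly ^ (b - 1)) v ≠ 0 := by
    by_contra! h
    exact hne (LinearMap.ext h)
  exact ⟨v, cyc_of_primary (Matrix.charpoly_monic x) hx hb hch hv⟩

theorem jordan_isUnit {x : Matrix (Fin a) (Fin a) F} (hx : IsUnit x) (b : ℕ) : IsUnit (jordanBlock x b) := by
  rw [Matrix.isUnit_iff_isUnit_det, isUnit_iff_ne_zero, Matrix.det_eq_sign_charpoly_coeff, jordan_charpoly, coeff_zero_eq_eval_zero, eval_pow]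
  have h : x.det ≠ 0 := isUnit_iff_ne_zero.1 ((Matrix.isUnit_iff_isUnit_det x).1 hx)
  rw [Matrix.det_eq_sign_charpoly_coeff, coeff_zero_eq_eval_zero] at h
  exact mul_ne_zero (pow_ne_zero _ (by simp)) (pow_ne_zero _ (right_ne_zero_of_mul h))

theorem cp_root {ℓ : F[X]} (hm : ℓ.Monic) (hℓ : Irreducible ℓ) {E : Type} [Field E] [Algebra F E] [Finite E] {η : E} (hη : aeval η ℓ = 0) {m : ℕ}
    (hd : finrank F E = m * ℓ.natDegree) : cp F η = ℓ ^ m ∧ dg F η = ℓ.natDegree := by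
  have hmin : minpoly F η = ℓ := (minpoly.eq_of_irreducible_of_monic hℓ hη hm).symm
  obtain ⟨j, hj⟩ := cp_eq (F := F) η
  have := natDegree_cp (F := F) η
  rw [hj, hmin, natDegree_pow, hd] at this
  rw [hj, hmin, Nat.eq_of_mul_eq_mul_right hℓ.natDegree_pos this]
  exact ⟨rfl, by rw [dg, hmin]⟩

end jordan
end MK

/-- for `n = ab`, a regular elliptic `x ∈ GL_a(F)` with root `ξ` of its
characteristic polynomial in a degree-`a` extension `E`, and `ω₁,…,ω_k` satisfying
`Σ ωᵢ^m = (-1)^(k-1) K_{E_m}(α,ψ,ξ_m)` for all `m ≥ 1`, the twisted matrix Kloosterman sum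
of the regular Jordan matrix `J_{(b)}(x)` equals
`(-1)^((k-1)n) q^((k-1)n(n-1)/2) h_b(ω₁,…,ω_k)`, where `h_b` is the complete homogeneous
symmetric polynomial of degree `b`. -/
theorem matrix_kloosterman_regular_jordan_symmetric_power
    {F : Type} [Field F] [Fintype F] [DecidableEq F]
    (ψ : AddChar F ℂ) (hψ : ∃ a : F, ψ a ≠ 1)
    {k : ℕ} (hk : 1 ≤ k) (α : Fin k → Fˣ →* ℂˣ)
    {n a b : ℕ} (hn : n = a * b) (hb : 1 ≤ b)
    (x : (Matrix (Fin a) (Fin a) F)ˣ)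
    (hx : Irreducible (Matrix.charpoly (x : Matrix (Fin a) (Fin a) F)))
    (E : Type) [Field E] [Fintype E] [DecidableEq E] [Algebra F E]
    (hE : Module.finrank F E = a)
    (ξ : E)
    (hξ : Polynomial.aeval ξ (Matrix.charpoly (x : Matrix (Fin a) (Fin a) F)) = 0)
    (Em : ℕ → Type) [∀ m, Field (Em m)] [∀ m, Fintype (Em m)] [∀ m, DecidableEq (Em m)]
    [∀ m, Algebra F (Em m)] [∀ m, Algebra E (Em m)] [∀ m, IsScalarTower F E (Em m)]
    (hEm : ∀ m, 1 ≤ m → Module.finrank E (Em m) = m)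
    (ω : Fin k → ℂ)
    (hω : ∀ m, 1 ≤ m →
      (∑ i, ω i ^ m) = (-1 : ℂ) ^ (k - 1) *
        fieldKloosterman α ψ (Em m) (algebraMap E (Em m) ξ)) :
    matrixKloosterman α ψ (jordanBlock (x : Matrix (Fin a) (Fin a) F) b)
    = (-1 : ℂ) ^ ((k - 1) * n) *
        (Fintype.card F : ℂ) ^ ((k - 1) * (n * (n - 1) / 2)) *
        ∑ d ∈ Finset.Nat.antidiagonalTuple k b, ∏ i, ω i ^ d i := by
  classical
  obtain ⟨k, rfl⟩ : ∃ k', k = k' + 1 := ⟨k - 1, by omega⟩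
  have hψ' : ψ ≠ 1 := by
    rintro rfl
    obtain ⟨c, hc⟩ := hψ
    exact hc (AddChar.one_apply c)
  have hm := Matrix.charpoly_monic (x : Matrix (Fin a) (Fin a) F)
  have hdeg : (Matrix.charpoly (x : Matrix (Fin a) (Fin a) F)).natDegree = a := by
    rw [Matrix.charpoly_natDegree_eq_dim, Fintype.card_fin]
  have hξ0 : ξ ≠ 0 := by
    rintro rfl
    have h1 : (Matrix.charpoly (x : Matrix (Fin a) (Fin a) F)).coeff 0 = 0 := by
      rw [← Polynomial.coeff_zero_eq_aeval_zero'] at hξ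
      exact (map_eq_zero _).1 hξ
    have h2 : Matrix.det (x : Matrix (Fin a) (Fin a) F) ≠ 0 :=
      isUnit_iff_ne_zero.1 ((Matrix.isUnit_iff_isUnit_det _).1 x.isUnit)
    rw [Matrix.det_eq_sign_charpoly_coeff, h1, mul_zero] at h2
    exact h2 rfl
  have hroot : ∀ m, Polynomial.aeval (algebraMap E (Em m) ξ) (Matrix.charpoly (x : Matrix (Fin a) (Fin a) F)) = 0 := by
    intro m
    rw [Polynomial.aeval_algebraMap_apply, hξ, map_zero]
  have hcp : ∀ m, 1 ≤ m → MK.cp F (algebraMap E (Em m) ξ) = (Matrix.charpoly (x : Matrix (Fin a) (Fin a) F)) ^ m ∧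
      MK.dg F (algebraMap E (Em m) ξ) = (Matrix.charpoly (x : Matrix (Fin a) (Fin a) F)).natDegree := by
    intro m h1
    refine MK.cp_root hm hx (hroot m) ?_
    rw [hdeg, ← Module.finrank_mul_finrank F E (Em m), hE, hEm m h1, mul_comm]
  have hlen : (List.ofFn fun i : Fin k => MulChar.ofUnitHom (α i.castSucc)).length = k := List.length_ofFn
  have key := MK.main_rec ψ (MulChar.ofUnitHom (α (Fin.last k))) hψ' (List.ofFn fun i : Fin k => MulChar.ofUnitHom (α i.castSucc))
    hm hx Em (fun m => algebraMap E (Em m) ξ) (fun m h => (hcp m h).1) (fun m h => (hcp m h).2)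
    (fun m => ∑ i, ω i ^ m) (MK.hs ω)
    (fun m h => by
      rw [hlen]
      beta_reduce
      rw [hω m h, MK.fieldK_eq ψ α _ ((map_ne_zero _).2 hξ0), Nat.add_sub_cancel, ← mul_assoc, ← pow_add, ← two_mul, pow_mul]
      norm_num)
    (MK.hs_zero ω) (MK.newton_hs ω) b _ _ (MK.jordan_IsJ hx hb)
  rw [MK.matK_eq ψ α _ (MK.jordan_isUnit x.isUnit b), key, hlen, hdeg, Nat.add_sub_cancel, Nat.card_eq_fintype_card, hn, mul_comm b a]
  rfl
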